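/- Fix a positive integer m and let δ⁰(m) denote the number of unordered factorizations m = m₁·m₂. Then: (a) for an even weak elliptic form φ of index m (parity +1), there exists a weak Jacobi form ψ of weight 2 and index m with c_ψ(n,r) = c_φ(n,r) for all pairs (n,r) with 4nm ≤ r² if and only if R_{m₁,m₂}(φ) = 0 for every unordered factorization m = m₁·m₂; and (b) the linear map sending an even weak elliptic form φ of index m to the vector (R_{m₁,m₂}(φ)), indexed by the unordered factorizations of m, is surjective onto ℂ^{δ⁰(m)}. -/

import Mathlib

noncomputable section

open Complex Filter Topology MeasureTheory
open scoped Classical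

/-- `ee x = e^{2πix}`. -/
def ee (x : ℂ) : ℂ := Complex.exp (2 * (Real.pi : ℂ) * Complex.I * x)

/-- The index-`m` elliptic transformation law on `ℍ × ℂ`. -/
def EllipticLaw (m : ℕ) (φ : ℂ → ℂ → ℂ) : Prop :=
  ∀ τ : ℂ, 0 < τ.im → ∀ z : ℂ, ∀ lam mu : ℤ,
    φ τ (z + (lam : ℂ) * τ + (mu : ℂ)) =
      ee (-(m : ℂ) * ((lam : ℂ) ^ 2 * τ + 2 * (lam : ℂ) * z)) * φ τ z

/-- The weight-`k` index-`m` modular transformation law on `ℍ × ℂ`. -/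
def ModularLaw (k : ℤ) (m : ℕ) (φ : ℂ → ℂ → ℂ) : Prop :=
  ∀ τ : ℂ, 0 < τ.im → ∀ z : ℂ, ∀ a b c d : ℤ, a * d - b * c = 1 →
    φ (((a : ℂ) * τ + (b : ℂ)) / ((c : ℂ) * τ + (d : ℂ))) (z / ((c : ℂ) * τ + (d : ℂ))) =
      ((c : ℂ) * τ + (d : ℂ)) ^ k *
        ee ((m : ℂ) * (c : ℂ) * z ^ 2 / ((c : ℂ) * τ + (d : ℂ))) * φ τ z

/-- The theta function `θ_{m,ℓ}(τ,z) = ∑_{r ≡ ℓ (mod 2m)} q^{r²/4m} y^r`. -/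
def jTheta (m : ℕ) (l : ℤ) (τ z : ℂ) : ℂ :=
  ∑' n : ℤ, ee (((l : ℂ) + 2 * (m : ℂ) * (n : ℂ)) ^ 2 / (4 * (m : ℂ)) * τ +
      ((l : ℂ) + 2 * (m : ℂ) * (n : ℂ)) * z)

/-- The point `z_s = ατ + β` for `s = (α,β) ∈ ℚ²`. -/
def zpt (s : ℚ × ℚ) (τ : ℂ) : ℂ := (s.1 : ℚ) * τ + (s.2 : ℚ)

/-- A holomorphic function on `ℍ × ℂ` satisfying the index-`m` elliptic transformation law,
together with its Fourier coefficient data `coeff Δ ℓ = C(Δ,ℓ)` (so that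
`c(n,r) = C(4nm - r², r)`, `C(Δ,ℓ)` depends on `ℓ` only modulo `2m`, and `C(Δ,ℓ) = 0` on
pairs with `Δ + ℓ² ≢ 0 (mod 4m)`). -/
structure EllFormData (m : ℕ) where
  toFun : ℂ → ℂ → ℂ
  coeff : ℤ → ℤ → ℂ
  holo : ∀ τ z : ℂ, 0 < τ.im → DifferentiableAt ℂ (fun p : ℂ × ℂ => toFun p.1 p.2) (τ, z)
  elliptic : EllipticLaw m toFun
  expansion : ∀ τ z : ℂ, 0 < τ.im →
    HasSum (fun p : ℤ × ℤ => coeff (4 * (m : ℤ) * p.1 - p.2 ^ 2) p.2 *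
      ee ((p.1 : ℂ) * τ + (p.2 : ℂ) * z)) (toFun τ z)
  periodic : ∀ Δ l : ℤ, coeff Δ (l + 2 * (m : ℤ)) = coeff Δ l
  support : ∀ Δ l : ℤ, ¬ (4 * (m : ℤ)) ∣ (Δ + l ^ 2) → coeff Δ l = 0

/-- An elliptic form is weak if `c(n,r) = 0` for `n < 0`. -/
def IsWeakC (m : ℕ) (C : ℤ → ℤ → ℂ) : Prop :=
  ∀ n r : ℤ, n < 0 → C (4 * (m : ℤ) * n - r ^ 2) r = 0

/-- Even coefficients: `C(Δ,-ℓ) = C(Δ,ℓ)`. -/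
def IsEvenC (C : ℤ → ℤ → ℂ) : Prop := ∀ Δ l : ℤ, C Δ (-l) = C Δ l

/-- Holomorphic (as opposed to weak): `C(Δ,ℓ) = 0` for `Δ < 0`. -/
def IsHolC (C : ℤ → ℤ → ℂ) : Prop := ∀ Δ l : ℤ, Δ < 0 → C Δ l = 0

/-- Cuspidal: `C(Δ,ℓ) = 0` for `Δ ≤ 0`. -/
def IsCuspC (C : ℤ → ℤ → ℂ) : Prop := ∀ Δ l : ℤ, Δ ≤ 0 → C Δ l = 0

/-- Optimal growth: `C(Δ,ℓ) = 0` for `Δ < -1`. -/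
def IsOGC (C : ℤ → ℤ → ℂ) : Prop := ∀ Δ l : ℤ, Δ < -1 → C Δ l = 0

/-- A representative `ℓ* = ℓ·(a·x - b·y)` (with `ax + by = gcd(a,b) = 1`) of the residue
class determined by `ℓ* ≡ -ℓ (mod 2a)`, `ℓ* ≡ ℓ (mod 2b)`, used to define the
Atkin–Lehner involution `W_a` on coefficients. -/
def lstar (a b : ℕ) (l : ℤ) : ℤ := l * ((a : ℤ) * Nat.gcdA a b - (b : ℤ) * Nat.gcdB a b)

/-- The coefficients of `φ|u_t` (index `m/t²`):
`C_{φ|u_t}(Δ,ℓ) = ∑_{r mod 2m/t, r ≡ ℓ (mod 2m/t²)} C_φ(Δt², rt)`. -/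
def CoeffU (m t : ℕ) (C : ℤ → ℤ → ℂ) (Δ l : ℤ) : ℂ :=
  ∑ j ∈ Finset.range t,
    C (Δ * (t : ℤ) ^ 2) ((l + 2 * (m : ℤ) / (t : ℤ) ^ 2 * (j : ℤ)) * (t : ℤ))

/-- For an unordered factorization `m = m₁·m₂` with `t = gcd(m₁,m₂)`,
`R_{m₁,m₂}(φ) = R[(φ|u_t)|W_{m₁/t}] = ∑_{r∈ℤ} C_{(φ|u_t)|W_{m₁/t}}(-r², r)`. -/
def Rfactor (m : ℕ) (C : ℤ → ℤ → ℂ) (m₁ m₂ : ℕ) : ℂ :=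
  ∑' r : ℤ, CoeffU m (Nat.gcd m₁ m₂) C (-(r ^ 2))
      (lstar (m₁ / Nat.gcd m₁ m₂) (m₂ / Nat.gcd m₁ m₂) r)

section
open Finset (range sum_congr mul_sum sum_comm sum_mul mem_range)
open PowerSeries (coeff)


lemma ee_add (x y : ℂ) : ee (x + y) = ee x * ee y := by
  simp [ee, mul_add, Complex.exp_add]

lemma ee_zero : ee 0 = 1 := by simp [ee]

lemma ee_neg (x : ℂ) : ee (-x) = (ee x)⁻¹ := by
  simp [ee, Complex.exp_neg]

lemma ee_ne (x : ℂ) : ee x ≠ 0 := Complex.exp_ne_zero _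

lemma ee_int (n : ℤ) : ee (n : ℂ) = 1 := by
  rw [ee, Complex.exp_eq_one_iff]; exact ⟨n, by ring⟩

lemma ee_nat (n : ℕ) : ee (n : ℂ) = 1 := by exact_mod_cast ee_int n

lemma ee_sub (x y : ℂ) : ee (x - y) = ee x / ee y := by
  rw [sub_eq_add_neg, ee_add, ee_neg, div_eq_mul_inv]

lemma ee_eq_of_sub {x y : ℂ} (n : ℤ) (h : x = y + n) : ee x = ee y := by
  rw [h, ee_add, ee_int, mul_one]

lemma ee_nsmul (n : ℕ) (x : ℂ) : ee (n * x) = ee x ^ n := by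
  simp only [ee]; rw [← Complex.exp_nat_mul]; congr 1; ring

lemma ee_zsmul (n : ℤ) (x : ℂ) : ee (n * x) = ee x ^ n := by
  simp only [ee]; rw [← Complex.exp_int_mul]; congr 1; ring

lemma norm_ee (x : ℂ) : ‖ee x‖ = Real.exp (-(2 * Real.pi * x.im)) := by
  rw [ee, Complex.norm_exp]; congr 1; simp [mul_assoc]

lemma ee_eq_one_iff (x : ℂ) : ee x = 1 ↔ ∃ n : ℤ, x = n := by
  rw [ee, Complex.exp_eq_one_iff]
  constructor
  · rintro ⟨n, h⟩
    refine ⟨n, ?_⟩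
    have : (2 * (Real.pi : ℂ) * I) ≠ 0 := by simp [Real.pi_ne_zero]
    apply mul_left_cancel₀ this; rw [h]; ring
  · rintro ⟨n, h⟩; exact ⟨n, by rw [h]; ring⟩

lemma conj_ee (x : ℂ) : (starRingEnd ℂ) (ee x) = ee (-(starRingEnd ℂ) x) := by
  rw [ee, ee, ← Complex.exp_conj]; congr 1; simp; left; exact map_ofNat _ 2

lemma ee_differentiable : Differentiable ℂ ee := by
  unfold ee; fun_prop

lemma ee_hasDerivAt (x : ℂ) : HasDerivAt ee (2 * Real.pi * I * ee x) x := by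
  have := ((hasDerivAt_id x).const_mul (2 * (Real.pi : ℂ) * I)).cexp
  simp only [id, mul_one] at this
  rw [mul_comm]; exact this

lemma ee_sum_range (n : ℕ) (hn : 0 < n) (a : ℤ) :
    ∑ j ∈ range n, ee ((a : ℂ) * j / n) = if (n : ℤ) ∣ a then (n : ℂ) else 0 := by
  have hn' : (n : ℂ) ≠ 0 := by exact_mod_cast hn.ne'
  have h1 : ∀ j : ℕ, ee ((a : ℂ) * j / n) = ee ((a : ℂ) / n) ^ j := by
    intro j; rw [← ee_nsmul]; congr 1; ring
  simp_rw [h1]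
  split_ifs with h
  · obtain ⟨k, rfl⟩ := h
    have : ee (((n : ℤ) * k : ℤ) / (n : ℂ)) = 1 := by
      rw [ee_eq_one_iff]; exact ⟨k, by push_cast; field_simp⟩
    rw [this]; simp
  · have hne : ee ((a : ℂ) / n) ≠ 1 := by
      intro h2
      obtain ⟨k, hk⟩ := (ee_eq_one_iff _).1 h2
      apply h
      refine ⟨k, ?_⟩
      rw [div_eq_iff hn'] at hk
      have : (a : ℂ) = ((k * n : ℤ) : ℂ) := by rw [hk]; push_cast; ring
      have := Int.cast_injective this
      rw [this]; ring
    rw [geom_sum_eq hne, ← ee_nsmul]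
    have : ee ((n : ℂ) * ((a : ℂ) / n)) = 1 := by
      rw [show (n : ℂ) * ((a : ℂ) / n) = a by field_simp]; exact ee_int a
    rw [this]; simp

def Rf (C : ℤ → ℤ → ℂ) (m₁ m₂ : ℕ) : ℂ :=
  ∑' f : ℤ, ∑ x ∈ range m₁,
    if (m₁ : ℤ) ∣ f - m₂ * x then C (-(f ^ 2)) (f - 2 * m₂ * x) else 0

lemma per_mul {G : ℤ → ℂ} {N : ℤ} (hG : ∀ y, G (y + N) = G y) (y k : ℤ) :
    G (y + N * k) = G y := by
  have h1 : ∀ (n : ℕ) (y : ℤ), G (y + N * n) = G y := by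
    intro n; induction n with
    | zero => simp
    | succ n ih => intro y; push_cast; rw [mul_add, mul_one, ← add_assoc, hG, ih]
  obtain ⟨n, rfl | rfl⟩ := k.eq_nat_or_neg
  · exact h1 n y
  · have := h1 n (y + N * (-(n : ℤ))); rw [← this]; congr 1; ring

lemma per_dvd {G : ℤ → ℂ} {N : ℤ} (hG : ∀ y, G (y + N) = G y) {x y : ℤ} (h : N ∣ x - y) :
    G x = G y := by
  obtain ⟨k, hk⟩ := h
  have := per_mul hG y k
  rw [← this]; congr 1; linarith

lemma sum_class (a t : ℕ) (ha : 0 < a) (ht : 0 < t) (G : ℤ → ℂ)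
    (hG : ∀ y, G (y + (a * t : ℕ)) = G y) (x0 : ℤ) :
    ∑ x ∈ range (a * t), (if (a : ℤ) ∣ x0 - x then G x else 0) =
      ∑ j ∈ range t, G (x0 - a * j) := by
  rw [← Finset.sum_filter]
  symm
  have hapos' := ha
  have hN : (0 : ℤ) < (a * t : ℕ) := by positivity
  have key : ∀ y : ℤ, (((y % (a * t : ℕ)).toNat : ℕ) : ℤ) = y % (a * t : ℕ) := fun y =>
    Int.toNat_of_nonneg (Int.emod_nonneg _ hN.ne')
  refine Finset.sum_bij (fun (j : ℕ) _ => ((x0 - a * j) % (a * t : ℕ)).toNat) ?_ ?_ ?_ ?_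
  · intro j hj
    rw [Finset.mem_filter, mem_range]
    constructor
    · have := Int.emod_lt_of_pos (x0 - a * j) hN
      have := key (x0 - a * j)
      omega
    · rw [key, Int.emod_def]
      refine ⟨j + t * ((x0 - a * j) / (a * t : ℕ)), ?_⟩
      push_cast; ring
  · intro j hj j' hj' h
    have h' : (x0 - a * j) % (a * t : ℕ) = (x0 - a * j') % (a * t : ℕ) := by
      have h0 := congrArg (Nat.cast : ℕ → ℤ) h
      simp only [key] at h0
      exact h0
    have h3 := Int.ModEq.dvd (n := ((a * t : ℕ) : ℤ)) h'
    obtain ⟨k, hk⟩ := h3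
    have h4 : (a : ℤ) * ((j : ℤ) - j') = a * (t * k) := by
      push_cast at hk; linarith
    have h5 := mul_left_cancel₀ (by exact_mod_cast hapos'.ne' : (a : ℤ) ≠ 0) h4
    rw [mem_range] at hj hj'
    have h6 : (t : ℤ) ∣ (j : ℤ) - j' := ⟨k, h5⟩
    have h7 := Int.eq_zero_of_abs_lt_dvd h6 (by rw [abs_lt]; constructor <;> omega)
    omega
  · intro x hx
    rw [Finset.mem_filter, mem_range] at hx
    obtain ⟨hx1, k, hk⟩ := hx
    have hT : (0 : ℤ) < t := by exact_mod_cast ht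
    refine ⟨(k % t).toNat, ?_, ?_⟩
    · rw [mem_range]
      have := Int.emod_lt_of_pos k hT
      have := Int.emod_nonneg k hT.ne'
      omega
    · have e1 : (((k % t).toNat : ℕ) : ℤ) = k % t := Int.toNat_of_nonneg (Int.emod_nonneg _ hT.ne')
      have : (x0 - a * ((k % t).toNat : ℕ)) % (a * t : ℕ) = x := by
        rw [e1, Int.emod_def k t]
        have : x0 - a * (k - t * (k / t)) = x + (a * t : ℕ) * (k / t) := by
          push_cast; linarith
        rw [this, Int.add_mul_emod_self_left]
        apply Int.emod_eq_of_lt <;> [positivity; exact_mod_cast hx1]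
      rw [this]; simp
  · intro j hj
    rw [key]
    apply per_dvd hG
    rw [Int.emod_def]
    exact ⟨(x0 - a * j) / (a * t : ℕ), by ring⟩

lemma Rfactor_eq (m₁ m₂ : ℕ) (h1 : 0 < m₁) (h2 : 0 < m₂) (C : ℤ → ℤ → ℂ)
    (hC : ∀ Δ l : ℤ, C Δ (l + 2 * ((m₁ * m₂ : ℕ) : ℤ)) = C Δ l) :
    Rfactor (m₁ * m₂) C m₁ m₂ = Rf C m₁ m₂ := by
  obtain ⟨t, ht⟩ : ∃ t, t = Nat.gcd m₁ m₂ := ⟨_, rfl⟩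
  have htpos : 0 < t := ht ▸ Nat.gcd_pos_of_pos_left _ h1
  obtain ⟨a, ha⟩ : t ∣ m₁ := ht ▸ Nat.gcd_dvd_left _ _
  obtain ⟨b, hb⟩ : t ∣ m₂ := ht ▸ Nat.gcd_dvd_right _ _
  have hcop : Nat.gcd a b = 1 := by
    have := ht; rw [ha, hb, Nat.gcd_mul_left] at this
    exact Nat.eq_of_mul_eq_mul_left htpos (by omega)
  have hapos : 0 < a := Nat.pos_of_ne_zero (by rintro rfl; omega)
  have hT : (t : ℤ) ≠ 0 := by exact_mod_cast htpos.ne'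
  have bez : (a : ℤ) * Nat.gcdA a b + b * Nat.gcdB a b = 1 := by
    rw [← Nat.gcd_eq_gcd_ab, hcop]; rfl
  unfold Rfactor Rf
  rw [← ht]
  have hinj : Function.Injective (fun r : ℤ => r * t) := fun x y h => mul_right_cancel₀ hT h
  rw [← hinj.tsum_eq (f := fun f : ℤ => ∑ x ∈ range m₁,
    if (m₁ : ℤ) ∣ f - m₂ * x then C (-(f ^ 2)) (f - 2 * m₂ * x) else 0)]
  · apply tsum_congr
    intro r
    have hma : m₁ / t = a := by rw [ha]; exact Nat.mul_div_cancel_left _ htpos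
    have hmb : m₂ / t = b := by rw [hb]; exact Nat.mul_div_cancel_left _ htpos
    rw [hma, hmb]
    have := sum_class a t hapos htpos (fun y => C (-((r * t) ^ 2)) (r * t - 2 * b * t * y))
      (by
        intro y
        have : r * t - 2 * b * t * (y + (a * t : ℕ)) + 2 * ((m₁ * m₂ : ℕ) : ℤ)
          = r * t - 2 * b * t * y := by rw [ha, hb]; push_cast; ring
        rw [← this, hC]) (Nat.gcdB a b * r)
    have hm1 : m₁ = a * t := by rw [ha]; ring
    rw [hm1]
    trans ∑ j ∈ range t, C (-((r * t) ^ 2)) (r * t - 2 * b * t * (Nat.gcdB a b * r - a * j))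
    · unfold CoeffU
      apply sum_congr rfl
      intro j _
      congr 1
      · ring
      · unfold lstar
        have e : 2 * (((a * t * m₂ : ℕ)) : ℤ) / (t : ℤ) ^ 2 = 2 * a * b := by
          rw [hb]
          apply Int.ediv_eq_of_eq_mul_left (by positivity)
          push_cast; ring
        rw [e]
        have : (a : ℤ) * Nat.gcdA a b = 1 - b * Nat.gcdB a b := by linarith
        rw [this]; ring
    · rw [← this]
      apply sum_congr rfl
      intro x _
      have e : ((a : ℤ) ∣ Nat.gcdB a b * r - x) ↔ ((a * t : ℕ) : ℤ) ∣ r * t - m₂ * x := by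
        have e1 : r * t - m₂ * x = (r - b * x) * t := by rw [hb]; push_cast; ring
        rw [e1, Nat.cast_mul, mul_dvd_mul_iff_right hT]
        have hc : IsCoprime (a : ℤ) b := ⟨Nat.gcdA a b, Nat.gcdB a b, by linarith⟩
        have e2 : r - b * x = b * (Nat.gcdB a b * r - x) + a * (Nat.gcdA a b * r) := by
          have : r = (a * Nat.gcdA a b + b * Nat.gcdB a b) * r := by rw [bez, one_mul]
          nth_rewrite 1 [this]; ring
        rw [e2, dvd_add_left (Dvd.intro _ rfl)]
        exact ⟨fun h => h.mul_left _, fun h => IsCoprime.dvd_of_dvd_mul_left hc h⟩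
      simp only [e]
      congr 2
      rw [hb]; push_cast; ring
  · intro f hf
    rw [Function.mem_support] at hf
    obtain ⟨x, _, hx⟩ := Finset.exists_ne_zero_of_sum_ne_zero hf
    have hd : (m₁ : ℤ) ∣ f - m₂ * x := by
      by_contra h; rw [if_neg h] at hx; exact hx rfl
    have h3 : (t : ℤ) ∣ m₁ := by rw [ha]; exact ⟨a, by push_cast; ring⟩
    have h4 : (t : ℤ) ∣ m₂ * x := by rw [hb]; exact ⟨b * x, by push_cast; ring⟩
    have h5 : (t : ℤ) ∣ f := by
      have := (h3.trans hd); rwa [dvd_sub_left h4] at this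
    obtain ⟨r, hr⟩ := h5
    exact ⟨r, by simp [hr]; ring⟩

def Om (m₁ m₂ : ℕ) (l f : ℤ) : Prop := (2 * m₁ : ℤ) ∣ l + f ∧ (2 * m₂ : ℤ) ∣ l - f

def Rom (m : ℕ) (C : ℤ → ℤ → ℂ) (m₁ m₂ : ℕ) : ℂ :=
  ∑' f : ℤ, ∑ l ∈ range (2 * m), if Om m₁ m₂ l f then C (-(f ^ 2)) l else 0

lemma Rf_eq_Rom (m₁ m₂ : ℕ) (h1 : 0 < m₁) (h2 : 0 < m₂) (C : ℤ → ℤ → ℂ)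
    (hC : ∀ Δ l : ℤ, C Δ (l + 2 * ((m₁ * m₂ : ℕ) : ℤ)) = C Δ l) :
    Rf C m₁ m₂ = Rom (m₁ * m₂) C m₁ m₂ := by
  unfold Rf Rom
  apply tsum_congr
  intro f
  rw [← Finset.sum_filter, ← Finset.sum_filter]
  have hN : (0 : ℤ) < (2 * (m₁ * m₂) : ℕ) := by positivity
  have hM1 : (0 : ℤ) < m₁ := by exact_mod_cast h1
  have hM2 : (0 : ℤ) < m₂ := by exact_mod_cast h2
  have key : ∀ y : ℤ, (((y % (2 * (m₁ * m₂) : ℕ)).toNat : ℕ) : ℤ) = y % (2 * (m₁ * m₂) : ℕ) :=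
    fun y => Int.toNat_of_nonneg (Int.emod_nonneg _ hN.ne')
  refine Finset.sum_bij (fun (x : ℕ) _ => ((f - 2 * m₂ * x) % (2 * (m₁ * m₂) : ℕ)).toNat)
    ?_ ?_ ?_ ?_
  · intro x hx
    rw [Finset.mem_filter, mem_range] at hx ⊢
    constructor
    · have := Int.emod_lt_of_pos (f - 2 * m₂ * x) hN
      have := key (f - 2 * m₂ * x)
      omega
    · rw [key, Int.emod_def]
      obtain ⟨hx, k, hk⟩ := hx
      generalize (f - 2 * m₂ * x) / ((2 * (m₁ * m₂) : ℕ) : ℤ) = w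
      constructor
      · refine ⟨k - m₂ * w, ?_⟩
        push_cast; linear_combination 2 * hk
      · refine ⟨-x - m₁ * w, ?_⟩
        push_cast; ring
  · intro x hx y hy h
    have h0 := congrArg (Nat.cast : ℕ → ℤ) h
    simp only [key] at h0
    obtain ⟨k, hk⟩ := Int.ModEq.dvd (n := ((2 * (m₁ * m₂) : ℕ) : ℤ)) h0
    rw [Finset.mem_filter, mem_range] at hx hy
    have h4 : (2 * m₂ : ℤ) * ((x : ℤ) - y) = 2 * m₂ * (m₁ * k) := by
      push_cast at hk; linarith
    have h5 := mul_left_cancel₀ (by positivity : (2 * m₂ : ℤ) ≠ 0) h4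
    have h6 : (m₁ : ℤ) ∣ (x : ℤ) - y := ⟨k, h5⟩
    have h7 := Int.eq_zero_of_abs_lt_dvd h6 (by rw [abs_lt]; constructor <;> omega)
    omega
  · intro l hl
    rw [Finset.mem_filter, mem_range] at hl
    obtain ⟨hl, ⟨u, hu⟩, ⟨v, hv⟩⟩ := hl
    have e1 : ((((-v) % m₁).toNat : ℕ) : ℤ) = (-v) % m₁ :=
      Int.toNat_of_nonneg (Int.emod_nonneg _ hM1.ne')
    refine ⟨((-v) % m₁).toNat, ?_, ?_⟩
    · rw [Finset.mem_filter, mem_range, e1]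
      refine ⟨?_, ?_⟩
      · have := Int.emod_lt_of_pos (-v) hM1
        omega
      · rw [Int.emod_def]
        refine ⟨u + m₂ * (-v / m₁), ?_⟩
        apply mul_left_cancel₀ (two_ne_zero : (2 : ℤ) ≠ 0)
        linear_combination hu - hv
    · have : (f - 2 * m₂ * (((-v) % m₁).toNat : ℕ)) % (2 * (m₁ * m₂) : ℕ) = l := by
        rw [e1, Int.emod_def (-v)]
        have : f - 2 * m₂ * (-v - m₁ * (-v / m₁)) = l + (2 * (m₁ * m₂) : ℕ) * (-v / m₁) := by
          push_cast; linear_combination -hv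
        rw [this, Int.add_mul_emod_self_left]
        apply Int.emod_eq_of_lt <;> [positivity; exact_mod_cast hl]
      rw [this]; simp
  · intro x hx
    rw [key]
    apply per_dvd (N := 2 * ((m₁ * m₂ : ℕ) : ℤ)) (hC _)
    rw [Int.emod_def]
    exact ⟨(f - 2 * m₂ * x) / (2 * (m₁ * m₂) : ℕ), by push_cast; ring⟩

lemma Rfactor_eq_Rom (m : ℕ) (hm : 0 < m) (m₁ m₂ : ℕ) (h : m₁ * m₂ = m) (C : ℤ → ℤ → ℂ)
    (hC : ∀ Δ l : ℤ, C Δ (l + 2 * (m : ℤ)) = C Δ l) :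
    Rfactor m C m₁ m₂ = Rom m C m₁ m₂ := by
  subst h
  have h1 := Nat.pos_of_mul_pos_right hm
  have h2 := Nat.pos_of_mul_pos_left hm
  rw [Rfactor_eq _ _ h1 h2 _ hC, Rf_eq_Rom _ _ h1 h2 _ hC]

def Kd (m d : ℕ) (Δ l : ℤ) : ℂ :=
  if Δ = -(((d : ℤ) - (m / d : ℕ)) ^ 2) ∧
    ((2 * m : ℤ) ∣ l - (d + (m / d : ℕ)) ∨ (2 * m : ℤ) ∣ l + (d + (m / d : ℕ))) then 1 else 0

lemma Rom_symm (m : ℕ) (C : ℤ → ℤ → ℂ) (m₁ m₂ : ℕ) : Rom m C m₁ m₂ = Rom m C m₂ m₁ := by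
  unfold Rom
  rw [← (Equiv.neg ℤ).tsum_eq]
  apply tsum_congr
  intro f
  apply sum_congr rfl
  intro l _
  have : Om m₁ m₂ l (Equiv.neg ℤ f) ↔ Om m₂ m₁ l f := by
    simp only [Equiv.neg_apply, Om, sub_neg_eq_add]
    exact and_comm
  rw [if_congr this rfl rfl]
  simp

lemma Kd_support (m d : ℕ) (C : ℤ → ℤ → ℂ) (hC : ∀ Δ l, C Δ l ≠ 0 → Kd m d Δ l ≠ 0) (m₁ m₂ : ℕ)
    (f : ℤ) (hf : f ∉ ({(d : ℤ) - (m / d : ℕ), -((d : ℤ) - (m / d : ℕ))} : Finset ℤ)) :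
    (∑ l ∈ range (2 * m), if Om m₁ m₂ l f then C (-(f ^ 2)) l else 0) = 0 := by
  apply Finset.sum_eq_zero
  intro l _
  split_ifs with h
  · by_contra h0
    have := hC _ _ h0
    unfold Kd at this
    rw [ne_eq, ite_eq_right_iff, not_forall] at this
    obtain ⟨⟨h1, -⟩, -⟩ := this
    apply hf
    have : f ^ 2 = ((d : ℤ) - (m / d : ℕ)) ^ 2 := by linarith
    rcases sq_eq_sq_iff_eq_or_eq_neg.1 this with h | h <;> simp [h]
  · rfl

lemma Rom_Kd_fin (m d m₁ m₂ : ℕ) : Rom m (Kd m d) m₁ m₂ =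
    ∑ f ∈ ({(d : ℤ) - (m / d : ℕ), -((d : ℤ) - (m / d : ℕ))} : Finset ℤ),
     ∑ l ∈ range (2 * m), if Om m₁ m₂ l f then Kd m d (-(f ^ 2)) l else 0 :=
  tsum_eq_sum (fun f hf => Kd_support m d _ (fun _ _ h => h) m₁ m₂ f hf)

lemma Rom_Kd_zero (m d m₁ m₂ : ℕ) (hm : 0 < m) (hd : d ∣ m) (h12 : m₁ * m₂ = m)
    (h1 : d ≠ m₁) (h2 : d ≠ m₂) : Rom m (Kd m d) m₁ m₂ = 0 := by
  obtain ⟨e, rfl⟩ := hd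
  have hd : 0 < d := Nat.pos_of_mul_pos_right hm
  have he : 0 < e := Nat.pos_of_mul_pos_left hm
  have hm1 : 0 < m₁ := Nat.pos_of_mul_pos_right (h12 ▸ hm)
  have hm2 : 0 < m₂ := Nat.pos_of_mul_pos_left (h12 ▸ hm)
  have hde : d * e / d = e := Nat.mul_div_cancel_left _ hd
  rw [Rom_Kd_fin]
  apply Finset.sum_eq_zero
  intro f _
  apply Finset.sum_eq_zero
  intro l _
  split_ifs with h
  · unfold Kd
    rw [hde]
    rw [if_neg]
    rintro ⟨hf, hl⟩
    have hf2 : f ^ 2 = ((d : ℤ) - e) ^ 2 := by linarith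
    have d1 : (m₁ : ℤ) ∣ (d * e : ℕ) := by rw [← h12]; exact ⟨m₂, by push_cast; ring⟩
    have d2 : (m₂ : ℤ) ∣ (d * e : ℕ) := by rw [← h12]; exact ⟨m₁, by push_cast; ring⟩
    obtain ⟨⟨u, hu⟩, ⟨v, hv⟩⟩ := h
    have aux : ((m₁ : ℤ) ∣ d ∧ (m₂ : ℤ) ∣ e) ∨ ((m₁ : ℤ) ∣ e ∧ (m₂ : ℤ) ∣ d) := by
      obtain ⟨p, hp⟩ := d1
      obtain ⟨q, hq⟩ := d2
      push_cast at hp hq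
      rcases sq_eq_sq_iff_eq_or_eq_neg.1 hf2 with h | h <;>
      rcases hl with ⟨k, hk⟩ | ⟨k, hk⟩ <;> push_cast at hk
      · left; exact ⟨⟨u - p * k, by linarith [congrArg (· * k) hp]⟩,
          ⟨v - q * k, by linarith [congrArg (· * k) hq]⟩⟩
      · right; exact ⟨⟨-u + p * k, by linarith [congrArg (· * k) hp]⟩,
          ⟨-v + q * k, by linarith [congrArg (· * k) hq]⟩⟩
      · right; exact ⟨⟨u - p * k, by linarith [congrArg (· * k) hp]⟩,
          ⟨v - q * k, by linarith [congrArg (· * k) hq]⟩⟩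
      · left; exact ⟨⟨-u + p * k, by linarith [congrArg (· * k) hp]⟩,
          ⟨-v + q * k, by linarith [congrArg (· * k) hq]⟩⟩
    rcases aux with ⟨a1, a2⟩ | ⟨a1, a2⟩
    · have a1 := Int.natCast_dvd_natCast.1 a1
      have a2 := Int.natCast_dvd_natCast.1 a2
      have b1 := Nat.le_of_dvd hd a1
      have b2 := Nat.le_of_dvd he a2
      have : m₁ < d := lt_of_le_of_ne b1 (Ne.symm h1)
      nlinarith
    · have a1 := Int.natCast_dvd_natCast.1 a1
      have a2 := Int.natCast_dvd_natCast.1 a2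
      have b1 := Nat.le_of_dvd he a1
      have b2 := Nat.le_of_dvd hd a2
      have : m₂ < d := lt_of_le_of_ne b2 (Ne.symm h2)
      nlinarith
  · rfl

lemma Rom_Kd_ne (m d : ℕ) (hm : 0 < m) (hd : d ∣ m) : Rom m (Kd m d) d (m / d) ≠ 0 := by
  obtain ⟨e, rfl⟩ := hd
  have hd : 0 < d := Nat.pos_of_mul_pos_right hm
  have he : 0 < e := Nat.pos_of_mul_pos_left hm
  have hde : d * e / d = e := Nat.mul_div_cancel_left _ hd
  rw [Rom_Kd_fin]
  have e1 : ∀ f l, (if Om d (d * e / d) l f then Kd (d * e) d (-(f ^ 2)) l else 0) =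
      (((if Om d (d * e / d) l f ∧ Kd (d * e) d (-(f ^ 2)) l ≠ 0 then 1 else 0 : ℕ)) : ℂ) := by
    intro f l
    by_cases h1 : Om d (d * e / d) l f <;> simp [h1]
    unfold Kd
    split_ifs <;> simp_all
  simp_rw [e1, ← Nat.cast_sum]
  rw [Nat.cast_ne_zero]
  rw [hde]
  have hN : (0 : ℤ) < (2 * (d * e) : ℕ) := by positivity
  have key : (((((d : ℤ) + e) % (2 * (d * e) : ℕ)).toNat : ℕ) : ℤ) = (d + e) % (2 * (d * e) : ℕ) :=
    Int.toNat_of_nonneg (Int.emod_nonneg _ hN.ne')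
  apply ne_of_gt
  apply Finset.sum_pos'
  · intros; positivity
  · refine ⟨(d : ℤ) - e, by simp, ?_⟩
    apply Finset.sum_pos'
    · intros; positivity
    · refine ⟨(((d : ℤ) + e) % (2 * (d * e) : ℕ)).toNat, ?_, ?_⟩
      · rw [mem_range]
        have := Int.emod_lt_of_pos ((d : ℤ) + e) hN
        omega
      · rw [key, Int.emod_def]
        generalize ((d : ℤ) + e) / ((2 * (d * e) : ℕ) : ℤ) = w
        rw [if_pos]
        · norm_num
        refine ⟨⟨⟨1 - e * w, by push_cast; ring⟩, ⟨1 - d * w, by push_cast; ring⟩⟩, ?_⟩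
        unfold Kd
        rw [hde, if_pos]
        · norm_num
        · refine ⟨rfl, Or.inl ⟨-w, by push_cast; ring⟩⟩

lemma hs_congr {ι : Type*} {f g : ι → ℂ} {a b : ℂ} (h : HasSum f a) (hfg : ∀ i, g i = f i)
    (hab : b = a) : HasSum g b := by
  have : g = f := funext hfg
  rw [this, hab]; exact h

lemma hasSum_int_split {N : ℕ} (hN : 0 < N) (g : ℤ → ℂ) (S : ℕ → ℂ)
    (h : ∀ l ∈ range N, HasSum (fun k : ℤ => g (l + N * k)) (S l)) :
    HasSum g (∑ l ∈ range N, S l) := by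
  have hN' : (0 : ℤ) < N := by exact_mod_cast hN
  have h1 : ∀ l ∈ range N,
      HasSum (fun r : ℤ => if r % N = l then g r else 0) (S l) := by
    intro l hl
    have hl' := mem_range.1 hl
    have inj : Function.Injective (fun k : ℤ => (l : ℤ) + N * k) := by
      intro a b hab
      simpa [hN.ne'] using hab
    have hlm : ∀ k : ℤ, ((l : ℤ) + N * k) % N = l := by
      intro k
      rw [Int.add_mul_emod_self_left]
      exact Int.emod_eq_of_lt (by positivity) (by exact_mod_cast hl')
    rw [← inj.hasSum_iff]
    · convert h l hl using 2 with k
      simp [hlm]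
    · intro r hr
      rw [if_neg]
      intro h2
      apply hr
      exact ⟨r / N, by simp only; have := Int.emod_add_mul_ediv r N; omega⟩
  have h2 := hasSum_sum h1
  convert h2 using 2 with r
  have hr0 := Int.emod_nonneg r hN'.ne'
  have hr1 := Int.emod_lt_of_pos r hN'
  rw [Finset.sum_eq_single (r % N).toNat]
  · rw [if_pos]; rw [Int.toNat_of_nonneg hr0]
  · intro b _ hb
    rw [if_neg]; intro h3; apply hb; omega
  · intro h3; exfalso; apply h3; rw [mem_range]; omega

lemma jTheta_term (m : ℕ) (hm : 0 < m) (l n : ℤ) (τ z : ℂ) :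
    ee (((l : ℂ) + 2 * (m : ℂ) * (n : ℂ)) ^ 2 / (4 * (m : ℂ)) * τ +
      ((l : ℂ) + 2 * (m : ℂ) * (n : ℂ)) * z) =
    ee ((l : ℂ) ^ 2 / (4 * m) * τ + l * z) * jacobiTheta₂_term n (l * τ + 2 * m * z) (2 * m * τ) := by
  have hm' : (m : ℂ) ≠ 0 := by exact_mod_cast hm.ne'
  rw [jacobiTheta₂_term, ee, ee, ← Complex.exp_add]
  congr 1
  field_simp
  ring

lemma im_2m {m : ℕ} (hm : 0 < m) {τ : ℂ} (hτ : 0 < τ.im) : 0 < (2 * (m : ℂ) * τ).im := by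
  have : (2 * (m : ℂ) * τ).im = 2 * m * τ.im := by
    simp [Complex.mul_im]
  rw [this]; positivity

lemma jTheta_hasSum (m : ℕ) (hm : 0 < m) (l : ℤ) {τ : ℂ} (hτ : 0 < τ.im) (z : ℂ) :
    HasSum (fun n : ℤ => ee (((l : ℂ) + 2 * (m : ℂ) * (n : ℂ)) ^ 2 / (4 * (m : ℂ)) * τ +
      ((l : ℂ) + 2 * (m : ℂ) * (n : ℂ)) * z)) (jTheta m l τ z) := by
  apply Summable.hasSum
  simp_rw [jTheta_term m hm]
  exact ((summable_jacobiTheta₂_term_iff _ _).2 (im_2m hm hτ)).mul_left _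

lemma jTheta_eq (m : ℕ) (hm : 0 < m) (l : ℤ) (τ z : ℂ) :
    jTheta m l τ z = ee ((l : ℂ) ^ 2 / (4 * m) * τ + l * z) *
      jacobiTheta₂ (l * τ + 2 * m * z) (2 * m * τ) := by
  unfold jTheta
  simp_rw [jTheta_term m hm]
  rw [tsum_mul_left]; rfl

lemma jTheta_diff (m : ℕ) (hm : 0 < m) (l : ℤ) {τ : ℂ} (hτ : 0 < τ.im) (z : ℂ) :
    DifferentiableAt ℂ (fun p : ℂ × ℂ => jTheta m l p.1 p.2) (τ, z) := by
  simp_rw [jTheta_eq m hm]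
  apply DifferentiableAt.mul
  · have : Differentiable ℂ (fun p : ℂ × ℂ => (l : ℂ) ^ 2 / (4 * m) * p.1 + l * p.2) := by fun_prop
    exact (ee_differentiable.comp this) _
  · have h1 := (hasFDerivAt_jacobiTheta₂ (l * τ + 2 * m * z) (im_2m hm hτ)).differentiableAt
    have h2 : DifferentiableAt ℂ
      (fun p : ℂ × ℂ => ((l : ℂ) * p.1 + 2 * m * p.2, 2 * (m : ℂ) * p.1)) (τ, z) := by fun_prop
    exact DifferentiableAt.comp (τ, z)
      (g := fun p : ℂ × ℂ => jacobiTheta₂ p.1 p.2) (f := fun p : ℂ × ℂ =>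
        ((l : ℂ) * p.1 + 2 * m * p.2, 2 * (m : ℂ) * p.1)) h1 h2

lemma jTheta_per (m : ℕ) (l : ℤ) (τ z : ℂ) : jTheta m (l + 2 * m) τ z = jTheta m l τ z := by
  unfold jTheta
  rw [← (Equiv.addRight (1 : ℤ)).tsum_eq (fun n : ℤ =>
    ee (((l : ℂ) + 2 * (m : ℂ) * (n : ℂ)) ^ 2 / (4 * (m : ℂ)) * τ +
      ((l : ℂ) + 2 * (m : ℂ) * (n : ℂ)) * z))]
  apply tsum_congr
  intro n
  simp only [Equiv.coe_addRight]
  push_cast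
  congr 1; ring

lemma jTheta_neg (m : ℕ) (l : ℤ) (τ z : ℂ) : jTheta m (-l) τ (-z) = jTheta m l τ z := by
  unfold jTheta
  rw [← (Equiv.neg ℤ).tsum_eq]
  apply tsum_congr
  intro n
  simp only [Equiv.neg_apply]
  push_cast
  congr 1; ring

lemma jTheta_T (m : ℕ) (hm : 0 < m) (l : ℤ) (τ z : ℂ) :
    jTheta m l (τ + 1) z = ee ((l : ℂ) ^ 2 / (4 * m)) * jTheta m l τ z := by
  have hm' : (m : ℂ) ≠ 0 := by exact_mod_cast hm.ne'
  unfold jTheta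
  rw [← tsum_mul_left]
  apply tsum_congr
  intro n
  rw [← ee_add]
  apply ee_eq_of_sub (l * n + m * n ^ 2)
  push_cast
  field_simp
  ring

lemma jTheta_elliptic (m : ℕ) (hm : 0 < m) (l : ℤ) : EllipticLaw m (jTheta m l) := by
  have hm' : (m : ℂ) ≠ 0 := by exact_mod_cast hm.ne'
  intro τ hτ z lam mu
  unfold jTheta
  rw [← tsum_mul_left, ← (Equiv.subRight lam).tsum_eq]
  apply tsum_congr
  intro n
  rw [← ee_add]
  apply ee_eq_of_sub ((l + 2 * m * (n - lam)) * mu)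
  simp only [Equiv.subRight_apply]
  push_cast
  field_simp
  ring

def rtS (m : ℕ) (τ : ℂ) : ℂ := (-I * (τ / (2 * m))) ^ (1 / 2 : ℂ)

lemma im_neg_inv {τ : ℂ} (hτ : 0 < τ.im) : 0 < (-1 / τ).im := by
  have : τ ≠ 0 := by rintro rfl; simp at hτ
  rw [neg_div, neg_im, one_div, inv_im, neg_div, neg_neg]
  exact div_pos hτ (normSq_pos.2 this)

lemma ne_of_im {τ : ℂ} (hτ : 0 < τ.im) : τ ≠ 0 := by rintro rfl; simp at hτ

lemma rtS_ne {m : ℕ} (hm : 0 < m) {τ : ℂ} (hτ : 0 < τ.im) : rtS m τ ≠ 0 := by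
  have hm' : (m : ℂ) ≠ 0 := by exact_mod_cast hm.ne'
  have := ne_of_im hτ
  unfold rtS
  rw [Complex.cpow_ne_zero_iff]
  left
  simp [hm', this]

lemma rtS_sq (m : ℕ) (τ : ℂ) : rtS m τ ^ 2 = -I * (τ / (2 * m)) := by
  unfold rtS
  rw [← Complex.cpow_nat_mul]; norm_num

lemma jTheta_S (m : ℕ) (hm : 0 < m) (l : ℤ) {τ : ℂ} (hτ : 0 < τ.im) (z : ℂ) :
    jTheta m l (-1 / τ) (z / τ) = rtS m τ * ee (m * z ^ 2 / τ) *
      ∑ l' ∈ range (2 * m), ee (-(l : ℂ) * l' / (2 * m)) * jTheta m l' τ z := by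
  have hm' : (m : ℂ) ≠ 0 := by exact_mod_cast hm.ne'
  have hτ0 := ne_of_im hτ
  have hT : 0 < (τ / (2 * m)).im := by
    have : τ / (2 * m) = ((1 / (2 * m) : ℝ) : ℂ) * τ := by push_cast; field_simp
    rw [this, Complex.im_ofReal_mul]; positivity
  have hsum : HasSum (fun n : ℤ => jacobiTheta₂_term n (z - l / (2 * m)) (τ / (2 * m)))
      (∑ l' ∈ range (2 * m), ee (-(l : ℂ) * l' / (2 * m)) * jTheta m l' τ z) := by
    apply hasSum_int_split (by positivity)
    intro l' _
    have := (jTheta_hasSum m hm l' hτ z).mul_left (ee (-(l : ℂ) * l' / (2 * m)))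
    refine hs_congr this (fun k => ?_) rfl
    rw [← ee_add, jacobiTheta₂_term]
    have : cexp (2 * Real.pi * I * ((l' + (2 * m : ℕ) * k : ℤ) : ℂ) * (z - l / (2 * m)) +
      Real.pi * I * ((l' + (2 * m : ℕ) * k : ℤ) : ℂ) ^ 2 * (τ / (2 * m))) =
      ee (((l' + (2 * m : ℕ) * k : ℤ) : ℂ) * (z - l / (2 * m)) +
        ((l' + (2 * m : ℕ) * k : ℤ) : ℂ) ^ 2 * (τ / (4 * m))) := by
      rw [ee]; congr 1; field_simp; ring
    rw [this]
    apply ee_eq_of_sub (-(l * k))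
    push_cast
    field_simp
    ring
  have hval := hsum.unique (hasSum_jacobiTheta₂_term _ hT)
  rw [hval, jacobiTheta₂_functional_equation, jTheta_eq m hm]
  have e1 : (z - l / (2 * m)) / (τ / (2 * m)) = (l : ℂ) * (-1 / τ) + 2 * m * (z / τ) := by
    field_simp; ring
  have e2 : -1 / (τ / (2 * m)) = 2 * (m : ℂ) * (-1 / τ) := by field_simp
  rw [e1, e2]
  have h3 := rtS_ne hm hτ
  unfold rtS at h3 ⊢
  generalize jacobiTheta₂ _ _ = J
  generalize (-I * (τ / (2 * m))) ^ (1 / 2 : ℂ) = s at h3 ⊢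
  have e3 : cexp (-Real.pi * I * (z - l / (2 * m)) ^ 2 / (τ / (2 * m))) =
     ee (-(z - l / (2 * m)) ^ 2 * m / τ) := by
    rw [ee]; congr 1; field_simp
  have e4 : s * ee (m * z ^ 2 / τ) * (1 / s * ee (-(z - l / (2 * m)) ^ 2 * m / τ) * J) =
     ee (m * z ^ 2 / τ + -(z - l / (2 * m)) ^ 2 * m / τ) * J := by
    rw [ee_add]; field_simp
  rw [e3, e4]
  congr 2
  field_simp
  ring

lemma hs_mul {ι κ : Type*} {f : ι → ℂ} {g : κ → ℂ} {a b : ℂ} (hf : HasSum f a) (hg : HasSum g b) :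
    HasSum (fun p : ι × κ => f p.1 * g p.2) (a * b) :=
  HasSum.mul hf hg (summable_mul_of_summable_norm (f := f) (g := g) hf.summable.norm
    hg.summable.norm)

lemma hasSum_int_split2 {N : ℕ} (hN : 0 < N) (g : ℤ × ℤ → ℂ) (S : ℕ → ℂ)
    (h : ∀ l ∈ range N, HasSum (fun p : ℤ × ℤ => g (p.1, l + N * p.2)) (S l)) :
    HasSum g (∑ l ∈ range N, S l) := by
  have hN' : (0 : ℤ) < N := by exact_mod_cast hN
  have h1 : ∀ l ∈ range N,
      HasSum (fun p : ℤ × ℤ => if p.2 % N = l then g p else 0) (S l) := by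
    intro l hl
    have hl' := mem_range.1 hl
    have inj : Function.Injective (fun p : ℤ × ℤ => ((p.1, (l : ℤ) + N * p.2) : ℤ × ℤ)) := by
      rintro ⟨a, b⟩ ⟨c, d⟩ hab
      simpa [hN.ne'] using hab
    have hlm : ∀ k : ℤ, ((l : ℤ) + N * k) % N = l := by
      intro k
      rw [Int.add_mul_emod_self_left]
      exact Int.emod_eq_of_lt (by positivity) (by exact_mod_cast hl')
    rw [← inj.hasSum_iff]
    · refine hs_congr (h l hl) (fun p => ?_) rfl
      simp [hlm]
    · rintro ⟨n, r⟩ hr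
      rw [if_neg]
      intro h2
      apply hr
      exact ⟨(n, r / N), by
        simp only [Prod.mk.injEq, true_and]; have := Int.emod_add_mul_ediv r N; simp only at h2; omega⟩
  have h2 := hasSum_sum h1
  refine hs_congr h2 (fun p => ?_) rfl
  have hr0 := Int.emod_nonneg p.2 hN'.ne'
  have hr1 := Int.emod_lt_of_pos p.2 hN'
  rw [Finset.sum_eq_single (p.2 % N).toNat]
  · rw [if_pos]; rw [Int.toNat_of_nonneg hr0]
  · intro b _ hb
    rw [if_neg]; intro h3; apply hb; omega
  · intro h3; exfalso; apply h3; rw [mem_range]; omega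

lemma mkEll_exp (m : ℕ) (hm : 0 < m) (C : ℤ → ℤ → ℂ) (H : ℤ → ℂ → ℂ)
    (hper : ∀ Δ l : ℤ, C Δ (l + 2 * (m : ℤ)) = C Δ l)
    (hsup : ∀ Δ l : ℤ, ¬ (4 * (m : ℤ)) ∣ (Δ + l ^ 2) → C Δ l = 0)
    (hs : ∀ l : ℤ, ∀ τ : ℂ, 0 < τ.im →
      HasSum (fun Δ : ℤ => C Δ l * ee ((Δ : ℂ) / (4 * m) * τ)) (H l τ))
    (τ z : ℂ) (hτ : 0 < τ.im) :
    HasSum (fun p : ℤ × ℤ => C (4 * (m : ℤ) * p.1 - p.2 ^ 2) p.2 *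
      ee ((p.1 : ℂ) * τ + (p.2 : ℂ) * z))
      (∑ l ∈ range (2 * m), H l τ * jTheta m l τ z) := by
  have hm' : (m : ℂ) ≠ 0 := by exact_mod_cast hm.ne'
  refine hasSum_int_split2 (N := 2 * m) (by positivity) _
    (fun l => H l τ * jTheta m l τ z) ?_
  intro l _
  simp only [Nat.cast_mul, Nat.cast_ofNat]
  have h1 := hs l τ hτ
  have h2 := jTheta_hasSum m hm l hτ z
  have h3 := hs_mul h1 h2
  have inj : Function.Injective (fun p : ℤ × ℤ =>
      ((4 * m * p.1 - (l + 2 * m * p.2) ^ 2, p.2) : ℤ × ℤ)) := by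
    rintro ⟨a, b⟩ ⟨c, d⟩ hab
    simp only [Prod.mk.injEq] at hab
    obtain ⟨h4, rfl⟩ := hab
    simpa [hm.ne'] using h4
  have perk : ∀ Δ k : ℤ, C Δ (l + 2 * m * k) = C Δ l := by
    intro Δ k
    exact per_dvd (hper Δ) (by rw [add_sub_cancel_left]; exact dvd_mul_right _ _)
  rw [← inj.hasSum_iff] at h3
  · refine hs_congr h3 (fun p => ?_) rfl
    simp only [Function.comp]
    push_cast
    rw [perk, mul_assoc (C _ _) (ee _) (ee _), ← ee_add]
    congr 2
    field_simp
    ring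
  · rintro ⟨D, k⟩ hD
    simp only
    rw [hsup D l, zero_mul, zero_mul]
    rintro ⟨n, hn⟩
    apply hD
    refine ⟨(n + l * k + m * k ^ 2, k), ?_⟩
    simp only [Prod.mk.injEq, and_true]
    linear_combination -hn

def mkEll (m : ℕ) (hm : 0 < m) (C : ℤ → ℤ → ℂ) (H : ℤ → ℂ → ℂ)
    (hper : ∀ Δ l : ℤ, C Δ (l + 2 * (m : ℤ)) = C Δ l)
    (hsup : ∀ Δ l : ℤ, ¬ (4 * (m : ℤ)) ∣ (Δ + l ^ 2) → C Δ l = 0)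
    (hd : ∀ l : ℤ, ∀ τ : ℂ, 0 < τ.im → DifferentiableAt ℂ (H l) τ)
    (hs : ∀ l : ℤ, ∀ τ : ℂ, 0 < τ.im →
      HasSum (fun Δ : ℤ => C Δ l * ee ((Δ : ℂ) / (4 * m) * τ)) (H l τ)) : EllFormData m where
  toFun τ z := ∑ l ∈ range (2 * m), H l τ * jTheta m l τ z
  coeff := C
  holo := by
    intro τ z hτ
    apply DifferentiableAt.fun_sum
    intro l _
    apply DifferentiableAt.mul
    · exact DifferentiableAt.comp (τ, z) (g := H l) (f := Prod.fst) (hd l τ hτ) differentiableAt_fst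
    · exact jTheta_diff m hm l hτ z
  elliptic := by
    intro τ hτ z lam mu
    simp only
    rw [mul_sum]
    apply sum_congr rfl
    intro l _
    rw [jTheta_elliptic m hm l τ hτ z lam mu]; ring
  expansion := fun τ z hτ => mkEll_exp m hm C H hper hsup hs τ z hτ
  periodic := hper
  support := hsup

lemma Kd_per (m d : ℕ) (Δ l : ℤ) : Kd m d Δ (l + 2 * m) = Kd m d Δ l := by
  unfold Kd
  have h1 : ∀ x : ℤ, (2 * m : ℤ) ∣ l + 2 * m - x ↔ (2 * m : ℤ) ∣ l - x := fun x => by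
    rw [show l + 2 * m - x = l - x + 2 * m by ring]; exact dvd_add_self_right
  have h2 : ∀ x : ℤ, (2 * m : ℤ) ∣ l + 2 * m + x ↔ (2 * m : ℤ) ∣ l + x := fun x => by
    rw [show l + 2 * m + x = l + x + 2 * m by ring]; exact dvd_add_self_right
  simp only [h1, h2]

lemma Kd_even (m d : ℕ) (Δ l : ℤ) : Kd m d Δ (-l) = Kd m d Δ l := by
  unfold Kd
  have h1 : ∀ x : ℤ, (2 * m : ℤ) ∣ -l - x ↔ (2 * m : ℤ) ∣ l + x := fun x => by
    rw [← dvd_neg]; congr! 1; ring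
  have h2 : ∀ x : ℤ, (2 * m : ℤ) ∣ -l + x ↔ (2 * m : ℤ) ∣ l - x := fun x => by
    rw [← dvd_neg]; congr! 1; ring
  simp only [h1, h2, or_comm]

lemma prod_nn (k d x : ℤ) (hd : 1 ≤ d) (hx : 1 ≤ x) : 0 ≤ (1 + k * d) * (1 + k * x) := by
  rcases le_or_gt 0 k with hk | hk
  · positivity
  · have h1 : 1 + k * d ≤ 0 := by nlinarith
    have h2 : 1 + k * x ≤ 0 := by nlinarith
    nlinarith

lemma Kd_ne (m d : ℕ) (hm : 0 < m) (hd : d ∣ m) (Δ l : ℤ) (h : Kd m d Δ l ≠ 0) :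
    Δ = -(((d : ℤ) - (m / d : ℕ)) ^ 2) ∧ ∃ n : ℤ, 0 ≤ n ∧ Δ = 4 * m * n - l ^ 2 := by
  unfold Kd at h
  split_ifs at h with h1
  · refine ⟨h1.1, ?_⟩
    have e : (d : ℤ) * (m / d : ℕ) = m := by exact_mod_cast Nat.mul_div_cancel' hd
    have hd1 : (1 : ℤ) ≤ d := by exact_mod_cast Nat.pos_of_dvd_of_pos hd hm
    have hx1 : (1 : ℤ) ≤ (m / d : ℕ) := by
      exact_mod_cast Nat.div_pos (Nat.le_of_dvd hm hd) (Nat.pos_of_dvd_of_pos hd hm)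
    rw [h1.1]
    generalize ((m / d : ℕ) : ℤ) = x at *
    rcases h1.2 with ⟨k, hk⟩ | ⟨k, hk⟩
    · refine ⟨(1 + k * d) * (1 + k * x), prod_nn _ _ _ hd1 hx1, ?_⟩
      have hl : l = d + x + 2 * m * k := by linarith
      rw [hl, ← e]; ring
    · refine ⟨(1 + (-k) * d) * (1 + (-k) * x), prod_nn _ _ _ hd1 hx1, ?_⟩
      have hl : l = -(d + x) + 2 * m * k := by linarith
      rw [hl, ← e]; ring
  · exact absurd rfl h

lemma ite_sum_zero (p : Prop) (s : Finset ℕ) (f : ℕ → ℂ) :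
    (if p then ∑ d ∈ s, f d else 0) = ∑ d ∈ s, if p then f d else 0 := by
  split_ifs <;> simp

lemma part_b (m : ℕ) (hm : 0 < m) (v : ℕ → ℕ → ℂ) (hv : ∀ m₁ m₂ : ℕ, v m₁ m₂ = v m₂ m₁) :
    ∃ φ : EllFormData m, IsEvenC φ.coeff ∧ IsWeakC m φ.coeff ∧
        ∀ m₁ m₂ : ℕ, m₁ * m₂ = m → Rfactor m φ.coeff m₁ m₂ = v m₁ m₂ := by
  set ds := m.divisors.filter (fun d => d * d ≤ m) with hds
  have hdd : ∀ d ∈ ds, d ∣ m := fun d hd => Nat.dvd_of_mem_divisors (Finset.mem_filter.1 hd).1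
  set c : ℕ → ℂ := fun d => v d (m / d) / Rom m (Kd m d) d (m / d) with hc
  set C : ℤ → ℤ → ℂ := fun Δ l => ∑ d ∈ ds, c d * Kd m d Δ l with hC
  have hne : ∀ Δ l, C Δ l ≠ 0 → ∃ d ∈ ds, Kd m d Δ l ≠ 0 := by
    intro Δ l h
    obtain ⟨d, hd, h1⟩ := Finset.exists_ne_zero_of_sum_ne_zero h
    exact ⟨d, hd, right_ne_zero_of_mul h1⟩
  have hper : ∀ Δ l : ℤ, C Δ (l + 2 * (m : ℤ)) = C Δ l := by
    intro Δ l; simp only [hC, Kd_per]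
  have hsup : ∀ Δ l : ℤ, ¬ (4 * (m : ℤ)) ∣ (Δ + l ^ 2) → C Δ l = 0 := by
    intro Δ l h
    by_contra h1
    obtain ⟨d, hd, h2⟩ := hne Δ l h1
    obtain ⟨_, n, _, h3⟩ := Kd_ne m d hm (hdd d hd) Δ l h2
    exact h ⟨n, by rw [h3]; ring⟩
  set s : Finset ℤ := ds.image (fun d : ℕ => -(((d : ℤ) - (m / d : ℕ)) ^ 2)) with hs
  have hzero : ∀ Δ l, Δ ∉ s → C Δ l = 0 := by
    intro Δ l h
    by_contra h1
    obtain ⟨d, hd, h2⟩ := hne Δ l h1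
    exact h (Finset.mem_image.2 ⟨d, hd, (Kd_ne m d hm (hdd d hd) Δ l h2).1.symm⟩)
  refine ⟨mkEll m hm C (fun l τ => ∑ Δ ∈ s, C Δ l * ee ((Δ : ℂ) / (4 * m) * τ)) hper hsup
    ?_ ?_, ?_, ?_, ?_⟩
  · intro l τ _
    apply DifferentiableAt.fun_sum
    intro Δ _
    apply DifferentiableAt.const_mul
    have : Differentiable ℂ (fun τ : ℂ => (Δ : ℂ) / (4 * m) * τ) := by fun_prop
    exact (ee_differentiable.comp this) τ
  · intro l τ _
    apply hasSum_sum_of_ne_finset_zero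
    intro Δ hΔ
    rw [hzero Δ l hΔ, zero_mul]
  · intro Δ l
    change C Δ (-l) = C Δ l
    simp only [hC, Kd_even]
  · intro n r hn
    change C _ r = 0
    by_contra h1
    obtain ⟨d, hd, h2⟩ := hne _ _ h1
    obtain ⟨_, n', h4, h3⟩ := Kd_ne m d hm (hdd d hd) _ _ h2
    have : (0 : ℤ) < 4 * m := by positivity
    nlinarith
  · intro m₁ m₂ h12
    change Rfactor m C m₁ m₂ = _
    rw [Rfactor_eq_Rom m hm m₁ m₂ h12 C hper]
    have hlin : ∀ a b : ℕ, Rom m C a b = ∑ d ∈ ds, c d * Rom m (Kd m d) a b := by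
      intro a b
      unfold Rom
      have hfin : ∀ d ∈ ds, HasSum (fun f : ℤ => c d * ∑ l ∈ range (2 * m),
          if Om a b l f then Kd m d (-(f ^ 2)) l else 0)
          (c d * ∑' f : ℤ, ∑ l ∈ range (2 * m),
          if Om a b l f then Kd m d (-(f ^ 2)) l else 0) := by
        intro d hd
        apply HasSum.mul_left
        apply Summable.hasSum
        apply summable_of_hasFiniteSupport
        apply Set.Finite.subset (s := {f : ℤ | f = (d : ℤ) - (m / d : ℕ) ∨
          f = -((d : ℤ) - (m / d : ℕ))})
        · exact (Set.toFinite {(d : ℤ) - (m / d : ℕ), -((d : ℤ) - (m / d : ℕ))})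
        · intro f hf
          obtain ⟨l, hl, h1⟩ := Finset.exists_ne_zero_of_sum_ne_zero hf
          split_ifs at h1 with h2
          · have := (Kd_ne m d hm (hdd d hd) _ _ h1).1
            exact sq_eq_sq_iff_eq_or_eq_neg.1 (by linarith)
          · exact absurd rfl h1
      rw [← (hasSum_sum hfin).tsum_eq]
      apply tsum_congr
      intro f
      simp only [hC]
      simp_rw [ite_sum_zero]
      rw [sum_comm]
      apply sum_congr rfl
      intro d _
      rw [mul_sum]
      apply sum_congr rfl
      intro l _
      split_ifs <;> simp
    have main : ∀ a b : ℕ, a * b = m → a * a ≤ m → Rom m C a b = v a b := by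
      intro a b hab ha
      have hb : m / a = b := by
        rw [← hab]; exact Nat.mul_div_cancel_left b (Nat.pos_of_ne_zero (by rintro rfl; omega))
      rw [hlin, Finset.sum_eq_single a]
      · simp only [hc]
        have := Rom_Kd_ne m a hm ⟨b, hab.symm⟩
        rw [hb] at this ⊢
        field_simp
      · intro d hd hda
        by_cases hdb : d = b
        · exfalso
          have h1 := (Finset.mem_filter.1 hd).2
          rw [hdb] at h1 hda
          rcases lt_or_gt_of_ne hda with h | h <;> nlinarith
        · rw [Rom_Kd_zero m d a b hm (hdd d hd) hab hda hdb, mul_zero]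
      · intro h
        exact absurd (Finset.mem_filter.2 ⟨Nat.mem_divisors.2 ⟨⟨b, hab.symm⟩, hm.ne'⟩, ha⟩) h
    rcases le_total (m₁ * m₁) m with h | h
    · exact main m₁ m₂ h12 h
    · rw [Rom_symm, hv]
      apply main m₂ m₁ (by rw [mul_comm]; exact h12)
      have : m₂ ≤ m₁ := by
        rw [← h12] at h
        exact Nat.le_of_mul_le_mul_left h (Nat.pos_of_ne_zero (by rintro rfl; omega))
      nlinarith

lemma int_coeff {ι : Type*} [Countable ι] (f : ℂ → ℂ) (τ₀ : ℂ) (c : ι → ℂ) (n : ι → ℤ)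
    (h : ∀ x : ℝ, HasSum (fun i => c i * ee (n i * (τ₀ + x))) (f (τ₀ + x))) :
    HasSum (fun i => if n i = 0 then c i else 0) (∫ x in (0 : ℝ)..1, f (τ₀ + x)) := by
  have hnorm : ∀ i (x : ℝ), ‖c i * ee (n i * (τ₀ + x))‖ = ‖c i * ee (n i * τ₀)‖ := by
    intro i x
    rw [norm_mul, norm_mul, norm_ee, norm_ee]
    congr 3
    simp
  have h0 : Summable (fun i => ‖c i * ee (n i * τ₀)‖) := by
    have := (h 0).summable.norm
    simpa using this
  have key := intervalIntegral.hasSum_integral_of_dominated_convergence (μ := volume) (a := 0)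
    (b := 1) (F := fun i (x : ℝ) => c i * ee (n i * (τ₀ + x))) (f := fun x : ℝ => f (τ₀ + x))
    (fun i _ => ‖c i * ee (n i * τ₀)‖) ?_ ?_ ?_ ?_ ?_
  · refine hs_congr key (fun i => ?_) rfl
    split_ifs with h1
    · simp [h1, ee_zero]
    · have h2 : ∀ x : ℝ, c i * ee (n i * (τ₀ + x)) =
        c i * ee (n i * τ₀) * cexp (2 * Real.pi * I * n i * x) := by
        intro x
        rw [mul_add, ee_add, mul_assoc]
        congr 2
        rw [ee]; congr 1; ring
      simp_rw [h2]
      rw [intervalIntegral.integral_const_mul, integral_exp_mul_complex]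
      · have : cexp (2 * Real.pi * I * n i * (1 : ℝ)) = 1 := by
          rw [Complex.exp_eq_one_iff]; exact ⟨n i, by push_cast; ring⟩
        rw [this]; simp
      · have : (n i : ℂ) ≠ 0 := by exact_mod_cast h1
        have hpi : (Real.pi : ℂ) ≠ 0 := by exact_mod_cast Real.pi_ne_zero
        simp [this]
  · intro i
    apply Continuous.aestronglyMeasurable
    have : Continuous ee := ee_differentiable.continuous
    fun_prop
  · intro i
    exact ae_of_all _ fun x _ => (hnorm i x).le
  · exact ae_of_all _ fun x _ => h0
  · exact intervalIntegrable_const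
  · exact ae_of_all _ fun x _ => h x

lemma resid_int (f : ℂ → ℂ) (hf : ∀ τ : ℂ, 0 < τ.im → DifferentiableAt ℂ f τ)
    (hS : ∀ τ : ℂ, 0 < τ.im → f (-1 / τ) = τ ^ 2 * f τ) :
    ∫ x in (0 : ℝ)..1, f ((-(1 / 2) + (Real.sqrt 3 / 2 : ℝ) * I) + x) = 0 := by
  set B := Metric.ball ((5 / 4 : ℝ) * I : ℂ) (3 / 4) with hB
  have memB : ∀ τ : ℂ, τ ∈ B ↔ τ.re ^ 2 + τ.im ^ 2 + 1 < 5 / 2 * τ.im := by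
    intro τ
    rw [hB, Metric.mem_ball, dist_eq_norm, ← sq_lt_sq₀ (norm_nonneg _) (by norm_num), ← normSq_eq_norm_sq,
      normSq_apply]
    simp only [sub_re, sub_im, mul_re, mul_im, ofReal_re, ofReal_im, I_re, I_im]
    constructor <;> intro h <;> nlinarith
  have imB : ∀ τ ∈ B, 0 < τ.im := by
    intro τ h
    have := (memB τ).1 h
    nlinarith [sq_nonneg τ.re, sq_nonneg τ.im]
  have SB : ∀ τ ∈ B, -1 / τ ∈ B := by
    intro τ h
    have h0 := ne_of_im (imB τ h)
    have h1 := (memB τ).1 h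
    have h2 : 0 < normSq τ := normSq_pos.2 h0
    rw [memB]
    have e1 : (-1 / τ).re = -τ.re / normSq τ := by
      rw [neg_div, neg_re, one_div, inv_re, neg_div]
    have e2 : (-1 / τ).im = τ.im / normSq τ := by
      rw [neg_div, neg_im, one_div, inv_im, neg_div, neg_neg]
    rw [e1, e2]
    have h3 : normSq τ = τ.re ^ 2 + τ.im ^ 2 := by rw [normSq_apply]; ring
    have h4 : (-τ.re / normSq τ) ^ 2 + (τ.im / normSq τ) ^ 2 = 1 / normSq τ := by
      field_simp; rw [h3]
    rw [h4, mul_div_assoc', div_add_one h2.ne', div_lt_div_iff_of_pos_right h2]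
    rw [h3]; linarith
  obtain ⟨G, hG⟩ := DifferentiableOn.isExactOn_ball (f := f) (c := ((5 / 4 : ℝ) * I : ℂ)) (r := 3 / 4)
    (fun τ h => (hf τ (imB τ h)).differentiableWithinAt)
  have hconst : ∀ τ ∈ B, G (-1 / τ) - G τ = 0 := by
    intro τ hτ
    have hi : I ∈ B := by rw [memB]; simp; norm_num
    have hd : ∀ x ∈ B, HasDerivAt (fun t => G (-1 / t) - G t) 0 x := by
      intro x hx
      have h0 := ne_of_im (imB x hx)
      have h1 : HasDerivAt (fun t : ℂ => -1 / t) (1 / x ^ 2) x := by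
        have h5 := (hasDerivAt_inv h0).neg
        have e : (fun t : ℂ => -1 / t) = -fun y : ℂ => y⁻¹ := by
          funext t; simp [neg_div]
        rw [e]
        exact h5.congr_deriv (by simp)
      have h2 := (hG _ (SB x hx)).comp x h1
      have h3 := h2.sub (hG x hx)
      refine HasDerivAt.congr_deriv h3 ?_
      rw [hS x (imB x hx)]; field_simp; simp
    have := (convex_ball ((5 / 4 : ℝ) * I : ℂ) (3 / 4)).is_const_of_fderivWithin_eq_zero (𝕜 := ℂ)
      (f := fun t => G (-1 / t) - G t)
      (fun x hx => (hd x hx).differentiableAt.differentiableWithinAt)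
      (fun x hx => by
        rw [fderivWithin_of_isOpen Metric.isOpen_ball hx]
        have := (hd x hx).hasFDerivAt.fderiv
        rw [this]; ext; simp) hτ hi
    rw [this]
    have : -1 / I = I := by rw [div_I]; simp
    simp only [this, sub_self]
  have h3 : Real.sqrt 3 ^ 2 = 3 := Real.sq_sqrt (by norm_num)
  have h3' : 8 / 5 < Real.sqrt 3 := Real.lt_sqrt_of_sq_lt (by norm_num)
  set ρ : ℂ := -(1 / 2) + (Real.sqrt 3 / 2 : ℝ) * I with hρ
  have ρre : ρ.re = -(1 / 2) := by simp [hρ]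
  have ρim : ρ.im = Real.sqrt 3 / 2 := by simp [hρ]
  have hseg : ∀ x ∈ Set.Icc (0 : ℝ) 1, ρ + x ∈ B := by
    intro x hx
    rw [memB]
    simp only [add_re, add_im, ρre, ρim, ofReal_re, ofReal_im]
    nlinarith [hx.1, hx.2]
  have hder : ∀ x ∈ Set.uIcc (0 : ℝ) 1, HasDerivAt (fun x : ℝ => G (ρ + x)) (f (ρ + x)) x := by
    intro x hx
    rw [Set.uIcc_of_le zero_le_one] at hx
    have h1 : HasDerivAt (fun x : ℂ => ρ + x) 1 (x : ℂ) := (hasDerivAt_id _).const_add ρ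
    have h2 := (hG _ (hseg x hx)).comp (x : ℂ) h1
    have := h2.comp_ofReal
    simpa using this
  rw [intervalIntegral.integral_eq_sub_of_hasDerivAt hder]
  · have hr : ρ ∈ B := by simpa using hseg 0 (by simp)
    have := hconst ρ hr
    have e : -1 / ρ = ρ + (1 : ℝ) := by
      rw [div_eq_iff (ne_of_im (imB ρ hr))]
      apply Complex.ext
      · simp [ρre, ρim]; nlinarith
      · simp [ρre, ρim]; ring
    rw [e] at this
    simpa using this
  · apply ContinuousOn.intervalIntegrable
    intro x hx
    rw [Set.uIcc_of_le zero_le_one] at hx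
    have h1 := (hf _ (imB _ (hseg x hx))).continuousAt
    have h2 : ContinuousAt (fun x : ℝ => f (ρ + x)) x :=
      ContinuousAt.comp (g := f) (f := fun x : ℝ => ρ + x) h1 (by fun_prop)
    exact h2.continuousWithinAt

lemma resid_sum {ι : Type*} [Countable ι] (f : ℂ → ℂ)
    (hf : ∀ τ : ℂ, 0 < τ.im → DifferentiableAt ℂ f τ)
    (hS : ∀ τ : ℂ, 0 < τ.im → f (-1 / τ) = τ ^ 2 * f τ) (c : ι → ℂ) (n : ι → ℤ)
    (h : ∀ τ : ℂ, 0 < τ.im → HasSum (fun i => c i * ee (n i * τ)) (f τ)) :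
    HasSum (fun i => if n i = 0 then c i else 0) 0 := by
  have := int_coeff f (-(1 / 2) + (Real.sqrt 3 / 2 : ℝ) * I) c n (fun x => h _ (by simp))
  rw [resid_int f hf hS] at this
  exact this

lemma sum_per_map {N : ℕ} (hN : 0 < N) {G : ℤ → ℂ} (hG : ∀ y, G (y + N) = G y) (u c : ℤ)
    (hu : IsCoprime u N) : ∑ x ∈ range N, G (u * x + c) = ∑ x ∈ range N, G x := by
  have hN' : (0 : ℤ) < N := by exact_mod_cast hN
  set i : ℕ → ℕ := fun x => ((u * x + c) % N).toNat with hi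
  have hiv : ∀ x, (i x : ℤ) = (u * x + c) % N := fun x =>
    Int.toNat_of_nonneg (Int.emod_nonneg _ hN'.ne')
  have hmap : ∀ x ∈ range N, i x ∈ range N := by
    intro x _
    have := Int.emod_lt_of_pos (u * x + c) hN'
    rw [← hiv] at this
    rw [mem_range]; exact_mod_cast this
  have hinj : Set.InjOn i (range N) := by
    intro x hx y hy h
    have h1 : (u * x + c) % N = (u * y + c) % N := by rw [← hiv, ← hiv, h]
    have h2 := Int.emod_emod_of_dvd
    have h3 : (N : ℤ) ∣ u * ((x : ℤ) - y) := by
      have := Int.ModEq.dvd (show (u * y + c) ≡ (u * x + c) [ZMOD N] from h1.symm)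
      rw [show u * x + c - (u * y + c) = u * ((x : ℤ) - y) by ring] at this
      exact this
    have h4 : (N : ℤ) ∣ (x : ℤ) - y := (hu.symm).dvd_of_dvd_mul_left h3
    have hx' := mem_range.1 hx
    have hy' := mem_range.1 hy
    have := Int.eq_zero_of_abs_lt_dvd h4 (by rw [abs_lt]; constructor <;> omega)
    omega
  refine Finset.sum_nbij i hmap hinj (Finset.surjOn_of_injOn_of_card_le i hmap hinj le_rfl) ?_
  intro x _
  apply per_dvd hG
  rw [hiv]
  exact Int.dvd_self_sub_emod

lemma hasSum_fin_prod {κ β : Type*} [Fintype κ] {f : κ → β → ℂ} {a : κ → ℂ}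
    (h : ∀ x, HasSum (f x) (a x)) : HasSum (fun p : κ × β => f p.1 p.2) (∑ x, a x) := by
  have h1 : ∀ x, HasSum (fun p : κ × β => if p.1 = x then f p.1 p.2 else 0) (a x) := by
    intro x
    have hinj : Function.Injective (fun b : β => (x, b)) := Prod.mk_right_injective x
    refine (hinj.hasSum_iff ?_).1 ?_
    · rintro ⟨y, b⟩ hy
      have : y ≠ x := by rintro rfl; exact hy ⟨b, rfl⟩
      simp [this]
    · refine hs_congr (h x) (fun b => ?_) rfl
      simp
  have h2 := hasSum_sum (s := Finset.univ) (fun x _ => h1 x)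
  refine hs_congr h2 (fun p => ?_) rfl
  simp

def TT (m k : ℕ) (ψ : ℂ → ℂ → ℂ) (τ : ℂ) (x y : ℤ) : ℂ :=
  ee (m * (x ^ 2 * τ + x * y) / k ^ 2) * ψ τ ((x * τ + y) / k)

lemma TT_per2 (k n : ℕ) (hk : 0 < k) (ψ : ℂ → ℂ → ℂ) (he : EllipticLaw (k * n) ψ) (τ : ℂ)
    (hτ : 0 < τ.im) (x y : ℤ) : TT (k * n) k ψ τ x (y + k) = TT (k * n) k ψ τ x y := by
  have hk' : (k : ℂ) ≠ 0 := by exact_mod_cast hk.ne'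
  have h := he τ hτ ((x * τ + y) / k) 0 1
  have e1 : ((x : ℂ) * τ + y) / k + ((0 : ℤ) : ℂ) * τ + ((1 : ℤ) : ℂ) =
    (x * τ + ((y + k : ℤ) : ℂ)) / k := by push_cast; field_simp; ring
  rw [e1] at h
  unfold TT
  rw [h, ← mul_assoc, ← ee_add]
  congr 1
  apply ee_eq_of_sub (n * x)
  push_cast; field_simp; ring

lemma TT_per1 (k n : ℕ) (hk : 0 < k) (ψ : ℂ → ℂ → ℂ) (he : EllipticLaw (k * n) ψ) (τ : ℂ)
    (hτ : 0 < τ.im) (x y : ℤ) : TT (k * n) k ψ τ (x + k) y = TT (k * n) k ψ τ x y := by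
  have hk' : (k : ℂ) ≠ 0 := by exact_mod_cast hk.ne'
  have h := he τ hτ ((x * τ + y) / k) 1 0
  have e1 : ((x : ℂ) * τ + y) / k + ((1 : ℤ) : ℂ) * τ + ((0 : ℤ) : ℂ) =
    (((x + k : ℤ) : ℂ) * τ + y) / k := by push_cast; field_simp; ring
  rw [e1] at h
  unfold TT
  rw [h, ← mul_assoc, ← ee_add]
  congr 1
  apply ee_eq_of_sub (-(n * y))
  push_cast; field_simp; ring

lemma TT_S (m k : ℕ) (hk : 0 < k) (ψ : ℂ → ℂ → ℂ) (hM : ModularLaw 2 m ψ) (τ : ℂ)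
    (hτ : 0 < τ.im) (x y : ℤ) : TT m k ψ (-1 / τ) x y = τ ^ 2 * TT m k ψ τ y (-x) := by
  have hk' : (k : ℂ) ≠ 0 := by exact_mod_cast hk.ne'
  have hτ0 := ne_of_im hτ
  have h := hM τ hτ ((y * τ - x) / k) 0 (-1) 1 0 (by norm_num)
  have e1 : (((0 : ℤ) : ℂ) * τ + ((-1 : ℤ) : ℂ)) / (((1 : ℤ) : ℂ) * τ + ((0 : ℤ) : ℂ)) = -1 / τ := by
    push_cast; simp
  have e2 : ((y : ℂ) * τ - x) / k / (((1 : ℤ) : ℂ) * τ + ((0 : ℤ) : ℂ)) = (x * (-1 / τ) + y) / k := by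
    rw [show (((1 : ℤ) : ℂ) * τ + ((0 : ℤ) : ℂ)) = τ by push_cast; ring]; field_simp; ring
  rw [e1, e2] at h
  unfold TT
  rw [h]
  push_cast
  rw [show (1 * τ + 0 : ℂ) = τ by ring, show (y * τ + -(x : ℂ)) = y * τ - x by ring]
  have e3 : ∀ a b c : ℂ, a * (τ ^ (2 : ℤ) * b * c) = τ ^ 2 * ((a * b) * c) := by
    intro a b c; rw [zpow_ofNat]; ring
  rw [e3, ← ee_add]
  congr 3
  field_simp; ring

lemma TT_sum (k n : ℕ) (hk : 0 < k) (ψ : ℂ → ℂ → ℂ) (he : EllipticLaw (k * n) ψ)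
    (hM : ModularLaw 2 (k * n) ψ) (τ : ℂ) (hτ : 0 < τ.im) :
    ∑ x ∈ range k, ∑ y ∈ range k, TT (k * n) k ψ (-1 / τ) x y =
      τ ^ 2 * ∑ x ∈ range k, ∑ y ∈ range k, TT (k * n) k ψ τ x y := by
  have e : ∀ x y : ℕ, TT (k * n) k ψ (-1 / τ) x y = τ ^ 2 * TT (k * n) k ψ τ y (-x) :=
    fun x y => TT_S (k * n) k hk ψ hM τ hτ x y
  simp only [e]
  rw [sum_comm, mul_sum]
  apply sum_congr rfl
  intro y _
  have := sum_per_map hk (TT_per2 k n hk ψ he τ hτ y) (-1) 0 isCoprime_one_left.neg_left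
  rw [← this, mul_sum]
  apply sum_congr rfl
  intro x _
  rw [show (-1 : ℤ) * (x : ℤ) + 0 = -(x : ℤ) by ring]

lemma TT_exp (k n : ℕ) (hk : 0 < k) (ψ : EllFormData (k * n)) (τ : ℂ) (hτ : 0 < τ.im) (x : ℕ) :
    HasSum (fun p : ℤ × ℤ => (if (k : ℤ) ∣ p.2 + n * x then
        (k : ℂ) * ψ.coeff (4 * ((k * n : ℕ) : ℤ) * p.1 - p.2 ^ 2) p.2 else 0) *
      ee (((p.1 + x * ((p.2 + n * x) / k) : ℤ) : ℂ) * τ))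
      (∑ y ∈ range k, TT (k * n) k ψ.toFun τ x y) := by
  have hk' : (k : ℂ) ≠ 0 := by exact_mod_cast hk.ne'
  have h1 : ∀ y ∈ range k, HasSum (fun p : ℤ × ℤ =>
      ee (((k * n : ℕ) : ℂ) * ((x : ℤ) ^ 2 * τ + (x : ℤ) * (y : ℤ)) / k ^ 2) *
      (ψ.coeff (4 * ((k * n : ℕ) : ℤ) * p.1 - p.2 ^ 2) p.2 *
      ee ((p.1 : ℂ) * τ + (p.2 : ℂ) * (((x : ℤ) * τ + (y : ℤ)) / k)))) (TT (k * n) k ψ.toFun τ x y) := by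
    intro y _
    exact (ψ.expansion τ _ hτ).mul_left _
  refine hs_congr (hasSum_sum h1) (fun p => ?_) rfl
  set c := ψ.coeff (4 * ((k * n : ℕ) : ℤ) * p.1 - p.2 ^ 2) p.2
  have h2 : ∀ y ∈ range k,
      ee (((k * n : ℕ) : ℂ) * ((x : ℤ) ^ 2 * τ + (x : ℤ) * (y : ℤ)) / k ^ 2) *
      (c * ee ((p.1 : ℂ) * τ + (p.2 : ℂ) * (((x : ℤ) * τ + (y : ℤ)) / k))) =
      c * ee ((p.1 + x * (p.2 + n * x) / k) * τ) * ee (((p.2 + n * x : ℤ) : ℂ) * y / k) := by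
    intro y _
    rw [mul_left_comm, mul_assoc, ← ee_add, ← ee_add]
    congr 2
    push_cast; field_simp; ring
  rw [sum_congr rfl h2, ← mul_sum, ee_sum_range k hk]
  split_ifs with h
  · obtain ⟨d, hd⟩ := h
    have hkz : (k : ℤ) ≠ 0 := by exact_mod_cast hk.ne'
    rw [hd, Int.mul_ediv_cancel_left _ hkz]
    have h3 : ((p.2 : ℂ) + n * x) = k * d := by exact_mod_cast hd
    rw [h3]
    have : ((p.1 : ℂ) + x * (k * d) / k) = ((p.1 + x * d : ℤ) : ℂ) := by
      push_cast; field_simp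
    rw [this]; ring
  · simp

lemma Rf_modular (k n : ℕ) (hk : 0 < k) (ψ : EllFormData (k * n))
    (hM : ModularLaw 2 (k * n) ψ.toFun) : Rf ψ.coeff k n = 0 := by
  have hkz : (k : ℤ) ≠ 0 := by exact_mod_cast hk.ne'
  have hk' : (k : ℂ) ≠ 0 := by exact_mod_cast hk.ne'
  have key := resid_sum (ι := Fin k × (ℤ × ℤ))
    (fun τ => ∑ x ∈ range k, ∑ y ∈ range k, TT (k * n) k ψ.toFun τ x y) ?_ ?_
    (fun q => if (k : ℤ) ∣ q.2.2 + n * (q.1 : ℕ) then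
        (k : ℂ) * ψ.coeff (4 * ((k * n : ℕ) : ℤ) * q.2.1 - q.2.2 ^ 2) q.2.2 else 0)
    (fun q => q.2.1 + (q.1 : ℕ) * ((q.2.2 + n * (q.1 : ℕ)) / k)) ?_
  · have hinj : Function.Injective (fun q : Fin k × ℤ => ((q.1, (-((q.1 : ℕ) : ℤ) *
        ((q.2 - n * (q.1 : ℕ)) / k), q.2 - 2 * n * (q.1 : ℕ))) : Fin k × (ℤ × ℤ))) := by
      rintro ⟨x, f⟩ ⟨y, g⟩ h
      simp only [Prod.mk.injEq] at h
      obtain ⟨rfl, _, h⟩ := h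
      simp only [Prod.mk.injEq, true_and]; linarith
    rw [← hinj.hasSum_iff] at key
    · have k2 := ((Equiv.prodComm ℤ (Fin k)).hasSum_iff.2 key)
      have k3 := k2.prod_fiberwise (fun b => hasSum_fintype _)
      have k4 := (k3.mul_left (k : ℂ)⁻¹).tsum_eq
      rw [mul_zero] at k4
      rw [← k4]
      unfold Rf
      apply tsum_congr
      intro f
      rw [mul_sum, Finset.sum_range]
      apply sum_congr rfl
      intro x _
      simp only [Function.comp, Equiv.prodComm_apply, Prod.swap]
      have e0 : f - 2 * (n : ℤ) * (x : ℕ) + n * (x : ℕ) = f - n * (x : ℕ) := by ring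
      have e00 : -((x : ℕ) : ℤ) * ((f - n * (x : ℕ)) / k) + (x : ℕ) * ((f - n * (x : ℕ)) / k) = 0 := by
        ring
      simp only [e0, e00, if_true]
      split_ifs with h
      · obtain ⟨d, hd⟩ := h
        rw [hd, Int.mul_ediv_cancel_left _ hkz, inv_mul_cancel_left₀ hk']
        congr 1
        have : f = k * d + n * (x : ℕ) := by linarith
        rw [this]; push_cast; ring
      · simp
    · rintro ⟨x, a, r⟩ hx
      simp only
      split_ifs with h1 h2
      · exfalso
        apply hx
        refine ⟨(x, r + 2 * n * (x : ℕ)), ?_⟩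
        simp only [Prod.mk.injEq, true_and]
        constructor
        · rw [show r + 2 * (n : ℤ) * (x : ℕ) - n * (x : ℕ) = r + n * (x : ℕ) by ring]; linarith
        · ring
      · rfl
      · rfl
  · intro τ hτ
    apply DifferentiableAt.fun_sum
    intro x _
    apply DifferentiableAt.fun_sum
    intro y _
    unfold TT
    apply DifferentiableAt.mul
    · exact (ee_differentiable _).comp τ (by fun_prop)
    · have h1 := ψ.holo τ (((x : ℤ) * τ + (y : ℤ)) / k) hτ
      exact DifferentiableAt.comp (f := fun t : ℂ => (t, ((x : ℤ) * t + (y : ℤ)) / (k : ℂ))) τ h1 (by fun_prop)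
  · intro τ hτ
    exact TT_sum k n hk ψ.toFun ψ.elliptic hM τ hτ
  · intro τ hτ
    refine hs_congr (hasSum_fin_prod (fun x : Fin k => TT_exp k n hk ψ τ hτ x)) (fun p => rfl) ?_
    rw [Finset.sum_range]

lemma part_a1 (m : ℕ) (hm : 0 < m) (φ ψ : EllFormData m) (hM : ModularLaw 2 m ψ.toFun)
    (h : ∀ n r : ℤ, 4 * (m : ℤ) * n ≤ r ^ 2 →
            ψ.coeff (4 * (m : ℤ) * n - r ^ 2) r = φ.coeff (4 * (m : ℤ) * n - r ^ 2) r)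
    (m₁ m₂ : ℕ) (h12 : m₁ * m₂ = m) : Rfactor m φ.coeff m₁ m₂ = 0 := by
  subst h12
  have h1 := Nat.pos_of_mul_pos_right hm
  have h2 := Nat.pos_of_mul_pos_left hm
  have hpol : ∀ f l : ℤ, φ.coeff (-(f ^ 2)) l = ψ.coeff (-(f ^ 2)) l := by
    intro f l
    by_cases hd : (4 * ((m₁ * m₂ : ℕ) : ℤ)) ∣ -(f ^ 2) + l ^ 2
    · obtain ⟨n, hn⟩ := hd
      have := h n l (by nlinarith [sq_nonneg f])
      rw [show 4 * ((m₁ * m₂ : ℕ) : ℤ) * n - l ^ 2 = -(f ^ 2) by linarith] at this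
      exact this.symm
    · rw [φ.support _ _ hd, ψ.support _ _ hd]
  rw [Rfactor_eq _ _ h1 h2 _ φ.periodic, ← Rf_modular m₁ m₂ h1 ψ hM]
  unfold Rf
  simp_rw [hpol]

def QRep (f : ℂ → ℂ) (P : PowerSeries ℂ) : Prop :=
  ∀ τ : ℂ, 0 < τ.im → HasSum (fun n : ℕ => coeff n P * ee (n * τ)) (f τ)

lemma ee_npow (n : ℕ) (τ : ℂ) : ee (n * τ) = ee τ ^ n := by
  rw [ee, ee, ← Complex.exp_nat_mul]; congr 1; ring

lemma ee_mem_ball {τ : ℂ} (hτ : 0 < τ.im) : ee τ ∈ Metric.ball (0 : ℂ) 1 := by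
  rw [mem_ball_zero_iff, norm_ee, Real.exp_lt_one_iff, neg_lt_zero]
  have := Real.pi_pos
  positivity

lemma ee_surj {q : ℂ} (hq : q ∈ Metric.ball (0 : ℂ) 1) (h0 : q ≠ 0) : ∃ τ : ℂ, 0 < τ.im ∧ ee τ = q := by
  have hpi := Real.pi_pos
  have hpi' : (Real.pi : ℂ) ≠ 0 := by exact_mod_cast hpi.ne'
  have he : ee (Complex.log q / (2 * Real.pi * I)) = q := by
    rw [ee, mul_div_cancel₀ _ (by simp [hpi']), Complex.exp_log h0]
  refine ⟨_, ?_, he⟩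
  rw [mem_ball_zero_iff, ← he, norm_ee, Real.exp_lt_one_iff, neg_lt_zero] at hq
  exact pos_of_mul_pos_right hq (by positivity)

lemma QRep.congr {f g : ℂ → ℂ} {P : PowerSeries ℂ} (h : QRep f P) (hfg : ∀ τ : ℂ, 0 < τ.im → g τ = f τ) :
    QRep g P := fun τ hτ => by rw [hfg τ hτ]; exact h τ hτ

lemma QRep.add {f g : ℂ → ℂ} {P Q : PowerSeries ℂ} (hf : QRep f P) (hg : QRep g Q) :
    QRep (fun τ => f τ + g τ) (P + Q) := fun τ hτ =>
  hs_congr ((hf τ hτ).add (hg τ hτ)) (fun n => by rw [map_add]; ring) rfl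

lemma QRep.smul {f : ℂ → ℂ} {P : PowerSeries ℂ} (c : ℂ) (hf : QRep f P) :
    QRep (fun τ => c * f τ) (c • P) := fun τ hτ =>
  hs_congr ((hf τ hτ).mul_left c) (fun n => by rw [map_smul, smul_eq_mul]; ring) rfl

lemma QRep.const (c : ℂ) : QRep (fun _ => c) (PowerSeries.C c) := fun τ _ => by
  have := hasSum_ite_eq (0 : ℕ) c
  refine hs_congr this (fun n => ?_) rfl
  rw [PowerSeries.coeff_C]
  by_cases h : n = 0
  · simp [h, ee_zero]
  · simp [h]

lemma QRep.sum {ι : Type*} (s : Finset ι) {f : ι → ℂ → ℂ} {P : ι → PowerSeries ℂ}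
    (h : ∀ i ∈ s, QRep (f i) (P i)) : QRep (fun τ => ∑ i ∈ s, f i τ) (∑ i ∈ s, P i) := fun τ hτ =>
  hs_congr (hasSum_sum (fun i hi => h i hi τ hτ)) (fun n => by rw [map_sum, sum_mul]) rfl

lemma QRep.mul {f g : ℂ → ℂ} {P Q : PowerSeries ℂ} (hf : QRep f P) (hg : QRep g Q) :
    QRep (fun τ => f τ * g τ) (P * Q) := fun τ hτ => by
  have h1 := (hf τ hτ).summable.norm
  have h2 := (hg τ hτ).summable.norm
  have h3 := tsum_mul_tsum_eq_tsum_sum_antidiagonal_of_summable_norm h1 h2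
  have h4 := (summable_norm_sum_mul_antidiagonal_of_summable_norm h1 h2).of_norm.hasSum
  rw [← h3, (hf τ hτ).tsum_eq, (hg τ hτ).tsum_eq] at h4
  refine hs_congr h4 (fun n => ?_) rfl
  rw [PowerSeries.coeff_mul, sum_mul]
  apply sum_congr rfl
  intro p hp
  obtain rfl := Finset.HasAntidiagonal.mem_antidiagonal.1 hp
  push_cast
  rw [add_mul, ee_add]; ring

lemma QRep.coeff_int {f : ℂ → ℂ} {ι : Type*} [Countable ι] (c : ι → ℂ) (k : ι → ℤ)
    (h : ∀ τ : ℂ, 0 < τ.im → HasSum (fun i => c i * ee (k i * τ)) (f τ)) (N : ℤ) :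
    HasSum (fun i => if k i = N then c i else 0) (∫ x in (0 : ℝ)..1, f (I + x) * ee (-N * (I + x))) := by
  have := int_coeff (fun τ => f τ * ee (-N * τ)) I c (fun i => k i - N) ?_
  · refine hs_congr this (fun i => ?_) rfl
    simp only [sub_eq_zero]
  · intro x
    refine hs_congr ((h (I + x) (by simp)).mul_right (ee (-N * (I + x)))) (fun i => ?_) rfl
    rw [mul_assoc, ← ee_add]
    congr 2; push_cast; ring

lemma QRep.coeff_eq {f : ℂ → ℂ} {P : PowerSeries ℂ} (h : QRep f P) (N : ℕ) :
    coeff N P = ∫ x in (0 : ℝ)..1, f (I + x) * ee (-((N : ℤ) : ℂ) * (I + x)) := by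
  have := QRep.coeff_int (fun n : ℕ => coeff n P) (fun n => (n : ℤ))
    (fun τ hτ => hs_congr (h τ hτ) (fun n => by push_cast; rfl) rfl) (N : ℤ)
  rw [← this.tsum_eq, tsum_eq_single N]
  · simp
  · intro n hn
    rw [if_neg]; exact_mod_cast hn

lemma QRep.unique {f : ℂ → ℂ} {P Q : PowerSeries ℂ} (h : QRep f P) (h' : QRep f Q) : P = Q := by
  ext N
  rw [h.coeff_eq, h'.coeff_eq]

lemma QRep.ofF (F : ℂ → ℂ) (hF : DifferentiableOn ℂ F (Metric.ball 0 1)) :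
    QRep (fun τ => F (ee τ)) (PowerSeries.mk fun n => iteratedDeriv n F 0 / (n.factorial : ℂ)) := by
  intro τ hτ
  have := Complex.hasSum_taylorSeries_on_ball hF (ee_mem_ball hτ)
  refine hs_congr this (fun n => ?_) rfl
  rw [PowerSeries.coeff_mk, ee_npow, sub_zero]
  simp only [smul_eq_mul]
  ring

lemma QRep.exF {f : ℂ → ℂ} {P : PowerSeries ℂ} (h : QRep f P) :
    ∃ F : ℂ → ℂ, DifferentiableOn ℂ F (Metric.ball 0 1) ∧ (∀ τ, 0 < τ.im → f τ = F (ee τ)) ∧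
      (∀ n, coeff n P = iteratedDeriv n F 0 / (n.factorial : ℂ)) ∧
      F 0 = coeff 0 P := by
  set F : ℂ → ℂ := fun q => ∑' n : ℕ, coeff n P * q ^ n with hF
  have hfF : ∀ τ, 0 < τ.im → f τ = F (ee τ) := by
    intro τ hτ
    rw [← (h τ hτ).tsum_eq]
    simp only [hF, ee_npow]
  have hd : DifferentiableOn ℂ F (Metric.ball 0 1) := by
    intro q hq
    rw [mem_ball_zero_iff] at hq
    obtain ⟨r, hr1, hr2⟩ := exists_between hq
    have hr0 : 0 < r := (norm_nonneg q).trans_lt hr1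
    obtain ⟨τ, hτ, he⟩ := ee_surj (q := (r : ℂ)) (by simpa [abs_of_pos hr0] using hr2)
      (by exact_mod_cast hr0.ne')
    have hs : Summable (fun n : ℕ => ‖coeff n P‖ * r ^ n) := by
      have := (h τ hτ).summable.norm
      refine this.congr (fun n => ?_)
      rw [norm_mul, ee_npow, he, norm_pow, norm_real, Real.norm_of_nonneg hr0.le]
    have := differentiableOn_tsum_of_summable_norm (F := fun (n : ℕ) (q : ℂ) => coeff n P * q ^ n)
      (U := Metric.ball 0 r) hs (fun n => by fun_prop) Metric.isOpen_ball (fun n w hw => by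
        rw [norm_mul, norm_pow]
        rw [mem_ball_zero_iff] at hw
        gcongr)
    exact ((this q (by simpa using hr1)).differentiableAt
      (Metric.isOpen_ball.mem_nhds (by simpa using hr1))).differentiableWithinAt
  refine ⟨F, hd, hfF, fun n => ?_, ?_⟩
  · rw [h.unique ((QRep.ofF F hd).congr hfF), PowerSeries.coeff_mk]
  · simp only [hF]
    rw [tsum_eq_single 0]
    · simp
    · intro n hn; simp [hn]

lemma QRep.diffAt {f : ℂ → ℂ} {P : PowerSeries ℂ} (h : QRep f P) {τ : ℂ} (hτ : 0 < τ.im) :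
    DifferentiableAt ℂ f τ := by
  obtain ⟨F, hd, hf, -⟩ := h.exF
  have h1 := (hd _ (ee_mem_ball hτ)).differentiableAt (Metric.isOpen_ball.mem_nhds (ee_mem_ball hτ))
  have h2 : DifferentiableAt ℂ (fun t => F (ee t)) τ := h1.comp τ (ee_differentiable τ)
  refine h2.congr_of_eventuallyEq ?_
  filter_upwards [(isOpen_lt continuous_const Complex.continuous_im).mem_nhds hτ] with t ht
  exact hf t ht

lemma QRep.deriv {f : ℂ → ℂ} {P : PowerSeries ℂ} (h : QRep f P) :
    QRep (fun τ => (2 * Real.pi * I)⁻¹ * deriv f τ)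
      (PowerSeries.mk fun n => n * coeff n P) := by
  obtain ⟨F, hd, hf, hc, -⟩ := h.exF
  have hd' : DifferentiableOn ℂ (_root_.deriv F) (Metric.ball 0 1) := hd.deriv Metric.isOpen_ball
  have h2 := QRep.ofF (fun q => q * _root_.deriv F q) (differentiableOn_id.mul hd')
  have h1 := QRep.ofF (_root_.deriv F) hd'
  have h3 : QRep (fun τ => ee τ) PowerSeries.X := by
    intro τ _
    refine hs_congr (hasSum_ite_eq (1 : ℕ) (ee τ)) (fun n => ?_) rfl
    rw [PowerSeries.coeff_X]
    by_cases hn : n = 1 <;> simp [hn]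
  have h4 := h3.mul h1
  have h5 : QRep (fun τ => (2 * Real.pi * I)⁻¹ * _root_.deriv f τ) (PowerSeries.X *
      PowerSeries.mk fun n => iteratedDeriv n (_root_.deriv F) 0 / (n.factorial : ℂ)) := by
    refine h4.congr (fun τ hτ => ?_)
    have e1 : _root_.deriv f τ = _root_.deriv (fun t => F (ee t)) τ := by
      apply Filter.EventuallyEq.deriv_eq
      filter_upwards [(isOpen_lt continuous_const Complex.continuous_im).mem_nhds hτ] with t ht
      exact hf t ht
    have e2 := ((hd _ (ee_mem_ball hτ)).differentiableAt
      (Metric.isOpen_ball.mem_nhds (ee_mem_ball hτ))).hasDerivAt.comp τ (ee_hasDerivAt τ)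
    have e3 : _root_.deriv (fun t => F (ee t)) τ = _ := e2.deriv
    rw [e1, e3]
    have hpi' : (Real.pi : ℂ) ≠ 0 := by exact_mod_cast Real.pi_pos.ne'
    field_simp
  have : (PowerSeries.mk fun n => (n : ℂ) * coeff n P) = PowerSeries.X *
      PowerSeries.mk fun n => iteratedDeriv n (_root_.deriv F) 0 / (n.factorial : ℂ) := by
    ext n
    rcases n with _ | n
    · simp
    · rw [PowerSeries.coeff_mk, PowerSeries.coeff_succ_X_mul, PowerSeries.coeff_mk, hc,
        iteratedDeriv_succ', Nat.factorial_succ]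
      have h1 : ((n.factorial : ℕ) : ℂ) ≠ 0 := by exact_mod_cast n.factorial_ne_zero
      have h2 : ((n : ℂ) + 1) ≠ 0 := by exact_mod_cast n.succ_ne_zero
      push_cast
      field_simp
  rw [this]; exact h5

lemma QRep.inv {f : ℂ → ℂ} {P : PowerSeries ℂ} (h : QRep f P) (h0 : coeff 0 P ≠ 0)
    (hne : ∀ τ, 0 < τ.im → f τ ≠ 0) : ∃ Q, QRep (fun τ => (f τ)⁻¹) Q ∧ P * Q = 1 := by
  obtain ⟨F, hd, hf, -, hF0⟩ := h.exF
  have hn : ∀ q ∈ Metric.ball (0 : ℂ) 1, F q ≠ 0 := by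
    intro q hq
    by_cases hq0 : q = 0
    · rw [hq0, hF0]; exact h0
    · obtain ⟨τ, hτ, rfl⟩ := ee_surj hq hq0
      rw [← hf τ hτ]; exact hne τ hτ
  have h1 := (QRep.ofF (fun q => (F q)⁻¹) (hd.inv hn)).congr (g := fun τ => (f τ)⁻¹)
    (fun τ hτ => by rw [hf τ hτ])
  refine ⟨_, h1, ?_⟩
  have h2 := (h.mul h1).congr (g := fun _ => 1) (fun τ hτ => (mul_inv_cancel₀ (hne τ hτ)).symm)
  rw [h2.unique (QRep.const 1), map_one]

lemma QRep.bdd {f : ℂ → ℂ} {P : PowerSeries ℂ} (h : QRep f P) :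
    ∃ M : ℝ, ∀ τ : ℂ, 1 ≤ τ.im → ‖f τ‖ ≤ M := by
  have hs := (h I (by simp)).summable.norm
  refine ⟨∑' n : ℕ, ‖coeff n P * ee (n * I)‖, fun τ hτ => ?_⟩
  have hτ' : 0 < τ.im := by linarith
  rw [← (h τ hτ').tsum_eq]
  refine (norm_tsum_le_tsum_norm (h τ hτ').summable.norm).trans ?_
  refine (h τ hτ').summable.norm.tsum_le_tsum (fun n => ?_) hs
  rw [norm_mul, norm_mul, norm_ee, norm_ee]
  gcongr
  have : (n : ℝ) * 1 ≤ n * τ.im := by gcongr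
  simpa using this

lemma QRep.per {f : ℂ → ℂ} {P : PowerSeries ℂ} (h : QRep f P) {τ : ℂ} (hτ : 0 < τ.im) :
    f (τ + 1) = f τ := by
  rw [← (h τ hτ).tsum_eq, ← (h (τ + 1) (by simpa using hτ)).tsum_eq]
  apply tsum_congr
  intro n
  congr 1
  apply ee_eq_of_sub n
  push_cast; ring

def IsQRep (f : ℂ → ℂ) : Prop := ∃ P, QRep f P

lemma IsQRep.prod {ι : Type*} (s : Finset ι) {f : ι → ℂ → ℂ}
    (h : ∀ i ∈ s, IsQRep (f i)) : IsQRep (fun τ => ∏ i ∈ s, f i τ) := by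
  induction s using Finset.induction_on with
  | empty => exact ⟨_, (QRep.const 1).congr (fun τ _ => by simp)⟩
  | insert a s ha ih =>
    obtain ⟨P, hP⟩ := ih (fun i hi => h i (Finset.mem_insert_of_mem hi))
    obtain ⟨Q, hQ⟩ := h a (Finset.mem_insert_self _ _)
    exact ⟨_, (hQ.mul hP).congr (fun τ _ => by rw [Finset.prod_insert ha])⟩

lemma IsQRep.sum {ι : Type*} (s : Finset ι) {f : ι → ℂ → ℂ}
    (h : ∀ i ∈ s, IsQRep (f i)) : IsQRep (fun τ => ∑ i ∈ s, f i τ) := by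
  choose! P hP using h
  exact ⟨_, QRep.sum s hP⟩

lemma IsQRep.mul {f g : ℂ → ℂ} (hf : IsQRep f) (hg : IsQRep g) : IsQRep (fun τ => f τ * g τ) := by
  obtain ⟨P, hP⟩ := hf
  obtain ⟨Q, hQ⟩ := hg
  exact ⟨_, hP.mul hQ⟩

lemma IsQRep.pow {f : ℂ → ℂ} (hf : IsQRep f) (n : ℕ) : IsQRep (fun τ => f τ ^ n) := by
  have := IsQRep.prod (range n) (f := fun _ => f) (fun _ _ => hf)
  simpa using this

lemma IsQRep.const (c : ℂ) : IsQRep (fun _ => c) := ⟨_, QRep.const c⟩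

lemma IsQRep.congr {f g : ℂ → ℂ} (hf : IsQRep f) (h : ∀ τ : ℂ, 0 < τ.im → g τ = f τ) : IsQRep g :=
  ⟨_, hf.choose_spec.congr h⟩

lemma IsQRep.det {n : ℕ} (M : ℂ → Matrix (Fin n) (Fin n) ℂ) (h : ∀ i j, IsQRep (fun τ => M τ i j)) :
    IsQRep (fun τ => (M τ).det) := by
  have := IsQRep.sum Finset.univ (f := fun (σ : Equiv.Perm (Fin n)) τ =>
    ((Equiv.Perm.sign σ : ℤ) : ℂ) * ∏ i, M τ (σ i) i)
    (fun σ _ => (IsQRep.const _).mul (IsQRep.prod _ (fun i _ => h _ _)))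
  refine this.congr (fun τ _ => ?_)
  rw [Matrix.det_apply']

lemma IsQRep.adj {n : ℕ} (M : ℂ → Matrix (Fin n) (Fin n) ℂ) (h : ∀ i j, IsQRep (fun τ => M τ i j))
    (i j : Fin n) : IsQRep (fun τ => (M τ).adjugate i j) := by
  have := IsQRep.det (fun τ => (M τ).updateRow j (Pi.single i 1)) (fun a b => ?_)
  · refine this.congr (fun τ _ => ?_)
    rw [Matrix.adjugate_apply]
  · by_cases ha : a = j
    · subst ha
      simp only [Matrix.updateRow_self]
      exact IsQRep.const _
    · simp only [Matrix.updateRow_ne ha]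
      exact h a b

def SLaw (k : ℤ) (f : ℂ → ℂ) : Prop := ∀ τ : ℂ, 0 < τ.im → f (-1 / τ) = τ ^ k * f τ

def MF (k : ℤ) (f : ℂ → ℂ) : Prop := IsQRep f ∧ SLaw k f

section
open UpperHalfPlane hiding I
open ModularForm MatrixGroups

def extF (f : ℍ → ℂ) : ℂ → ℂ := fun τ => f (ofComplex τ)

lemma extF_apply (f : ℍ → ℂ) {τ : ℂ} (hτ : 0 < τ.im) : extF f τ = f ⟨τ, hτ⟩ := by
  rw [extF, ofComplex_apply_of_im_pos hτ]

lemma extF_neg_inv (f : ℍ → ℂ) {τ : ℂ} (hτ : 0 < τ.im) :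
    extF f (-1 / τ) = f (ModularGroup.S • (⟨τ, hτ⟩ : ℍ)) := by
  rw [extF_apply f (im_neg_inv hτ), UpperHalfPlane.modular_S_smul]
  congr 1
  ext
  simp [neg_div]

lemma slash_S_apply (f : ℍ → ℂ) (k : ℤ) {τ : ℂ} (hτ : 0 < τ.im) :
    (f ∣[k] ModularGroup.S) ⟨τ, hτ⟩ = extF f (-1 / τ) * (τ ^ k)⁻¹ := by
  rw [SL_slash_apply, extF_neg_inv f hτ, zpow_neg]
  rw [ModularGroup.denom_S]

lemma MF_bundle {k : ℤ} {f : ℂ → ℂ} (h : MF k f) :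
    ∃ g : ModularForm 𝒮ℒ k, ∀ τ : ℍ, g τ = f τ := by
  obtain ⟨⟨P, hP⟩, hS⟩ := h
  set F : ℍ → ℂ := fun τ => f τ with hF
  have he : ∀ τ : ℂ, 0 < τ.im → extF F τ = f τ := fun τ hτ => by rw [extF_apply F hτ]
  have h1 : F ∣[k] ModularGroup.S = F := by
    ext ⟨τ, hτ⟩
    have hτ' : 0 < τ.im := hτ
    rw [slash_S_apply F k hτ', he _ (im_neg_inv hτ'), hS τ hτ']
    have : τ ^ k ≠ 0 := zpow_ne_zero _ (ne_of_im hτ')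
    simp only [hF]
    field_simp
  have h2 : F ∣[k] ModularGroup.T = F := by
    ext τ
    rw [SL_slash_apply, UpperHalfPlane.modular_T_smul]
    have := hP.per τ.2
    have hd : denom (ModularGroup.T : GL (Fin 2) ℝ) τ = 1 := by
      rw [ModularGroup.denom_apply]; simp [ModularGroup.T]
    rw [hd]
    simp only [hF]
    simp [add_comm (1 : ℂ)]
    exact this
  have h3 := SlashInvariantForm.slash_action_generators_SL2Z h1 h2
  refine ⟨⟨⟨F, ?_⟩, ?_, ?_⟩, fun τ => rfl⟩
  · rintro A ⟨A, rfl⟩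
    exact h3 A
  · rw [UpperHalfPlane.mdifferentiable_iff]
    intro τ hτ
    refine DifferentiableWithinAt.congr (hP.diffAt hτ).differentiableWithinAt (fun t ht => he t ht) (he τ hτ)
  · intro c hc
    rw [Subgroup.IsArithmetic.isCusp_iff_isCusp_SL2Z] at hc
    rw [OnePoint.isBoundedAt_iff_forall_SL2Z hc]
    intro γ _
    rw [h3 γ, isBoundedAtImInfty_iff]
    obtain ⟨M, hM⟩ := hP.bdd
    exact ⟨M, 1, fun τ hτ => hM τ hτ⟩

lemma extF_QRep {k : ℤ} (g : ModularForm 𝒮ℒ k) : QRep (extF g) (qExpansion 1 g) := by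
  intro τ hτ
  have := ModularForm.hasSum_qExpansion (h := 1) (f := g) one_pos one_mem_strictPeriods_SL ⟨τ, hτ⟩
  rw [extF_apply g hτ]
  refine hs_congr this (fun n => ?_) rfl
  rw [ee_npow]
  congr 2
  simp [Function.Periodic.qParam, ee]

lemma extF_SLaw {k : ℤ} (g : ModularForm 𝒮ℒ k) : SLaw k (extF g) := by
  intro τ hτ
  have h1 : (g : ℍ → ℂ) ∣[k] ModularGroup.S = g := g.slash_action_eq' _ ⟨ModularGroup.S, rfl⟩
  have h2 := slash_S_apply g k hτ
  rw [h1] at h2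
  rw [extF_apply g hτ, h2]
  have : τ ^ k ≠ 0 := zpow_ne_zero _ (ne_of_im hτ)
  field_simp

lemma MF_zero_const {f : ℂ → ℂ} (h : MF 0 f) : ∃ c, ∀ τ : ℂ, 0 < τ.im → f τ = c := by
  obtain ⟨g, hg⟩ := MF_bundle h
  obtain ⟨c, hc⟩ := ModularFormClass.levelOne_weight_zero_const g
  exact ⟨c, fun τ hτ => by rw [← hg ⟨τ, hτ⟩, hc]; rfl⟩

lemma MF_neg {k : ℤ} (hk : k < 0) {f : ℂ → ℂ} (h : MF k f) {τ : ℂ} (hτ : 0 < τ.im) : f τ = 0 := by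
  obtain ⟨g, hg⟩ := MF_bundle h
  rw [← hg ⟨τ, hτ⟩, ModularFormClass.levelOne_neg_weight_eq_zero hk g]; rfl

lemma MF_two {f : ℂ → ℂ} (h : MF 2 f) {τ : ℂ} (hτ : 0 < τ.im) : f τ = 0 := by
  obtain ⟨g, hg⟩ := MF_bundle h
  have := rank_zero_iff_forall_zero.1 levelOne_weight_two_rank_zero g
  rw [← hg ⟨τ, hτ⟩, this]; rfl

def fE4 : ℂ → ℂ := extF ModularForm.E₄
def fE6 : ℂ → ℂ := extF ModularForm.E₆
def fDl : ℂ → ℂ := extF ModularForm.discriminant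
def fE2 : ℂ → ℂ := extF EisensteinSeries.E2

lemma fDl_eq {τ : ℂ} (hτ : 0 < τ.im) : fDl τ = (1 / 1728) * (fE4 τ ^ 3 + (-1) * fE6 τ ^ 2) := by
  rw [fDl, extF_apply _ hτ, discriminant_eq_E₄_cube_sub_E₆_sq, fE4, fE6, extF_apply _ hτ, extF_apply _ hτ]
  ring

lemma fDl_ne {τ : ℂ} (hτ : 0 < τ.im) : fDl τ ≠ 0 := by
  rw [fDl, extF_apply _ hτ]; exact discriminant_ne_zero _

lemma fE2_S {τ : ℂ} (hτ : 0 < τ.im) : fE2 (-1 / τ) = τ ^ 2 * fE2 τ + 12 * τ / (2 * Real.pi * I) := by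
  have h1 := congrFun (EisensteinSeries.E2_slash_action ModularGroup.S) ⟨τ, hτ⟩
  rw [slash_S_apply _ _ hτ] at h1
  have h2 := EisensteinSeries.D2_S ⟨τ, hτ⟩
  simp only [Pi.sub_apply, Pi.smul_apply, h2, smul_eq_mul, riemannZeta_two] at h1
  rw [fE2, extF_apply _ hτ]
  have h0 := ne_of_im hτ
  have hpi' : (Real.pi : ℂ) ≠ 0 := by exact_mod_cast Real.pi_pos.ne'
  rw [mul_inv_eq_iff_eq_mul₀ (zpow_ne_zero _ h0)] at h1
  rw [h1]
  have hI : (I : ℂ) ^ 2 = -1 := I_sq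
  field_simp
  linear_combination (-12) * hI

lemma fE2_QRep : QRep fE2 (PowerSeries.mk fun n => if n = 0 then 1 else -24 * (ArithmeticFunction.sigma 1 n : ℂ)) := by
  intro τ hτ
  have := EisensteinSeries.hasSum_qExpansion_E2 (z := ⟨τ, hτ⟩)
  rw [fE2, extF_apply _ hτ]
  refine hs_congr this (fun n => ?_) rfl
  rw [ee_npow, smul_eq_mul, PowerSeries.coeff_mk]
  simp [ee]

end

def IntC (N : ℕ) : Subring ℂ where
  carrier := {x | ∃ k : ℕ, ∃ n : ℤ, (N : ℂ) ^ k * x = n}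
  mul_mem' := by
    rintro x y ⟨k, n, h⟩ ⟨l, o, h'⟩
    exact ⟨k + l, n * o, by push_cast; rw [← h, ← h']; ring⟩
  one_mem' := ⟨0, 1, by simp⟩
  add_mem' := by
    rintro x y ⟨k, n, h⟩ ⟨l, o, h'⟩
    exact ⟨k + l, N ^ l * n + N ^ k * o, by push_cast; rw [← h, ← h']; ring⟩
  zero_mem' := ⟨0, 0, by simp⟩
  neg_mem' := by
    rintro x ⟨k, n, h⟩
    exact ⟨k, -n, by push_cast; rw [← h]; ring⟩

lemma IntC.inv {N a : ℕ} (k : ℕ) (ha : a ∣ N ^ k) (ha0 : a ≠ 0) : ((a : ℂ)⁻¹) ∈ IntC N := by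
  obtain ⟨b, hb⟩ := ha
  refine ⟨k, b, ?_⟩
  have : (a : ℂ) ≠ 0 := by exact_mod_cast ha0
  rw [← Nat.cast_pow, hb]; push_cast; field_simp

def RPS (N : ℕ) : Subring (PowerSeries ℂ) := (PowerSeries.map (IntC N).subtype).range

lemma mem_RPS {N : ℕ} {P : PowerSeries ℂ} : P ∈ RPS N ↔ ∀ n, coeff n P ∈ IntC N := by
  constructor
  · rintro ⟨Q, rfl⟩ n
    rw [PowerSeries.coeff_map]; exact (coeff n Q).2
  · intro h
    refine ⟨PowerSeries.mk fun n => ⟨_, h n⟩, ?_⟩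
    ext n
    rw [PowerSeries.coeff_map, PowerSeries.coeff_mk]; rfl

lemma RPS_inv {N : ℕ} {P Q : PowerSeries ℂ} (h : P ∈ RPS N) (h1 : coeff 0 P = 1)
    (hPQ : P * Q = 1) : Q ∈ RPS N := by
  obtain ⟨P', rfl⟩ := h
  have h2 : P' * PowerSeries.invOfUnit P' 1 = 1 := by
    apply PowerSeries.mul_invOfUnit
    apply Subtype.val_injective
    rw [← PowerSeries.coeff_zero_eq_constantCoeff_apply]
    rw [PowerSeries.coeff_map] at h1
    simpa using h1
  refine ⟨PowerSeries.invOfUnit P' 1, ?_⟩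
  have h3 := congrArg (PowerSeries.map (IntC N).subtype) h2
  rw [map_mul, map_one] at h3
  calc _ = PowerSeries.map (IntC N).subtype (PowerSeries.invOfUnit P' 1) *
        (PowerSeries.map (IntC N).subtype P' * Q) := by rw [hPQ, mul_one]
    _ = (PowerSeries.map (IntC N).subtype P' *
        PowerSeries.map (IntC N).subtype (PowerSeries.invOfUnit P' 1)) * Q := by ring
    _ = Q := by rw [h3, one_mul]

lemma RPS_smul {N : ℕ} {P : PowerSeries ℂ} {c : ℂ} (hc : c ∈ IntC N) (h : P ∈ RPS N) : c • P ∈ RPS N := by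
  rw [mem_RPS] at *
  intro n
  rw [map_smul]; exact mul_mem hc (h n)

def QI (N : ℕ) (f : ℂ → ℂ) : Prop := ∃ P, QRep f P ∧ P ∈ RPS N

lemma QI.mul {N : ℕ} {f g : ℂ → ℂ} (hf : QI N f) (hg : QI N g) : QI N (fun τ => f τ * g τ) := by
  obtain ⟨P, hP, h1⟩ := hf
  obtain ⟨Q, hQ, h2⟩ := hg
  exact ⟨_, hP.mul hQ, mul_mem h1 h2⟩

lemma QI.add {N : ℕ} {f g : ℂ → ℂ} (hf : QI N f) (hg : QI N g) : QI N (fun τ => f τ + g τ) := by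
  obtain ⟨P, hP, h1⟩ := hf
  obtain ⟨Q, hQ, h2⟩ := hg
  exact ⟨_, hP.add hQ, add_mem h1 h2⟩

lemma QI.smul {N : ℕ} {f : ℂ → ℂ} {c : ℂ} (hc : c ∈ IntC N) (hf : QI N f) : QI N (fun τ => c * f τ) := by
  obtain ⟨P, hP, h1⟩ := hf
  exact ⟨_, hP.smul c, RPS_smul hc h1⟩

lemma QI.one {N : ℕ} : QI N (fun _ => 1) := ⟨_, QRep.const 1, by rw [map_one]; exact one_mem _⟩

lemma QI.congr {N : ℕ} {f g : ℂ → ℂ} (hf : QI N f) (h : ∀ τ : ℂ, 0 < τ.im → g τ = f τ) : QI N g := by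
  obtain ⟨P, hP, h1⟩ := hf
  exact ⟨P, hP.congr h, h1⟩

lemma QI.pow {N : ℕ} {f : ℂ → ℂ} (hf : QI N f) (n : ℕ) : QI N (fun τ => f τ ^ n) := by
  induction n with
  | zero => exact QI.one.congr (fun _ _ => pow_zero _)
  | succ n ih => exact (ih.mul hf).congr (fun _ _ => pow_succ _ _)

lemma QI.isQ {N : ℕ} {f : ℂ → ℂ} (hf : QI N f) : IsQRep f := ⟨_, hf.choose_spec.1⟩

lemma QRep.shift {f : ℂ → ℂ} {Q : PowerSeries ℂ} (h : QRep f (PowerSeries.X * Q)) :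
    QRep (fun τ => f τ * (ee τ)⁻¹) Q := by
  intro τ hτ
  have h1 := h τ hτ
  have h2 := (hasSum_nat_add_iff' 1).2 h1
  rw [Finset.sum_range_one] at h2
  refine hs_congr (h2.mul_right ((ee τ)⁻¹)) (fun n => ?_) ?_
  · rw [PowerSeries.coeff_succ_X_mul, ee_npow, ee_npow, pow_succ]
    field_simp [ee_ne τ]
  · simp

lemma c0mul (P Q : PowerSeries ℂ) : coeff 0 (P * Q) = coeff 0 P * coeff 0 Q := by
  simp

lemma c1mul (P Q : PowerSeries ℂ) : coeff 1 (P * Q) =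
    coeff 0 P * coeff 1 Q + coeff 1 P * coeff 0 Q := by
  rw [PowerSeries.coeff_mul, Finset.Nat.sum_antidiagonal_eq_sum_range_succ
    (f := fun i j => coeff i P * coeff j Q)]
  simp [Finset.sum_range_succ]

lemma fE4_QI (N : ℕ) : QRep fE4 (UpperHalfPlane.qExpansion 1 ModularForm.E₄) ∧
    UpperHalfPlane.qExpansion 1 ModularForm.E₄ ∈ RPS N ∧
    ∀ n, coeff n (UpperHalfPlane.qExpansion 1 ModularForm.E₄) =
      if n = 0 then 1 else 240 * (ArithmeticFunction.sigma 3 n : ℂ) := by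
  have h : ∀ n, coeff n (UpperHalfPlane.qExpansion 1 ModularForm.E₄) =
      if n = 0 then 1 else 240 * (ArithmeticFunction.sigma 3 n : ℂ) := by
    intro n
    rw [EisensteinSeries.E_qExpansion_coeff _ (by decide)]
    have hb : bernoulli 4 = -1 / 30 := by rw [bernoulli_eq_bernoulli'_of_ne_one (by norm_num), bernoulli'_four]
    rw [hb]
    norm_num
  refine ⟨extF_QRep _, mem_RPS.2 fun n => ?_, h⟩
  rw [h]
  split_ifs
  · exact one_mem _
  · exact_mod_cast natCast_mem (IntC N) (240 * ArithmeticFunction.sigma 3 n)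

lemma bern6 : bernoulli 6 = 1 / 42 := by
  have h5 : bernoulli 5 = 0 := by
    rw [bernoulli_eq_bernoulli'_of_ne_one (by norm_num)]
    exact bernoulli'_eq_zero_of_odd (by decide) (by norm_num)
  have hb : bernoulli 4 = -1 / 30 := by rw [bernoulli_eq_bernoulli'_of_ne_one (by norm_num), bernoulli'_four]
  have h3 : bernoulli 3 = 0 := by
    rw [bernoulli_eq_bernoulli'_of_ne_one (by norm_num)]
    exact bernoulli'_eq_zero_of_odd (by decide) (by norm_num)
  have h := sum_bernoulli 7
  simp only [Finset.sum_range_succ, Finset.sum_range_zero, h5, hb, h3, bernoulli_two, bernoulli_one, bernoulli_zero] at h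
  norm_num [Nat.choose] at h
  linarith

lemma fE6_QI (N : ℕ) : QRep fE6 (UpperHalfPlane.qExpansion 1 ModularForm.E₆) ∧
    UpperHalfPlane.qExpansion 1 ModularForm.E₆ ∈ RPS N ∧
    ∀ n, coeff n (UpperHalfPlane.qExpansion 1 ModularForm.E₆) =
      if n = 0 then 1 else -504 * (ArithmeticFunction.sigma 5 n : ℂ) := by
  have h : ∀ n, coeff n (UpperHalfPlane.qExpansion 1 ModularForm.E₆) =
      if n = 0 then 1 else -504 * (ArithmeticFunction.sigma 5 n : ℂ) := by
    intro n
    rw [EisensteinSeries.E_qExpansion_coeff _ (by decide), bern6]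
    norm_num
  refine ⟨extF_QRep _, mem_RPS.2 fun n => ?_, h⟩
  rw [h]
  split_ifs
  · exact one_mem _
  · have := intCast_mem (IntC N) (-504 * (ArithmeticFunction.sigma 5 n : ℤ))
    exact_mod_cast this

lemma fE2_QI (N : ℕ) : QI N fE2 := by
  refine ⟨_, fE2_QRep, mem_RPS.2 fun n => ?_⟩
  rw [PowerSeries.coeff_mk]
  split_ifs
  · exact one_mem _
  · have := intCast_mem (IntC N) (-24 * (ArithmeticFunction.sigma 1 n : ℤ))
    exact_mod_cast this

def dN (m : ℕ) : ℕ := 24 * m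

lemma dN_inv {m a : ℕ} (k : ℕ) (ha : a ∣ (24 * m) ^ k) (ha0 : a ≠ 0) : ((a : ℂ)⁻¹) ∈ IntC (dN m) := IntC.inv k ha ha0

lemma fDl_exp (m : ℕ) : ∃ U, QRep fDl (PowerSeries.X * U) ∧ U ∈ RPS (dN m) ∧ coeff 0 U = 1 := by
  obtain ⟨h4, i4, c4⟩ := fE4_QI (dN m)
  obtain ⟨h6, i6, c6⟩ := fE6_QI (dN m)
  set P4 := UpperHalfPlane.qExpansion 1 ModularForm.E₄
  set P6 := UpperHalfPlane.qExpansion 1 ModularForm.E₆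
  have h1 := ((((h4.mul h4).mul h4).add ((h6.mul h6).smul (-1))).smul (1 / 1728)).congr (g := fDl)
    (fun τ hτ => by rw [fDl_eq hτ]; ring)
  set P : PowerSeries ℂ := (1 / 1728 : ℂ) • (P4 * P4 * P4 + (-1 : ℂ) • (P6 * P6)) with hP
  have hc : (1 / 1728 : ℂ) ∈ IntC (dN m) := by
    have := dN_inv (m := m) (a := 1728) 3 ⟨8 * m ^ 3, by ring⟩ (by norm_num)
    simpa using this
  have hi : P ∈ RPS (dN m) := by
    refine RPS_smul hc (add_mem (mul_mem (mul_mem i4 i4) i4) (RPS_smul (neg_mem (one_mem _)) (mul_mem i6 i6)))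
  have e0 : coeff 0 P = 0 := by
    simp only [hP, map_smul, map_add, c0mul, c4, c6]
    norm_num
  have e1 : coeff 1 P = 1 := by
    simp only [hP, map_smul, map_add, c1mul, c0mul, c4, c6]
    norm_num
  have hX : P = PowerSeries.X * PowerSeries.mk fun n => coeff (n + 1) P := by
    ext n
    rcases n with _ | n
    · rw [e0]; simp
    · rw [PowerSeries.coeff_succ_X_mul, PowerSeries.coeff_mk]
  refine ⟨PowerSeries.mk fun n => coeff (n + 1) P, by rw [← hX]; exact h1, ?_, ?_⟩
  · rw [mem_RPS] at hi ⊢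
    intro n; rw [PowerSeries.coeff_mk]; exact hi _
  · rw [PowerSeries.coeff_mk]; exact e1

def fU (τ : ℂ) : ℂ := fDl τ * (ee τ)⁻¹

lemma fU_ne {τ : ℂ} (hτ : 0 < τ.im) : fU τ ≠ 0 := mul_ne_zero (fDl_ne hτ) (inv_ne_zero (ee_ne τ))

lemma fDl_fU (τ : ℂ) : fDl τ = ee τ * fU τ := by
  rw [fU]; field_simp [ee_ne τ]

lemma fU_exp (m : ℕ) : ∃ U V, QRep fU U ∧ U ∈ RPS (dN m) ∧ coeff 0 U = 1 ∧
    QRep (fun τ => (fU τ)⁻¹) V ∧ V ∈ RPS (dN m) ∧ coeff 0 V = 1 := by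
  obtain ⟨U, h1, h2, h3⟩ := fDl_exp m
  have h4 : QRep fU U := h1.shift
  obtain ⟨V, h5, h6⟩ := h4.inv (by rw [h3]; exact one_ne_zero) (fun τ hτ => fU_ne hτ)
  refine ⟨U, V, h4, h2, h3, h5, RPS_inv h2 h3 h6, ?_⟩
  have := congrArg (coeff 0) h6
  rw [c0mul, h3] at this
  simpa using this

lemma fU_QI (m : ℕ) : QI (dN m) fU := by
  obtain ⟨U, V, h1, h2, -⟩ := fU_exp m
  exact ⟨U, h1, h2⟩

lemma fUinv_QI (m : ℕ) : QI (dN m) (fun τ => (fU τ)⁻¹) := by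
  obtain ⟨U, V, -, -, -, h1, h2, -⟩ := fU_exp m
  exact ⟨V, h1, h2⟩

lemma SLaw.mul {k l : ℤ} {f g : ℂ → ℂ} (hf : SLaw k f) (hg : SLaw l g) : SLaw (k + l) (fun τ => f τ * g τ) := by
  intro τ hτ
  beta_reduce
  rw [hf τ hτ, hg τ hτ, zpow_add₀ (ne_of_im hτ)]; ring

lemma SLaw.pow {k : ℤ} {f : ℂ → ℂ} (hf : SLaw k f) (n : ℕ) : SLaw (n * k) (fun τ => f τ ^ n) := by
  intro τ hτ
  beta_reduce
  rw [hf τ hτ, mul_pow, ← zpow_natCast, ← zpow_mul, mul_comm k]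

lemma SLaw.inv {k : ℤ} {f : ℂ → ℂ} (hf : SLaw k f) : SLaw (-k) (fun τ => (f τ)⁻¹) := by
  intro τ hτ
  beta_reduce
  rw [hf τ hτ, mul_inv, zpow_neg]

lemma SLaw.add {k : ℤ} {f g : ℂ → ℂ} (hf : SLaw k f) (hg : SLaw k g) : SLaw k (fun τ => f τ + g τ) := by
  intro τ hτ
  beta_reduce
  rw [hf τ hτ, hg τ hτ]; ring

lemma SLaw.smul {k : ℤ} {f : ℂ → ℂ} (c : ℂ) (hf : SLaw k f) : SLaw k (fun τ => c * f τ) := by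
  intro τ hτ
  beta_reduce
  rw [hf τ hτ]; ring

lemma fE4_S : SLaw 4 fE4 := extF_SLaw _
lemma fE6_S : SLaw 6 fE6 := extF_SLaw _
lemma fDl_S : SLaw 12 fDl := by
  intro τ hτ
  rw [fDl_eq hτ, fDl_eq (im_neg_inv hτ), fE4_S τ hτ, fE6_S τ hτ]
  norm_cast
  ring

lemma exists_mono {k : ℤ} (m : ℕ) (hk : 0 ≤ k) (he : Even k) (h2 : k ≠ 2) :
    ∃ f P, SLaw k f ∧ QRep f P ∧ P ∈ RPS (dN m) ∧ coeff 0 P = 1 := by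
  obtain ⟨a, b, hab⟩ : ∃ a b : ℕ, k = a * 4 + b * 6 := by
    obtain ⟨j, rfl⟩ := he
    by_cases hj : Even j
    · obtain ⟨i, rfl⟩ := hj
      exact ⟨i.toNat, 0, by omega⟩
    · obtain ⟨i, rfl⟩ := Int.not_even_iff_odd.1 hj
      exact ⟨(i - 1).toNat, 1, by omega⟩
  obtain ⟨h4, i4, c4⟩ := fE4_QI (dN m)
  obtain ⟨h6, i6, c6⟩ := fE6_QI (dN m)
  have key : ∀ (f : ℂ → ℂ) (P : PowerSeries ℂ), QRep f P → P ∈ RPS (dN m) → coeff 0 P = 1 → ∀ n : ℕ,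
      QRep (fun τ => f τ ^ n) (P ^ n) ∧ P ^ n ∈ RPS (dN m) ∧ coeff 0 (P ^ n) = 1 := by
    intro f P h1 h2 h3 n
    refine ⟨?_, pow_mem h2 n, ?_⟩
    · induction n with
      | zero => exact ((QRep.const 1).congr (fun _ _ => pow_zero _))
      | succ n ih => rw [pow_succ]; exact (ih.mul h1).congr (fun _ _ => pow_succ _ _)
    · rw [PowerSeries.coeff_zero_eq_constantCoeff_apply] at *
      rw [map_pow, h3, one_pow]
  obtain ⟨p1, p2, p3⟩ := key _ _ h4 i4 (by rw [c4]; simp) a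
  obtain ⟨r1, r2, r3⟩ := key _ _ h6 i6 (by rw [c6]; simp) b
  refine ⟨_, _, by rw [hab]; exact (fE4_S.pow a).mul (fE6_S.pow b), p1.mul r1, mul_mem p2 r2, ?_⟩
  rw [c0mul, p3, r3, one_mul]

lemma MF_odd {k : ℤ} (hk : ¬ Even k) {f : ℂ → ℂ} (h : SLaw k f) {τ : ℂ} (hτ : 0 < τ.im) : f τ = 0 := by
  have h1 := h _ (im_neg_inv hτ)
  have h0 := ne_of_im hτ
  rw [h τ hτ, ← mul_assoc, ← mul_zpow, show -1 / (-1 / τ) = τ by field_simp,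
    show -1 / τ * τ = -1 by field_simp, (Int.not_even_iff_odd.1 hk).neg_one_zpow] at h1
  linear_combination h1 / 2

lemma MF_div {k : ℤ} {f : ℂ → ℂ} {P : PowerSeries ℂ} (hP : QRep f P) (hS : SLaw k f)
    (h0 : coeff 0 P = 0) : MF (k - 12) (fun τ => f τ * (fDl τ)⁻¹) := by
  refine ⟨?_, by have := hS.mul fDl_S.inv; rwa [← sub_eq_add_neg] at this⟩
  have hX : P = PowerSeries.X * PowerSeries.mk fun n => coeff (n + 1) P := by
    ext n
    rcases n with _ | n
    · rw [h0]; simp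
    · rw [PowerSeries.coeff_succ_X_mul, PowerSeries.coeff_mk]
  rw [hX] at hP
  have hq : IsQRep (fun τ => f τ * (ee τ)⁻¹) := ⟨_, hP.shift⟩
  refine (hq.mul (fUinv_QI 1).isQ).congr (fun τ hτ => ?_)
  rw [fDl_fU, mul_inv]; ring

lemma MF_span (m : ℕ) : ∀ (j : ℕ) (k : ℤ), k < 12 * j → ∃ (n : ℕ) (b : Fin n → ℂ → ℂ),
    (∀ i, QI (dN m) (b i)) ∧ (∀ i, SLaw k (b i)) ∧
    ∀ f, MF k f → ∃ c : Fin n → ℂ, ∀ τ : ℂ, 0 < τ.im → f τ = ∑ i, c i * b i τ := by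
  intro j
  induction j with
  | zero =>
    intro k hk
    exact ⟨0, fun i => i.elim0, fun i => i.elim0, fun i => i.elim0, fun f hf => ⟨fun i => i.elim0, fun τ hτ => by
      rw [MF_neg (by simpa using hk) hf hτ]; simp⟩⟩
  | succ j ih =>
    intro k hk
    by_cases hk0 : k < 0
    · exact ⟨0, fun i => i.elim0, fun i => i.elim0, fun i => i.elim0, fun f hf => ⟨fun i => i.elim0, fun τ hτ => by
        rw [MF_neg hk0 hf hτ]; simp⟩⟩
    by_cases he : Even k
    swap
    · exact ⟨0, fun i => i.elim0, fun i => i.elim0, fun i => i.elim0, fun f hf => ⟨fun i => i.elim0, fun τ hτ => by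
        rw [MF_odd he hf.2 hτ]; simp⟩⟩
    by_cases h2 : k = 2
    · subst h2
      exact ⟨0, fun i => i.elim0, fun i => i.elim0, fun i => i.elim0, fun f hf => ⟨fun i => i.elim0, fun τ hτ => by
        rw [MF_two hf hτ]; simp⟩⟩
    obtain ⟨e, Pe, e1, e2, e3, e4⟩ := exists_mono m (not_lt.1 hk0) he h2
    obtain ⟨n, b, b1, b2, b3⟩ := ih (k - 12) (by push_cast at hk; linarith)
    have hD : QI (dN m) fDl := by
      obtain ⟨U, u1, u2, -⟩ := fDl_exp m
      refine ⟨_, u1, mul_mem (mem_RPS.2 fun n => ?_) u2⟩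
      rw [PowerSeries.coeff_X]
      split_ifs
      · exact one_mem _
      · exact zero_mem _
    refine ⟨n + 1, Fin.cons e (fun i τ => fDl τ * b i τ), ?_, ?_, ?_⟩
    · intro i
      refine Fin.cases ⟨Pe, e2, e3⟩ (fun i => ?_) i
      rw [Fin.cons_succ]; exact hD.mul (b1 i)
    · intro i
      refine Fin.cases e1 (fun i => ?_) i
      rw [Fin.cons_succ]
      have := fDl_S.mul (b2 i)
      rwa [add_sub_cancel] at this
    · rintro f ⟨⟨P, hP⟩, hS⟩
      set c0 := coeff 0 P with hc0
      have h1 := hP.add (e2.smul (-c0))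
      have h3 := hS.add (e1.smul (-c0))
      have h4 := MF_div h1 h3 (by rw [map_add, map_smul, e4, ← hc0]; simp)
      obtain ⟨c, hc⟩ := b3 _ h4
      refine ⟨Fin.cons c0 c, fun τ hτ => ?_⟩
      rw [Fin.sum_univ_succ]
      simp only [Fin.cons_zero, Fin.cons_succ]
      have h5 := hc τ hτ
      have h6 := fDl_ne hτ
      rw [mul_inv_eq_iff_eq_mul₀ h6, sum_mul] at h5
      have h7 : ∑ i, c i * (fDl τ * b i τ) = ∑ i, c i * b i τ * fDl τ := sum_congr rfl fun i _ => by ring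
      rw [h7, ← h5]; ring

lemma isOpen_im : IsOpen {τ : ℂ | 0 < τ.im} := isOpen_lt continuous_const Complex.continuous_im

lemma nhds_im {τ : ℂ} (hτ : 0 < τ.im) : ∀ᶠ t in 𝓝 τ, 0 < t.im := isOpen_im.mem_nhds hτ

def kj (j : ℕ) : ℂ := (1 + 4 * j) / 2

def Th (m : ℕ) : ℕ → ℤ → ℂ → ℂ
  | 0, l, τ => jTheta m l τ 0
  | j + 1, l, τ => (2 * Real.pi * I)⁻¹ * deriv (Th m j l) τ - kj j / 12 * fE2 τ * Th m j l τ

lemma Th_per (m j : ℕ) (l : ℤ) : Th m j (l + 2 * m) = Th m j l := by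
  induction j with
  | zero => ext τ; exact jTheta_per m l τ 0
  | succ j ih => ext τ; simp only [Th, ih]

lemma Th_neg (m j : ℕ) (l : ℤ) : Th m j (-l) = Th m j l := by
  induction j with
  | zero => ext τ; have := jTheta_neg m l τ 0; rw [neg_zero] at this; exact this
  | succ j ih => ext τ; simp only [Th, ih]

lemma fE2_diff {τ : ℂ} (hτ : 0 < τ.im) : DifferentiableAt ℂ fE2 τ := fE2_QRep.diffAt hτ

lemma Th_diff (m : ℕ) (hm : 0 < m) (j : ℕ) (l : ℤ) {τ : ℂ} (hτ : 0 < τ.im) : DifferentiableAt ℂ (Th m j l) τ := by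
  induction j generalizing τ with
  | zero =>
    have h := jTheta_diff m hm l hτ 0
    have h2 : DifferentiableAt ℂ (fun t : ℂ => (t, (0 : ℂ))) τ := by fun_prop
    exact DifferentiableAt.comp (f := fun t : ℂ => (t, (0 : ℂ))) τ h h2
  | succ j ih =>
    have h1 : DifferentiableOn ℂ (Th m j l) {τ : ℂ | 0 < τ.im} := fun t ht => (ih ht).differentiableWithinAt
    have h2 := (h1.deriv isOpen_im).differentiableAt (isOpen_im.mem_nhds hτ)
    exact (h2.const_mul _).sub (((fE2_diff hτ).const_mul _).mul (ih hτ))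

lemma rtS_deriv {m : ℕ} (hm : 0 < m) {τ : ℂ} (hτ : 0 < τ.im) : HasDerivAt (rtS m) (rtS m τ / (2 * τ)) τ := by
  have hm' : (m : ℂ) ≠ 0 := by exact_mod_cast hm.ne'
  have h0 := ne_of_im hτ
  have hne : -I * (τ / (2 * m)) ≠ 0 := by
    refine mul_ne_zero (neg_ne_zero.2 I_ne_zero) (div_ne_zero h0 (by simpa using hm'))
  have h1 : HasDerivAt (fun t : ℂ => -I * (t / (2 * m))) (-I * (1 / (2 * m))) τ :=
    ((hasDerivAt_id τ).div_const _).const_mul _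
  have hs : -I * (τ / (2 * m)) ∈ Complex.slitPlane := by
    left
    have : (-I * (τ / (2 * m))).re = τ.im / (2 * m) := by
      have : (2 * (m : ℂ)) = ((2 * m : ℝ) : ℂ) := by push_cast; ring
      rw [this]
      rw [← Complex.div_ofReal_im]
      simp [Complex.mul_re]
    rw [this]; positivity
  refine (h1.cpow_const (c := (1 / 2 : ℂ)) hs).congr_deriv ?_
  rw [rtS, Complex.cpow_sub _ _ hne, Complex.cpow_one]
  have := I_ne_zero
  field_simp

lemma neg_inv_deriv {τ : ℂ} (hτ : 0 < τ.im) : HasDerivAt (fun t : ℂ => -1 / t) (1 / τ ^ 2) τ := by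
  have h0 := ne_of_im hτ
  have := (hasDerivAt_inv h0).neg
  refine (this.congr_of_eventuallyEq (Filter.Eventually.of_forall fun t => ?_)).congr_deriv (by field_simp)
  simp [neg_div]

lemma Th_S (m : ℕ) (hm : 0 < m) (j : ℕ) (l : ℤ) {τ : ℂ} (hτ : 0 < τ.im) :
    Th m j l (-1 / τ) = rtS m τ * τ ^ (2 * j) *
      ∑ l' ∈ range (2 * m), ee (-(l : ℂ) * l' / (2 * m)) * Th m j l' τ := by
  induction j generalizing τ with
  | zero =>
    have := jTheta_S m hm l hτ 0
    simp only [zero_div, ne_eq, OfNat.ofNat_ne_zero, not_false_eq_true, zero_pow, mul_zero, ee_zero, mul_one] at this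
    simp only [Th, mul_zero, pow_zero, mul_one, this]
  | succ j ih =>
    have h0 := ne_of_im hτ
    have hpi : (2 * (Real.pi : ℂ) * I) ≠ 0 := by simp [Real.pi_ne_zero]
    set S0 := ∑ l' ∈ range (2 * m), ee (-(l : ℂ) * l' / (2 * m)) * Th m j l' τ with hS0
    set S1 := ∑ l' ∈ range (2 * m), ee (-(l : ℂ) * l' / (2 * m)) * deriv (Th m j l') τ with hS1
    have d1 : HasDerivAt (fun t => ∑ l' ∈ range (2 * m), ee (-(l : ℂ) * l' / (2 * m)) * Th m j l' t) S1 τ :=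
      HasDerivAt.fun_sum fun l' _ => (Th_diff m hm j l' hτ).hasDerivAt.const_mul _
    have d2 := ((rtS_deriv hm hτ).mul (hasDerivAt_pow (2 * j) τ)).mul d1
    have d3 := (Th_diff m hm j l (im_neg_inv hτ)).hasDerivAt.comp τ (neg_inv_deriv hτ)
    have d4 := d3.unique (d2.congr_of_eventuallyEq (by
      filter_upwards [nhds_im hτ] with t ht
      exact ih ht))
    simp only [Pi.mul_apply] at d4
    rw [← hS0] at d4
    have e1 : ∑ l' ∈ range (2 * m), ee (-(l : ℂ) * l' / (2 * m)) * Th m (j + 1) l' τ =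
        (2 * Real.pi * I)⁻¹ * S1 - kj j / 12 * fE2 τ * S0 := by
      rw [hS1, hS0, mul_sum, mul_sum, ← Finset.sum_sub_distrib]
      apply sum_congr rfl
      intro l' _
      simp only [Th]; ring
    rw [e1]
    simp only [Th]
    rw [ih hτ, fE2_S hτ, ← hS0]
    have d5 : deriv (Th m j l) (-1 / τ) = τ ^ 2 * ((rtS m τ / (2 * τ) * τ ^ (2 * j) + rtS m τ *
      (((2 * j : ℕ) : ℂ) * τ ^ (2 * j - 1))) * S0 + rtS m τ * τ ^ (2 * j) * S1) := by
      rw [← d4]; field_simp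
    rw [d5]
    have e2 : (((2 * j : ℕ) : ℂ) * τ ^ (2 * j - 1)) = 2 * j * τ ^ (2 * j) / τ := by
      rcases j with _ | j
      · simp
      · rw [show 2 * (j + 1) - 1 = 2 * j + 1 by omega, show 2 * (j + 1) = (2 * j + 1) + 1 by ring, pow_succ τ (2 * j + 1)]
        push_cast
        field_simp
        ring
    rw [e2, kj, show 2 * (j + 1) = 2 * j + 2 by ring, pow_add]
    field_simp
    ring

lemma Th_zero_rep (m : ℕ) (hm : 0 < m) (l : ℕ) (hl : l ≤ m) :
    ∃ P : PowerSeries ℂ, P ∈ RPS (dN m) ∧ coeff 0 P ≠ 0 ∧ ∃ g, QRep g P ∧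
      ∀ τ : ℂ, 0 < τ.im → Th m 0 l τ = ee ((l : ℂ) ^ 2 / (4 * m) * τ) * g τ := by
  have hm' : (m : ℂ) ≠ 0 := by exact_mod_cast hm.ne'
  have hnn : ∀ n : ℤ, 0 ≤ (l : ℤ) * n + m * n ^ 2 := by
    intro n
    have : (0 : ℤ) ≤ l := by positivity
    have h2 : (l : ℤ) ≤ m := by exact_mod_cast hl
    rcases le_or_gt 0 n with h | h
    · positivity
    · nlinarith [mul_nonneg (sub_nonneg.2 h2) (neg_nonneg.2 h.le), mul_nonneg (by positivity : (0 : ℤ) ≤ m) (mul_nonneg (neg_nonneg.2 h.le) (by linarith : (0 : ℤ) ≤ -1 - n))]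
  set e : ℤ → ℕ := fun n => ((l : ℤ) * n + m * n ^ 2).toNat with he
  have hev : ∀ n, ((e n : ℕ) : ℤ) = (l : ℤ) * n + m * n ^ 2 := fun n => Int.toNat_of_nonneg (hnn n)
  have hfin : ∀ N : ℕ, Finite {n : ℤ // e n = N} := by
    intro N
    have hsub : {n : ℤ | e n = N} ⊆ Set.Icc (-(N + 1 : ℤ)) (N + 1) := by
      intro n hn
      have h1 : ((l : ℤ) * n + m * n ^ 2) = N := by rw [← hev, hn]
      have : (0 : ℤ) ≤ l := by positivity
      have h2 : (l : ℤ) ≤ m := by exact_mod_cast hl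
      have h3 : (1 : ℤ) ≤ m := by exact_mod_cast hm
      have hN : (0 : ℤ) ≤ N := by positivity
      constructor
      · by_contra hc
        push Not at hc
        nlinarith [mul_nonneg (sub_nonneg.2 h2) (by linarith : (0 : ℤ) ≤ -n), mul_nonneg (sub_nonneg.2 h3) (mul_nonneg (by linarith : (0 : ℤ) ≤ -n) (by linarith : (0 : ℤ) ≤ -1 - n)), mul_nonneg (by linarith : (0 : ℤ) ≤ -n - (N + 1)) (by linarith : (0 : ℤ) ≤ -1 - n)]
      · by_contra hc
        push Not at hc
        nlinarith [mul_nonneg this (by linarith : (0 : ℤ) ≤ n), mul_nonneg (sub_nonneg.2 h3) (sq_nonneg n), mul_nonneg (by linarith : (0 : ℤ) ≤ n - (N + 1)) (by linarith : (0 : ℤ) ≤ n)]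
    exact Set.Finite.to_subtype ((Set.finite_Icc _ _).subset hsub)
  haveI := fun N => Fintype.ofFinite {n : ℤ // e n = N}
  refine ⟨PowerSeries.mk fun N => (Fintype.card {n : ℤ // e n = N} : ℂ), mem_RPS.2 fun n => ?_, ?_,
    fun τ => Th m 0 l τ * ee (-((l : ℂ) ^ 2 / (4 * m) * τ)), ?_, ?_⟩
  · rw [PowerSeries.coeff_mk]; exact natCast_mem _ _
  · rw [PowerSeries.coeff_mk]
    have : Nonempty {n : ℤ // e n = 0} := ⟨⟨0, by simp [he]⟩⟩
    exact_mod_cast Fintype.card_ne_zero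
  · intro τ hτ
    have h1 := (jTheta_hasSum m hm l hτ 0).mul_right (ee (-((l : ℂ) ^ 2 / (4 * m) * τ)))
    have h2 : HasSum (fun n : ℤ => ee (e n * τ)) (Th m 0 l τ * ee (-((l : ℂ) ^ 2 / (4 * m) * τ))) := by
      refine hs_congr h1 (fun n => ?_) rfl
      rw [← ee_add]
      congr 1
      have : ((e n : ℕ) : ℂ) = (l : ℂ) * n + m * n ^ 2 := by
        have := hev n
        exact_mod_cast congrArg (Int.cast : ℤ → ℂ) this
      rw [this]
      push_cast
      field_simp
      ring
    have h3 := ((Equiv.sigmaFiberEquiv e).hasSum_iff (f := fun n : ℤ => ee (e n * τ))).2 h2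
    have h4 := h3.sigma (g := fun N => ∑ x : {n : ℤ // e n = N}, ee (e x.1 * τ)) (fun N => hasSum_fintype _)
    refine hs_congr h4 (fun N => ?_) rfl
    rw [PowerSeries.coeff_mk, sum_congr rfl (fun x _ => by rw [x.2]), Finset.sum_const, Finset.card_univ,
      nsmul_eq_mul]
  · intro τ hτ
    rw [mul_left_comm, ← ee_add]
    simp [ee_zero]

lemma Th_rep (m : ℕ) (hm : 0 < m) (l : ℕ) (hl : l ≤ m) : ∃ c : ℂ, c ≠ 0 ∧ ∀ j : ℕ,
    ∃ P : PowerSeries ℂ, P ∈ RPS (dN m) ∧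
      coeff 0 P = c * ∏ i ∈ range j, ((l : ℂ) ^ 2 / (4 * m) - kj i / 12) ∧ ∃ g, QRep g P ∧
      ∀ τ : ℂ, 0 < τ.im → Th m j l τ = ee ((l : ℂ) ^ 2 / (4 * m) * τ) * g τ := by
  have hm' : (m : ℂ) ≠ 0 := by exact_mod_cast hm.ne'
  obtain ⟨P0, i0, c0, g0, q0, e0⟩ := Th_zero_rep m hm l hl
  refine ⟨_, c0, fun j => ?_⟩
  induction j with
  | zero => exact ⟨P0, i0, by simp, g0, q0, e0⟩
  | succ j ih =>
    obtain ⟨P, i1, c1, g, q1, e1⟩ := ih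
    set a : ℂ := (l : ℂ) ^ 2 / (4 * m) with ha
    obtain ⟨PE, qE, iE⟩ := fE2_QI (dN m)
    have hE0 : coeff 0 PE = 1 := by rw [qE.unique fE2_QRep]; simp
    have ha' : a ∈ IntC (dN m) := by
      have := mul_mem (natCast_mem (IntC (dN m)) (l ^ 2)) (dN_inv (m := m) (a := 4 * m) 1 ⟨6, by ring⟩ (by positivity))
      rw [ha, div_eq_mul_inv]; exact_mod_cast this
    have hk' : -(kj j / 12) ∈ IntC (dN m) := by
      refine neg_mem ?_
      have := mul_mem (natCast_mem (IntC (dN m)) (1 + 4 * j)) (dN_inv (m := m) (a := 24) 1 ⟨m, by ring⟩ (by positivity))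
      have e : kj j / 12 = ((1 + 4 * j : ℕ) : ℂ) * ((24 : ℕ) : ℂ)⁻¹ := by rw [kj]; push_cast; ring
      rw [e]; exact this
    refine ⟨a • P + ((PowerSeries.mk fun n => n * coeff n P) + (-(kj j / 12)) • (PE * P)), ?_, ?_,
      _, (q1.smul a).add (q1.deriv.add ((qE.mul q1).smul (-(kj j / 12)))), ?_⟩
    · refine add_mem (RPS_smul ha' i1) (add_mem (mem_RPS.2 fun n => ?_) (RPS_smul hk' (mul_mem iE i1)))
      rw [PowerSeries.coeff_mk]
      exact mul_mem (natCast_mem _ _) (mem_RPS.1 i1 n)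
    · rw [map_add, map_add, map_smul, map_smul, c0mul, hE0, c1, Finset.prod_range_succ, PowerSeries.coeff_mk]
      simp only [smul_eq_mul, Nat.cast_zero]
      ring
    · intro τ hτ
      have d1 : HasDerivAt (fun t => ee (a * t) * g t) (2 * Real.pi * I * a * ee (a * τ) * g τ + ee (a * τ) * deriv g τ) τ := by
        have h1 : HasDerivAt (fun t => ee (a * t)) (2 * Real.pi * I * a * ee (a * τ)) τ := by
          have := (ee_hasDerivAt (a * τ)).comp τ ((hasDerivAt_id τ).const_mul a)
          refine this.congr_deriv ?_
          ring
        exact h1.mul (q1.diffAt hτ).hasDerivAt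
      have d2 : deriv (Th m j l) τ = _ := (d1.congr_of_eventuallyEq (by
        filter_upwards [nhds_im hτ] with t ht using e1 t ht)).deriv
      have hpi : (2 * (Real.pi : ℂ) * I) ≠ 0 := by simp [Real.pi_ne_zero]
      simp only [Th]
      rw [d2, e1 τ hτ]
      field_simp
      ring

def eps (m l : ℕ) : ℂ := if l = 0 ∨ l = m then 1 else 2

lemma eps_ne (m l : ℕ) : eps m l ≠ 0 := by unfold eps; split_ifs <;> norm_num

lemma fold_sum (m : ℕ) (hm : 0 < m) (F : ℤ → ℂ) (hper : ∀ l, F (l + 2 * m) = F l) (hev : ∀ l, F (-l) = F l) :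
    ∑ l ∈ range (2 * m), F l = ∑ l : Fin (m + 1), eps m l * F (l : ℕ) := by
  rw [← Finset.sum_range (fun l : ℕ => eps m l * F l), two_mul, Finset.sum_range_add]
  have h1 : ∑ x ∈ range m, F ((m + x : ℕ) : ℤ) = ∑ x ∈ range m, F ((x + 1 : ℕ) : ℤ) := by
    rw [← Finset.sum_range_reflect]
    apply sum_congr rfl
    intro x hx
    rw [mem_range] at hx
    rw [← hev, ← hper]
    congr 1
    omega
  rw [h1]
  have h2 : ∀ l ∈ range (m + 1), eps m l * F l = 2 * F l - ((if l = 0 then F l else 0) + if l = m then F l else 0) := by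
    intro l _
    unfold eps
    by_cases h0 : l = 0
    · subst h0
      simp only [true_or, if_true]
      rw [if_neg (by omega)]; ring
    · by_cases h3 : l = m
      · simp only [h0, h3, or_true, if_true, if_neg hm.ne']; ring
      · simp only [h0, h3, or_self, if_false]; ring
  rw [sum_congr rfl h2, Finset.sum_sub_distrib, Finset.sum_add_distrib, Finset.sum_ite_eq' , Finset.sum_ite_eq',
    if_pos (by simp), if_pos (by simp), ← mul_sum]
  have h3 := Finset.sum_range_succ (fun l : ℕ => F l) m
  have h4 := Finset.sum_range_succ' (fun l : ℕ => F l) m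
  linear_combination -h3 - h4

def Mth (m : ℕ) (τ : ℂ) : Matrix (Fin (m + 1)) (Fin (m + 1)) ℂ := Matrix.of fun l j => Th m j (l : ℕ) τ
def aE (m l : ℕ) : ℂ := (l : ℂ) ^ 2 / (4 * m)
def Gth (m : ℕ) (τ : ℂ) : Matrix (Fin (m + 1)) (Fin (m + 1)) ℂ :=
  Matrix.of fun l j => ee (-(aE m l * τ)) * Th m j (l : ℕ) τ

def Bm (m : ℕ) : Matrix (Fin (m + 1)) (Fin (m + 1)) ℂ :=
  Matrix.of fun l l' => eps m l' * ((ee (-((l : ℕ) : ℂ) * (l' : ℕ) / (2 * m)) + ee (((l : ℕ) : ℂ) * (l' : ℕ) / (2 * m))) / 2)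

lemma dft_fold (m : ℕ) (hm : 0 < m) (F : ℤ → ℂ) (hper : ∀ l, F (l + 2 * m) = F l) (hev : ∀ l, F (-l) = F l) (l : ℤ) :
    ∑ l' ∈ range (2 * m), ee (-(l : ℂ) * l' / (2 * m)) * F l' =
    ∑ l' : Fin (m + 1), eps m l' * ((ee (-(l : ℂ) * (l' : ℕ) / (2 * m)) + ee ((l : ℂ) * (l' : ℕ) / (2 * m))) / 2 * F (l' : ℕ)) := by
  have hm' : (m : ℂ) ≠ 0 := by exact_mod_cast hm.ne'
  have hp : ∀ x : ℤ, ee (-(l : ℂ) * ((x + 2 * m : ℤ) : ℂ) / (2 * m)) = ee (-(l : ℂ) * (x : ℂ) / (2 * m)) := by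
    intro x
    apply ee_eq_of_sub (-l)
    push_cast; field_simp; ring
  have hp' : ∀ x : ℤ, ee ((l : ℂ) * ((x + 2 * m : ℤ) : ℂ) / (2 * m)) = ee ((l : ℂ) * (x : ℂ) / (2 * m)) := by
    intro x
    apply ee_eq_of_sub l
    push_cast; field_simp
  have h1 := sum_per_map (N := 2 * m) (by positivity) (G := fun x : ℤ => ee (-(l : ℂ) * x / (2 * m)) * F x)
    (fun y => by
      have := hp y; have := hper y
      push_cast at *
      simp only [*]) (-1) 0 isCoprime_one_left.neg_left
  have h2 := fold_sum m hm (fun x : ℤ => ((ee (-(l : ℂ) * x / (2 * m)) + ee ((l : ℂ) * x / (2 * m))) / 2 * F x))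
    (fun y => by simp only [hp, hp', hper]) (fun y => by
      simp only [hev]
      push_cast
      rw [neg_mul_neg, mul_neg, neg_mul]
      ring)
  simp only [Int.cast_natCast] at h2 h1
  rw [← h2]
  have h3 : ∑ x ∈ range (2 * m), ee ((l : ℂ) * (x : ℂ) / (2 * m)) * F x = ∑ x ∈ range (2 * m), ee (-(l : ℂ) * (x : ℂ) / (2 * m)) * F x := by
    rw [← h1]
    apply sum_congr rfl
    intro x _
    rw [show (-1 : ℤ) * (x : ℤ) + 0 = -(x : ℤ) by ring, hev]
    push_cast
    rw [neg_mul_neg]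
  have h4 : ∀ x ∈ range (2 * m), (ee (-(l : ℂ) * (x : ℂ) / (2 * m)) + ee ((l : ℂ) * (x : ℂ) / (2 * m))) / 2 * F x =
    (1 / 2) * (ee (-(l : ℂ) * (x : ℂ) / (2 * m)) * F x) + (1 / 2) * (ee ((l : ℂ) * (x : ℂ) / (2 * m)) * F x) := fun x _ => by ring
  rw [sum_congr rfl h4, Finset.sum_add_distrib, ← mul_sum, ← mul_sum, h3]
  ring

lemma Mth_S (m : ℕ) (hm : 0 < m) {τ : ℂ} (hτ : 0 < τ.im) :
    Mth m (-1 / τ) = Bm m * Mth m τ * Matrix.diagonal (fun j : Fin (m + 1) => rtS m τ * τ ^ (2 * (j : ℕ))) := by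
  ext l j
  rw [Matrix.mul_diagonal, Matrix.mul_apply]
  simp only [Mth, Bm, Matrix.of_apply]
  rw [Th_S m hm j _ hτ, dft_fold m hm (fun l' => Th m j l' τ) (fun l' => by rw [Th_per]) (fun l' => by rw [Th_neg]), mul_comm]
  congr 1
  apply sum_congr rfl
  intro l' _
  push_cast
  ring

lemma Mth_G (m : ℕ) (τ : ℂ) : Mth m τ = Matrix.diagonal (fun l : Fin (m + 1) => ee (aE m l * τ)) * Gth m τ := by
  ext l j
  rw [Matrix.diagonal_mul]
  simp only [Mth, Gth, Matrix.of_apply]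
  rw [← mul_assoc, ← ee_add]; simp [ee_zero]

lemma QRep.prod {ι : Type*} (s : Finset ι) {f : ι → ℂ → ℂ} {P : ι → PowerSeries ℂ}
    (h : ∀ i ∈ s, QRep (f i) (P i)) : QRep (fun τ => ∏ i ∈ s, f i τ) (∏ i ∈ s, P i) := by
  induction s using Finset.induction_on with
  | empty => exact (QRep.const 1).congr (fun τ _ => by simp)
  | insert a s ha ih =>
    rw [Finset.prod_insert ha]
    exact ((h a (Finset.mem_insert_self _ _)).mul (ih (fun i hi => h i (Finset.mem_insert_of_mem hi)))).congr
      (fun τ _ => by rw [Finset.prod_insert ha])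

lemma QRep.pow {f : ℂ → ℂ} {P : PowerSeries ℂ} (h : QRep f P) (n : ℕ) : QRep (fun τ => f τ ^ n) (P ^ n) := by
  have := QRep.prod (range n) (f := fun _ => f) (P := fun _ => P) (fun _ _ => h)
  simpa using this

lemma QRep.det {n : ℕ} (M : ℂ → Matrix (Fin n) (Fin n) ℂ) (P : Matrix (Fin n) (Fin n) (PowerSeries ℂ))
    (h : ∀ i j, QRep (fun τ => M τ i j) (P i j)) : QRep (fun τ => (M τ).det) P.det := by
  have := QRep.sum Finset.univ (f := fun (σ : Equiv.Perm (Fin n)) τ =>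
    ((Equiv.Perm.sign σ : ℤ) : ℂ) * ∏ i, M τ (σ i) i) (P := fun σ => ((Equiv.Perm.sign σ : ℤ) : ℂ) • ∏ i, P (σ i) i)
    (fun σ _ => (QRep.prod _ (fun i _ => h _ _)).smul _)
  rw [Matrix.det_apply']
  have e : ∑ σ : Equiv.Perm (Fin n), (((Equiv.Perm.sign σ : ℤ) : ℂ) • ∏ i, P (σ i) i) =
      ∑ σ : Equiv.Perm (Fin n), ((Equiv.Perm.sign σ : ℤ) : PowerSeries ℂ) * ∏ i, P (σ i) i := by
    apply sum_congr rfl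
    intro σ _
    rw [PowerSeries.smul_eq_C_mul]; simp
  rw [← e]
  refine this.congr (fun τ _ => ?_)
  rw [Matrix.det_apply']

lemma Gth_rep (m : ℕ) (hm : 0 < m) : ∃ P : Matrix (Fin (m + 1)) (Fin (m + 1)) (PowerSeries ℂ),
    (∀ l j, QRep (fun τ => Gth m τ l j) (P l j) ∧ P l j ∈ RPS (dN m)) ∧ coeff 0 P.det ≠ 0 := by
  have hm' : (m : ℂ) ≠ 0 := by exact_mod_cast hm.ne'
  have h := fun l : Fin (m + 1) => Th_rep m hm l (Nat.lt_succ_iff.1 l.2)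
  choose c hc P iP cP g qP eP using h
  refine ⟨Matrix.of fun l j => P l j, fun l j => ⟨(qP l j).congr fun τ hτ => ?_, iP l j⟩, ?_⟩
  · simp only [Gth, Matrix.of_apply]
    rw [eP l j τ hτ, ← mul_assoc, ← ee_add, aE]; simp [ee_zero]
  · rw [PowerSeries.coeff_zero_eq_constantCoeff_apply, RingHom.map_det]
    have e : (PowerSeries.constantCoeff (R := ℂ)).mapMatrix (Matrix.of fun (l j : Fin (m + 1)) => P l j) =
      Matrix.diagonal c * Matrix.of (fun l j : Fin (m + 1) => (∏ i ∈ range j, (Polynomial.X - Polynomial.C (kj i / 12))).eval (aE m l)) := by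
      ext l j
      rw [Matrix.diagonal_mul]
      simp only [RingHom.mapMatrix_apply, Matrix.map_apply, Matrix.of_apply]
      rw [← PowerSeries.coeff_zero_eq_constantCoeff_apply, cP, Polynomial.eval_prod]
      simp [aE]
    rw [e, Matrix.det_mul, Matrix.det_diagonal, ← Matrix.det_eval_matrixOfPolynomials_eq_det_vandermonde]
    · refine mul_ne_zero (Finset.prod_ne_zero_iff.2 fun l _ => hc l) (Matrix.det_vandermonde_ne_zero_iff.2 ?_)
      intro l l' hl
      simp only [aE] at hl
      have h4 : (4 * (m : ℂ)) ≠ 0 := by simpa using hm'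
      rw [div_left_inj' h4] at hl
      have : (l : ℕ) ^ 2 = (l' : ℕ) ^ 2 := by exact_mod_cast hl
      exact Fin.ext (Nat.pow_left_injective (n := 2) (by norm_num) this)
    · intro i
      rw [Polynomial.natDegree_finsetProd_X_sub_C_eq_card]; simp
    · intro i
      exact Polynomial.monic_prod_X_sub_C _ _

lemma ee_prod_aE (m : ℕ) (hm : 0 < m) (τ : ℂ) :
    (∏ l : Fin (m + 1), ee (aE m l * τ)) ^ 24 = ee τ ^ ((m + 1) * (2 * m + 1)) := by
  have hm' : (m : ℂ) ≠ 0 := by exact_mod_cast hm.ne'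
  have h1 : ∀ n : ℕ, (∏ l ∈ range (n + 1), ee ((l : ℂ) ^ 2 / (4 * m) * τ)) = ee ((n * (n + 1) * (2 * n + 1) / (24 * m) : ℂ) * τ) := by
    intro n
    induction n with
    | zero => simp [ee_zero]
    | succ n ih =>
      rw [Finset.prod_range_succ, ih, ← ee_add]
      congr 1
      push_cast
      field_simp
      ring
  have h2 := h1 m
  rw [Finset.prod_range (fun l : ℕ => ee ((l : ℂ) ^ 2 / (4 * m) * τ))] at h2
  simp only [aE]
  rw [h2, ← ee_npow, ← ee_npow]
  congr 1
  push_cast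
  field_simp

lemma rtS_inv_sq {m : ℕ} (hm : 0 < m) {τ : ℂ} (hτ : 0 < τ.im) :
    (rtS m τ * rtS m (-1 / τ)) ^ 2 * (2 * m) ^ 2 = 1 := by
  have hm' : (m : ℂ) ≠ 0 := by exact_mod_cast hm.ne'
  have h0 := ne_of_im hτ
  rw [mul_pow, rtS_sq, rtS_sq]
  have := I_sq
  field_simp
  linear_combination (-1 : ℂ) * this

lemma det_const (m : ℕ) (hm : 0 < m) : (Bm m).det ^ 4 = (2 * m) ^ (2 * (m + 1)) := by
  have hm' : (m : ℂ) ≠ 0 := by exact_mod_cast hm.ne'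
  obtain ⟨P, hP, h0⟩ := Gth_rep m hm
  have h1 := QRep.det (Gth m) P (fun l j => (hP l j).1)
  have : ∃ τ : ℂ, 0 < τ.im ∧ (Gth m τ).det ≠ 0 := by
    by_contra hc
    push Not at hc
    have h2 := h1.congr (g := fun _ => 0) (fun τ hτ => (hc τ hτ).symm)
    apply h0
    rw [h2.unique (QRep.const 0)]; simp
  obtain ⟨τ, hτ, hd⟩ := this
  have hd' : (Mth m τ).det ≠ 0 := by
    rw [Mth_G, Matrix.det_mul, Matrix.det_diagonal]
    exact mul_ne_zero (Finset.prod_ne_zero_iff.2 fun _ _ => ee_ne _) hd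
  have hτ0 := ne_of_im hτ
  have s1 := congrArg Matrix.det (Mth_S m hm hτ)
  have s2 := congrArg Matrix.det (Mth_S m hm (im_neg_inv hτ))
  rw [show -1 / (-1 / τ) = τ by field_simp] at s2
  simp only [Matrix.det_mul, Matrix.det_diagonal] at s1 s2
  rw [s1] at s2
  set pr : ℂ := (∏ x : Fin (m + 1), rtS m τ * τ ^ (2 * (x : ℕ))) * ∏ x : Fin (m + 1), rtS m (-1 / τ) * (-1 / τ) ^ (2 * (x : ℕ)) with hpr
  have hpr2 : pr = (rtS m τ * rtS m (-1 / τ)) ^ (m + 1) := by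
    rw [hpr, ← Finset.prod_mul_distrib]
    have : ∀ x ∈ (Finset.univ : Finset (Fin (m + 1))), rtS m τ * τ ^ (2 * (x : ℕ)) * (rtS m (-1 / τ) * (-1 / τ) ^ (2 * (x : ℕ))) =
      rtS m τ * rtS m (-1 / τ) := by
      intro x _
      have : τ ^ (2 * (x : ℕ)) * (-1 / τ) ^ (2 * (x : ℕ)) = 1 := by
        rw [← mul_pow, show τ * (-1 / τ) = -1 by field_simp, pow_mul]; norm_num
      linear_combination (rtS m τ * rtS m (-1 / τ)) * this
    rw [Finset.prod_congr rfl this, Finset.prod_const, Finset.card_univ, Fintype.card_fin]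
  have s3 : (Bm m).det ^ 2 * pr = 1 := by
    have : (Mth m τ).det * ((Bm m).det ^ 2 * pr) = (Mth m τ).det * 1 := by
      rw [mul_one]; conv_rhs => rw [s2]
      rw [hpr]; ring
    exact mul_left_cancel₀ hd' this
  have s4 : pr ^ 2 * (2 * m) ^ (2 * (m + 1)) = 1 := by
    rw [hpr2, ← pow_mul, mul_comm (m + 1), pow_mul, pow_mul, ← mul_pow, rtS_inv_sq hm hτ, one_pow]
  have hpr0 : pr ^ 2 ≠ 0 := by
    intro h; rw [h, zero_mul] at s4; exact one_ne_zero s4.symm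
  apply mul_left_cancel₀ hpr0
  rw [s4]
  linear_combination ((Bm m).det ^ 2 * pr + 1) * s3

lemma Gth_det_ne (m : ℕ) (hm : 0 < m) {τ : ℂ} (hτ : 0 < τ.im) : (Gth m τ).det ≠ 0 := by
  have hm' : (m : ℂ) ≠ 0 := by exact_mod_cast hm.ne'
  obtain ⟨P, hP, h0⟩ := Gth_rep m hm
  have h1 := QRep.det (Gth m) P (fun l j => (hP l j).1)
  obtain ⟨U, V, -, -, -, hV, -, hV0⟩ := fU_exp m
  set e := (m + 1) * (2 * m + 1) with he
  have h2 := (h1.pow 24).mul (hV.pow e)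
  have hM : ∀ t : ℂ, 0 < t.im → (Gth m t).det ^ 24 * (fU t)⁻¹ ^ e = (Mth m t).det ^ 24 * ((fDl t) ^ e)⁻¹ := by
    intro t ht
    rw [Mth_G, Matrix.det_mul, Matrix.det_diagonal, mul_pow, ee_prod_aE m hm, fDl_fU, mul_pow, ← he, inv_pow]
    have := pow_ne_zero e (ee_ne t)
    have := pow_ne_zero e (fU_ne ht)
    field_simp
  have hS : SLaw 0 (fun τ => (Gth m τ).det ^ 24 * (fU τ)⁻¹ ^ e) := by
    intro t ht
    beta_reduce
    rw [hM t ht, hM _ (im_neg_inv ht), Mth_S m hm ht, Matrix.det_mul, Matrix.det_mul, Matrix.det_diagonal, fDl_S t ht]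
    have ht0 := ne_of_im ht
    have hpr : (∏ x : Fin (m + 1), rtS m t * t ^ (2 * (x : ℕ))) ^ 24 * (Bm m).det ^ 24 = t ^ (12 * e) := by
      have e1 : (∏ x : Fin (m + 1), t ^ (2 * (x : ℕ))) = t ^ (m * (m + 1)) := by
        rw [← Finset.prod_range (fun x => t ^ (2 * x)), Finset.prod_pow_eq_pow_sum, ← mul_sum, mul_comm 2, Finset.sum_range_id_mul_two,
          Nat.add_sub_cancel, mul_comm]
      have e2 : (rtS m t) ^ 24 = (t / (2 * m)) ^ 12 := by
        rw [show 24 = 2 * 12 by norm_num, pow_mul, rtS_sq, mul_pow]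
        have : (-I) ^ 12 = 1 := by rw [show 12 = 2 * 6 by norm_num, pow_mul, neg_sq, I_sq]; norm_num
        rw [this, one_mul]
      rw [Finset.prod_mul_distrib, Finset.prod_const, Finset.card_univ, Fintype.card_fin, e1, mul_pow, ← pow_mul, mul_comm (m + 1) 24,
        pow_mul, e2, show (Bm m).det ^ 24 = ((Bm m).det ^ 4) ^ 6 by ring, det_const m hm, ← pow_mul, ← pow_mul, ← pow_mul,
        show 2 * (m + 1) * 6 = 12 * (m + 1) by ring, div_pow, he,
        show 12 * ((m + 1) * (2 * m + 1)) = 12 * (m + 1) + m * (m + 1) * 24 by ring, pow_add]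
      field_simp
    have hz : (t ^ (12 : ℤ)) ^ e = t ^ (12 * e) := by
      rw [show (t ^ (12 : ℤ)) = t ^ 12 from zpow_ofNat t 12, ← pow_mul]
    rw [mul_pow (t ^ (12 : ℤ)) (fDl t) e, hz, zpow_zero, one_mul, mul_pow, mul_pow, mul_inv]
    have h3 := pow_ne_zero (12 * e) ht0
    calc _ = ((∏ x : Fin (m + 1), rtS m t * t ^ (2 * (x : ℕ))) ^ 24 * (Bm m).det ^ 24) * (t ^ (12 * e))⁻¹ * ((Mth m t).det ^ 24 * (fDl t ^ e)⁻¹) := by ring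
      _ = _ := by rw [hpr, mul_inv_cancel₀ h3, one_mul]
  obtain ⟨c, hc⟩ := MF_zero_const ⟨⟨_, h2⟩, hS⟩
  have h3 := h2.congr (g := fun _ => c) (fun t ht => (hc t ht).symm)
  have h4 := congrArg (coeff 0) (h3.unique (QRep.const c))
  rw [c0mul, PowerSeries.coeff_zero_C, PowerSeries.coeff_zero_eq_constantCoeff_apply, PowerSeries.coeff_zero_eq_constantCoeff_apply, map_pow, map_pow,
    ← PowerSeries.coeff_zero_eq_constantCoeff_apply, ← PowerSeries.coeff_zero_eq_constantCoeff_apply, hV0, one_pow, mul_one] at h4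
  intro hz
  have h5 := hc τ hτ
  rw [hz, ← h4] at h5
  exact pow_ne_zero 24 h0 (by rw [← h5]; simp)

lemma Mth_det_ne (m : ℕ) (hm : 0 < m) {τ : ℂ} (hτ : 0 < τ.im) : (Mth m τ).det ≠ 0 := by
  rw [Mth_G, Matrix.det_mul, Matrix.det_diagonal]
  exact mul_ne_zero (Finset.prod_ne_zero_iff.2 fun _ _ => ee_ne _) (Gth_det_ne m hm hτ)

lemma ev_per_zero {m : ℕ} (hm : 0 < m) {x : ℤ → ℂ} (hper : ∀ l, x (l + 2 * m) = x l) (hev : ∀ l, x (-l) = x l)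
    (h : ∀ l : ℕ, l ≤ m → x l = 0) (l : ℤ) : x l = 0 := by
  have hm2 : (0 : ℤ) < 2 * m := by positivity
  have h1 : x l = x (l % (2 * m)) := by
    apply per_dvd (N := 2 * m) hper
    exact Int.dvd_self_sub_emod
  have h2 := Int.emod_nonneg l hm2.ne'
  have h3 := Int.emod_lt_of_pos l hm2
  rw [h1]
  set r := l % (2 * m)
  rcases le_or_gt r m with h4 | h4
  · have := h r.toNat (by omega)
    rwa [Int.toNat_of_nonneg h2] at this
  · have := h (2 * m - r).toNat (by omega)
    rw [Int.toNat_of_nonneg (by omega)] at this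
    rw [← hev, ← hper, ← this]; congr 1; ring

lemma Th_indep (m : ℕ) (hm : 0 < m) {τ : ℂ} (hτ : 0 < τ.im) {x : ℤ → ℂ} (hper : ∀ l, x (l + 2 * m) = x l) (hev : ∀ l, x (-l) = x l)
    (h : ∀ j : ℕ, j ≤ m → ∑ l ∈ range (2 * m), x l * Th m j l τ = 0) (l : ℤ) : x l = 0 := by
  refine ev_per_zero hm hper hev (fun l hl => ?_) l
  have h1 : Matrix.vecMul (fun l : Fin (m + 1) => eps m l * x (l : ℕ)) (Mth m τ) = 0 := by
    ext j
    have h2 := fold_sum m hm (fun l => x l * Th m j l τ) (fun l => by rw [hper, Th_per]) (fun l => by rw [hev, Th_neg])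
    rw [h j (Nat.lt_succ_iff.1 j.2)] at h2
    rw [Matrix.vecMul, dotProduct, Pi.zero_apply, h2]
    apply sum_congr rfl
    intro l _
    simp only [Mth, Matrix.of_apply]; ring
  have h3 := Matrix.eq_zero_of_vecMul_eq_zero (Mth_det_ne m hm hτ) h1
  have h4 := congrFun h3 ⟨l, by omega⟩
  simpa [eps_ne] using h4

def JLaw (J : ℂ → ℂ) (m : ℕ) (Ψ : ℂ → ℂ → ℂ) : Prop :=
  ∀ τ : ℂ, 0 < τ.im → ∀ z : ℂ, ∀ a b c d : ℤ, a * d - b * c = 1 →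
    Ψ (((a : ℂ) * τ + (b : ℂ)) / ((c : ℂ) * τ + (d : ℂ))) (z / ((c : ℂ) * τ + (d : ℂ))) =
      J ((c : ℂ) * τ + (d : ℂ)) * ee ((m : ℂ) * (c : ℂ) * z ^ 2 / ((c : ℂ) * τ + (d : ℂ))) * Ψ τ z

lemma den_ne {τ : ℂ} (hτ : 0 < τ.im) {a b c d : ℤ} (h : a * d - b * c = 1) : (c : ℂ) * τ + d ≠ 0 := by
  intro h0
  have h1 := congrArg Complex.im h0
  have h2 := congrArg Complex.re h0
  simp at h1 h2
  rcases h1 with h1 | h1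
  · subst h1; simp at h2; subst h2; simp at h
  · exact hτ.ne' h1

lemma mob_im {τ : ℂ} (hτ : 0 < τ.im) {a b c d : ℤ} (h : a * d - b * c = 1) :
    0 < (((a : ℂ) * τ + (b : ℂ)) / ((c : ℂ) * τ + (d : ℂ))).im := by
  have h1 := Complex.normSq_pos.2 (den_ne hτ h)
  have h' : (a : ℝ) * d - b * c = 1 := by exact_mod_cast h
  have : (((a : ℂ) * τ + (b : ℂ)) / ((c : ℂ) * τ + (d : ℂ))).im = τ.im / Complex.normSq ((c : ℂ) * τ + d) := by
    rw [Complex.div_im, ← sub_div]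
    congr 1
    simp
    linear_combination τ.im * h'
  rw [this]; positivity

lemma JLaw_gen {J : ℂ → ℂ} (hJ : ∀ x y, J (x * y) = J x * J y) (hJ1 : J 1 = 1) {m : ℕ} {Ψ : ℂ → ℂ → ℂ}
    (hT : ∀ τ : ℂ, 0 < τ.im → ∀ z, Ψ (τ + 1) z = Ψ τ z)
    (hS : ∀ τ : ℂ, 0 < τ.im → ∀ z, Ψ (-1 / τ) (z / τ) = J τ * ee (m * z ^ 2 / τ) * Ψ τ z) : JLaw J m Ψ := by
  let P : Matrix.SpecialLinearGroup (Fin 2) ℤ → Prop := fun g => ∀ τ : ℂ, 0 < τ.im → ∀ z : ℂ,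
    Ψ (((g 0 0 : ℤ) * τ + (g 0 1 : ℤ)) / ((g 1 0 : ℤ) * τ + (g 1 1 : ℤ))) (z / ((g 1 0 : ℤ) * τ + (g 1 1 : ℤ))) =
      J ((g 1 0 : ℤ) * τ + (g 1 1 : ℤ)) * ee ((m : ℂ) * (g 1 0 : ℤ) * z ^ 2 / ((g 1 0 : ℤ) * τ + (g 1 1 : ℤ))) * Ψ τ z
  have key : ∀ g, P g := by
    intro g
    have hg : g ∈ Subgroup.closure {ModularGroup.S, ModularGroup.T} := by simp [SpecialLinearGroup.SL2Z_generators]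
    have hdet : ∀ g : Matrix.SpecialLinearGroup (Fin 2) ℤ, g 0 0 * g 1 1 - g 0 1 * g 1 0 = 1 := fun g => by
      have := g.2; rwa [Matrix.det_fin_two] at this
    induction hg using Subgroup.closure_induction with
    | mem x hx =>
      intro τ hτ z
      rcases hx with rfl | hx
      · have := hS τ hτ z
        simpa [ModularGroup.S] using this
      · rw [Set.mem_singleton_iff] at hx
        subst hx
        have := hT τ hτ z
        simpa [ModularGroup.T, hJ1, ee_zero] using this
    | one => intro τ hτ z; simp [hJ1, ee_zero]
    | mul x y _ _ hx hy =>
      intro τ hτ z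
      have dx := hdet x
      have dy := hdet y
      have j0 := den_ne hτ dy
      have him := mob_im hτ dy
      have j1 := den_ne him dx
      have e := hx _ him (z / ((y 1 0 : ℤ) * τ + (y 1 1 : ℤ)))
      rw [hy τ hτ z] at e
      simp only [Matrix.SpecialLinearGroup.coe_mul, Matrix.mul_apply, Fin.sum_univ_two]
      generalize x 0 0 = a at *; generalize x 0 1 = b at *; generalize x 1 0 = c at *; generalize x 1 1 = d at *
      generalize y 0 0 = a' at *; generalize y 0 1 = b' at *; generalize y 1 0 = c' at *; generalize y 1 1 = d' at *
      have hJ2 : (((c * a' + d * c' : ℤ) : ℂ) * τ + ((c * b' + d * d' : ℤ) : ℂ)) =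
        ((c : ℂ) * (((a' : ℂ) * τ + b') / ((c' : ℂ) * τ + d')) + d) * ((c' : ℂ) * τ + d') := by
        push_cast; field_simp; ring
      have hn : (((a * a' + b * c' : ℤ) : ℂ) * τ + ((a * b' + b * d' : ℤ) : ℂ)) =
        ((a : ℂ) * (((a' : ℂ) * τ + b') / ((c' : ℂ) * τ + d')) + b) * ((c' : ℂ) * τ + d') := by
        push_cast; field_simp; ring
      rw [hJ2, hn, mul_div_mul_right _ _ j0, hJ]
      have e1 : z / (((c : ℂ) * (((a' : ℂ) * τ + b') / ((c' : ℂ) * τ + d')) + d) * ((c' : ℂ) * τ + d')) =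
        z / ((c' : ℂ) * τ + d') / ((c : ℂ) * (((a' : ℂ) * τ + b') / ((c' : ℂ) * τ + d')) + d) := by
        rw [div_div, mul_comm]
      rw [e1, e]
      have e2 : ee ((m : ℂ) * ((c * a' + d * c' : ℤ) : ℂ) * z ^ 2 / (((c : ℂ) * (((a' : ℂ) * τ + b') / ((c' : ℂ) * τ + d')) + d) * ((c' : ℂ) * τ + d'))) =
        ee ((m : ℂ) * c * (z / ((c' : ℂ) * τ + d')) ^ 2 / ((c : ℂ) * (((a' : ℂ) * τ + b') / ((c' : ℂ) * τ + d')) + d)) *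
        ee ((m : ℂ) * c' * z ^ 2 / ((c' : ℂ) * τ + d')) := by
        rw [← ee_add]
        congr 1
        set u := (c : ℂ) * (((a' : ℂ) * τ + b') / ((c' : ℂ) * τ + d')) + d with hu
        have hu2 : u * ((c' : ℂ) * τ + d') = c * (a' * τ + b') + d * (c' * τ + d') := by
          rw [← hJ2]; push_cast; ring
        have dy' : (a' : ℂ) * d' - b' * c' = 1 := by exact_mod_cast dy
        field_simp
        push_cast
        linear_combination (-(m : ℂ) * c' * z ^ 2) * hu2 + (m : ℂ) * c * z ^ 2 * dy'
      rw [e2]; ring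
    | inv x _ hx =>
      intro τ hτ z
      have dx := hdet x
      rw [Matrix.SpecialLinearGroup.SL2_inv_expl]
      simp only [Matrix.of_apply, Matrix.cons_val_zero, Matrix.cons_val_one, Matrix.cons_val', Matrix.cons_val_fin_one]
      have di : (x 1 1) * (x 0 0) - (-(x 0 1)) * (-(x 1 0)) = 1 := by linarith
      have j0 := den_ne hτ di
      have him := mob_im hτ di
      have j1 := den_ne him dx
      have e := hx _ him (z / (((-(x 1 0) : ℤ) : ℂ) * τ + (x 0 0 : ℤ)))
      generalize x 0 0 = a at *; generalize x 0 1 = b at *; generalize x 1 0 = c at *; generalize x 1 1 = d at *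
      have dx' : (a : ℂ) * d - b * c = 1 := by exact_mod_cast dx
      push_cast at *
      have hu : (c : ℂ) * ((d * τ + -b) / (-c * τ + a)) + d = (-c * τ + a)⁻¹ := by
        apply eq_inv_of_mul_eq_one_left
        rw [add_mul, mul_assoc, div_mul_cancel₀ _ j0]; linear_combination dx'
      have hn : (a : ℂ) * ((d * τ + -b) / (-c * τ + a)) + b = τ * (-c * τ + a)⁻¹ := by
        rw [eq_mul_inv_iff_mul_eq₀ j0, add_mul, mul_assoc, div_mul_cancel₀ _ j0]; linear_combination τ * dx'
      rw [hu, hn, mul_div_assoc, div_self (inv_ne_zero j0), mul_one, div_inv_eq_mul, div_mul_cancel₀ _ j0] at e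
      have e1 : J (-c * τ + a) * J ((-c * τ + a)⁻¹) = 1 := by rw [← hJ, mul_inv_cancel₀ j0, hJ1]
      rw [e]
      have e2 : ee (m * -c * z ^ 2 / (-c * τ + a)) * ee (m * c * (z / (-c * τ + a)) ^ 2 / (-c * τ + a)⁻¹) = 1 := by
        rw [← ee_add, ← ee_zero]; congr 1; field_simp; ring
      linear_combination (-(Ψ ((d * τ + -b) / (-c * τ + a)) (z / (-c * τ + a)))) * (e1 + J (-c * τ + a) * J ((-c * τ + a)⁻¹) * e2)
  intro τ hτ z a b c d h
  exact key ⟨!![a, b; c, d], by rw [Matrix.det_fin_two_of]; linarith⟩ τ hτ z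

def fl (m : ℕ) (l : ℤ) : ℕ := (min (l % (2 * m)) (2 * m - l % (2 * m))).toNat

lemma fl_spec {m : ℕ} (hm : 0 < m) (l : ℤ) : fl m l ≤ m ∧ ((2 * m : ℤ) ∣ l - fl m l ∨ (2 * m : ℤ) ∣ l + fl m l) := by
  have hm2 : (0 : ℤ) < 2 * m := by positivity
  have h2 := Int.emod_nonneg l hm2.ne'
  have h3 := Int.emod_lt_of_pos l hm2
  have h4 : (2 * m : ℤ) ∣ l - l % (2 * m) := Int.dvd_self_sub_emod
  have h5 : ((fl m l : ℕ) : ℤ) = min (l % (2 * m)) (2 * m - l % (2 * m)) := by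
    unfold fl; rw [Int.toNat_of_nonneg]; omega
  refine ⟨by omega, ?_⟩
  rcases le_total (l % (2 * m)) (2 * m - l % (2 * m)) with h | h
  · left; rw [h5, min_eq_left h]; exact h4
  · right; rw [h5, min_eq_right h, show l + (2 * m - l % (2 * m)) = (l - l % (2 * m)) + 2 * m by ring]
    exact dvd_add_self_right.2 h4

lemma fl_eq {m : ℕ} {G : ℤ → ℂ} (hm : 0 < m) (hper : ∀ l, G (l + 2 * m) = G l) (hev : ∀ l, G (-l) = G l) (l : ℤ) :
    G (fl m l) = G l := by
  rcases (fl_spec hm l).2 with h | h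
  · exact (per_dvd hper h).symm
  · rw [← hev l]; apply per_dvd hper; rw [sub_neg_eq_add, add_comm]; exact h

lemma fl_per (m : ℕ) (l : ℤ) : fl m (l + 2 * m) = fl m l := by unfold fl; rw [Int.add_emod_right]

lemma fl_neg {m : ℕ} (hm : 0 < m) (l : ℤ) : fl m (-l) = fl m l := by
  have hm2 : (0 : ℤ) < 2 * m := by positivity
  unfold fl
  have h2 := Int.emod_nonneg l hm2.ne'
  have h3 := Int.emod_lt_of_pos l hm2
  by_cases h : l % (2 * m) = 0
  · rw [h, Int.emod_eq_zero_of_dvd ((Int.dvd_of_emod_eq_zero h).neg_right)]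
  · have : -l % (2 * m) = 2 * m - l % (2 * m) := by
      rw [Int.neg_emod, if_neg (fun hd => h (Int.emod_eq_zero_of_dvd hd))]
      simp [Int.natAbs_mul]
    rw [this]; congr 1; omega

lemma fl_id {m l : ℕ} (hm : 0 < m) (hl : l ≤ m) : fl m l = l := by
  unfold fl
  rw [Int.emod_eq_of_lt (by positivity) (by omega)]; omega

lemma fl_sq {m : ℕ} (hm : 0 < m) (l : ℤ) : (4 * m : ℤ) ∣ l ^ 2 - (fl m l : ℤ) ^ 2 ∧ (fl m l : ℤ) ^ 2 ≤ l ^ 2 := by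
  obtain ⟨h1, h2⟩ := fl_spec hm l
  have e : l ^ 2 - (fl m l : ℤ) ^ 2 = (l - fl m l) * (l + fl m l) := by ring
  constructor
  · rw [e]
    rcases h2 with ⟨k, hk⟩ | ⟨k, hk⟩
    · exact ⟨k * (fl m l + m * k), by linear_combination (l + fl m l + 2 * m * k) * hk - 2 * m * k * hk + 2 * m * k * hk - 2 * m * k * hk + 2 * m * k * hk⟩
    · exact ⟨k * (m * k - fl m l), by rw [hk]; linear_combination (2 * m * k) * hk⟩
  · by_contra hc
    push Not at hc
    have h3 : |l| < fl m l := by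
      exact abs_lt_of_sq_lt_sq hc (by positivity)
    rw [abs_lt] at h3
    rcases h2 with h2 | h2
    · have := Int.eq_zero_of_abs_lt_dvd h2 (by rw [abs_lt]; constructor <;> omega)
      omega
    · have := Int.eq_zero_of_abs_lt_dvd h2 (by rw [abs_lt]; constructor <;> omega)
      omega

lemma Ginv_rep (m : ℕ) (hm : 0 < m) : ∃ P Q : Matrix (Fin (m + 1)) (Fin (m + 1)) (PowerSeries ℂ),
    (∀ l j, QRep (fun τ => Gth m τ l j) (P l j) ∧ P l j ∈ RPS (dN m)) ∧
    (∀ j l, QRep (fun τ => (Gth m τ)⁻¹ j l) (Q j l)) ∧ P * Q = 1 := by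
  obtain ⟨P, hP, h0⟩ := Gth_rep m hm
  obtain ⟨R, hR, -⟩ := (QRep.det (Gth m) P (fun l j => (hP l j).1)).inv h0 (fun τ hτ => Gth_det_ne m hm hτ)
  have h1 : ∀ j l, IsQRep (fun τ => (Gth m τ)⁻¹ j l) := by
    intro j l
    have hq : IsQRep (fun τ => ((Gth m τ).det)⁻¹) := ⟨_, hR⟩
    refine (hq.mul (IsQRep.adj (Gth m) (fun i j => ⟨_, (hP i j).1⟩) j l)).congr (fun τ hτ => ?_)
    rw [Matrix.inv_def, Matrix.smul_apply, Ring.inverse_eq_inv', smul_eq_mul]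
  choose Q hQ using h1
  refine ⟨P, Matrix.of Q, hP, hQ, ?_⟩
  ext1 l l'
  have h2 := QRep.sum Finset.univ (fun j _ => ((hP l j).1).mul (hQ j l'))
  have h3 : QRep (fun τ => ∑ j, Gth m τ l j * (Gth m τ)⁻¹ j l') (PowerSeries.C ((1 : Matrix (Fin (m + 1)) (Fin (m + 1)) ℂ) l l')) := by
    refine (QRep.const _).congr (fun τ hτ => ?_)
    rw [← Matrix.mul_apply, Matrix.mul_nonsing_inv _ (Ne.isUnit (Gth_det_ne m hm hτ))]
  rw [Matrix.mul_apply]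
  refine (h2.unique h3).trans ?_
  rw [Matrix.one_apply, Matrix.one_apply]; split_ifs <;> simp

def arr (m : ℕ) (o : ℕ → ℤ) (P : ℕ → PowerSeries ℂ) (D l : ℤ) : ℂ :=
  if (4 * m : ℤ) ∣ D - o (fl m l) ∧ o (fl m l) ≤ D then
    coeff ((D - o (fl m l)) / (4 * m)).toNat (P (fl m l)) else 0

lemma arr_val {m : ℕ} (hm : 0 < m) (o : ℕ → ℤ) (P : ℕ → PowerSeries ℂ) (l : ℤ) (n : ℕ) :
    arr m o P (o (fl m l) + 4 * m * n) l = coeff n (P (fl m l)) := by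
  unfold arr
  rw [if_pos ⟨⟨n, by ring⟩, by have : (0 : ℤ) ≤ 4 * m * n := by positivity
                               linarith⟩, add_sub_cancel_left, Int.mul_ediv_cancel_left _ (by positivity)]
  simp

lemma arr_sum {m : ℕ} (hm : 0 < m) (o : ℕ → ℤ) (P : ℕ → PowerSeries ℂ) (l : ℤ) {f : ℂ → ℂ} (hf : QRep f (P (fl m l)))
    {τ : ℂ} (hτ : 0 < τ.im) :
    HasSum (fun D : ℤ => arr m o P D l * ee ((D : ℂ) / (4 * m) * τ)) (ee ((o (fl m l) : ℂ) / (4 * m) * τ) * f τ) := by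
  have hm' : (m : ℂ) ≠ 0 := by exact_mod_cast hm.ne'
  have hm4 : (0 : ℤ) < 4 * m := by positivity
  have hi : Function.Injective (fun n : ℕ => o (fl m l) + 4 * m * (n : ℤ)) := by
    intro a b h
    simp only [add_right_inj] at h
    have := mul_left_cancel₀ hm4.ne' h
    exact_mod_cast this
  rw [← hi.hasSum_iff]
  · refine hs_congr ((hf τ hτ).mul_left (ee ((o (fl m l) : ℂ) / (4 * m) * τ))) (fun n => ?_) rfl
    simp only [Function.comp]
    rw [arr_val hm]
    have : ee ((((o (fl m l) + 4 * m * n : ℤ) : ℂ)) / (4 * m) * τ) = ee ((o (fl m l) : ℂ) / (4 * m) * τ) * ee (n * τ) := by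
      rw [← ee_add]; congr 1; push_cast; field_simp
    rw [this]; ring
  · intro D hD
    unfold arr
    rw [if_neg, zero_mul]
    rintro ⟨⟨k, hk⟩, h2⟩
    apply hD
    have hk0 : 0 ≤ k := by
      by_contra hc
      push Not at hc
      nlinarith
    refine ⟨k.toNat, ?_⟩
    simp only [Int.toNat_of_nonneg hk0]; linarith

lemma arr_per (m : ℕ) (o : ℕ → ℤ) (P : ℕ → PowerSeries ℂ) (D l : ℤ) : arr m o P D (l + 2 * m) = arr m o P D l := by
  unfold arr; rw [fl_per]

lemma arr_ev {m : ℕ} (hm : 0 < m) (o : ℕ → ℤ) (P : ℕ → PowerSeries ℂ) (D l : ℤ) : arr m o P D (-l) = arr m o P D l := by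
  unfold arr; rw [fl_neg hm]

lemma psi_exists (m : ℕ) (hm : 0 < m) {Q : Matrix (Fin (m + 1)) (Fin (m + 1)) (PowerSeries ℂ)}
    (hQ : ∀ j l, QRep (fun τ => (Gth m τ)⁻¹ j l) (Q j l)) (g : Fin (m + 1) → ℂ → ℂ) (Pg : Fin (m + 1) → PowerSeries ℂ)
    (hg : ∀ j, QRep (g j) (Pg j)) (hS : ∀ j : Fin (m + 1), SLaw (2 + 2 * (j : ℕ)) (g j)) :
    ∃ ψ : EllFormData m, ModularLaw 2 m ψ.toFun ∧ IsWeakC m ψ.coeff ∧ IsEvenC ψ.coeff ∧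
      ∀ (l : Fin (m + 1)) (n : ℕ), eps m l * ψ.coeff (4 * m * n - (l : ℕ) ^ 2) (l : ℕ) = coeff n (∑ j, Pg j * Q j l) := by
  have hm' : (m : ℂ) ≠ 0 := by exact_mod_cast hm.ne'
  set PF : Fin (m + 1) → PowerSeries ℂ := fun l => (eps m l)⁻¹ • ∑ j, Pg j * Q j l with hPF
  set fF : Fin (m + 1) → ℂ → ℂ := fun l τ => (eps m l)⁻¹ * ∑ j, g j τ * (Gth m τ)⁻¹ j l with hfF
  have hq : ∀ l, QRep (fF l) (PF l) := fun l => (QRep.sum _ (fun j _ => (hg j).mul (hQ j l))).smul _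
  set o : ℕ → ℤ := fun r => -(r : ℤ) ^ 2 with ho
  set P : ℕ → PowerSeries ℂ := fun r => PF (Fin.ofNat (m + 1) r) with hP
  set H : ℤ → ℂ → ℂ := fun l τ => ee ((o (fl m l) : ℂ) / (4 * m) * τ) * fF (Fin.ofNat (m + 1) (fl m l)) τ with hH
  have hofn : ∀ l : Fin (m + 1), Fin.ofNat (m + 1) (l : ℕ) = l := fun l => by
    ext; simp [Nat.mod_eq_of_lt l.2]
  have hHs : ∀ l : ℤ, ∀ τ : ℂ, 0 < τ.im → HasSum (fun D : ℤ => arr m o P D l * ee ((D : ℂ) / (4 * m) * τ)) (H l τ) :=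
    fun l τ hτ => arr_sum hm o P l (hq _) hτ
  have hHper : ∀ l τ, H (l + 2 * m) τ = H l τ := fun l τ => by simp only [hH, fl_per]
  have hHev : ∀ l τ, H (-l) τ = H l τ := fun l τ => by simp only [hH, fl_neg hm]
  have hTh : ∀ (j : ℕ), j ≤ m → ∀ τ : ℂ, 0 < τ.im → ∑ l ∈ range (2 * m), H l τ * Th m j l τ = g (Fin.ofNat (m + 1) j) τ := by
    intro j hj τ hτ
    rw [fold_sum m hm (fun l => H l τ * Th m j l τ) (fun l => by rw [hHper, Th_per]) (fun l => by rw [hHev, Th_neg])]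
    have e : ∀ l : Fin (m + 1), eps m l * (H (l : ℕ) τ * Th m j (l : ℕ) τ) = (∑ j', g j' τ * (Gth m τ)⁻¹ j' l) * Gth m τ l (Fin.ofNat (m + 1) j) := by
      intro l
      simp only [hH, hfF, fl_id hm (Nat.lt_succ_iff.1 l.2), hofn, Gth, Matrix.of_apply, Fin.val_ofNat, Nat.mod_eq_of_lt (Nat.lt_succ_iff.2 hj), Nat.mod_eq_of_lt l.2, ho, aE]
      have e0 : (((-((l : ℕ) : ℤ) ^ 2 : ℤ) : ℂ) / (4 * m) * τ) = -((((l : ℕ) : ℂ)) ^ 2 / (4 * m) * τ) := by push_cast; ring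
      rw [e0]
      have := eps_ne m l
      field_simp
    rw [sum_congr rfl (fun l _ => e l)]
    have e2 : Matrix.vecMul (Matrix.vecMul (fun j => g j τ) (Gth m τ)⁻¹) (Gth m τ) = fun j => g j τ := by
      rw [Matrix.vecMul_vecMul, Matrix.nonsing_inv_mul _ (Ne.isUnit (Gth_det_ne m hm hτ)), Matrix.vecMul_one]
    exact congrFun e2 (Fin.ofNat (m + 1) j)
  have hHS : ∀ τ : ℂ, 0 < τ.im → ∀ l' : ℤ, rtS m τ * ∑ l ∈ range (2 * m), H l (-1 / τ) * ee (-(l : ℂ) * l' / (2 * m)) = τ ^ 2 * H l' τ := by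
    intro τ hτ l'
    have h0 := ne_of_im hτ
    rw [← sub_eq_zero]
    refine Th_indep m hm hτ (x := fun l' => rtS m τ * ∑ l ∈ range (2 * m), H l (-1 / τ) * ee (-(l : ℂ) * l' / (2 * m)) - τ ^ 2 * H l' τ)
      (fun l' => ?_) (fun l' => ?_) (fun j hj => ?_) l'
    · rw [hHper]
      congr 2
      apply sum_congr rfl
      intro l _
      congr 1
      apply ee_eq_of_sub (-l)
      push_cast; field_simp; ring
    · rw [hHev]
      congr 2
      have := sum_per_map (N := 2 * m) (by positivity) (G := fun l : ℤ => H l (-1 / τ) * ee (-(l : ℂ) * l' / (2 * m)))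
        (fun l => by
          have e1 : ee (-((l + (2 * m : ℕ) : ℤ) : ℂ) * l' / (2 * m)) = ee (-(l : ℂ) * l' / (2 * m)) := by
            apply ee_eq_of_sub (-l')
            push_cast; field_simp; ring
          have e2 := hHper l (-1 / τ)
          push_cast at *
          rw [e1, e2]) (-1) 0 isCoprime_one_left.neg_left
      simp only [Int.cast_natCast] at this
      rw [← this]
      apply sum_congr rfl
      intro l _
      rw [show (-1 : ℤ) * (l : ℤ) + 0 = -(l : ℤ) by ring, hHev]
      push_cast
      rw [neg_mul_neg, neg_neg]
    · have e1 : ∀ l ∈ range (2 * m), (rtS m τ * ∑ k ∈ range (2 * m), H k (-1 / τ) * ee (-(k : ℂ) * (l : ℤ) / (2 * m)) - τ ^ 2 * H l τ) * Th m j l τ =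
        (∑ k ∈ range (2 * m), rtS m τ * (H k (-1 / τ) * (ee (-(k : ℂ) * l / (2 * m)) * Th m j l τ))) - τ ^ 2 * (H l τ * Th m j l τ) := by
        intro l _
        rw [sub_mul, mul_sum, sum_mul]
        push_cast
        congr 1
        · exact sum_congr rfl (fun k _ => by ring)
        · ring
      rw [sum_congr rfl e1, Finset.sum_sub_distrib, sum_comm, ← mul_sum, hTh j hj τ hτ]
      have e2 : ∀ k ∈ range (2 * m), ∑ l ∈ range (2 * m), rtS m τ * (H k (-1 / τ) * (ee (-(k : ℂ) * l / (2 * m)) * Th m j l τ)) =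
        (τ ^ (2 * j))⁻¹ * (H k (-1 / τ) * Th m j k (-1 / τ)) := by
        intro k _
        rw [← mul_sum, ← mul_sum, Th_S m hm j k hτ]
        push_cast
        field_simp
      rw [sum_congr rfl e2, ← mul_sum, hTh j hj _ (im_neg_inv hτ), hS _ τ hτ]
      rw [Fin.val_ofNat, Nat.mod_eq_of_lt (Nat.lt_succ_iff.2 hj), zpow_add₀ h0, show (2 * (j : ℤ)) = ((2 * j : ℕ) : ℤ) by push_cast; rfl, zpow_natCast]
      field_simp
      ring
  refine ⟨mkEll m hm (arr m o P) H (arr_per m o P) (fun D l h => ?_) (fun l τ hτ => ?_) hHs, ?_, ?_, arr_ev hm o P, ?_⟩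
  · unfold arr
    rw [if_neg]
    rintro ⟨h1, -⟩
    apply h
    have := dvd_add h1 (fl_sq hm l).1
    simp only [ho] at this
    rwa [show D - -(fl m l : ℤ) ^ 2 + (l ^ 2 - (fl m l : ℤ) ^ 2) = D + l ^ 2 by ring] at this
  · refine DifferentiableAt.mul ?_ ((hq _).diffAt hτ)
    exact (ee_differentiable.comp (differentiable_id.const_mul _)) τ
  · refine JLaw_gen (J := fun x => x ^ (2 : ℤ)) (fun x y => mul_zpow x y 2) (by simp) ?_ ?_
    · intro τ hτ z
      change ∑ l ∈ range (2 * m), H l (τ + 1) * jTheta m l (τ + 1) z = ∑ l ∈ range (2 * m), H l τ * jTheta m l τ z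
      apply sum_congr rfl
      intro l _
      rw [jTheta_T m hm]
      simp only [hH]
      rw [(hq _).per hτ]
      have e : ee ((o (fl m l) : ℂ) / (4 * m) * (τ + 1)) * ee (((l : ℤ) : ℂ) ^ 2 / (4 * m)) = ee ((o (fl m l) : ℂ) / (4 * m) * τ) := by
        obtain ⟨k, hk⟩ := (fl_sq hm l).1
        rw [← ee_add]
        apply ee_eq_of_sub k
        have hk' : (((l : ℤ) : ℂ)) ^ 2 - ((fl m l : ℕ) : ℂ) ^ 2 = 4 * m * k := by exact_mod_cast hk
        simp only [ho]
        push_cast at *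
        field_simp
        linear_combination hk'
      linear_combination (fF (Fin.ofNat (m + 1) (fl m l)) τ * jTheta m l τ z) * e
    · intro τ hτ z
      change ∑ l ∈ range (2 * m), H l (-1 / τ) * jTheta m l (-1 / τ) (z / τ) = _ * ∑ l ∈ range (2 * m), H l τ * jTheta m l τ z
      have h0 := ne_of_im hτ
      have e1 : ∀ l ∈ range (2 * m), H l (-1 / τ) * jTheta m l (-1 / τ) (z / τ) =
        ∑ l' ∈ range (2 * m), ee (m * z ^ 2 / τ) * (jTheta m l' τ z * (rtS m τ * (H l (-1 / τ) * ee (-(l : ℂ) * l' / (2 * m))))) := by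
        intro l _
        rw [jTheta_S m hm l hτ z, mul_sum, mul_sum]
        refine sum_congr rfl (fun l' _ => ?_)
        push_cast; ring
      rw [sum_congr rfl e1, sum_comm, mul_sum]
      refine sum_congr rfl (fun l' _ => ?_)
      rw [← mul_sum, ← mul_sum, ← mul_sum]
      have := hHS τ hτ l'
      push_cast at this
      rw [this]
      norm_cast; ring
  · intro n r hn
    change arr m o P _ _ = 0
    unfold arr
    rw [if_neg]
    rintro ⟨-, h2⟩
    have := (fl_sq hm r).2
    simp only [ho] at h2
    have : (4 * m : ℤ) * n < 0 := mul_neg_of_pos_of_neg (by positivity) hn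
    linarith
  · intro l n
    change eps m l * arr m o P _ _ = _
    have e : (4 * m * n - ((l : ℕ) : ℤ) ^ 2 : ℤ) = o (fl m ((l : ℕ) : ℤ)) + 4 * m * n := by
      rw [fl_id hm (Nat.lt_succ_iff.1 l.2)]; simp only [ho]; ring
    rw [e, arr_val hm, fl_id hm (Nat.lt_succ_iff.1 l.2)]
    simp only [hP, hPF, hofn]
    rw [map_smul, smul_eq_mul, mul_inv_cancel_left₀ (eps_ne m l)]

lemma QRep.X : QRep ee PowerSeries.X := fun τ _ => by
  refine hs_congr (hasSum_ite_eq (1 : ℕ) (ee τ)) (fun n => ?_) rfl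
  rw [PowerSeries.coeff_X]
  by_cases h : n = 1
  · simp [h]
  · simp [h]

lemma coeff_lead {P W : PowerSeries ℂ} (t i : ℕ) (h0 : coeff 0 P = 1) (hW : ∀ n < i, coeff n W = 0) :
    coeff (t + i) (PowerSeries.X ^ t * P * W) = coeff i W := by
  obtain ⟨W', rfl⟩ := PowerSeries.X_pow_dvd_iff.2 hW
  rw [show PowerSeries.X ^ t * P * (PowerSeries.X ^ i * W') = PowerSeries.X ^ (t + i) * (P * W') by rw [pow_add]; ring]
  have e1 := PowerSeries.coeff_X_pow_mul (P * W') (t + i) 0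
  have e2 := PowerSeries.coeff_X_pow_mul W' i 0
  rw [zero_add] at e1 e2
  rw [e1, e2, PowerSeries.coeff_zero_eq_constantCoeff_apply, map_mul, ← PowerSeries.coeff_zero_eq_constantCoeff_apply, h0, one_mul,
    ← PowerSeries.coeff_zero_eq_constantCoeff_apply]

lemma wt2_coeff {g f : ℂ → ℂ} {Pg F : PowerSeries ℂ} {k : ℤ} (s : ℕ) (hg : QRep g Pg) (hS : SLaw k g) (hf : QRep f F)
    (hSf : SLaw (2 - k) (fun τ => f τ * (ee τ ^ s)⁻¹)) : coeff s (Pg * F) = 0 := by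
  have hq := hg.mul hf
  have h1 := resid_sum (fun τ => g τ * (f τ * (ee τ ^ s)⁻¹)) (fun τ hτ => ?_) (fun τ hτ => ?_)
    (fun n : ℕ => coeff n (Pg * F)) (fun n => (n : ℤ) - s) (fun τ hτ => ?_)
  · rw [← h1.tsum_eq, tsum_eq_single s]
    · simp
    · intro n hn
      rw [if_neg]
      omega
  · exact (hg.diffAt hτ).mul ((hf.diffAt hτ).mul (((ee_differentiable τ).pow s).inv (pow_ne_zero _ (ee_ne τ))))
  · have := hS.mul hSf τ hτ
    rw [add_sub_cancel] at this
    exact this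
  · refine hs_congr ((hq τ hτ).mul_right (ee τ ^ s)⁻¹) (fun n => ?_) (by ring)
    rw [← ee_npow s τ, ← ee_neg, mul_assoc, ← ee_add]
    congr 2; push_cast; ring

lemma scal_dual (k : ℤ) (hk : Even k) (s : ℕ) (W : PowerSeries ℂ)
    (hW : ∀ g Pg, SLaw k g → QRep g Pg → coeff s (Pg * W) = 0) :
    ∃ f F, QRep f F ∧ SLaw (2 - k) (fun τ => f τ * (ee τ ^ s)⁻¹) ∧ ∀ n ≤ s, coeff n F = coeff n W := by
  obtain ⟨U, V, hU, -, hU0, hV, -, hV0⟩ := fU_exp 1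
  suffices H : ∀ i ≤ s + 1, ∃ f F, QRep f F ∧ SLaw (2 - k) (fun τ => f τ * (ee τ ^ s)⁻¹) ∧
      ∀ n < i, coeff n F = coeff n W by
    obtain ⟨f, F, h1, h2, h3⟩ := H (s + 1) le_rfl
    exact ⟨f, F, h1, h2, fun n hn => h3 n (Nat.lt_succ_of_le hn)⟩
  intro i
  induction i with
  | zero => exact fun _ => ⟨fun _ => 0, _, QRep.const 0, fun τ _ => by simp, fun n hn => absurd hn (Nat.not_lt_zero n)⟩
  | succ i ih =>
    intro hi
    obtain ⟨f, F, h1, h2, h3⟩ := ih (by omega)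
    obtain ⟨t, rfl⟩ : ∃ t, s = t + i := ⟨s - i, by omega⟩
    have hlow : ∀ n < i, coeff n (W - F) = 0 := fun n hn => by rw [map_sub, h3 n hn, sub_self]
    by_cases hx : 0 ≤ k - 12 * t ∧ k - 12 * t ≠ 2
    · obtain ⟨g, P, hgS, hgP, -, hP0⟩ := exists_mono 1 hx.1 (hk.sub ⟨6 * t, by ring⟩) hx.2
      have hq := (QRep.X.pow t).mul ((hU.pow t).mul hgP)
      have hS : SLaw k (fun τ => ee τ ^ t * (fU τ ^ t * g τ)) := by
        have := (fDl_S.pow t).mul hgS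
        rw [show (t : ℤ) * 12 + (k - 12 * t) = k by ring] at this
        convert this using 2
        rw [fDl_fU]; ring
      have e1 := hW _ _ hS hq
      have e2 := wt2_coeff _ hq hS h1 h2
      have e3 : coeff (t + i) (PowerSeries.X ^ t * (U ^ t * P) * (W - F)) = 0 := by
        rw [mul_sub, map_sub, e1, e2, sub_zero]
      rw [coeff_lead t i (by simp only [PowerSeries.coeff_zero_eq_constantCoeff_apply, map_mul, map_pow] at *; simp [hU0, hP0]) hlow, map_sub, sub_eq_zero] at e3
      refine ⟨f, F, h1, h2, fun n hn => ?_⟩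
      rcases Nat.lt_succ_iff_lt_or_eq.1 hn with h | rfl
      · exact h3 n h
      · exact e3.symm
    · have hy : 0 ≤ 2 - (k - 12 * t) ∧ 2 - (k - 12 * t) ≠ 2 := by
        obtain ⟨k', rfl⟩ := hk
        omega
      obtain ⟨g, P, hgS, hgP, -, hP0⟩ := exists_mono 1 hy.1 ((even_two).sub (hk.sub ⟨6 * t, by ring⟩)) hy.2
      set c := coeff i (W - F)
      refine ⟨_, _, h1.add (((QRep.X.pow i).mul ((hV.pow t).mul hgP)).smul c), ?_, fun n hn => ?_⟩
      · have := (fDl_S.pow t).inv.mul hgS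
        rw [show -((t : ℤ) * 12) + (2 - (k - 12 * t)) = 2 - k by ring] at this
        convert h2.add (this.smul c) using 2 with τ
        rw [fDl_fU, pow_add, mul_pow]
        simp only [inv_pow]
        field_simp [ee_ne]
      · rw [map_add, map_smul, smul_eq_mul]
        have h4 : coeff n (PowerSeries.X ^ i * (V ^ t * P)) = if n < i then 0 else 1 := by
          split_ifs with h
          · rw [PowerSeries.coeff_X_pow_mul', if_neg (by omega)]
          · obtain rfl : n = i := by omega
            have := PowerSeries.coeff_X_pow_mul (V ^ t * P) n 0
            rw [zero_add] at this
            rw [this]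
            simp only [PowerSeries.coeff_zero_eq_constantCoeff_apply, map_mul, map_pow] at *; simp [hV0, hP0]
        rw [h4]
        split_ifs with h
        · rw [h3 n h]; ring
        · obtain rfl : n = i := by omega
          simp [c]

def hv (m : ℕ) (a : ℤ → ℤ → ℂ) (l : ℤ) (τ : ℂ) : ℂ := ∑' D : ℤ, a D l * ee ((D : ℂ) / (4 * m) * τ)

structure VV (m : ℕ) (a : ℤ → ℤ → ℂ) : Prop where
  per : ∀ D l, a D (l + 2 * m) = a D l
  ev : ∀ D l, a D (-l) = a D l
  sup : ∀ D l, a D l ≠ 0 → (4 * m : ℤ) ∣ D - l ^ 2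
  pos : ∀ D l, D < 0 → a D l = 0
  sm : ∀ l τ, 0 < τ.im → Summable (fun D : ℤ => a D l * ee ((D : ℂ) / (4 * m) * τ))
  S : ∀ l τ, 0 < τ.im → hv m a l (-1 / τ) = rtS m τ * ∑ l' ∈ range (2 * m), ee (-(l : ℂ) * l' / (2 * m)) * hv m a l' τ

lemma VV_of_w (m : ℕ) (hm : 0 < m) (Pm : Matrix (Fin (m + 1)) (Fin (m + 1)) (PowerSeries ℂ))
    (hPm : ∀ l j, QRep (fun τ => Gth m τ l j) (Pm l j)) (f : Fin (m + 1) → ℂ → ℂ) (F : Fin (m + 1) → PowerSeries ℂ)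
    (hf : ∀ j, QRep (f j) (F j)) (s : ℕ) (hS : ∀ j : Fin (m + 1), SLaw (-2 * (j : ℕ)) (fun τ => f j τ * (ee τ ^ s)⁻¹))
    (o : ℕ → ℤ) (ho : ∀ r, o r = r ^ 2 - 4 * m * s) (P : ℕ → PowerSeries ℂ)
    (hP : ∀ r, P r = ∑ j, Pm (Fin.ofNat (m + 1) r) j * F j)
    (hpos : ∀ D l, D < 0 → arr m o P D l = 0) : VV m (arr m o P) := by
  have hm' : (m : ℂ) ≠ 0 := by exact_mod_cast hm.ne'
  have hq : ∀ r, QRep (fun τ => ∑ j, Gth m τ (Fin.ofNat (m + 1) r) j * f j τ) (P r) := fun r => by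
    rw [hP]; exact QRep.sum _ (fun j _ => (hPm _ j).mul (hf j))
  have hsum := fun (l : ℤ) (τ : ℂ) (hτ : 0 < τ.im) => arr_sum hm o P l (hq (fl m l)) hτ
  have hval : ∀ (l : ℤ) (τ : ℂ), 0 < τ.im → hv m (arr m o P) l τ = ∑ j : Fin (m + 1), Th m j l τ * (f j τ * (ee τ ^ s)⁻¹) := by
    intro l τ hτ
    rw [hv, (hsum l τ hτ).tsum_eq, mul_sum]
    apply sum_congr rfl
    intro j _
    have e1 : Th m j (fl m l : ℤ) τ = Th m j l τ := fl_eq hm (G := fun l => Th m j l τ) (fun l => by rw [Th_per]) (fun l => by rw [Th_neg]) l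
    have e2 : ((Fin.ofNat (m + 1) (fl m l) : Fin (m + 1)) : ℕ) = fl m l := by
      rw [Fin.val_ofNat, Nat.mod_eq_of_lt (Nat.lt_succ_iff.2 (fl_spec hm l).1)]
    simp only [Gth, Matrix.of_apply, aE, e2, e1, ho]
    rw [← ee_npow s τ, ← ee_neg]
    have e3 : ee ((((fl m l : ℤ) ^ 2 - 4 * m * s : ℤ) : ℂ) / (4 * m) * τ) = ee (((fl m l : ℂ)) ^ 2 / (4 * m) * τ) * ee (-(s * τ)) := by
      rw [← ee_add]; congr 1; push_cast; field_simp; ring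
    have e4 : ee (((fl m l : ℂ)) ^ 2 / (4 * m) * τ) * ee (-(((fl m l : ℂ)) ^ 2 / (4 * m) * τ)) = 1 := by
      rw [← ee_add, add_neg_cancel, ee_zero]
    rw [e3]
    linear_combination (ee (-(s * τ)) * Th m j l τ * f j τ) * e4
  refine ⟨arr_per m o P, arr_ev hm o P, fun D l h => ?_, hpos, fun l τ hτ => (hsum l τ hτ).summable, fun l τ hτ => ?_⟩
  · unfold arr at h
    split_ifs at h with h1
    · have h2 := (fl_sq hm l).1
      have h3 := h1.1
      rw [ho] at h3
      have : D - l ^ 2 = (D - ((fl m l : ℤ) ^ 2 - 4 * m * s)) - (l ^ 2 - (fl m l : ℤ) ^ 2) - 4 * m * s := by ring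
      rw [this]
      exact dvd_sub (dvd_sub h3 h2) ⟨s, by ring⟩
    · exact absurd rfl h
  · have h0 := ne_of_im hτ
    rw [hval l _ (im_neg_inv hτ)]
    have : ∀ j ∈ Finset.univ, Th m (j : Fin (m + 1)) l (-1 / τ) * (f j (-1 / τ) * (ee (-1 / τ) ^ s)⁻¹) =
        ∑ l' ∈ range (2 * m), rtS m τ * (ee (-(l : ℂ) * l' / (2 * m)) * (Th m j l' τ * (f j τ * (ee τ ^ s)⁻¹))) := by
      intro j _
      have e := hS j τ hτ
      beta_reduce at e
      rw [Th_S m hm j l hτ, e, mul_sum, sum_mul]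
      apply sum_congr rfl
      intro l' _
      rw [show (-2 * ((j : ℕ) : ℤ)) = -((2 * j : ℕ) : ℤ) by push_cast; ring, zpow_neg, zpow_natCast]
      field_simp
    rw [sum_congr rfl this, sum_comm, mul_sum]
    apply sum_congr rfl
    intro l' _
    rw [hval _ _ hτ, mul_sum, mul_sum]

lemma VV_dual (m : ℕ) (hm : 0 < m) (Pm Q : Matrix (Fin (m + 1)) (Fin (m + 1)) (PowerSeries ℂ))
    (hPm : ∀ l j, QRep (fun τ => Gth m τ l j) (Pm l j)) (hPQ : Pm * Q = 1)
    (lam : Fin (m + 1) → Fin (m + 1) → ℂ) (hmask : ∀ n l : Fin (m + 1), ((l : ℕ) : ℤ) ^ 2 < 4 * m * (n : ℕ) → lam n l = 0)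
    (hann : ∀ (j : Fin (m + 1)) g Pg, SLaw (2 + 2 * (j : ℕ)) g → QRep g Pg →
      ∑ n : Fin (m + 1), ∑ l, lam n l * coeff n (Pg * Q j l) = 0) :
    ∃ a, VV m a ∧ ∀ n l : Fin (m + 1), a ((l : ℕ) ^ 2 - 4 * m * (n : ℕ)) (l : ℕ) = lam n l := by
  have hm4 : (0 : ℤ) < 4 * m := by positivity
  set lt : Fin (m + 1) → PowerSeries ℂ := fun l => ∑ n : Fin (m + 1), lam n l • (PowerSeries.X ^ (m - n)) with hlt
  have hltc : ∀ l, ∀ n : Fin (m + 1), coeff (m - n) (lt l) = lam n l := by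
    intro l n
    rw [hlt]
    simp only [map_sum, map_smul, PowerSeries.coeff_X_pow, smul_eq_mul]
    rw [Finset.sum_eq_single n]
    · simp
    · intro b _ hb
      rw [if_neg, mul_zero]
      have := b.2; have := n.2
      intro h; apply hb; ext; omega
    · simp
  have hd : ∀ j : Fin (m + 1), ∃ f F, QRep f F ∧ SLaw (2 - (2 + 2 * (j : ℕ))) (fun τ => f τ * (ee τ ^ m)⁻¹) ∧
      ∀ n ≤ m, coeff n F = coeff n (∑ l, Q j l * lt l) := by
    intro j
    refine scal_dual _ ⟨1 + (j : ℕ), by ring⟩ m _ (fun g Pg hg hP => ?_)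
    rw [← hann j g Pg hg hP, mul_sum, map_sum, sum_comm]
    apply sum_congr rfl
    intro l _
    rw [← mul_assoc, hlt, mul_sum, map_sum]
    apply sum_congr rfl
    intro n _
    rw [mul_smul_comm, map_smul, smul_eq_mul, PowerSeries.coeff_mul_X_pow', if_pos (by omega)]
    congr 3
    have := n.2; omega
  choose f F hf hS hF using hd
  set P : ℕ → PowerSeries ℂ := fun r => ∑ j, Pm (Fin.ofNat (m + 1) r) j * F j with hP
  have hofn : ∀ l : Fin (m + 1), Fin.ofNat (m + 1) (l : ℕ) = l := fun l => by ext; simp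
  have hPc : ∀ l : Fin (m + 1), ∀ n ≤ m, coeff n (P l) = coeff n (lt l) := by
    intro l n hn
    have e1 : lt l = ∑ j, Pm l j * ∑ l', Q j l' * lt l' := by
      have : lt = Matrix.mulVec Pm (Matrix.mulVec Q lt) := by
        rw [Matrix.mulVec_mulVec, hPQ, Matrix.one_mulVec]
      exact congrFun this l
    rw [e1, hP]
    simp only [hofn, map_sum]
    apply sum_congr rfl
    intro j _
    rw [PowerSeries.coeff_mul, PowerSeries.coeff_mul]
    apply sum_congr rfl
    intro x hx
    rw [Finset.HasAntidiagonal.mem_antidiagonal] at hx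
    rw [hF j x.2 (by omega)]
  set o : ℕ → ℤ := fun r => (r : ℤ) ^ 2 - 4 * m * m with ho
  refine ⟨arr m o P, VV_of_w m hm Pm hPm f F hf m (fun j => ?_) o (fun r => rfl) P (fun r => rfl) ?_, ?_⟩
  · have := hS j
    rwa [show (2 : ℤ) - (2 + 2 * (j : ℕ)) = -2 * (j : ℕ) by ring] at this
  · intro D l hD
    by_cases h : (4 * m : ℤ) ∣ D - o (fl m l) ∧ o (fl m l) ≤ D
    · obtain ⟨⟨n, hn⟩, h2⟩ := h
      have hn0 : 0 ≤ n := by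
        by_contra h; push Not at h; nlinarith
      lift n to ℕ using hn0
      obtain rfl : D = o (fl m l) + 4 * m * n := by linarith
      have hfl := (fl_spec hm l).1
      have hnm : n < m := by
        rw [ho] at hD
        have : (4 * m : ℤ) * n < 4 * m * m := by nlinarith
        exact_mod_cast lt_of_mul_lt_mul_left this hm4.le
      have h3 := hPc (Fin.ofNat (m + 1) (fl m l)) n hnm.le
      have h4 := hltc (Fin.ofNat (m + 1) (fl m l)) (Fin.ofNat (m + 1) (m - n))
      have e2 : ((Fin.ofNat (m + 1) (fl m l) : Fin (m + 1)) : ℕ) = fl m l := by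
        rw [Fin.val_ofNat, Nat.mod_eq_of_lt (Nat.lt_succ_iff.2 hfl)]
      have e3 : ((Fin.ofNat (m + 1) (m - n) : Fin (m + 1)) : ℕ) = m - n := by
        rw [Fin.val_ofNat, Nat.mod_eq_of_lt (by omega)]
      rw [e3, Nat.sub_sub_self hnm.le] at h4
      rw [e2] at h3
      rw [arr_val hm, h3, h4]
      apply hmask
      rw [e2, e3, Nat.cast_sub hnm.le]
      rw [ho] at hD
      linarith
    · unfold arr; rw [if_neg h]
  · intro n l
    have hl := fl_id hm (Nat.lt_succ_iff.1 l.2)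
    have hn := Nat.lt_succ_iff.1 n.2
    have e := arr_val hm o P ((l : ℕ) : ℤ) (m - n)
    rw [hl, hPc l _ (by omega), hltc] at e
    rw [← e]
    congr 1
    rw [ho]; push_cast [Nat.cast_sub hn]; ring

lemma hv_per {m : ℕ} {a : ℤ → ℤ → ℂ} (h : VV m a) (l : ℤ) (τ : ℂ) : hv m a (l + 2 * m) τ = hv m a l τ := by
  simp only [hv, h.per]

lemma hv_ev {m : ℕ} {a : ℤ → ℤ → ℂ} (h : VV m a) (l : ℤ) (τ : ℂ) : hv m a (-l) τ = hv m a l τ := by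
  simp only [hv, h.ev]

lemma VV.hs {m : ℕ} {a : ℤ → ℤ → ℂ} (h : VV m a) (l : ℤ) {τ : ℂ} (hτ : 0 < τ.im) :
    HasSum (fun D : ℤ => a D l * ee ((D : ℂ) / (4 * m) * τ)) (hv m a l τ) := (h.sm l τ hτ).hasSum

def oV (m r : ℕ) : ℤ := (r : ℤ) ^ 2 - 4 * m * m

lemma sq_bd {m r : ℕ} (hr : r ≤ m) : oV m r ≤ 0 := by
  have : (r : ℤ) ≤ m := by exact_mod_cast hr
  unfold oV
  nlinarith

lemma VV_K {m : ℕ} (hm : 0 < m) {a : ℤ → ℤ → ℂ} (h : VV m a) (l : ℕ) (hl : l ≤ m) :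
    QRep (fun τ => ee τ ^ m * (ee (-(aE m l * τ)) * hv m a l τ)) (PowerSeries.mk fun n => a (oV m l + 4 * m * n) l) := by
  intro τ hτ
  have hm' : (m : ℂ) ≠ 0 := by exact_mod_cast hm.ne'
  have hm4 : (0 : ℤ) < 4 * m := by positivity
  have hi : Function.Injective (fun n : ℕ => oV m l + 4 * m * (n : ℤ)) := by
    intro a b h
    simp only [add_right_inj] at h
    have := mul_left_cancel₀ hm4.ne' h
    exact_mod_cast this
  have h1 := h.hs l hτ
  rw [← hi.hasSum_iff] at h1
  · refine hs_congr (h1.mul_left (ee τ ^ m * ee (-(aE m l * τ)))) (fun n => ?_) (by ring)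
    simp only [Function.comp, PowerSeries.coeff_mk]
    rw [mul_left_comm, ← ee_npow m, ← ee_add, ← ee_add]
    congr 2
    rw [aE, oV]; push_cast; field_simp; ring
  · intro D hD
    by_contra hne
    have hne := left_ne_zero_of_mul hne
    obtain ⟨k, hk⟩ := h.sup D l hne
    apply hD
    have h0 : 0 ≤ D := by
      by_contra h0; exact hne (h.pos D l (by omega))
    have h2 := sq_bd hl
    have hk' : D = oV m l + 4 * m * (k + m) := by unfold oV; linarith
    have hn0 : 0 ≤ k + m := by
      by_contra h3; push Not at h3; nlinarith
    refine ⟨(k + m).toNat, ?_⟩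
    beta_reduce
    rw [Int.toNat_of_nonneg hn0]; omega

lemma VV_arr {m : ℕ} (hm : 0 < m) {a : ℤ → ℤ → ℂ} (h : VV m a) (D l : ℤ) :
    a D l = arr m (oV m) (fun r => PowerSeries.mk fun n => a (oV m r + 4 * m * n) r) D l := by
  rw [← fl_eq hm (G := a D) (h.per D) (h.ev D) l]
  unfold arr
  split_ifs with h1
  · obtain ⟨⟨k, hk⟩, h2⟩ := h1
    have hm4 : (0 : ℤ) < 4 * m := by positivity
    have hn0 : 0 ≤ k := by
      by_contra h3; push Not at h3; nlinarith
    rw [PowerSeries.coeff_mk, hk, Int.mul_ediv_cancel_left _ hm4.ne', Int.toNat_of_nonneg hn0]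
    congr 1; linarith
  · by_contra hne
    apply h1
    have h2 := h.sup _ _ hne
    have h0 : 0 ≤ D := by
      by_contra h0; exact hne (h.pos D _ (by omega))
    refine ⟨?_, (sq_bd (fl_spec hm l).1).trans h0⟩
    have : D - oV m (fl m l) = (D - (fl m l : ℤ) ^ 2) + 4 * m * m := by unfold oV; ring
    rw [this]
    exact dvd_add h2 ⟨m, by ring⟩

lemma VV_w {m : ℕ} (hm : 0 < m) {a : ℤ → ℤ → ℂ} (h : VV m a) :
    ∃ w : Fin (m + 1) → ℂ → ℂ, (∀ j : Fin (m + 1), MF (12 * m - 2 * (j : ℕ)) (fun τ => fDl τ ^ m * w j τ)) ∧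
      ∀ l : Fin (m + 1), ∀ τ, 0 < τ.im → ee (-(aE m l * τ)) * hv m a (l : ℕ) τ = ∑ j, Gth m τ l j * w j τ := by
  obtain ⟨Pm, Q, -, hQ, -⟩ := Ginv_rep m hm
  set v : ℂ → Fin (m + 1) → ℂ := fun τ l => ee (-(aE m l * τ)) * hv m a (l : ℕ) τ with hvd
  set w : ℂ → Fin (m + 1) → ℂ := fun τ => (Gth m τ)⁻¹.mulVec (v τ) with hw
  have hG : ∀ τ, 0 < τ.im → (Gth m τ).mulVec (w τ) = v τ := fun τ hτ => by
    rw [hw]; simp only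
    rw [Matrix.mulVec_mulVec, Matrix.mul_nonsing_inv _ (Ne.isUnit (Gth_det_ne m hm hτ)), Matrix.one_mulVec]
  have hM : ∀ τ, 0 < τ.im → (Mth m τ).mulVec (w τ) = fun l : Fin (m + 1) => hv m a (l : ℕ) τ := fun τ hτ => by
    rw [Mth_G, ← Matrix.mulVec_mulVec, hG τ hτ]
    ext l
    rw [Matrix.mulVec_diagonal, hvd]; simp only
    rw [← mul_assoc, ← ee_add, add_neg_cancel, ee_zero, one_mul]
  refine ⟨fun j τ => w τ j, fun j => ⟨?_, fun τ hτ => ?_⟩, fun l τ hτ => (congrFun (hG τ hτ) l).symm⟩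
  · have h1 : IsQRep (fun τ => fU τ ^ m * ∑ l : Fin (m + 1), (Gth m τ)⁻¹ j l * (ee τ ^ m * v τ l)) :=
      ((fU_QI m).isQ.pow m).mul (IsQRep.sum _ fun l _ => by
        have hq : IsQRep (fun τ => (Gth m τ)⁻¹ j l) := ⟨_, hQ j l⟩
        exact hq.mul ⟨_, VV_K hm h l (Nat.lt_succ_iff.1 l.2)⟩)
    refine h1.congr fun τ hτ => ?_
    have : w τ j = ∑ l : Fin (m + 1), (Gth m τ)⁻¹ j l * v τ l := rfl
    beta_reduce
    rw [this, fDl_fU, mul_pow, mul_assoc, mul_left_comm, mul_sum]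
    congr 1
    exact sum_congr rfl fun l _ => by ring
  · beta_reduce
    have h0 := ne_of_im hτ
    have hr := rtS_ne (m := m) hm hτ
    have e1 := hM _ (im_neg_inv hτ)
    have e2 : (Mth m (-1 / τ)).mulVec (Matrix.mulVec (Matrix.diagonal (fun j : Fin (m + 1) => (τ ^ (2 * (j : ℕ)))⁻¹)) (w τ)) =
        fun l : Fin (m + 1) => hv m a (l : ℕ) (-1 / τ) := by
      rw [Mth_S m hm hτ, Matrix.mulVec_mulVec, Matrix.mul_assoc, Matrix.diagonal_mul_diagonal]
      have : (fun i : Fin (m + 1) => rtS m τ * τ ^ (2 * (i : ℕ)) * (τ ^ (2 * (i : ℕ)))⁻¹) = fun _ => rtS m τ := by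
        ext i; field_simp
      rw [this]
      have e3 : Matrix.diagonal (fun _ : Fin (m + 1) => rtS m τ) = rtS m τ • (1 : Matrix (Fin (m + 1)) (Fin (m + 1)) ℂ) :=
        (Matrix.smul_one_eq_diagonal _).symm
      rw [e3, Matrix.mul_smul, Matrix.mul_one, Matrix.smul_mulVec, ← Matrix.mulVec_mulVec, hM τ hτ]
      ext l
      rw [Pi.smul_apply, smul_eq_mul, h.S _ τ hτ, dft_fold m hm (fun l' => hv m a l' τ) (fun l' => hv_per h _ _) (fun l' => hv_ev h _ _)]
      congr 1
      rw [Matrix.mulVec, dotProduct]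
      refine sum_congr rfl fun l' _ => ?_
      simp only [Bm, Matrix.of_apply]
      push_cast; ring
    have e4 := Matrix.eq_zero_of_mulVec_eq_zero (Mth_det_ne m hm (im_neg_inv hτ)) (by rw [Matrix.mulVec_sub, e1, e2, sub_self] :
      (Mth m (-1 / τ)).mulVec (w (-1 / τ) - Matrix.mulVec (Matrix.diagonal (fun j : Fin (m + 1) => (τ ^ (2 * (j : ℕ)))⁻¹)) (w τ)) = 0)
    have e5 := congrFun (sub_eq_zero.1 e4) j
    rw [Matrix.mulVec_diagonal] at e5
    rw [e5, fDl_S τ hτ, zpow_sub₀ h0, zpow_mul, show (2 * ((j : ℕ) : ℤ)) = ((2 * j : ℕ) : ℤ) by push_cast; rfl, zpow_natCast, zpow_natCast, mul_pow]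
    field_simp

lemma VV_span (m : ℕ) (hm : 0 < m) : ∃ (κ : Type) (_ : Fintype κ) (b : κ → ℤ → ℤ → ℂ),
    (∀ i D l, b i D l ∈ IntC (dN m)) ∧ ∀ a, VV m a → ∃ c : κ → ℂ, ∀ D l, a D l = ∑ i, c i * b i D l := by
  obtain ⟨Pm, -, hPm, -⟩ := Ginv_rep m hm
  have h1 : ∀ j : Fin (m + 1), ∃ (n : ℕ) (b : Fin n → ℂ → ℂ), (∀ i, QI (dN m) (b i)) ∧
      ∀ f, MF (12 * m - 2 * (j : ℕ)) f → ∃ c : Fin n → ℂ, ∀ τ : ℂ, 0 < τ.im → f τ = ∑ i, c i * b i τ := fun j => by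
    obtain ⟨n, b, h1, -, h3⟩ := MF_span m (m + 1) (12 * m - 2 * (j : ℕ)) (by push_cast; omega)
    exact ⟨n, b, h1, h3⟩
  choose n b hb hsp using h1
  have h2 : ∀ (l : Fin (m + 1)) (i : (j : Fin (m + 1)) × Fin (n j)),
      QI (dN m) (fun τ => Gth m τ l i.1 * ((fU τ)⁻¹ ^ m * b i.1 i.2 τ)) := fun l i =>
    QI.mul ⟨_, hPm l i.1⟩ (((fUinv_QI m).pow m).mul (hb i.1 i.2))
  choose B hB hBI using h2
  refine ⟨_, inferInstance, fun i => arr m (oV m) (fun r => B (Fin.ofNat (m + 1) r) i), fun i D l => ?_, fun a ha => ?_⟩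
  · unfold arr
    beta_reduce
    split_ifs
    · exact mem_RPS.1 (hBI _ _) _
    · exact zero_mem _
  · obtain ⟨w, hw1, hw2⟩ := VV_w hm ha
    choose c hc using fun j => hsp j _ (hw1 j)
    refine ⟨fun i => c i.1 i.2, fun D l => ?_⟩
    rw [VV_arr hm ha]
    have e : ∀ r : ℕ, r ≤ m → (PowerSeries.mk fun n => a (oV m r + 4 * m * n) r) = ∑ i : (j : Fin (m + 1)) × Fin (n j), c i.1 i.2 • B (Fin.ofNat (m + 1) r) i := by
      intro r hr
      refine ((VV_K hm ha r hr).congr (fun τ hτ => ?_)).unique (QRep.sum Finset.univ fun i _ => (hB (Fin.ofNat (m + 1) r) i).smul (c i.1 i.2))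
      have e0 := hw2 (Fin.ofNat (m + 1) r) τ hτ
      rw [Fin.val_ofNat, Nat.mod_eq_of_lt (Nat.lt_succ_iff.2 hr)] at e0
      rw [e0, Fintype.sum_sigma, mul_sum]
      apply sum_congr rfl
      intro j _
      have e1 := hc j τ hτ
      rw [fDl_fU, mul_pow] at e1
      have hU := fU_ne hτ
      calc _ = Gth m τ (Fin.ofNat (m + 1) r) j * (fU τ)⁻¹ ^ m * ∑ i, c j i * b j i τ := by
            rw [mul_sum]; exact sum_congr rfl fun i _ => by ring
        _ = _ := by rw [← e1]; simp only [inv_pow]; field_simp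
    unfold arr
    beta_reduce
    rw [e _ (fl_spec hm l).1]
    split_ifs
    · simp only [map_sum, map_smul, smul_eq_mul]
    · simp

lemma dft_inv {N : ℕ} (hN : 0 < N) {x : ℤ → ℂ} (hx : ∀ l, x (l + N) = x l) (l0 : ℤ) :
    ∑ k ∈ range N, ee ((l0 : ℂ) * k / N) * ∑ l ∈ range N, ee (-(l : ℂ) * k / N) * x l = N * x l0 := by
  have h1 := sum_class N 1 hN one_pos x (fun y => by simpa using hx y) l0
  simp only [mul_one, Finset.range_one, Finset.sum_singleton, Nat.cast_zero, mul_zero, sub_zero] at h1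
  rw [← h1, mul_sum]
  simp only [mul_sum]
  rw [sum_comm]
  refine sum_congr rfl fun l _ => ?_
  have h2 := ee_sum_range N hN (l0 - l)
  calc _ = (∑ k ∈ range N, ee (((l0 - l : ℤ) : ℂ) * k / N)) * x l := by
        rw [sum_mul]
        refine sum_congr rfl fun k _ => ?_
        rw [← mul_assoc, ← ee_add]; congr 2; push_cast; ring
    _ = _ := by rw [h2]; split_ifs <;> simp

lemma rtS_conj {m : ℕ} (hm : 0 < m) (τ : ℂ) : rtS m τ * starRingEnd ℂ (rtS m τ) * (2 * m) = ‖τ‖ := by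
  have hm' : (0 : ℝ) < m := by exact_mod_cast hm
  have h : ‖rtS m τ‖ ^ 2 = ‖τ‖ / (2 * m) := by rw [← norm_pow, rtS_sq]; simp
  rw [Complex.mul_conj, Complex.normSq_eq_norm_sq, h]
  have : (m : ℂ) ≠ 0 := by exact_mod_cast hm.ne'
  push_cast; field_simp

def Psi (m : ℕ) (a : ℤ → ℤ → ℂ) (τ z : ℂ) : ℂ :=
  ∑ l ∈ range (2 * m), starRingEnd ℂ (hv m a l τ) * jTheta m l τ z

lemma Psi_S0 (m : ℕ) (hm : 0 < m) (a : ℤ → ℤ → ℂ) {τ : ℂ} (hτ : 0 < τ.im) (z : ℂ) : Psi m a (-1 / τ) (z / τ) =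
    rtS m τ * ee (m * z ^ 2 / τ) * ∑ k ∈ range (2 * m), (∑ l ∈ range (2 * m),
      ee (-(l : ℂ) * k / (2 * m : ℕ)) * starRingEnd ℂ (hv m a l (-1 / τ))) * jTheta m k τ z := by
  rw [Psi, sum_congr rfl fun l _ => by rw [jTheta_S m hm l hτ z]]
  simp only [mul_sum, sum_mul]
  rw [sum_comm]
  refine sum_congr rfl fun k _ => sum_congr rfl fun l _ => ?_
  push_cast; ring

lemma hv_T {m : ℕ} (hm : 0 < m) {a} (sup : ∀ D l, a D l ≠ 0 → (4 * m : ℤ) ∣ D - l ^ 2) (l : ℤ) (τ : ℂ) :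
    hv m a l (τ + 1) = ee ((l : ℂ) ^ 2 / (4 * m)) * hv m a l τ := by
  have hm' : (m : ℂ) ≠ 0 := by exact_mod_cast hm.ne'
  rw [hv, hv, ← tsum_mul_left]
  refine tsum_congr fun D => ?_
  by_cases h : a D l = 0
  · simp [h]
  obtain ⟨c, hc⟩ := sup D l h
  have hc' : (D : ℂ) = l ^ 2 + 4 * m * c := by rw [← sub_eq_iff_eq_add']; exact_mod_cast hc
  rw [mul_left_comm, ← ee_add]
  congr 1
  refine ee_eq_of_sub c ?_
  rw [hc']; field_simp; ring

lemma Psi_T {m : ℕ} (hm : 0 < m) {a} (sup : ∀ D l, a D l ≠ 0 → (4 * m : ℤ) ∣ D - l ^ 2) (τ z : ℂ) :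
    Psi m a (τ + 1) z = Psi m a τ z := by
  refine sum_congr rfl fun l _ => ?_
  rw [hv_T hm sup, jTheta_T m hm, map_mul, conj_ee, mul_mul_mul_comm, ← ee_add]
  rw [show -(starRingEnd ℂ ((((l : ℕ) : ℤ) : ℂ) ^ 2 / (4 * m))) + (((l : ℕ) : ℤ) : ℂ) ^ 2 / (4 * m) = 0 by simp [map_ofNat], ee_zero, one_mul]

lemma VV_JLaw {m : ℕ} (hm : 0 < m) {a} (h : VV m a) : JLaw (fun x => (‖x‖ : ℂ)) m (Psi m a) := by
  refine JLaw_gen (by intros; simp) (by simp) (fun τ _ z => Psi_T hm h.sup τ z) fun τ hτ z => ?_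
  rw [Psi_S0 m hm a hτ, Psi, ← rtS_conj hm]
  have hm' : (m : ℂ) ≠ 0 := by exact_mod_cast hm.ne'
  have e : ∀ k ∈ range (2 * m), (∑ l ∈ range (2 * m),
      ee (-(l : ℂ) * k / (2 * m : ℕ)) * starRingEnd ℂ (hv m a l (-1 / τ))) * jTheta m k τ z =
      starRingEnd ℂ (rtS m τ) * (2 * m) * (starRingEnd ℂ (hv m a k τ) * jTheta m k τ z) := by
    intro k _
    have h2 := congrArg (starRingEnd ℂ) (dft_inv (N := 2 * m) (by positivity) (x := fun l => hv m a l τ)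
      (fun l => by exact_mod_cast hv_per h l τ) k)
    have h1 : ∑ l ∈ range (2 * m), ee (-(l : ℂ) * k / (2 * m : ℕ)) * starRingEnd ℂ (hv m a l (-1 / τ)) =
      starRingEnd ℂ (rtS m τ) * starRingEnd ℂ (((2 * m : ℕ) : ℂ) * hv m a k τ) := by
      rw [← h2, map_sum, mul_sum]
      refine sum_congr rfl fun l _ => ?_
      rw [h.S l τ hτ, map_mul, map_mul, mul_left_comm]
      congr 2
      · rw [conj_ee]; congr 1; simp [map_ofNat]; ring
      · congr 1
        refine sum_congr rfl fun l' _ => ?_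
        congr 2; push_cast; ring
    rw [h1]; simp [map_ofNat]; ring
  rw [sum_congr rfl e, ← mul_sum]
  ring

lemma theta_indep {M : ℕ} (hM : 0 < M) {τ : ℂ} (hτ : 0 < τ.im) (x : ℤ → ℂ)
    (h : ∀ z, ∑ l ∈ range (2 * M), x l * jTheta M l τ z = 0) : ∀ l ∈ range (2 * M), x l = 0 := by
  intro l hl
  have hM' : (M : ℂ) ≠ 0 := by exact_mod_cast hM.ne'
  have hN : 0 < 2 * M := by positivity
  have hs : ∀ z, HasSum (fun r : ℤ => x (r % (2 * M : ℕ)) * ee ((r : ℂ) ^ 2 / (4 * M) * τ + l * z) * ee ((r - l : ℤ) * z)) 0 := by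
    intro z
    rw [← h z]
    refine hasSum_int_split hN _ (fun l => x l * jTheta M l τ z) fun k hk => ?_
    refine hs_congr ((jTheta_hasSum M hM k hτ z).mul_left _) (fun n => ?_) rfl
    have : (((k : ℕ) : ℤ) + (2 * M : ℕ) * n) % (2 * M : ℕ) = k := by
      rw [Int.add_mul_emod_self_left]; exact_mod_cast Nat.mod_eq_of_lt (mem_range.1 hk)
    rw [this, mul_assoc, ← ee_add]; congr 2; push_cast; ring
  have h2 := int_coeff (fun _ => 0) 0 (fun r : ℤ => x (r % (2 * M : ℕ)) * ee ((r : ℂ) ^ 2 / (4 * M) * τ)) (fun r => r - l) (fun y => by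
    refine hs_congr ((hs y).mul_left (ee (-(l * y)))) (fun r => ?_) (by simp)
    rw [zero_add, ee_add, ee_neg]; field_simp [ee_ne])
  have h3 := (hasSum_ite_eq (l : ℤ) (x (l % (2 * M : ℕ)) * ee ((l : ℂ) ^ 2 / (4 * M) * τ))).unique
    (hs_congr h2 (fun r => by beta_reduce; simp only [sub_eq_zero]; split_ifs with h <;> simp [h]) rfl)
  rw [intervalIntegral.integral_zero] at h3
  rw [show ((l : ℕ) : ℤ) % (2 * M : ℕ) = l by exact_mod_cast Nat.mod_eq_of_lt (mem_range.1 hl)] at h3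
  exact (mul_eq_zero.1 h3).resolve_right (ee_ne _)

lemma VV_of_Psi {m : ℕ} (hm : 0 < m) {a} (per : ∀ D l, a D (l + 2 * m) = a D l) (ev : ∀ D l, a D (-l) = a D l)
    (sup : ∀ D l, a D l ≠ 0 → (4 * m : ℤ) ∣ D - l ^ 2) (pos : ∀ D l, D < 0 → a D l = 0)
    (sm : ∀ l τ, 0 < τ.im → Summable (fun D : ℤ => a D l * ee ((D : ℂ) / (4 * m) * τ)))
    (S : ∀ τ : ℂ, 0 < τ.im → ∀ z, Psi m a (-1 / τ) (z / τ) = ‖τ‖ * ee (m * z ^ 2 / τ) * Psi m a τ z) : VV m a := by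
  refine ⟨per, ev, sup, pos, sm, fun l τ hτ => ?_⟩
  have hm' : (m : ℂ) ≠ 0 := by exact_mod_cast hm.ne'
  have hr := rtS_ne hm hτ
  have h1 := theta_indep hm hτ (fun k => rtS m τ * (∑ l ∈ range (2 * m),
      ee (-(l : ℂ) * k / (2 * m : ℕ)) * starRingEnd ℂ (hv m a l (-1 / τ))) - ‖τ‖ * starRingEnd ℂ (hv m a k τ)) (fun z => by
    have h2 := S τ hτ z
    rw [Psi_S0 m hm a hτ, mul_comm (rtS m τ), mul_assoc, mul_comm (‖τ‖ : ℂ), mul_assoc] at h2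
    have h3 := mul_left_cancel₀ (ee_ne _) h2
    rw [← sub_eq_zero, Psi, mul_sum, mul_sum, ← Finset.sum_sub_distrib] at h3
    rw [← h3]
    refine sum_congr rfl fun k _ => ?_
    push_cast; ring)
  have h2 := dft_inv (N := 2 * m) (by positivity) (x := fun l => starRingEnd ℂ (hv m a l (-1 / τ)))
    (fun l => by simp only [hv]; push_cast; simp only [per]) l
  have h3 : ∀ k ∈ range (2 * m), ∑ l ∈ range (2 * m),
      ee (-(l : ℂ) * k / (2 * m : ℕ)) * starRingEnd ℂ (hv m a l (-1 / τ)) = 2 * m * starRingEnd ℂ (rtS m τ * hv m a k τ) := by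
    intro k hk
    have := h1 k hk
    rw [← rtS_conj hm] at this
    apply mul_left_cancel₀ hr
    rw [map_mul]; push_cast at this ⊢; linear_combination this
  rw [sum_congr rfl fun k hk => by rw [h3 k hk]] at h2
  have h4 := congrArg (starRingEnd ℂ) h2
  rw [map_mul, starRingEnd_self_apply, map_natCast] at h4
  apply mul_left_cancel₀ (show ((2 * m : ℕ) : ℂ) ≠ 0 by push_cast; simpa using hm')
  rw [← h4, map_sum, mul_sum, mul_sum]
  refine sum_congr rfl fun k _ => ?_
  rw [map_mul, map_mul, starRingEnd_self_apply, conj_ee]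
  simp [map_ofNat]
  rw [show -((l : ℂ) * k) / (2 * m) = -(l * k / (2 * m)) by ring]
  ring

lemma sum_range_prod (n k : ℕ) (F : ℕ → ℂ) :
    ∑ r ∈ range (n * k), F r = ∑ l ∈ range n, ∑ j ∈ range k, F (l + n * j) := by
  rw [mul_comm n k, Finset.sum_range, ← finProdFinEquiv.sum_comp, Fintype.sum_prod_type_right, Finset.sum_range]
  refine sum_congr rfl fun l _ => ?_
  rw [Finset.sum_range]
  rfl

def vp (m p : ℕ) (a : ℤ → ℤ → ℂ) (D r : ℤ) : ℂ :=
  (if (4 * m * p : ℤ) ∣ D - r ^ 2 then a D r else 0) + if (p : ℤ) ∣ r ∧ (p : ℤ) ^ 2 ∣ D then a (D / p ^ 2) (r / p) else 0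

def w1 (m p : ℕ) (a : ℤ → ℤ → ℂ) (r : ℤ) (τ : ℂ) : ℂ :=
  (p : ℂ)⁻¹ * ∑ b ∈ range p, ee (-((r : ℂ) ^ 2 * b / (4 * m * p))) * hv m a r ((τ + b) / p)

lemma im_b {p : ℕ} (hp : 0 < p) {τ : ℂ} (hτ : 0 < τ.im) (b : ℕ) : 0 < ((τ + b) / p).im := by
  have h : ((τ + b) / p).im = τ.im / p := by
    rw [← Complex.ofReal_natCast p, Complex.div_ofReal_im]; simp
  rw [h]; positivity

lemma im_p {p : ℕ} (hp : 0 < p) {τ : ℂ} (hτ : 0 < τ.im) : 0 < ((p : ℂ) * τ).im := by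
  simp; positivity

lemma vp_hs {m p : ℕ} (hm : 0 < m) (hp : 0 < p) {a} (h : VV m a) (r : ℤ) {τ : ℂ} (hτ : 0 < τ.im) :
    HasSum (fun D : ℤ => vp m p a D r * ee ((D : ℂ) / (4 * (m * p : ℕ)) * τ))
      (w1 m p a r τ + if (p : ℤ) ∣ r then hv m a (r / p) (p * τ) else 0) := by
  have hm' : (m : ℂ) ≠ 0 := by exact_mod_cast hm.ne'
  have hp' : (p : ℂ) ≠ 0 := by exact_mod_cast hp.ne'
  have hpz : (p : ℤ) ≠ 0 := by exact_mod_cast hp.ne'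
  have h1 : HasSum (fun D : ℤ => (if (4 * m * p : ℤ) ∣ D - r ^ 2 then a D r else 0) * ee ((D : ℂ) / (4 * (m * p : ℕ)) * τ)) (w1 m p a r τ) := by
    have h2 := (hasSum_sum fun b (_ : b ∈ range p) => ((h.hs r (im_b hp hτ b)).mul_left (ee (-((r : ℂ) ^ 2 * b / (4 * m * p)))))).mul_left (p : ℂ)⁻¹
    refine hs_congr h2 (fun D => ?_) rfl
    by_cases ha : a D r = 0
    · simp [ha]
    obtain ⟨c, hc⟩ := h.sup D r ha
    have hc' : (D : ℂ) = r ^ 2 + 4 * m * c := by rw [← sub_eq_iff_eq_add']; exact_mod_cast hc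
    have h3 := ee_sum_range p hp c
    have e : ∀ b ∈ range p, ee (-((r : ℂ) ^ 2 * b / (4 * m * p))) * (a D r * ee ((D : ℂ) / (4 * m) * ((τ + b) / p))) =
        a D r * ee ((D : ℂ) / (4 * (m * p : ℕ)) * τ) * ee (c * b / p) := by
      intro b _
      rw [mul_left_comm, ← ee_add, mul_assoc (a D r), ← ee_add, hc']; congr 2; push_cast; field_simp; ring
    rw [sum_congr rfl e, ← mul_sum, h3, hc]
    simp only [mul_dvd_mul_iff_left (show (4 * m : ℤ) ≠ 0 by positivity)]
    split_ifs
    · field_simp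
    · simp
  have h4 : HasSum (fun D : ℤ => (if (p : ℤ) ∣ r ∧ (p : ℤ) ^ 2 ∣ D then a (D / p ^ 2) (r / p) else 0) * ee ((D : ℂ) / (4 * (m * p : ℕ)) * τ))
      (if (p : ℤ) ∣ r then hv m a (r / p) (p * τ) else 0) := by
    by_cases hr : (p : ℤ) ∣ r
    · have hi : Function.Injective (fun D : ℤ => (p : ℤ) ^ 2 * D) := fun x y hxy => mul_left_cancel₀ (pow_ne_zero 2 hpz) hxy
      rw [if_pos hr, ← hi.hasSum_iff (fun D hD => by
        rw [if_neg, zero_mul]; rintro ⟨-, c, hc⟩; exact hD ⟨c, hc.symm⟩)]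
      refine hs_congr (h.hs (r / p) (im_p hp hτ)) (fun D => ?_) rfl
      simp only [Function.comp_apply, hr, dvd_mul_right, and_self, if_true, Int.mul_ediv_cancel_left _ (pow_ne_zero 2 hpz)]
      congr 2; push_cast; field_simp
    · simp only [hr, false_and, if_false, zero_mul]; exact hasSum_zero
  exact hs_congr (h1.add h4) (fun D => by rw [vp]; ring) rfl

lemma Psi_b {m p : ℕ} (hm : 0 < m) (hp : 0 < p) {a} (h : VV m a) (b : ℕ) {τ : ℂ} (hτ : 0 < τ.im) (z : ℂ) :
    Psi m a ((τ + b) / p) z = ∑ r ∈ range (2 * (m * p)), starRingEnd ℂ (ee (-((r : ℂ) ^ 2 * b / (4 * m * p))) *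
      hv m a r ((τ + b) / p)) * jTheta (m * p) r τ z := by
  have hm' : (m : ℂ) ≠ 0 := by exact_mod_cast hm.ne'
  have hp' : (p : ℂ) ≠ 0 := by exact_mod_cast hp.ne'
  rw [Psi, ← mul_assoc 2 m p, sum_range_prod (2 * m) p]
  refine sum_congr rfl fun l _ => ?_
  have h1 : HasSum (fun n : ℤ => ee (((l : ℤ) + 2 * (m : ℂ) * n) ^ 2 / (4 * m) * ((τ + b) / p) + ((l : ℤ) + 2 * (m : ℂ) * n) * z))
      (∑ j ∈ range p, ee ((l + 2 * m * j : ℂ) ^ 2 * b / (4 * m * p)) * jTheta (m * p) ((l + 2 * m * j : ℕ) : ℤ) τ z) := by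
    refine hasSum_int_split hp _ _ fun j _ => ?_
    refine hs_congr ((jTheta_hasSum (m * p) (by positivity) ((l + 2 * m * j : ℕ) : ℤ) hτ z).mul_left _) (fun n => ?_) rfl
    rw [← ee_add]
    refine ee_eq_of_sub (b * ((l + 2 * m * j) * n + m * p * n ^ 2)) ?_
    push_cast; field_simp; ring
  rw [(jTheta_hasSum m hm l (im_b hp hτ b) z).unique h1, mul_sum]
  refine sum_congr rfl fun j _ => ?_
  have h2 : hv m a ((l + 2 * m * j : ℕ) : ℤ) ((τ + b) / p) = hv m a l ((τ + b) / p) := by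
    have := per_dvd (G := fun l => hv m a l ((τ + b) / p)) (N := 2 * m) (fun l => hv_per h l _) (x := l + 2 * m * j) (y := l) ⟨j, by ring⟩
    exact_mod_cast this
  rw [h2, map_mul, conj_ee]
  simp [map_ofNat]
  ring

lemma Psi_vp {m p : ℕ} (hm : 0 < m) (hp : 0 < p) {a} (h : VV m a) {τ : ℂ} (hτ : 0 < τ.im) (z : ℂ) :
    Psi (m * p) (vp m p a) τ z = Psi m a (p * τ) (p * z) + (p : ℂ)⁻¹ * ∑ b ∈ range p, Psi m a ((τ + b) / p) z := by
  have hm' : (m : ℂ) ≠ 0 := by exact_mod_cast hm.ne'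
  have hp' : (p : ℂ) ≠ 0 := by exact_mod_cast hp.ne'
  have hpz : (p : ℤ) ≠ 0 := by exact_mod_cast hp.ne'
  have e : ∀ r : ℤ, hv (m * p) (vp m p a) r τ = _ := fun r => (vp_hs hm hp h r hτ).tsum_eq
  rw [Psi]
  simp only [e, map_add, add_mul, Finset.sum_add_distrib]
  rw [add_comm]
  congr 1
  · rw [Psi, show 2 * (m * p) = p * (2 * m) by ring, sum_range_prod, Finset.sum_eq_single 0]
    · refine sum_congr rfl fun j _ => ?_
      rw [zero_add, if_pos ⟨j, by push_cast; ring⟩]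
      push_cast
      rw [Int.mul_ediv_cancel_left _ hpz]
      congr 1
      refine (hs_congr (jTheta_hasSum m hm j (im_p hp hτ) (p * z)) (fun n => ?_) rfl).unique (jTheta_hasSum (m * p) (by positivity) (p * j) hτ z) |>.symm
      congr 1; push_cast; field_simp
    · intro i hi hi0
      refine Finset.sum_eq_zero fun j _ => ?_
      rw [if_neg, map_zero, zero_mul]
      rintro ⟨c, hc⟩
      push_cast at hc
      have : (p : ℤ) ∣ i := ⟨c - j, by linear_combination hc⟩
      exact hi0 (Nat.eq_zero_of_dvd_of_lt (by exact_mod_cast this) (mem_range.1 hi))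
    · intro h; exact absurd (mem_range.2 hp) h
  · rw [sum_congr rfl fun b _ => Psi_b hm hp h b hτ z, sum_comm, mul_sum]
    refine sum_congr rfl fun r _ => ?_
    simp only [w1, map_mul, map_inv₀, map_natCast, map_sum, sum_mul, mul_sum, mul_assoc, Int.cast_natCast]

lemma VV_Vp {m p : ℕ} (hm : 0 < m) (hp : p.Prime) {a} (h : VV m a) : VV (m * p) (vp m p a) := by
  have hp0 := hp.pos
  have hm' : (m : ℂ) ≠ 0 := by exact_mod_cast hm.ne'
  have hp' : (p : ℂ) ≠ 0 := by exact_mod_cast hp0.ne'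
  have hpz : (p : ℤ) ≠ 0 := by exact_mod_cast hp0.ne'
  refine VV_of_Psi (by positivity) (fun D l => ?_) (fun D l => ?_) (fun D l hne => ?_) (fun D l hD => ?_)
    (fun l τ hτ => (vp_hs hm hp0 h l hτ).summable) fun τ hτ z => ?_
  · have e1 : a D (l + 2 * (m * p : ℕ)) = a D l := per_dvd (N := 2 * m) (h.per D) ⟨p, by push_cast; ring⟩
    have e2 : (4 * m * p : ℤ) ∣ D - (l + 2 * (m * p : ℕ)) ^ 2 ↔ (4 * m * p : ℤ) ∣ D - l ^ 2 := by
      rw [show D - (l + 2 * (m * p : ℕ)) ^ 2 = D - l ^ 2 - 4 * m * p * (l + m * p) by push_cast; ring]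
      exact dvd_sub_left ⟨_, rfl⟩
    have e3 : (l + 2 * (m * p : ℕ)) / (p : ℤ) = l / p + 2 * m := by
      rw [show l + 2 * ((m * p : ℕ) : ℤ) = l + 2 * m * p by push_cast; ring, Int.add_mul_ediv_right _ _ hpz]
    have e4 : (p : ℤ) ∣ l + 2 * (m * p : ℕ) ↔ (p : ℤ) ∣ l := dvd_add_left ⟨2 * m, by push_cast; ring⟩
    simp only [vp, e1, e2, e3, e4, h.per]
  · simp only [vp, h.ev, neg_sq, dvd_neg]
    congr 1
    split_ifs with hc
    · rw [Int.neg_ediv_of_dvd hc.1, h.ev]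
    · rfl
  · rw [vp] at hne
    by_contra hc
    have hc' : ¬ (4 * m * p : ℤ) ∣ D - l ^ 2 := by push_cast at hc; rwa [mul_assoc]
    rw [if_neg hc', zero_add] at hne
    split_ifs at hne with h1
    · obtain ⟨⟨x, rfl⟩, y, rfl⟩ := h1
      rw [Int.mul_ediv_cancel_left _ hpz, Int.mul_ediv_cancel_left _ (pow_ne_zero 2 hpz)] at hne
      obtain ⟨c, hc⟩ := h.sup _ _ hne
      exact hc' ⟨p * c, by linear_combination (p : ℤ) ^ 2 * hc⟩
    · exact hne rfl
  · rw [vp, h.pos D _ hD, h.pos _ _ (Int.ediv_neg_of_neg_of_pos hD (by positivity))]; simp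
  · have := Fact.mk hp
    have h0 := ne_of_im hτ
    have J := VV_JLaw hm h
    rw [Psi_vp hm hp0 h (im_neg_inv hτ), Psi_vp hm hp0 h hτ]
    set c : ℂ := ‖τ‖ * ee ((m * p : ℕ) * z ^ 2 / τ) with hc
    have hZ : ∀ f : ℕ → ℂ, ∑ b ∈ range p, f b = ∑ b : ZMod p, f b.val := by
      intro f
      obtain ⟨n, rfl⟩ := Nat.exists_eq_succ_of_ne_zero hp0.ne'
      rw [Finset.sum_range]; rfl
    have j1 : Psi m a (p * (-1 / τ)) (p * (z / τ)) = (p : ℂ)⁻¹ * (c * Psi m a ((τ + ((0 : ZMod p).val : ℕ)) / p) z) := by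
      have := J (τ / p) (by simpa using im_b hp0 hτ 0) z 0 (-1) 1 0 (by norm_num)
      rw [ZMod.val_zero]
      push_cast at this
      rw [show (0 * (τ / p) + -1) / (1 * (τ / p) + 0) = p * (-1 / τ) by simp only [zero_mul, one_mul, add_zero, zero_add]; field_simp, show z / (1 * (τ / p) + 0) = p * (z / τ) by simp only [zero_mul, one_mul, add_zero, zero_add]; field_simp] at this
      rw [this, hc]
      simp only [Nat.cast_zero, add_zero, one_mul, norm_div, Complex.norm_natCast, mul_one]
      rw [show (m : ℂ) * z ^ 2 / (τ / p) = (m * p : ℕ) * z ^ 2 / τ by push_cast; field_simp]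
      push_cast; ring
    have j2 : Psi m a ((-1 / τ + ((0 : ZMod p).val : ℕ)) / p) (z / τ) = p * c * Psi m a (p * τ) (p * z) := by
      have := J (p * τ) (im_p hp0 hτ) (p * z) 0 (-1) 1 0 (by norm_num)
      rw [ZMod.val_zero]
      push_cast at this
      rw [show (0 * (p * τ) + -1) / (1 * (p * τ) + 0) = (-1 / τ) / p by simp only [zero_mul, one_mul, add_zero, zero_add]; field_simp, show p * z / (1 * (p * τ) + 0) = z / τ by simp only [zero_mul, one_mul, add_zero, zero_add]; field_simp] at this
      rw [Nat.cast_zero, add_zero, this, hc]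
      simp only [add_zero, one_mul, norm_mul, Complex.norm_natCast, mul_one]
      rw [show (m : ℂ) * (p * z) ^ 2 / (p * τ) = (m * p : ℕ) * z ^ 2 / τ by push_cast; field_simp]
      push_cast; ring
    have j3 : ∀ b : ZMod p, b ≠ 0 → Psi m a ((-1 / τ + (b.val : ℕ)) / p) (z / τ) = c * Psi m a ((τ + ((-b⁻¹).val : ℕ)) / p) z := by
      intro b hb
      set b' := -b⁻¹ with hb'
      have hd : (p : ℤ) ∣ b.val * b'.val + 1 := by
        rw [← ZMod.intCast_zmod_eq_zero_iff_dvd]; push_cast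
        rw [ZMod.natCast_zmod_val, ZMod.natCast_zmod_val, hb']; field_simp; simp
      obtain ⟨k, hk⟩ := hd
      have hk' : (b.val : ℂ) * b'.val + 1 = p * k := by exact_mod_cast hk
      have := J _ (im_b hp0 hτ b'.val) z b.val (-k) p (-b'.val) (by linear_combination (-1 : ℤ) * hk)
      push_cast at this
      have e0 : (p : ℂ) * ((τ + b'.val) / p) + -b'.val = τ := by field_simp; ring
      rw [e0] at this
      rw [hc]
      push_cast
      rw [← this]
      congr 1
      rw [show (k : ℂ) = (b.val * b'.val + 1) / p by rw [hk']; field_simp]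
      field_simp; ring
    have j4 : ∑ b : ZMod p, Psi m a ((τ + ((-b⁻¹).val : ℕ)) / p) z = ∑ b : ZMod p, Psi m a ((τ + (b.val : ℕ)) / p) z :=
      ((Function.Involutive.toPerm _ (inv_involutive (G := ZMod p))).trans (Equiv.neg _)).sum_comp (fun b : ZMod p => Psi m a ((τ + (b.val : ℕ)) / p) z)
    have j5 : ∑ b : ZMod p, Psi m a ((-1 / τ + (b.val : ℕ)) / p) (z / τ) - p * c * Psi m a (p * τ) (p * z) =
        c * ∑ b : ZMod p, Psi m a ((τ + (b.val : ℕ)) / p) z - c * Psi m a ((τ + ((0 : ZMod p).val : ℕ)) / p) z := by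
      rw [← j4, ← j2, mul_sum, ← Finset.add_sum_erase _ _ (Finset.mem_univ (0 : ZMod p)),
        ← Finset.add_sum_erase _ (fun b : ZMod p => c * _) (Finset.mem_univ (0 : ZMod p)),
        sum_congr rfl fun b hb => j3 b (Finset.ne_of_mem_erase hb)]
      simp only [inv_zero, neg_zero]; ring
    rw [j1, hZ, hZ]
    rw [sub_eq_iff_eq_add] at j5
    rw [j5]
    field_simp; ring

def upo (m p : ℕ) (a : ℤ → ℤ → ℂ) (D l : ℤ) : ℂ := ∑ j ∈ range p, a (D * p ^ 2) (p * (l + 2 * m * j))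

lemma rtS_p {m p : ℕ} (hp : 0 < p) (τ : ℂ) : p * rtS (m * p ^ 2) τ = rtS m τ := by
  have hp' : (p : ℂ) ≠ 0 := by exact_mod_cast hp.ne'
  have e : -I * (τ / (2 * m)) = (((p : ℝ) ^ 2 : ℝ) : ℂ) * (-I * (τ / (2 * (m * p ^ 2 : ℕ)))) := by push_cast; field_simp
  rw [rtS, rtS, e]
  set x := -I * (τ / (2 * (m * p ^ 2 : ℕ)))
  have hpr : (0 : ℝ) < p := by exact_mod_cast hp
  by_cases hx : x = 0
  · simp [hx]
  rw [Complex.cpow_def_of_ne_zero hx, Complex.cpow_def_of_ne_zero (by simp [hx, hp']), Complex.log_ofReal_mul (by positivity) hx,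
    add_mul, Complex.exp_add, Real.log_pow]
  congr 1
  rw [show (((2 : ℕ) * Real.log p : ℝ) : ℂ) * (1 / 2) = ((Real.log p : ℝ) : ℂ) by push_cast; ring, ← Complex.ofReal_exp, Real.exp_log hpr]
  simp

lemma upo_hs {m p : ℕ} (hm : 0 < m) (hp : 0 < p) {a} (h : VV (m * p ^ 2) a) (l : ℤ) {τ : ℂ} (hτ : 0 < τ.im) :
    HasSum (fun D : ℤ => upo m p a D l * ee ((D : ℂ) / (4 * m) * τ)) (∑ j ∈ range p, hv (m * p ^ 2) a (p * (l + 2 * m * j)) τ) := by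
  have hm' : (m : ℂ) ≠ 0 := by exact_mod_cast hm.ne'
  have hp' : (p : ℂ) ≠ 0 := by exact_mod_cast hp.ne'
  have hpz : (p : ℤ) ≠ 0 := by exact_mod_cast hp.ne'
  have hi : Function.Injective (fun D : ℤ => D * (p : ℤ) ^ 2) := fun x y hxy => mul_right_cancel₀ (pow_ne_zero 2 hpz) hxy
  have h1 := hasSum_sum fun j (_ : j ∈ range p) => (hi.hasSum_iff (fun D hD => by
    rw [mul_eq_zero]; left; by_contra hc
    obtain ⟨c, hc⟩ := h.sup _ _ hc
    exact hD ⟨4 * m * c + (l + 2 * m * j) ^ 2, by push_cast at hc; linear_combination (-1 : ℤ) * hc⟩)).2 (h.hs (p * (l + 2 * m * j)) hτ)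
  refine hs_congr h1 (fun D => ?_) rfl
  rw [upo, sum_mul]
  refine sum_congr rfl fun j _ => ?_
  simp only [Function.comp_apply]
  congr 2; push_cast; field_simp

lemma VV_up {m p : ℕ} (hm : 0 < m) (hp : 0 < p) {a} (h : VV (m * p ^ 2) a) : VV m (upo m p a) := by
  have hm' : (m : ℂ) ≠ 0 := by exact_mod_cast hm.ne'
  have hp' : (p : ℂ) ≠ 0 := by exact_mod_cast hp.ne'
  have hpz : (p : ℤ) ≠ 0 := by exact_mod_cast hp.ne'
  have hG : ∀ D l, a D (p * (l + 2 * m * p)) = a D (p * l) := fun D l => per_dvd (h.per D) ⟨1, by push_cast; ring⟩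
  refine ⟨fun D l => ?_, fun D l => ?_, fun D l hne => ?_, fun D l hD => ?_, fun l τ hτ => (upo_hs hm hp h l hτ).summable, fun l τ hτ => ?_⟩
  · have := sum_per_map hp (G := fun j => a (D * p ^ 2) (p * (l + 2 * m * j)))
      (fun y => by rw [mul_add (2 * (m : ℤ)), ← add_assoc, hG]) 1 1 isCoprime_one_left
    rw [upo, upo, ← this]
    refine sum_congr rfl fun j _ => ?_
    congr 1; ring
  · have := sum_per_map hp (G := fun j => a (D * p ^ 2) (p * (l + 2 * m * j)))
      (fun y => by rw [mul_add (2 * (m : ℤ)), ← add_assoc, hG]) (-1) 0 isCoprime_one_left.neg_left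
    rw [upo, upo, ← this]
    refine sum_congr rfl fun j _ => ?_
    rw [← h.ev]; congr 1; ring
  · obtain ⟨j, _, hj⟩ := Finset.exists_ne_zero_of_sum_ne_zero hne
    obtain ⟨c, hc⟩ := h.sup _ _ hj
    refine ⟨c + j * (l + m * j), mul_left_cancel₀ (pow_ne_zero 2 hpz) ?_⟩
    push_cast at hc; linear_combination hc
  · exact Finset.sum_eq_zero fun j _ => h.pos _ _ (mul_neg_of_neg_of_pos hD (by positivity))
  · rw [hv, (upo_hs hm hp h l (im_neg_inv hτ)).tsum_eq, ← rtS_p hp, mul_comm (p : ℂ), mul_assoc]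
    have e0 : ∀ l : ℤ, hv m (upo m p a) l τ = _ := fun l => (upo_hs hm hp h l hτ).tsum_eq
    simp only [e0]
    rw [sum_congr rfl fun j _ => h.S _ τ hτ, ← mul_sum, sum_comm]
    congr 1
    have e1 : ∀ k ∈ range (2 * (m * p ^ 2)), ∑ j ∈ range p, ee (-((p * (l + 2 * m * j) : ℤ) : ℂ) * k / (2 * (m * p ^ 2 : ℕ))) * hv (m * p ^ 2) a k τ =
        if (p : ℤ) ∣ k then p * (ee (-(l : ℂ) * k / (2 * m * p)) * hv (m * p ^ 2) a k τ) else 0 := by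
      intro k _
      have e2 : ∀ j ∈ range p, ee (-((p * (l + 2 * m * j) : ℤ) : ℂ) * k / (2 * (m * p ^ 2 : ℕ))) * hv (m * p ^ 2) a k τ =
        ee ((-k : ℤ) * j / p) * (ee (-(l : ℂ) * k / (2 * m * p)) * hv (m * p ^ 2) a k τ) := by
        intro j _
        rw [← mul_assoc, ← ee_add]; congr 2; push_cast; field_simp; ring
      rw [sum_congr rfl e2, ← sum_mul, ee_sum_range p hp]
      simp only [dvd_neg]
      split_ifs <;> simp
    rw [sum_congr rfl e1, show 2 * (m * p ^ 2) = p * (2 * m * p) by ring, sum_range_prod, Finset.sum_eq_single 0]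
    · rw [sum_range_prod (2 * m) p, mul_sum]
      refine sum_congr rfl fun k _ => ?_
      rw [mul_sum, mul_sum]
      refine sum_congr rfl fun j _ => ?_
      rw [if_pos ⟨k + 2 * m * j, by push_cast; ring⟩]
      congr 2
      · refine ee_eq_of_sub (-(l * j)) ?_
        push_cast; field_simp; ring
      · congr 1; push_cast; ring
    · intro i hi hi0
      refine Finset.sum_eq_zero fun j _ => ?_
      rw [if_neg]
      rintro ⟨c, hc⟩
      push_cast at hc
      have : (p : ℤ) ∣ i := ⟨c - j, by linear_combination hc⟩
      exact hi0 (Nat.eq_zero_of_dvd_of_lt (by exact_mod_cast this) (mem_range.1 hi))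
    · intro h; exact absurd (mem_range.2 hp) h

def tp (m p : ℕ) (a : ℤ → ℤ → ℂ) : ℤ → ℤ → ℂ := upo m p (vp (m * p) p (vp m p a))

lemma VV_tp {m p : ℕ} (hm : 0 < m) (hp : p.Prime) {a} (h : VV m a) : VV m (tp m p a) := by
  have hp0 := hp.pos
  refine VV_up hm hp0 ?_
  rw [pow_two, ← mul_assoc]
  exact VV_Vp (by positivity) hp (VV_Vp hm hp h)

lemma count_sq {p : ℕ} [Fact p.Prime] (hp2 : p ≠ 2) (D l u : ℤ) (hu : IsCoprime u p) :
    ∑ j ∈ range p, (if (p : ℤ) ∣ D - (l + u * j) ^ 2 then (1 : ℂ) else 0) = legendreSym p D + 1 := by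
  have hp0 : 0 < p := (Fact.out : p.Prime).pos
  have h1 := sum_per_map hp0 (G := fun x => if (p : ℤ) ∣ D - x ^ 2 then (1 : ℂ) else 0) (fun y => by
    have : (p : ℤ) ∣ D - (y + p) ^ 2 ↔ (p : ℤ) ∣ D - y ^ 2 := by
      rw [show D - (y + p) ^ 2 = D - y ^ 2 - p * (2 * y + p) by ring]; exact dvd_sub_left ⟨_, rfl⟩
    simp only [this]) u l hu
  have h2 := legendreSym.card_sqrts p hp2 D
  have h3 : (legendreSym p D : ℂ) + 1 = ((legendreSym p D + 1 : ℤ) : ℂ) := by push_cast; ring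
  rw [h3, ← h2]
  calc _ = _ := sum_congr rfl fun j _ => by rw [add_comm l]
    _ = _ := h1
    _ = ∑ x : ZMod p, if x ^ 2 = (D : ZMod p) then (1 : ℂ) else 0 := by
      have hZ : ∀ f : ℕ → ℂ, ∑ b ∈ range p, f b = ∑ b : ZMod p, f b.val := by
        intro f
        obtain ⟨n, rfl⟩ := Nat.exists_eq_succ_of_ne_zero hp0.ne'
        rw [Finset.sum_range]; rfl
      rw [hZ]
      refine sum_congr rfl fun x _ => ?_
      have : (p : ℤ) ∣ D - (x.val : ℤ) ^ 2 ↔ x ^ 2 = (D : ZMod p) := by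
        rw [← ZMod.intCast_zmod_eq_zero_iff_dvd]; push_cast
        rw [ZMod.natCast_zmod_val, sub_eq_zero, eq_comm]
      simp only [this]
    _ = _ := by
      rw [Finset.sum_boole]; push_cast; congr 2; ext x; simp

lemma tp_coeff {m p : ℕ} (hm : 0 < m) [Fact p.Prime] (hp : IsCoprime (4 * m : ℤ) p) {a} (h : VV m a) {D : ℤ} (h1 : 0 < D)
    (h2 : D < p ^ 2) (l : ℤ) : tp m p a D l = p * a (D * p ^ 2) (p * l) + (p + 1 + legendreSym p D) * a D l := by
  have hpp : p.Prime := Fact.out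
  have hpz : (p : ℤ) ≠ 0 := by exact_mod_cast hpp.ne_zero
  have hnd : ¬ (p : ℤ) ^ 2 ∣ D := fun hd => absurd (Int.le_of_dvd h1 hd) (not_le.2 h2)
  have hp2 : p ≠ 2 := by
    rintro rfl
    obtain ⟨u, v, huv⟩ := hp
    have : (2 : ℤ) ∣ 1 := ⟨u * (2 * m) + v, by rw [← huv]; push_cast; ring⟩
    omega
  have hr : ∀ j : ℕ, (4 * m : ℤ) ∣ D - (l + 2 * m * j) ^ 2 ↔ (4 * m : ℤ) ∣ D - l ^ 2 := fun j => by
    rw [show D - (l + 2 * m * j) ^ 2 = D - l ^ 2 - 4 * m * (j * (l + m * j)) by ring]; exact dvd_sub_left ⟨_, rfl⟩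
  have e : ∀ j ∈ range p, vp (m * p) p (vp m p a) (D * p ^ 2) (p * (l + 2 * m * j)) =
      a (D * p ^ 2) (p * l) + a D l + (if (p : ℤ) ∣ D - (l + 2 * m * j) ^ 2 then 1 else 0) * a D l := by
    intro j _
    have a1 : a D (l + 2 * m * j) = a D l := per_dvd (h.per D) ⟨j, by ring⟩
    have a2 : a (D * p ^ 2) (p * (l + 2 * m * j)) = a (D * p ^ 2) (p * l) := per_dvd (h.per _) ⟨p * j, by ring⟩
    have c1 : (4 * (m * p : ℕ) * p : ℤ) ∣ D * p ^ 2 - (p * (l + 2 * m * j)) ^ 2 ↔ (4 * m : ℤ) ∣ D - l ^ 2 := by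
      rw [← hr j, show (4 * (m * p : ℕ) * p : ℤ) = p ^ 2 * (4 * m) by push_cast; ring,
        show D * p ^ 2 - (p * (l + 2 * m * j)) ^ 2 = p ^ 2 * (D - (l + 2 * m * j) ^ 2) by ring, mul_dvd_mul_iff_left (pow_ne_zero 2 hpz)]
    have c2 : (4 * m * p : ℤ) ∣ D - (l + 2 * m * j) ^ 2 ↔ (4 * m : ℤ) ∣ D - l ^ 2 ∧ (p : ℤ) ∣ D - (l + 2 * m * j) ^ 2 := by
      rw [← hr j]
      exact ⟨fun hd => ⟨dvd_trans ⟨_, rfl⟩ hd, dvd_trans ⟨_, mul_comm _ _⟩ hd⟩, fun hd => hp.mul_dvd hd.1 hd.2⟩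
    have b1 : vp m p a D (l + 2 * m * j) = (if (4 * m * p : ℤ) ∣ D - (l + 2 * m * j) ^ 2 then a D l else 0) := by
      simp only [vp, hnd, and_false, if_false, add_zero, a1]
    rw [vp, if_pos (show (p : ℤ) ∣ p * (l + 2 * m * j) ∧ (p : ℤ) ^ 2 ∣ D * p ^ 2 from ⟨⟨_, rfl⟩, ⟨_, mul_comm _ _⟩⟩),
      Int.mul_ediv_cancel _ (pow_ne_zero 2 hpz), Int.mul_ediv_cancel_left _ hpz, b1]
    simp only [c1, c2]
    by_cases hc : (4 * m : ℤ) ∣ D - l ^ 2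
    · rw [if_pos hc, vp, if_pos (show (p : ℤ) ∣ p * (l + 2 * m * j) ∧ (p : ℤ) ^ 2 ∣ D * p ^ 2 from ⟨⟨_, rfl⟩, ⟨_, mul_comm _ _⟩⟩),
        Int.mul_ediv_cancel _ (pow_ne_zero 2 hpz), Int.mul_ediv_cancel_left _ hpz, a1, a2, if_pos]
      · simp only [hc, true_and]; split_ifs <;> simp
      · obtain ⟨c, hc'⟩ := (hr j).2 hc
        exact ⟨p * c, by linear_combination (p : ℤ) ^ 2 * hc'⟩
    · have z1 : a D l = 0 := by by_contra hn; exact hc (h.sup _ _ hn)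
      have z2 : a (D * p ^ 2) (p * l) = 0 := by
        by_contra hn
        have := h.sup _ _ hn
        rw [show D * p ^ 2 - (p * l) ^ 2 = p ^ 2 * (D - l ^ 2) by ring] at this
        exact hc (hp.pow_right.dvd_of_dvd_mul_left this)
      simp [hc, z1, z2]
  have hu : IsCoprime (2 * m : ℤ) p := by
    rw [show (4 * m : ℤ) = 2 * (2 * m) by ring] at hp; exact hp.of_mul_left_right
  rw [tp, upo, sum_congr rfl e, Finset.sum_add_distrib, ← sum_mul, count_sq hp2 D l (2 * m) hu]
  simp; ring

lemma hv_zero (m : ℕ) (l : ℤ) (τ : ℂ) : hv m (fun _ _ => 0) l τ = 0 := by simp [hv]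

lemma hv_add {m : ℕ} {a b : ℤ → ℤ → ℂ} (ha : VV m a) (hb : VV m b) (l : ℤ) {τ : ℂ} (hτ : 0 < τ.im) :
    hv m (fun D l => a D l + b D l) l τ = hv m a l τ + hv m b l τ := by
  unfold hv
  rw [← (ha.sm l τ hτ).tsum_add (hb.sm l τ hτ)]
  exact tsum_congr fun D => by ring

lemma hv_smul {m : ℕ} {a : ℤ → ℤ → ℂ} (c : ℂ) (l : ℤ) (τ : ℂ) :
    hv m (fun D l => c * a D l) l τ = c * hv m a l τ := by
  unfold hv
  rw [← tsum_mul_left]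
  exact tsum_congr fun D => by ring

def Vs (m : ℕ) : Submodule ℂ (ℤ → ℤ → ℂ) where
  carrier := {a | VV m a}
  zero_mem' := by
    refine ⟨by simp, by simp, by simp, by simp, by simp [summable_zero], fun l τ _ => ?_⟩
    rw [show (0 : ℤ → ℤ → ℂ) = fun _ _ => 0 from rfl]
    simp [hv_zero]
  add_mem' := by
    intro a b ha hb
    have h : (a + b) = fun D l => a D l + b D l := rfl
    refine ⟨fun D l => ?_, fun D l => ?_, fun D l hD => ?_, fun D l hD => ?_, fun l τ hτ => ?_, fun l τ hτ => ?_⟩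
    · simp [ha.per, hb.per]
    · simp [ha.ev, hb.ev]
    · by_contra h2
      apply hD
      have h3 : a D l = 0 := by
        by_contra h3
        exact h2 (ha.sup D l h3)
      have h4 : b D l = 0 := by
        by_contra h3
        exact h2 (hb.sup D l h3)
      simp [h3, h4]
    · simp [ha.pos D l hD, hb.pos D l hD]
    · exact ((ha.sm l τ hτ).add (hb.sm l τ hτ)).congr fun D => by simp [add_mul]
    · rw [h, hv_add ha hb l (im_neg_inv hτ), ha.S l τ hτ, hb.S l τ hτ, ← mul_add, ← Finset.sum_add_distrib]
      congr 1
      exact sum_congr rfl fun l' _ => by rw [hv_add ha hb _ hτ]; ring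
  smul_mem' := by
    intro c a ha
    have h : (c • a) = fun D l => c * a D l := rfl
    refine ⟨fun D l => ?_, fun D l => ?_, fun D l hD => ?_, fun D l hD => ?_, fun l τ hτ => ?_, fun l τ hτ => ?_⟩
    · simp [ha.per]
    · simp [ha.ev]
    · exact ha.sup D l fun h3 => hD (by simp [h3])
    · simp [ha.pos D l hD]
    · exact ((ha.sm l τ hτ).mul_left c).congr fun D => by simp [mul_assoc]
    · rw [h, hv_smul, ha.S l τ hτ, mul_left_comm, mul_sum]
      congr 1
      exact sum_congr rfl fun l' _ => by rw [hv_smul]; ring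

lemma mem_Vs {m : ℕ} {a : ℤ → ℤ → ℂ} : a ∈ Vs m ↔ VV m a := Iff.rfl

lemma Vs_fd (m : ℕ) (hm : 0 < m) : FiniteDimensional ℂ (Vs m) := by
  obtain ⟨κ, _, b, _, h⟩ := VV_span m hm
  have : Vs m ≤ Submodule.span ℂ (Set.range b) := by
    intro a ha
    obtain ⟨c, hc⟩ := h a ha
    have : a = ∑ i, c i • b i := by
      funext D l
      rw [hc]; simp [Finset.sum_apply]
    rw [this]
    exact Submodule.sum_mem _ fun i _ => Submodule.smul_mem _ _ (Submodule.subset_span ⟨i, rfl⟩)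
  have := FiniteDimensional.span_of_finite ℂ (Set.finite_range b)
  exact Submodule.finiteDimensional_of_le ‹_›

lemma arith_big {ι : Type} [Fintype ι] {N : ℕ} (hN : 0 < N) (e : ι → ℂ) {x : ℂ} (hx : x ≠ 0) :
    ∃ B : ℕ, ∀ p : ℕ, p.Prime → B < p → ∀ n : ι → ℂ, (∀ i, n i ∈ IntC N) → x ≠ p * ∑ i, n i * e i := by
  obtain ⟨f, hf⟩ : ∃ f : Module.Dual ℚ ℂ, f x ≠ 0 := by
    by_contra h
    push Not at h
    exact hx ((Module.forall_dual_apply_eq_zero_iff ℚ x).1 h)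
  set d := ∏ i, (f (e i)).den with hd
  have hd0 : 0 < d := Finset.prod_pos fun i _ => (f (e i)).pos
  have hnum : (f x).num.natAbs ≠ 0 := by simpa using hf
  refine ⟨N + d + (f x).num.natAbs, fun p hp hB n hn hE => ?_⟩
  choose k z hz using hn
  have h1 : ∀ i, ((N : ℂ) ^ (∑ i, k i)) * n i = ((N ^ (∑ i, k i - k i) * z i : ℤ) : ℂ) := by
    intro i
    have : k i ≤ ∑ i, k i := Finset.single_le_sum (f := k) (fun _ _ => Nat.zero_le _) (Finset.mem_univ i)
    push_cast
    rw [← hz i, ← mul_assoc, ← pow_add, Nat.sub_add_cancel this]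
  have h2 : ∀ i, ∃ w : ℤ, (d : ℚ) * f (e i) = w := by
    intro i
    obtain ⟨c, hc⟩ := Finset.dvd_prod_of_mem (fun i => (f (e i)).den) (Finset.mem_univ i)
    refine ⟨c * (f (e i)).num, ?_⟩
    rw [hd, hc]
    push_cast
    rw [← Rat.mul_den_eq_num]; ring
  choose w hw using h2
  have h3 : ((N : ℚ) ^ (∑ i, k i)) * f x = p * ∑ i, ((N ^ (∑ i, k i - k i) * z i : ℤ) : ℚ) * f (e i) := by
    have : ((N ^ (∑ i, k i) : ℚ)) • x = (p : ℚ) • ∑ i, ((N ^ (∑ i, k i - k i) * z i : ℤ) : ℚ) • e i := by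
      simp only [Rat.smul_def]
      push_cast
      rw [hE, mul_left_comm, mul_sum]
      congr 1
      refine sum_congr rfl fun i _ => ?_
      rw [← mul_assoc, h1]; push_cast; ring
    have := congrArg f this
    simpa only [map_smul, map_sum, smul_eq_mul] using this
  have h4 : ((N ^ (∑ i, k i) * d * (f x).num : ℤ) : ℚ) = ((p * ((∑ i, (N ^ (∑ i, k i - k i) * z i) * w i) * (f x).den) : ℤ) : ℚ) := by
    have : (∑ i, ((N ^ (∑ i, k i - k i) * z i : ℤ) : ℚ) * (w i : ℚ)) = d * ∑ i, ((N ^ (∑ i, k i - k i) * z i : ℤ) : ℚ) * f (e i) := by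
      rw [mul_sum]
      exact sum_congr rfl fun i _ => by rw [← hw]; ring
    push_cast at this h3 ⊢
    rw [this, ← Rat.mul_den_eq_num]
    linear_combination (d * (f x).den : ℚ) * h3
  have h5 : (p : ℤ) ∣ N ^ (∑ i, k i) * d * (f x).num := ⟨_, by exact_mod_cast h4⟩
  have hp' := Nat.prime_iff_prime_int.1 hp
  have key : ∀ y : ℕ, 0 < y → y < p → ¬ p ∣ y := fun y h1 h2 h => absurd (Nat.le_of_dvd h1 h) (by omega)
  rcases hp'.dvd_or_dvd h5 with h | h
  · rcases hp'.dvd_or_dvd h with h | h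
    · exact key N hN (by omega) (Int.natCast_dvd_natCast.1 (hp'.dvd_of_dvd_pow h))
    · exact key d hd0 (by omega) (Int.natCast_dvd_natCast.1 h)
  · exact key (f x).num.natAbs (Nat.pos_of_ne_zero hnum) (by omega) (Int.natCast_dvd.1 h)

def PrS (s : ℤ → ℤ) : Prop := ∀ N B : ℕ, ∃ p : ℕ, ∃ _ : Fact p.Prime, B < p ∧ ∀ D : ℤ, 0 < D → D ≤ N → legendreSym p D = s D

lemma twist_fin {m : ℕ} (hm : 0 < m) {s : ℤ → ℤ} (hs : PrS s) {a : ℤ → ℤ → ℂ} (ha : VV m a) (N : ℕ) :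
    ∃ g, VV m g ∧ ∀ D l : ℤ, 0 < D → D ≤ N → g D l = s D * a D l := by
  let ι := (Finset.Icc (1 : ℤ) N ×ˢ Finset.Ico (0 : ℤ) (2 * m) : Finset (ℤ × ℤ))
  let ρ : (ℤ → ℤ → ℂ) →ₗ[ℂ] (ι → ℂ) :=
    { toFun := fun a i => a i.1.1 i.1.2, map_add' := fun _ _ => rfl, map_smul' := fun _ _ => rfl }
  by_cases hx : ρ (fun D l => s D * a D l) ∈ (Vs m).map ρ
  · obtain ⟨g, hg, h⟩ := hx
    have hg : VV m g := hg
    refine ⟨g, hg, fun D l h1 h2 => ?_⟩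
    have hl : (2 * m : ℤ) ∣ l - l % (2 * m) := Int.dvd_self_sub_emod
    have := congrFun h ⟨(D, l % (2 * m)), Finset.mem_product.2 ⟨Finset.mem_Icc.2 ⟨h1, h2⟩,
      Finset.mem_Ico.2 ⟨Int.emod_nonneg _ (by omega), Int.emod_lt_of_pos _ (by omega)⟩⟩⟩
    change g D (l % (2 * m)) = s D * a D (l % (2 * m)) at this
    have e1 := per_dvd (G := g D) (N := (2 * m : ℤ)) (fun y => hg.per D y) hl
    have e2 := per_dvd (G := a D) (N := (2 * m : ℤ)) (fun y => ha.per D y) hl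
    rw [e1, e2, this]
  exfalso
  obtain ⟨f, hf, hker⟩ := Submodule.exists_le_ker_of_notMem hx
  obtain ⟨κ, _, b, hb, hspan⟩ := VV_span m hm
  obtain ⟨c, hc⟩ := hspan a ha
  obtain ⟨B, hB⟩ := arith_big (N := dN m) (by unfold dN; omega) (fun i : ι × κ => f (Pi.single i.1 1) * c i.2) hf
  obtain ⟨p, hpf, hp, hpD⟩ := hs N (B + N + 4 * m)
  have hpp := hpf.out
  have hcop : IsCoprime (4 * m : ℤ) p := by
    rw [← Nat.cast_ofNat, ← Nat.cast_mul, Nat.isCoprime_iff_coprime, Nat.coprime_comm, hpp.coprime_iff_not_dvd]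
    exact fun h => absurd (Nat.le_of_dvd (by omega) h) (by omega)
  have h0 : f (ρ (tp m p a)) = 0 := hker ⟨_, VV_tp hm hpp ha, rfl⟩
  have h1 : f (ρ a) = 0 := hker ⟨_, ha, rfl⟩
  have h2 : ρ (tp m p a) = (p : ℂ) • ρ (fun D l => a (D * p ^ 2) (p * l)) + (p + 1 : ℂ) • ρ a + ρ (fun D l => s D * a D l) := by
    funext i
    obtain ⟨⟨D, l⟩, hi⟩ := i
    have hi := Finset.mem_Icc.1 (Finset.mem_product.1 hi).1
    dsimp only at hi
    change tp m p a D l = p * a (D * p ^ 2) (p * l) + (p + 1 : ℂ) * a D l + s D * a D l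
    rw [tp_coeff hm hcop ha (by omega) (by have : (N : ℤ) < p := by omega
                                           nlinarith), hpD D (by omega) (by omega)]
    ring
  rw [h2, map_add, map_add, map_smul, map_smul, h1, smul_zero, add_zero] at h0
  refine hB p hpp (by omega) (fun i => -b i.2 (i.1.1.1 * p ^ 2) (p * i.1.1.2)) (fun i => neg_mem (hb _ _ _)) ?_
  rw [eq_neg_of_add_eq_zero_right h0, smul_eq_mul, ← mul_neg]
  congr 1
  rw [LinearMap.pi_apply_eq_sum_univ, Fintype.sum_prod_type, ← Finset.sum_neg_distrib]
  refine sum_congr rfl fun i _ => ?_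
  change -(a _ _ • _) = _
  rw [hc, smul_eq_mul, sum_mul, ← Finset.sum_neg_distrib]
  refine sum_congr rfl fun k _ => ?_
  have : (fun j => if i = j then (1 : ℂ) else 0) = Pi.single i 1 := by
    funext j; simp [Pi.single_apply, eq_comm]
  rw [this]; ring

lemma twist {m : ℕ} (hm : 0 < m) {s : ℤ → ℤ} (hs : PrS s) {a : ℤ → ℤ → ℂ} (ha : VV m a) :
    ∃ g, VV m g ∧ ∀ D l, 0 < D → g D l = s D * a D l := by
  have := Vs_fd m hm
  choose g hg hgs using twist_fin hm hs ha
  let K : ℕ → Submodule ℂ (Vs m) := fun N =>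
    { carrier := {x | ∀ D l : ℤ, 0 < D → D ≤ N → x.1 D l = 0}
      zero_mem' := fun _ _ _ _ => rfl
      add_mem' := fun {x y} hx hy D l h1 h2 => by
        change x.1 D l + y.1 D l = 0
        rw [hx D l h1 h2, hy D l h1 h2, add_zero]
      smul_mem' := fun c x hx D l h1 h2 => by
        change c * x.1 D l = 0
        rw [hx D l h1 h2, mul_zero] }
  obtain ⟨n, hn⟩ := IsArtinian.monotone_stabilizes (R := ℂ) (M := Vs m)
    ⟨fun N => OrderDual.toDual (K N), fun i j hij x hx D l h1 h2 => hx D l h1 (by omega)⟩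
  refine ⟨g n, hg n, fun D l hD => ?_⟩
  have h1 : (⟨g (n + D.toNat), hg _⟩ - ⟨g n, hg n⟩ : Vs m) ∈ K n := by
    intro D l h1 h2
    change g (n + _) D l - g n D l = 0
    rw [hgs _ D l h1 (by push_cast; omega), hgs _ D l h1 h2, sub_self]
  have h2 : K n = K (n + D.toNat) := hn (n + D.toNat) (by omega)
  rw [h2] at h1
  have h3 := h1 D l hD (by push_cast; omega)
  change g (n + _) D l - g n D l = 0 at h3
  rw [← sub_eq_zero.1 h3, hgs _ D l hD (by push_cast; omega)]

lemma leg_mod {p : ℕ} [Fact p.Prime] {a b : ℕ} (h : a ≡ b [MOD p]) : legendreSym p a = legendreSym p b := by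
  rw [legendreSym.mod p a, legendreSym.mod p b]
  congr 1
  exact_mod_cast h

lemma PrS_sq (q : ℕ) [hq : Fact q.Prime] : PrS (fun D => (-1) ^ padicValInt q D) := by
  intro N B
  have hM0 : ordCompl[q] N.factorial ≠ 0 := (Nat.ordCompl_pos q (Nat.factorial_ne_zero N)).ne'
  have hMq : (ordCompl[q] N.factorial).Coprime q := (Nat.coprime_ordCompl hq.out (Nat.factorial_ne_zero N)).symm
  set M := ordCompl[q] N.factorial with hM
  have hMr : ∀ r : ℕ, r.Prime → r ≤ N → r ≠ q → r ∣ M := by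
    intro r hr hN hrq
    have : r ∣ q ^ (N.factorial.factorization q) * M := by
      rw [hM, Nat.ordProj_mul_ordCompl_eq_self]; exact (hr.dvd_factorial).2 hN
    rcases hr.dvd_mul.1 this with h | h
    · exact absurd ((Nat.prime_dvd_prime_iff_eq hr hq.out).1 (hr.dvd_of_dvd_pow h)) hrq
    · exact h
  obtain ⟨p, hpB, hp, h4, h8, hpr, hpq⟩ : ∃ p : ℕ, B < p ∧ p.Prime ∧ p % 4 = 1 ∧ (q ≠ 2 → p % 8 = 1) ∧ (p ≡ 1 [MOD M]) ∧
      (∀ _ : Fact p.Prime, legendreSym p q = -1) := by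
    by_cases h2 : q = 2
    · subst h2
      have hc : Nat.Coprime 8 M := by
        rw [show 8 = 2 ^ 3 by norm_num]; exact Nat.Coprime.pow_left 3 hMq.symm
      obtain ⟨k, hk1, hk2⟩ := Nat.chineseRemainder hc 5 1
      have hkc : k.Coprime (8 * M) := by
        refine Nat.Coprime.mul_right ?_ ?_
        · rw [Nat.Coprime, hk1.gcd_eq]; norm_num
        · rw [Nat.Coprime, hk2.gcd_eq]; norm_num
      obtain ⟨p, hpB, hp, hpk⟩ := Nat.forall_exists_prime_gt_and_modEq B (q := 8 * M) (by omega) hkc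
      have h8 : p % 8 = 5 := (hpk.of_mul_right M).trans hk1
      refine ⟨p, hpB, hp, by omega, by simp, (hpk.of_mul_left 8).trans hk2, fun hf => ?_⟩
      rw [Nat.cast_ofNat, legendreSym.at_two (by omega), ZMod.χ₈_nat_eq_if_mod_eight]
      simp [h8]; omega
    · obtain ⟨u, hu⟩ := FiniteField.exists_nonsquare (F := ZMod q) (by rwa [ZMod.ringChar_zmod_n])
      have hc : Nat.Coprime (8 * M) q := by
        refine Nat.Coprime.mul_left ?_ hMq
        rw [show 8 = 2 ^ 3 by norm_num]
        exact Nat.Coprime.pow_left 3 ((Nat.coprime_primes Nat.prime_two hq.out).2 (Ne.symm h2))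
      obtain ⟨k, hk1, hk2⟩ := Nat.chineseRemainder hc 1 u.val
      have hkc : k.Coprime (8 * M * q) := by
        refine Nat.Coprime.mul_right ?_ ?_
        · rw [Nat.Coprime, hk1.gcd_eq]; norm_num
        · rw [Nat.Coprime, hk2.gcd_eq]
          refine ((hq.out.coprime_iff_not_dvd).2 fun h => hu ?_).symm
          have := Nat.eq_zero_of_dvd_of_lt h u.val_lt
          rw [(ZMod.val_eq_zero u).1 this]; exact IsSquare.zero
      obtain ⟨p, hpB, hp, hpk⟩ := Nat.forall_exists_prime_gt_and_modEq B (q := 8 * M * q)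
        (by have := hq.out.ne_zero; positivity) hkc
      have h1 := (hpk.of_mul_right q).trans hk1
      have h8 : p % 8 = 1 := (h1.of_mul_right M)
      refine ⟨p, hpB, hp, by omega, fun _ => h8, h1.of_mul_left 8, fun hf => ?_⟩
      have e := legendreSym.quadratic_reciprocity_one_mod_four (p := p) (q := q) (by omega) h2
      rw [← e, leg_mod ((hpk.of_mul_left _).trans hk2), legendreSym.eq_neg_one_iff]
      simpa using hu
  refine ⟨p, ⟨hp⟩, hpB, ?_⟩
  have hf : Fact p.Prime := ⟨hp⟩
  have hr : ∀ r : ℕ, r.Prime → r ≤ N → legendreSym p r = if r = q then -1 else 1 := by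
    intro r hr hN
    split_ifs with h
    · rw [h]; exact hpq hf
    have hr1 : p ≡ 1 [MOD r] := hpr.of_dvd (hMr r hr hN h)
    by_cases h2 : r = 2
    · subst h2
      rw [Nat.cast_ofNat, legendreSym.at_two (by omega), ZMod.χ₈_nat_eq_if_mod_eight]
      simp [h8 (Ne.symm h)]; omega
    · have hfr : Fact r.Prime := ⟨hr⟩
      rw [← legendreSym.quadratic_reciprocity_one_mod_four (p := p) (q := r) (by omega) h2, leg_mod hr1]
      simp
  have key : ∀ D : ℕ, 0 < D → D ≤ N → legendreSym p D = (-1) ^ padicValNat q D := by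
    intro D
    induction D using induction_on_primes with
    | zero => simp
    | one => simp
    | prime_mul r a hrp ih =>
      intro h1 h2
      have ha : 0 < a := Nat.pos_of_ne_zero (by rintro rfl; simp at h1)
      have e1 : a ≤ N := le_trans (Nat.le_mul_of_pos_left _ hrp.pos) h2
      have e2 : r ≤ N := le_trans (Nat.le_mul_of_pos_right _ ha) h2
      have hfr : Fact r.Prime := ⟨hrp⟩
      rw [Nat.cast_mul, legendreSym.mul, ih ha e1, hr r hrp e2, padicValNat.mul hrp.ne_zero ha.ne', pow_add]
      congr 1
      split_ifs with h
      · subst h; simp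
      · rw [padicValNat_primes (Ne.symm h)]; simp
  intro D h1 h2
  lift D to ℕ using h1.le
  simp only [padicValInt.of_nat]
  exact key D (by omega) (by omega)

def Vq (m q : ℕ) (a : ℤ → ℤ → ℂ) : Prop := VV m a ∧ ∀ D l, a D l ≠ 0 → (q : ℤ) ∣ D ∧ (D ≠ 0 → Odd (padicValInt q D))

lemma Vq_split {m q : ℕ} (hm : 0 < m) (hq : q.Prime) (h0 : ∀ a, Vq m q a → ∀ D l, a D l = 0) {a} (ha : VV m a)
    {D l : ℤ} (hD : 0 < D) (hne : a D l ≠ 0) : Even (padicValInt q D) := by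
  have : Fact q.Prime := ⟨hq⟩
  obtain ⟨g, hg, h⟩ := twist hm (PrS_sq q) ha
  have hv : VV m (a - g) := (Vs m).sub_mem ha hg
  have := h0 _ ⟨hv, fun D l h1 => ?_⟩ D l
  · by_contra h2
    rw [Nat.not_even_iff_odd] at h2
    have h3 : a D l - g D l = 0 := this
    rw [h D l hD] at h3
    push_cast at h3
    rw [h2.neg_one_pow] at h3
    apply hne
    linear_combination h3 / 2
  · by_cases hz : D = 0
    · subst hz; simp
    have hp : 0 < D := by
      rcases lt_trichotomy D 0 with h | h | h
      · exact absurd (hv.pos D l h) h1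
      · exact absurd h hz
      · exact h
    have ho : Odd (padicValInt q D) := by
      rw [← Nat.not_even_iff_odd]
      intro he
      apply h1
      change a D l - g D l = 0
      rw [h D l hp]
      push_cast
      rw [he.neg_one_pow]; ring
    refine ⟨?_, fun _ => ho⟩
    by_contra hnd
    rw [padicValInt.eq_zero_of_not_dvd hnd] at ho
    simp at ho

lemma coef_zero {m : ℕ} (hm : 0 < m) {c : ℤ → ℂ}
    (h : ∀ τ : ℂ, 0 < τ.im → HasSum (fun D : ℤ => c D * ee ((D : ℂ) / (4 * m) * τ)) 0) (D : ℤ) : c D = 0 := by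
  have hm' : (m : ℂ) ≠ 0 := by exact_mod_cast hm.ne'
  have h1 := int_coeff (fun _ => 0) I c (fun E : ℤ => E - D) (fun x => by
    have h2 := (h (4 * m * (I + x)) (by simp [mul_im]; omega)).mul_right (ee (-(D : ℂ) * (I + x)))
    refine hs_congr h2 (fun E => ?_) (by simp)
    rw [mul_assoc, ← ee_add]
    congr 2
    push_cast
    field_simp; ring)
  have h2 := hasSum_ite_eq D (c D)
  have := h1.unique (hs_congr h2 (fun E => by
    by_cases hE : E = D
    · simp [hE]
    · simp [hE, sub_eq_zero]) rfl)
  simpa using this.symm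

lemma neg_inv_inv {τ : ℂ} (hτ : 0 < τ.im) : -1 / (-1 / τ) = τ := by
  have := ne_of_im hτ
  field_simp

lemma VV_shift {m d : ℕ} (hm : 0 < m) {a} (ha : VV m a) (hd : d ∣ 2 * m) (hs : ∀ D l, a D l ≠ 0 → (d : ℤ) ∣ l) (D l : ℤ) :
    a D (l + (2 * m / d : ℕ)) = a D l := by
  obtain ⟨k, hk⟩ := hd
  have hd0 : 0 < d := Nat.pos_of_ne_zero (by rintro rfl; omega)
  have hkd : 2 * m / d = k := by rw [hk, Nat.mul_div_cancel_left _ hd0]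
  rw [hkd, ← sub_eq_zero]
  refine coef_zero hm (c := fun D => a D (l + k) - a D l) (fun τ hτ => ?_) D
  have h1 := (ha.hs (l + k) hτ).sub (ha.hs l hτ)
  refine hs_congr h1 (fun D => by ring) ?_
  symm
  rw [sub_eq_zero, ← neg_inv_inv hτ, ha.S _ _ (im_neg_inv hτ), ha.S _ _ (im_neg_inv hτ)]
  congr 1
  refine sum_congr rfl fun l' _ => ?_
  by_cases hl : (d : ℤ) ∣ l'
  · congr 1
    obtain ⟨u, hu⟩ := hl
    apply ee_eq_of_sub (-u)
    have e1 : (l' : ℂ) = d * u := by exact_mod_cast hu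
    have e2 : (2 * m : ℂ) = d * k := by exact_mod_cast hk
    have hdc : (d : ℂ) ≠ 0 := by exact_mod_cast hd0.ne'
    have hkc : (k : ℂ) ≠ 0 := by
      rintro h
      rw [h, mul_zero] at e2
      norm_cast at e2; omega
    rw [e1, e2]; push_cast; field_simp; ring
  · have : hv m a l' (-1 / τ) = 0 := by
      unfold hv
      simp only [show ∀ D, a D l' = 0 from fun D => by by_contra h; exact hl (hs _ _ h), zero_mul, tsum_zero]
    rw [this, mul_zero, mul_zero]

lemma Vq_desc {m q d : ℕ} (hm : 0 < m) (hq : q.Prime) {a} (ha : Vq m q a) (hd : d ∣ 2 * m) (hqd : q ∣ d)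
    (hs : ∀ D l, a D l ≠ 0 → (d : ℤ) ∣ l) (hd2 : d ∣ 2 * m / d → q ^ 2 ∣ m)
    (ih : ∀ m' < m, 0 < m' → ∀ a, Vq m' q a → ∀ D l, a D l = 0) (D l : ℤ) : a D l = 0 := by
  have hper := VV_shift hm ha.1 hd hs
  by_contra hne
  have hdd : d ∣ 2 * m / d := by
    have h1 := hs D (l + (2 * m / d : ℕ)) (by rwa [hper])
    exact Int.natCast_dvd_natCast.1 ((dvd_add_right (hs D l hne)).1 h1)
  obtain ⟨m', hm'⟩ := hd2 hdd
  have hql : (q : ℤ) ∣ l := (Int.natCast_dvd_natCast.2 hqd).trans (hs D l hne)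
  have hq2 : (q : ℤ) ^ 2 ∣ D := by
    have h1 := ha.1.sup D l hne
    have h2 : (q : ℤ) ^ 2 ∣ 4 * m := ⟨4 * m', by rw [hm']; push_cast; ring⟩
    have h3 : (q : ℤ) ^ 2 ∣ l ^ 2 := pow_dvd_pow_of_dvd hql 2
    have := dvd_add (h2.trans h1) h3
    simpa using this
  obtain ⟨l', rfl⟩ := hql
  obtain ⟨D', rfl⟩ := hq2
  have hm0 : 0 < m' := Nat.pos_of_ne_zero (by rintro rfl; omega)
  have hq1 := hq.two_le
  have hv : VV (m' * q ^ 2) a := by rw [mul_comm, ← hm']; exact ha.1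
  have hdq : ((2 * m / d : ℕ) : ℤ) ∣ (q * (2 * m') : ℕ) := by
    rw [Int.natCast_dvd_natCast]
    obtain ⟨e, he⟩ := hqd
    have hd0 : 0 < d := Nat.pos_of_dvd_of_pos hd (by omega)
    refine ⟨e, ?_⟩
    have h1 := Nat.div_mul_cancel hd
    refine Nat.eq_of_mul_eq_mul_left hq.pos ?_
    calc q * (q * (2 * m')) = 2 * m := by rw [hm']; ring
      _ = 2 * m / d * d := h1.symm
      _ = _ := by rw [mul_comm, he]; ring_nf
  have hup : ∀ D l, upo m' q a D l = q * a (D * q ^ 2) (q * l) := by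
    intro D l
    unfold upo
    rw [sum_congr rfl (g := fun _ => a (D * q ^ 2) (q * l)), Finset.sum_const, Finset.card_range, nsmul_eq_mul]
    intro j _
    apply per_dvd (G := a (D * q ^ 2)) (N := ((2 * m / d : ℕ) : ℤ)) (hper _)
    refine hdq.trans ⟨j, ?_⟩
    push_cast; ring
  have hz := ih m' (by have : 4 ≤ q ^ 2 := by nlinarith
                       rw [hm']; nlinarith) hm0 (upo m' q a) ⟨VV_up hm0 hq.pos hv, fun D l h => ?_⟩ D' l'
  · rw [hup] at hz
    have : (q : ℂ) ≠ 0 := by exact_mod_cast hq.ne_zero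
    rw [mul_comm] at hne
    exact hne ((mul_eq_zero.1 hz).resolve_left this)
  · rw [hup] at h
    have h1 := ha.2 _ _ (right_ne_zero_of_mul h)
    by_cases hD : D = 0
    · subst hD; simp
    have hf : Fact q.Prime := ⟨hq⟩
    have hqz : (q : ℤ) ≠ 0 := by exact_mod_cast hq.ne_zero
    have h2 := h1.2 (mul_ne_zero hD (pow_ne_zero 2 hqz))
    rw [padicValInt.mul hD (pow_ne_zero 2 hqz), sq, padicValInt.mul hqz hqz, padicValInt.self hq.one_lt] at h2
    have h3 : Odd (padicValInt q D) := by
      rw [Nat.odd_iff] at h2 ⊢; omega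
    refine ⟨?_, fun _ => h3⟩
    by_contra hnd
    rw [padicValInt.eq_zero_of_not_dvd hnd] at h3
    simp at h3

lemma Vq_ii {m q : ℕ} (hm : 0 < m) (hq : q.Prime) {a} (ha : Vq m q a) (hqm : q ∣ 2 * m)
    (ih : ∀ m' < m, 0 < m' → ∀ a, Vq m' q a → ∀ D l, a D l = 0) (D l : ℤ) : a D l = 0 := by
  have hqp := Nat.prime_iff_prime_int.1 hq
  have hlq : ∀ D l, a D l ≠ 0 → (q : ℤ) ∣ l := fun D l h => by
    have h1 := (ha.2 D l h).1
    have h2 : (q : ℤ) ∣ 4 * m := ((Int.natCast_dvd_natCast.2 hqm).trans ⟨2, by push_cast; ring⟩)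
    have h3 := dvd_sub h1 (h2.trans (ha.1.sup D l h))
    rw [sub_sub_cancel] at h3
    exact hqp.dvd_of_dvd_pow h3
  by_cases h2 : q = 2
  · subst h2
    by_cases hmo : 2 ∣ m
    · obtain ⟨k, rfl⟩ := hmo
      refine Vq_desc (d := 4) hm hq ha ⟨k, by ring⟩ ⟨2, rfl⟩ (fun D l h => ?_) (fun h => ?_) ih D l
      · obtain ⟨u, hu⟩ := hlq D l h
        obtain ⟨w, hw⟩ := ha.1.sup D l h
        have h8 : (8 : ℤ) ∣ D := by
          by_cases hD : D = 0
          · simp [hD]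
          have ho := (ha.2 D l h).2 hD
          have hf : Fact (Nat.Prime 2) := ⟨hq⟩
          have h4 : ((2 : ℕ) : ℤ) ^ 2 ∣ D := ⟨2 * k * w + u ^ 2, by push_cast at *; subst hu; linear_combination hw⟩
          have h5 : 2 ≤ padicValInt 2 D := ((padicValInt_dvd_iff 2 D).1 h4).resolve_left hD
          have h6 : 3 ≤ padicValInt 2 D := by rw [Nat.odd_iff] at ho; omega
          have h7 := (padicValInt_dvd_iff (p := 2) 3 D).2 (Or.inr h6)
          norm_num at h7; exact h7
        obtain ⟨v, hv⟩ := h8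
        have h9 : (2 : ℤ) ∣ u ^ 2 := ⟨v - k * w, by push_cast at *; subst hu hv; linarith⟩
        obtain ⟨x, hx⟩ := Int.prime_two.dvd_of_dvd_pow h9
        exact ⟨x, by rw [hu, hx]; push_cast; ring⟩
      · obtain ⟨x, hx⟩ := h
        exact ⟨2 * x, by omega⟩
    · refine Vq_desc (d := 2) hm hq ha ⟨m, rfl⟩ dvd_rfl (fun D l h => hlq D l h) (fun h => ?_) ih D l
      rw [Nat.mul_div_cancel_left _ (by norm_num)] at h
      exact absurd h hmo
  · have hqm' : q ∣ m := (hq.dvd_mul.1 hqm).resolve_left fun h => h2 ((Nat.prime_dvd_prime_iff_eq hq Nat.prime_two).1 h)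
    refine Vq_desc (d := q) hm hq ha hqm dvd_rfl hlq (fun h => ?_) ih D l
    obtain ⟨k, rfl⟩ := hqm'
    rw [show 2 * (q * k) = q * (2 * k) by ring, Nat.mul_div_cancel_left _ hq.pos] at h
    have := (hq.dvd_mul.1 h).resolve_left fun h => h2 ((Nat.prime_dvd_prime_iff_eq hq Nat.prime_two).1 h)
    rw [sq]; exact Nat.mul_dvd_mul_left q this

def N2 (m : ℕ) (a : ℤ → ℤ → ℂ) (τ : ℂ) : ℝ := ∑ l ∈ range (2 * m), ‖hv m a l τ‖ ^ 2

lemma parseval {N : ℕ} (hN : 0 < N) {x : ℤ → ℂ} (hx : ∀ l, x (l + N) = x l) :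
    ∑ k ∈ range N, ‖∑ l ∈ range N, ee (-(l : ℂ) * k / N) * x l‖ ^ 2 = N * ∑ l ∈ range N, ‖x l‖ ^ 2 := by
  have key : (∑ k ∈ range N, (‖∑ l ∈ range N, ee (-(l : ℂ) * k / N) * x l‖ : ℂ) ^ 2) =
      N * ∑ l ∈ range N, (‖x l‖ : ℂ) ^ 2 := by
    simp only [← mul_conj']
    calc _ = ∑ k ∈ range N, ∑ j ∈ range N, starRingEnd ℂ (x j) * (ee ((j : ℤ) * k / N) *
            ∑ l ∈ range N, ee (-(l : ℂ) * k / N) * x l) := by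
          refine sum_congr rfl fun k _ => ?_
          rw [map_sum, mul_sum]
          refine sum_congr rfl fun j _ => ?_
          rw [map_mul, conj_ee]
          have : -(starRingEnd ℂ) (-(j : ℂ) * k / N) = ((j : ℤ) : ℂ) * k / N := by
            simp [neg_div]
          rw [this]; ring
      _ = _ := by
          rw [sum_comm, mul_sum]
          refine sum_congr rfl fun j _ => ?_
          rw [← mul_sum, dft_inv hN hx j]; ring
  exact_mod_cast key

lemma N2_S {m : ℕ} (hm : 0 < m) {a} (h : VV m a) {τ : ℂ} (hτ : 0 < τ.im) : N2 m a (-1 / τ) = ‖τ‖ * N2 m a τ := by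
  unfold N2
  have hr : ‖rtS m τ‖ ^ 2 * (2 * m) = ‖τ‖ := by
    have := rtS_conj hm τ
    rw [mul_conj'] at this
    exact_mod_cast this
  have hp := parseval (N := 2 * m) (by omega) (x := fun l => hv m a l τ) (fun l => by push_cast; exact hv_per h l τ)
  push_cast at hp
  rw [← hr, mul_assoc, ← hp, mul_sum]
  refine sum_congr rfl fun k _ => ?_
  rw [h.S _ _ hτ, norm_mul, mul_pow]
  congr 3
  exact sum_congr rfl fun l _ => by congr 2; push_cast; ring

lemma N2_q {m q : ℕ} (hm : 0 < m) (hq : q.Prime) {a} (ha : Vq m q a) (hqm : ¬ q ∣ 2 * m) (hq2 : q ≠ 2) (τ : ℂ) :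
    N2 m a (τ + 1 / q) = N2 m a τ := by
  have hc : IsCoprime (q : ℤ) (4 * m) := by
    have h1 : Nat.Coprime q (2 * m) := (hq.coprime_iff_not_dvd).2 hqm
    have h2 : Nat.Coprime q 2 := (Nat.coprime_primes hq Nat.prime_two).2 hq2
    have := Nat.isCoprime_iff_coprime.2 (h2.mul_right h1)
    push_cast at this
    rwa [← mul_assoc, show (2 * 2 : ℤ) = 4 by norm_num] at this
  obtain ⟨x, y, hxy⟩ := hc
  have hm' : (m : ℂ) ≠ 0 := by exact_mod_cast hm.ne'
  have hq' : (q : ℂ) ≠ 0 := by exact_mod_cast hq.ne_zero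
  unfold N2
  refine sum_congr rfl fun l _ => ?_
  have : hv m a l (τ + 1 / q) = ee (((l : ℝ) ^ 2 * x / (4 * m) : ℝ)) * hv m a l τ := by
    unfold hv
    rw [← tsum_mul_left]
    refine tsum_congr fun D => ?_
    by_cases hD : a D l = 0
    · simp [hD]
    obtain ⟨k, hk⟩ := ha.1.sup D l hD
    obtain ⟨D', hD'⟩ := (ha.2 D l hD).1
    rw [mul_left_comm, ← ee_add]
    congr 1
    apply ee_eq_of_sub (k * x + D' * y)
    have e1 : (D : ℂ) - (l : ℂ) ^ 2 = 4 * m * k := by exact_mod_cast hk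
    have e2 : (D : ℂ) = q * D' := by exact_mod_cast hD'
    have e3 : (x : ℂ) * q + y * (4 * m) = 1 := by exact_mod_cast hxy
    push_cast
    field_simp
    linear_combination -(D : ℂ) * e3 + (4 * m * y : ℂ) * e2 + (x * q : ℂ) * e1
  rw [this, norm_mul, norm_ee, ofReal_im]
  simp

lemma N2_qq {m q : ℕ} (hm : 0 < m) (hq : q.Prime) {a} (ha : Vq m q a) (hqm : ¬ q ∣ 2 * m) (hq2 : q ≠ 2) {τ : ℂ} (hτ : 0 < τ.im) :
    N2 m a τ = q * N2 m a (q ^ 2 * τ) := by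
  have hq' : (q : ℂ) ≠ 0 := by exact_mod_cast hq.ne_zero
  have hqr : (0 : ℝ) < q := by exact_mod_cast hq.pos
  have h1 := N2_q hm hq ha hqm hq2
  have h2 : ∀ (n : ℕ) τ, N2 m a (τ + n / q) = N2 m a τ := by
    intro n τ
    induction n with
    | zero => simp
    | succ n ih => rw [← ih, ← h1 (τ + n / q)]; congr 1; push_cast; ring
  have h3 : ∀ τ, N2 m a (τ + q) = N2 m a τ := fun τ => by
    rw [← h2 (q ^ 2) τ]; congr 2; push_cast; field_simp
  have ht := ne_of_im hτ
  have him : 0 < ((q : ℂ) ^ 2 * τ).im := by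
    rw [← ofReal_natCast, ← ofReal_pow, im_ofReal_mul]; positivity

  set τ1 : ℂ := τ + 1 / q with hτ1
  have i1 : 0 < τ1.im := by
    have : (1 / (q : ℂ)).im = 0 := by
      rw [← ofReal_natCast, ← ofReal_one, ← ofReal_div, ofReal_im]
    rw [hτ1, add_im, this, add_zero]; exact hτ
  have n1 := ne_of_im i1
  set τ2 : ℂ := -1 / τ1 + q with hτ2
  have i2 : 0 < τ2.im := by
    rw [hτ2, add_im, natCast_im, add_zero]; exact im_neg_inv i1
  have n2 := ne_of_im i2
  have e2 : τ2 = q * (q * τ) / (q * τ + 1) := by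
    have : (q : ℂ) * τ + 1 ≠ 0 := by
      intro h; apply n1; rw [hτ1]; field_simp; linear_combination h
    rw [hτ2, hτ1, show τ + 1 / (q : ℂ) = (q * τ + 1) / q by field_simp]; field_simp; ring
  have e3 : -1 / τ2 + 1 / q = -1 / (q ^ 2 * τ) := by
    have : (q : ℂ) * τ + 1 ≠ 0 := by
      intro h; apply n1; rw [hτ1]; field_simp; linear_combination h
    rw [e2]; field_simp; ring
  have s1 := N2_S hm ha.1 i1
  have s2 := N2_S hm ha.1 i2
  have s3 := N2_S hm ha.1 him
  rw [← e3, h1, s2, hτ2, h3, s1, ← hτ2, hτ1, h1, ← hτ1, e2, hτ1] at s3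
  have hn : ‖(q : ℂ) * (q * τ) / (q * τ + 1)‖ * ‖τ + 1 / q‖ = q * ‖τ‖ := by
    have : (q : ℂ) * τ + 1 ≠ 0 := by
      intro h; apply n1; rw [hτ1]; field_simp; linear_combination h
    rw [← norm_mul, show (q : ℂ) * (q * τ) / (q * τ + 1) * (τ + 1 / q) = q * τ by field_simp, norm_mul, Complex.norm_natCast]
  rw [← mul_assoc, hn, norm_mul, norm_pow, Complex.norm_natCast] at s3
  have : ‖τ‖ ≠ 0 := by simpa using ht
  have h4 : (q * ‖τ‖) * N2 m a τ = (q * ‖τ‖) * (q * N2 m a (q ^ 2 * τ)) := by rw [s3]; ring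
  exact mul_left_cancel₀ (by positivity) h4

lemma hv_dec {m : ℕ} (hm : 0 < m) {a} (h : VV m a) (l : ℤ) : ∃ K : ℝ, 0 ≤ K ∧ ∀ τ : ℂ, 1 < τ.im →
    ‖hv m a l τ - a 0 l‖ ≤ K / (τ.im - 1) := by
  set F : ℤ → ℝ := fun D => ‖a D l * ee ((D : ℂ) / (4 * m) * I)‖ with hF
  have hs : Summable F := (h.sm l I (by simp)).norm
  have hK0 : 0 ≤ ∑' D, F D := tsum_nonneg fun D => norm_nonneg _
  have hmr : (0 : ℝ) < m := by exact_mod_cast hm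
  refine ⟨(∑' D, F D) * (4 * m), by positivity, fun τ hτ => ?_⟩
  have hg := (h.hs l (show 0 < τ.im by linarith)).sub (hasSum_ite_eq 0 (a 0 l))
  have hF2 : HasSum (fun D => F D * (4 * m / (τ.im - 1))) ((∑' D, F D) * (4 * m / (τ.im - 1))) := hs.hasSum.mul_right _
  rw [mul_div_assoc]
  refine hg.norm_le_of_bounded hF2 fun D => ?_
  have hpos : 0 < τ.im - 1 := by linarith
  rcases lt_trichotomy D 0 with hD | hD | hD
  · simp [h.pos D l hD, hF, hD.ne]
  · subst hD
    simp [ee_zero]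
    positivity
  · rw [if_neg hD.ne', sub_zero, hF]
    simp only [norm_mul, norm_ee]
    rw [mul_assoc ‖a D l‖]
    refine mul_le_mul_of_nonneg_left ?_ (norm_nonneg (a D l))
    have him : ∀ z : ℂ, ((D : ℂ) / (4 * m) * z).im = D / (4 * m) * z.im := by
      intro z
      rw [show (D : ℂ) / (4 * m) = ((D / (4 * m) : ℝ) : ℂ) by push_cast; rfl, im_ofReal_mul]
    rw [him, him, I_im]
    have hD1 : (1 : ℝ) ≤ D := by exact_mod_cast hD
    have hpi := Real.pi_gt_three
    set u := (τ.im - 1) / (4 * m) with hu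
    have hu0 : 0 < u := by positivity
    have e1 : -(2 * Real.pi * (D / (4 * m) * τ.im)) = -(2 * Real.pi * (D / (4 * m) * 1)) + -(2 * Real.pi * D * u) := by
      rw [hu]; field_simp; ring
    rw [e1, Real.exp_add]
    refine mul_le_mul_of_nonneg_left ?_ (Real.exp_nonneg _)
    rw [show 4 * m / (τ.im - 1) = u⁻¹ by rw [hu, inv_div], Real.exp_neg]
    apply inv_anti₀ hu0
    have := Real.add_one_le_exp (2 * Real.pi * D * u)
    nlinarith [mul_pos (show (0:ℝ) < D by linarith) hu0]

lemma Vq_i {m q : ℕ} (hm : 0 < m) (hq : q.Prime) {a} (ha : Vq m q a) (hqm : ¬ q ∣ 2 * m) (hq2 : q ≠ 2) (D l : ℤ) : a D l = 0 := by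
  have hq1 : (1 : ℝ) < q := by exact_mod_cast hq.one_lt
  have himk : ∀ (k : ℕ) (τ : ℂ), ((q : ℂ) ^ k * τ).im = q ^ k * τ.im := by
    intro k τ
    rw [← ofReal_natCast, ← ofReal_pow, im_ofReal_mul]
  have hit : ∀ (k : ℕ) (τ : ℂ), 0 < τ.im → N2 m a τ = q ^ k * N2 m a (q ^ (2 * k) * τ) := by
    intro k τ hτ
    induction k with
    | zero => simp
    | succ k ih =>
      rw [ih, N2_qq hm hq ha hqm hq2 (τ := q ^ (2 * k) * τ) (by rw [himk]; positivity), show (q : ℂ) ^ 2 * (q ^ (2 * k) * τ) = q ^ (2 * (k + 1)) * τ by ring]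
      ring
  have hle : ∀ l : ℤ, ∀ τ, ‖hv m a l τ‖ ^ 2 ≤ N2 m a τ := by
    intro l τ
    have h2 : hv m a l τ = hv m a ((l % (2 * m)).toNat : ℤ) τ := by
      apply per_dvd (G := fun l => hv m a l τ) (N := (2 * m : ℤ)) (fun y => hv_per ha.1 y τ)
      rw [Int.toNat_of_nonneg (Int.emod_nonneg _ (by omega))]
      exact Int.dvd_self_sub_emod
    rw [h2]
    refine Finset.single_le_sum (f := fun l : ℕ => ‖hv m a (l : ℤ) τ‖ ^ 2) (fun _ _ => by positivity) (mem_range.2 ?_)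
    have := Int.emod_lt_of_pos l (show (0 : ℤ) < 2 * m by omega)
    have := Int.emod_nonneg l (show (2 * m : ℤ) ≠ 0 by omega)
    omega
  have hqk : Tendsto (fun k : ℕ => ((q : ℝ) ^ k)⁻¹) atTop (𝓝 0) :=
    (tendsto_pow_atTop_atTop_of_one_lt hq1).inv_tendsto_atTop
  have hqk2 : ∀ τ : ℂ, 0 < τ.im → Tendsto (fun k : ℕ => (q : ℝ) ^ k * τ.im - 1) atTop atTop := fun τ hτ =>
    tendsto_atTop_add_const_right _ _ ((tendsto_pow_atTop_atTop_of_one_lt hq1).atTop_mul_const hτ)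
  choose K hK0 hK using hv_dec hm ha.1
  have ha0 : ∀ l, a 0 l = 0 := by
    intro l
    have t1 : Tendsto (fun k : ℕ => hv m a l (q ^ (2 * k) * I)) atTop (𝓝 0) := by
      have : Tendsto (fun k : ℕ => ‖hv m a l (q ^ (2 * k) * I)‖ ^ 2) atTop (𝓝 0) := by
        refine squeeze_zero (fun _ => by positivity) (fun k => hle l _) ?_
        have := hqk.mul_const (N2 m a I)
        rw [zero_mul] at this
        refine this.congr fun k => ?_
        rw [hit k I (by simp), ← mul_assoc, inv_mul_cancel₀ (by positivity), one_mul]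
      have h2 := (Real.continuous_sqrt.tendsto 0).comp this
      rw [Real.sqrt_zero] at h2
      rw [tendsto_zero_iff_norm_tendsto_zero]
      exact h2.congr fun k => by simp [Real.sqrt_sq]
    have t2 : Tendsto (fun k : ℕ => hv m a l (q ^ (2 * k) * I) - a 0 l) atTop (𝓝 0) := by
      have t3 : Tendsto (fun k : ℕ => K l / (q ^ (2 * k) * I.im - 1)) atTop (𝓝 0) :=
        ((hqk2 I (by simp)).comp (tendsto_id.const_mul_atTop' (by norm_num : 0 < 2))).const_div_atTop (K l)
      refine squeeze_zero_norm' ?_ t3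
      filter_upwards [((hqk2 I (by simp)).comp (tendsto_id.const_mul_atTop' (by norm_num : 0 < 2))).eventually_gt_atTop 0] with k hk
      have hk : 0 < (q : ℝ) ^ (2 * k) * I.im - 1 := hk
      have := hK l (q ^ (2 * k) * I) (by rw [himk]; linarith)
      rwa [himk] at this
    have t4 := t1.sub t2
    simp only [sub_sub_cancel, sub_zero] at t4
    exact (tendsto_nhds_unique t4 tendsto_const_nhds).symm
  have hz : ∀ l τ, 0 < τ.im → hv m a l τ = 0 := by
    intro l τ hτ
    have h1 : N2 m a τ ≤ 0 := by
      have t0 := (hqk2 τ hτ).comp (tendsto_id.const_mul_atTop' (by norm_num : 0 < 2))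
      have t3 : Tendsto (fun k : ℕ => ∑ l ∈ range (2 * m), (K l / (q ^ k * τ.im - 1)) * (K l / (q ^ (2 * k) * τ.im - 1))) atTop (𝓝 0) := by
        rw [← Finset.sum_const_zero (s := range (2 * m))]
        refine tendsto_finsetSum _ fun l _ => ?_
        rw [← mul_zero (0 : ℝ)]
        exact ((hqk2 τ hτ).const_div_atTop (K l)).mul (t0.const_div_atTop (K l))
      refine ge_of_tendsto t3 ?_
      filter_upwards [t0.eventually_gt_atTop 0, (hqk2 τ hτ).eventually_gt_atTop 0] with k hk hk2
      have hk : 0 < (q : ℝ) ^ (2 * k) * τ.im - 1 := hk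
      rw [hit k τ hτ, N2, mul_sum]
      refine Finset.sum_le_sum fun l _ => ?_
      have h3 := hK l (q ^ (2 * k) * τ) (by rw [himk]; linarith)
      rw [himk, ha0, sub_zero] at h3
      have hw : (1 : ℝ) ≤ q ^ k := one_le_pow₀ hq1.le
      have h4 : (q : ℝ) ^ k * (K l / (q ^ (2 * k) * τ.im - 1)) ≤ K l / (q ^ k * τ.im - 1) := by
        rw [mul_div_assoc', div_le_div_iff₀ hk hk2, pow_mul']
        nlinarith [hK0 l, mul_nonneg (hK0 l) (sub_nonneg.2 hw)]
      calc (q : ℝ) ^ k * ‖hv m a l (q ^ (2 * k) * τ)‖ ^ 2 ≤ q ^ k * (K l / (q ^ (2 * k) * τ.im - 1)) ^ 2 := by gcongr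
        _ = (q ^ k * (K l / (q ^ (2 * k) * τ.im - 1))) * (K l / (q ^ (2 * k) * τ.im - 1)) := by ring
        _ ≤ _ := mul_le_mul_of_nonneg_right h4 (div_nonneg (hK0 l) hk.le)
    have h2 := hle l τ
    have : ‖hv m a l τ‖ = 0 := by nlinarith [norm_nonneg (hv m a l τ)]
    simpa using this
  exact coef_zero hm (c := fun D => a D l) (fun τ hτ => by rw [← hz l τ hτ]; exact ha.1.hs l hτ) D

lemma Vq_zero {q : ℕ} (hq : q.Prime) (m : ℕ) : 0 < m → ∀ a, Vq m q a → ∀ D l, a D l = 0 := by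
  induction m using Nat.strong_induction_on with
  | _ m ih =>
    intro hm a ha D l
    by_cases h : q ∣ 2 * m
    · exact Vq_ii hm hq ha h (fun m' h1 h2 => ih m' h1 h2) D l
    · exact Vq_i hm hq ha h (by rintro rfl; exact h ⟨m, rfl⟩) D l

lemma VV_sq {m : ℕ} (hm : 0 < m) {a} (ha : VV m a) {D l : ℤ} (hne : a D l ≠ 0) : ∃ r : ℕ, D = (r : ℤ) ^ 2 := by
  rcases lt_trichotomy D 0 with h | h | h
  · exact absurd (ha.pos D l h) hne
  · exact ⟨0, by simp [h]⟩
  have key : ∀ q : ℕ, q.Prime → Even (padicValInt q D) := fun q hq =>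
    Vq_split hm hq (Vq_zero hq m hm) ha h hne
  lift D to ℕ using h.le
  have hD : D ≠ 0 := by omega
  obtain ⟨x, b, hxb, hx⟩ := Nat.sq_mul_squarefree D
  have hb0 : b ≠ 0 := by rintro rfl; simp at hxb; omega
  have hx0 : x ≠ 0 := hx.ne_zero
  by_cases h1 : x = 1
  · exact ⟨b, by rw [← hxb, h1]; push_cast; ring⟩
  exfalso
  obtain ⟨r, hr, hrx⟩ := Nat.exists_prime_and_dvd h1
  have hf : Fact r.Prime := ⟨hr⟩
  have h2 := key r hr
  rw [padicValInt.of_nat, ← hxb, padicValNat.mul (pow_ne_zero 2 hb0) hx0, padicValNat.pow] at h2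
  have h3 : padicValNat r x ≤ 1 := by
    rw [← Nat.factorization_def _ hr]; exact hx.natFactorization_le_one r
  have h4 : 1 ≤ padicValNat r x := one_le_padicValNat_of_dvd hx0 hrx
  rw [Nat.even_iff] at h2
  omega

lemma ddiff {m : ℕ} (c : ℤ → ℂ)
    (hs : ∀ τ : ℂ, 0 < τ.im → Summable (fun r : ℤ => c r * ee ((r : ℂ) ^ 2 / (4 * m) * τ))) {τ : ℂ} (hτ : 0 < τ.im) :
    HasDerivAt (fun τ => ∑' r : ℤ, c r * ee ((r : ℂ) ^ 2 / (4 * m) * τ))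
      (2 * Real.pi * I / (4 * m) * ∑' r : ℤ, (c r * r ^ 2) * ee ((r : ℂ) ^ 2 / (4 * m) * τ)) τ ∧
    (0 < m → Summable (fun r : ℤ => (c r * r ^ 2) * ee ((r : ℂ) ^ 2 / (4 * m) * τ))) := by
  set y := τ.im / 2 with hy
  have hy0 : 0 < y := by positivity
  have hU : IsOpen {z : ℂ | y < z.im} := isOpen_lt continuous_const continuous_im
  have hu := (hs (y * I) (by simpa using hy0)).norm
  have him : ∀ (r : ℤ) (z : ℂ), ((r : ℂ) ^ 2 / (4 * m) * z).im = r ^ 2 / (4 * m) * z.im := by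
    intro r z
    rw [show (r : ℂ) ^ 2 / (4 * m) = ((r ^ 2 / (4 * m) : ℝ) : ℂ) by push_cast; rfl, im_ofReal_mul]
  have hder : ∀ (r : ℤ) (z : ℂ), HasDerivAt (fun τ => c r * ee ((r : ℂ) ^ 2 / (4 * m) * τ))
      (2 * Real.pi * I / (4 * m) * ((c r * r ^ 2) * ee ((r : ℂ) ^ 2 / (4 * m) * z))) z := by
    intro r z
    have h1 : HasDerivAt (fun τ => (r : ℂ) ^ 2 / (4 * m) * τ) ((r : ℂ) ^ 2 / (4 * m)) z := by
      simpa using (hasDerivAt_id z).const_mul ((r : ℂ) ^ 2 / (4 * m))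
    have h2 := ((ee_hasDerivAt _).comp z h1).const_mul (c r)
    refine h2.congr_deriv ?_
    ring
  have hb : ∀ (r : ℤ), ∀ w ∈ {z : ℂ | y < z.im}, ‖c r * ee ((r : ℂ) ^ 2 / (4 * m) * w)‖ ≤ ‖c r * ee ((r : ℂ) ^ 2 / (4 * m) * (y * I))‖ := by
    intro r w hw
    rw [norm_mul, norm_mul, norm_ee, norm_ee, him, him]
    have hw : y < w.im := hw
    refine mul_le_mul_of_nonneg_left (Real.exp_le_exp.2 ?_) (norm_nonneg _)
    have e : ((y : ℂ) * I).im = y := by simp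
    rw [e]
    have h1 : (0 : ℝ) ≤ r ^ 2 / (4 * m) := by positivity
    have := Real.pi_pos
    have h2 := mul_le_mul_of_nonneg_left hw.le h1
    nlinarith
  have hd : ∀ r : ℤ, DifferentiableOn ℂ (fun τ => c r * ee ((r : ℂ) ^ 2 / (4 * m) * τ)) {z : ℂ | y < z.im} :=
    fun r z _ => (hder r z).differentiableAt.differentiableWithinAt
  have hmem : τ ∈ {z : ℂ | y < z.im} := by
    change y < τ.im
    rw [hy]; linarith
  have h3 := Complex.differentiableOn_tsum_of_summable_norm hu hd hU hb
  have h4 := Complex.hasSum_deriv_of_summable_norm hu hd hU hb hmem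
  simp only [(hder _ τ).deriv] at h4
  constructor
  · have h5 := ((h3 τ hmem).differentiableAt (hU.mem_nhds hmem)).hasDerivAt
    refine h5.congr_deriv ?_
    rw [← tsum_mul_left]; exact h4.tsum_eq.symm
  · intro hm
    have hm' : (m : ℂ) ≠ 0 := by exact_mod_cast hm.ne'
    have hc : 2 * Real.pi * I / (4 * m) ≠ 0 := by
      simp [Real.pi_ne_zero, hm']
    exact (summable_mul_left_iff hc).1 h4.summable

def Aq (a : ℤ → ℤ → ℂ) (l r : ℤ) : ℂ := if r = 0 then a 0 l else a (r ^ 2) l / 2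

lemma sq_hs {h : ℤ → ℂ} {s : ℂ} (hs : HasSum h s) (hq : ∀ D, h D ≠ 0 → ∃ r : ℕ, D = (r : ℤ) ^ 2) :
    HasSum (fun r : ℤ => if r = 0 then h 0 else h (r ^ 2) / 2) s := by
  have hinj : Function.Injective (fun r : ℕ => ((r : ℤ) ^ 2)) := fun x y h => by
    have : (x : ℤ) ^ 2 = (y : ℤ) ^ 2 := h
    exact_mod_cast (pow_left_inj₀ (by positivity) (by positivity) two_ne_zero).1 this
  rw [← hinj.hasSum_iff] at hs
  swap
  · intro D hD
    by_contra h0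
    obtain ⟨r, hr⟩ := hq D h0
    exact hD ⟨r, hr.symm⟩
  have h2 : HasSum (fun n : ℕ => if (n : ℤ) = 0 then h 0 else h ((n : ℤ) ^ 2) / 2) (s * (1 / 2) + h 0 / 2) := by
    refine hs_congr ((hs.mul_right (1 / 2)).add (hasSum_ite_eq 0 (h 0 / 2))) (fun n => ?_) rfl
    by_cases hn : n = 0
    · subst hn; simp; ring
    · simp [hn]; ring
  have h3 := HasSum.of_nat_of_neg (f := fun r : ℤ => if r = 0 then h 0 else h (r ^ 2) / 2) h2
    (hs_congr h2 (fun n => by simp) rfl)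
  refine hs_congr h3 (fun _ => rfl) ?_
  simp; ring

lemma Aq_hs {m : ℕ} (hm : 0 < m) {a} (ha : VV m a) (l : ℤ) {τ : ℂ} (hτ : 0 < τ.im) :
    HasSum (fun r : ℤ => Aq a l r * ee ((r : ℂ) ^ 2 / (4 * m) * τ)) (hv m a l τ) := by
  refine hs_congr (sq_hs (ha.hs l hτ) fun D hD => VV_sq hm ha (left_ne_zero_of_mul hD)) (fun r => ?_) rfl
  unfold Aq
  split_ifs with h
  · subst h; simp
  · push_cast; ring

def Vk (m : ℕ) (a : ℤ → ℤ → ℂ) (k : ℕ) (l : ℤ) (τ : ℂ) : ℂ :=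
  ∑' r : ℤ, (Aq a l r * r ^ (2 * k) / (2 * k).factorial) * ee ((r : ℂ) ^ 2 / (4 * m) * τ)

lemma Vk_sm {m : ℕ} (hm : 0 < m) {a} (ha : VV m a) (k : ℕ) (l : ℤ) {τ : ℂ} (hτ : 0 < τ.im) :
    Summable (fun r : ℤ => (Aq a l r * r ^ (2 * k) / (2 * k).factorial) * ee ((r : ℂ) ^ 2 / (4 * m) * τ)) := by
  induction k generalizing τ with
  | zero => simpa using (Aq_hs hm ha l hτ).summable
  | succ k ih =>
    have h := ((ddiff _ (fun τ h => ih h) hτ).2 hm).mul_right (1 / ((2 * k + 2) * (2 * k + 1) : ℂ))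
    refine h.congr fun r => ?_
    rw [show 2 * (k + 1) = 2 * k + 1 + 1 by ring, Nat.factorial_succ, Nat.factorial_succ]
    have h1 : ((2 * k).factorial : ℂ) ≠ 0 := by exact_mod_cast Nat.factorial_ne_zero _
    have h2 : (2 * k + 1 : ℂ) ≠ 0 := by norm_cast
    have h3 : (2 * k + 2 : ℂ) ≠ 0 := by norm_cast
    have h4 : (2 * k + 1 + 1 : ℂ) ≠ 0 := by norm_cast
    push_cast
    field_simp
    ring

lemma Vk_deriv {m : ℕ} (hm : 0 < m) {a} (ha : VV m a) (k : ℕ) (l : ℤ) {τ : ℂ} (hτ : 0 < τ.im) :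
    HasDerivAt (Vk m a k l) (2 * Real.pi * I / (4 * m) * ((2 * k + 2) * (2 * k + 1) * Vk m a (k + 1) l τ)) τ := by
  refine (ddiff _ (fun τ h => Vk_sm hm ha k l h) hτ).1.congr_deriv ?_
  congr 1
  rw [Vk, ← tsum_mul_left]
  refine tsum_congr fun r => ?_
  rw [show 2 * (k + 1) = 2 * k + 1 + 1 by ring, Nat.factorial_succ, Nat.factorial_succ]
  have h1 : ((2 * k).factorial : ℂ) ≠ 0 := by exact_mod_cast Nat.factorial_ne_zero _
  have h2 : (2 * k + 1 : ℂ) ≠ 0 := by norm_cast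
  have h4 : (2 * k + 1 + 1 : ℂ) ≠ 0 := by norm_cast
  push_cast
  field_simp
  ring

def Xk (m : ℕ) (a : ℤ → ℤ → ℂ) (l : ℤ) (k : ℕ) (τ : ℂ) : ℂ :=
  ∑ l' ∈ range (2 * m), ee (-(l : ℂ) * l' / (2 * m)) * Vk m a k l' τ

def kap (m : ℕ) : ℂ := m / (2 * Real.pi * I)

lemma Vk_S {m : ℕ} (hm : 0 < m) {a} (ha : VV m a) (k : ℕ) (l : ℤ) {τ : ℂ} (hτ : 0 < τ.im) :
    Vk m a k l (-1 / τ) = rtS m τ * ∑ p ∈ Finset.HasAntidiagonal.antidiagonal k, kap m ^ p.1 / p.1.factorial * τ ^ (p.1 + 2 * p.2) * Xk m a l p.2 τ := by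
  induction k generalizing τ with
  | zero =>
    have h0 : ∀ (l : ℤ) (τ : ℂ), 0 < τ.im → Vk m a 0 l τ = hv m a l τ := fun l τ hτ => by
      rw [← (Aq_hs hm ha l hτ).tsum_eq, Vk]; simp
    simp only [Finset.Nat.antidiagonal_zero, Finset.sum_singleton, Xk]
    rw [h0 _ _ (im_neg_inv hτ), ha.S _ _ hτ]
    simp [h0 _ _ hτ]
  | succ k ih =>
    have ht := ne_of_im hτ
    have hm' : (m : ℂ) ≠ 0 := by exact_mod_cast hm.ne'
    have hpi : (2 * (Real.pi : ℂ) * I) ≠ 0 := by simp [Real.pi_ne_zero]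
    have dX : ∀ j, HasDerivAt (Xk m a l j) (2 * Real.pi * I / (4 * m) * ((2 * j + 2) * (2 * j + 1) * Xk m a l (j + 1) τ)) τ := by
      intro j
      have : HasDerivAt (Xk m a l j) _ τ := HasDerivAt.fun_sum fun l' _ => (Vk_deriv hm ha j l' hτ).const_mul (ee (-(l : ℂ) * l' / (2 * m)))
      refine this.congr_deriv ?_
      rw [Xk, mul_sum, mul_sum]
      exact sum_congr rfl fun _ _ => by ring
    have d1 : HasDerivAt (fun τ => ∑ p ∈ Finset.HasAntidiagonal.antidiagonal k, kap m ^ p.1 / p.1.factorial * τ ^ (p.1 + 2 * p.2) * Xk m a l p.2 τ) _ τ :=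
      HasDerivAt.fun_sum fun p _ => ((hasDerivAt_pow (p.1 + 2 * p.2) τ).const_mul (kap m ^ p.1 / p.1.factorial)).mul (dX p.2)
    have d2 := (rtS_deriv hm hτ).mul d1
    have d3 := (Vk_deriv hm ha k l (im_neg_inv hτ)).comp τ (neg_inv_deriv hτ)
    have d4 := d3.unique (d2.congr_of_eventuallyEq (by
      filter_upwards [nhds_im hτ] with t ht
      exact ih ht))
    set G : ℕ × ℕ → ℂ := fun p => kap m ^ p.1 / p.1.factorial * τ ^ (p.1 + 2 * p.2) * Xk m a l p.2 τ with hG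
    have e1 : ∀ p : ℕ × ℕ, kap m ^ p.1 / p.1.factorial * τ ^ (p.1 + 2 * p.2 + 2) * Xk m a l (p.2 + 1) τ = G (p.1, p.2 + 1) := by
      intro p; simp only [hG]; ring
    have e2 : ∀ p : ℕ × ℕ, 4 * (p.1 + 1) * G (p.1 + 1, p.2) = 4 * kap m * τ * G p := by
      intro p; simp only [hG]
      have h1 : (p.1 + 1 : ℂ) ≠ 0 := by norm_cast
      have h2 : (p.1.factorial : ℂ) ≠ 0 := by exact_mod_cast Nat.factorial_ne_zero _
      rw [Nat.factorial_succ]; push_cast; field_simp; ring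
    have e3 : ∀ n : ℕ, (n : ℂ) * τ ^ (n - 1) = n * τ ^ n / τ := by
      intro n
      rcases n with _ | n
      · simp
      · rw [Nat.add_sub_cancel, pow_succ]; field_simp
    have hsum : (2 * k + 2) * (2 * k + 1) * ∑ p ∈ Finset.HasAntidiagonal.antidiagonal (k + 1), G p =
        ∑ p ∈ Finset.HasAntidiagonal.antidiagonal k, ((2 * p.2 + 2) * (2 * p.2 + 1) * G (p.1, p.2 + 1) + 4 * kap m * τ * (1 / 2 + p.1 + 2 * p.2) * G p) := by
      have hs : (2 * k + 2) * (2 * k + 1) * ∑ p ∈ Finset.HasAntidiagonal.antidiagonal (k + 1), G p =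
          ∑ p ∈ Finset.HasAntidiagonal.antidiagonal (k + 1), (2 * p.2 : ℂ) * (2 * p.2 - 1) * G p + ∑ p ∈ Finset.HasAntidiagonal.antidiagonal (k + 1), 4 * (p.1 : ℂ) * (p.1 - 1 / 2 + 2 * p.2) * G p := by
        rw [mul_sum, ← Finset.sum_add_distrib]
        refine sum_congr rfl fun p hp => ?_
        have : (k : ℂ) + 1 = p.1 + p.2 := by exact_mod_cast (Finset.HasAntidiagonal.mem_antidiagonal.1 hp).symm
        have e : (k : ℂ) = p.1 + p.2 - 1 := by linear_combination this
        rw [e]; ring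
      rw [hs, Finset.Nat.sum_antidiagonal_succ', Finset.Nat.sum_antidiagonal_succ, Finset.sum_add_distrib]
      simp only [Nat.cast_zero, mul_zero, zero_mul, zero_add]
      congr 1
      · exact sum_congr rfl fun p _ => by push_cast; ring
      · refine sum_congr rfl fun p _ => ?_
        have := e2 p
        push_cast
        linear_combination (p.1 + 1 - 1 / 2 + 2 * p.2 : ℂ) * this
    have hk : ((2 * k + 2) * (2 * k + 1) : ℂ) ≠ 0 := by norm_cast
    refine mul_left_cancel₀ hk ?_
    rw [mul_left_comm, hsum]
    have hkap : (2 * Real.pi * I / (4 * m) : ℂ) * (4 * kap m) = 1 := by unfold kap; field_simp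
    have hc0 : (2 * Real.pi * I / (4 * m) : ℂ) ≠ 0 := left_ne_zero_of_mul_eq_one hkap
    set K := (2 * Real.pi * I / (4 * m) : ℂ) with hK
    have d5 : K * ((2 * k + 2) * (2 * k + 1) * Vk m a (k + 1) l (-1 / τ)) = τ ^ 2 * (K * ((2 * k + 2) * (2 * k + 1) * Vk m a (k + 1) l (-1 / τ)) * (1 / τ ^ 2)) := by
      field_simp
    refine mul_left_cancel₀ hc0 ?_
    rw [d5, d4]
    rw [mul_sum, mul_sum, mul_sum, mul_sum, ← Finset.sum_add_distrib, mul_sum]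
    refine sum_congr rfl fun p _ => ?_
    rw [← e1, e3]
    simp only [hG]
    push_cast
    have : 4 * kap m = K⁻¹ := by rw [eq_comm, inv_eq_of_mul_eq_one_right hkap]
    rw [this]
    field_simp
    ring

def Ph (m : ℕ) (a : ℤ → ℤ → ℂ) (l : ℤ) (τ z : ℂ) : ℂ := ∑' r : ℤ, Aq a l r * ee ((r : ℂ) ^ 2 / (4 * m) * τ + r * z)

lemma Ph_bound {m : ℕ} (hm : 0 < m) {a} (ha : VV m a) (l : ℤ) {τ : ℂ} (hτ : 0 < τ.im) (z : ℂ) :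
    Summable (fun r : ℤ => ‖Aq a l r * ee ((r : ℂ) ^ 2 / (4 * m) * τ)‖ * Real.exp (2 * Real.pi * ‖z‖ * |(r : ℝ)|)) := by
  have h1 := (Aq_hs hm ha l (τ := (τ.im / 2 : ℝ) * I) (by rw [im_ofReal_mul]; simpa using hτ)).summable.norm
  have hmr : (0 : ℝ) < m := by exact_mod_cast hm
  refine Summable.of_nonneg_of_le (fun r => by positivity) (fun r => ?_) (h1.mul_right (Real.exp (2 * Real.pi * (2 * m * ‖z‖ ^ 2 / τ.im))))
  have him : ∀ (z : ℂ), ((r : ℂ) ^ 2 / (4 * m) * z).im = r ^ 2 / (4 * m) * z.im := by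
    intro z
    rw [show (r : ℂ) ^ 2 / (4 * m) = ((r ^ 2 / (4 * m) : ℝ) : ℂ) by push_cast; rfl, im_ofReal_mul]
  rw [norm_mul, norm_mul, norm_ee, norm_ee, him, him, mul_assoc ‖Aq a l r‖, mul_assoc ‖Aq a l r‖, ← Real.exp_add, ← Real.exp_add]
  refine mul_le_mul_of_nonneg_left (Real.exp_le_exp.2 ?_) (norm_nonneg _)
  have e : (((τ.im / 2 : ℝ) : ℂ) * I).im = τ.im / 2 := by simp
  rw [e]
  have key : ‖z‖ * |(r : ℝ)| ≤ (r : ℝ) ^ 2 * τ.im / (8 * m) + 2 * m * ‖z‖ ^ 2 / τ.im := by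
    have : (r : ℝ) ^ 2 * τ.im / (8 * m) + 2 * m * ‖z‖ ^ 2 / τ.im - ‖z‖ * |(r : ℝ)| = (|(r : ℝ)| * τ.im - 4 * m * ‖z‖) ^ 2 / (8 * m * τ.im) := by
      rw [← sq_abs (r : ℝ)]; field_simp; ring
    have h2 : 0 ≤ (|(r : ℝ)| * τ.im - 4 * m * ‖z‖) ^ 2 / (8 * m * τ.im) := by positivity
    linarith
  have e2 : -(2 * Real.pi * ((r : ℝ) ^ 2 / (4 * m) * (τ.im / 2))) + 2 * Real.pi * (2 * m * ‖z‖ ^ 2 / τ.im) - (-(2 * Real.pi * ((r : ℝ) ^ 2 / (4 * m) * τ.im)) + 2 * Real.pi * ‖z‖ * |(r : ℝ)|) = 2 * Real.pi * ((r : ℝ) ^ 2 * τ.im / (8 * m) + 2 * m * ‖z‖ ^ 2 / τ.im - ‖z‖ * |(r : ℝ)|) := by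
    ring
  have := mul_nonneg (by positivity : 0 ≤ 2 * Real.pi) (sub_nonneg.2 key)
  linarith

lemma Ph_hs {m : ℕ} (hm : 0 < m) {a} (ha : VV m a) (l : ℤ) {τ : ℂ} (hτ : 0 < τ.im) (z : ℂ) :
    HasSum (fun r : ℤ => Aq a l r * ee ((r : ℂ) ^ 2 / (4 * m) * τ + r * z)) (Ph m a l τ z) := by
  refine (Summable.of_norm_bounded (Ph_bound hm ha l hτ z) fun r => ?_).hasSum
  rw [ee_add, ← mul_assoc, norm_mul, norm_ee ((r : ℂ) * z)]
  refine mul_le_mul_of_nonneg_left (Real.exp_le_exp.2 ?_) (norm_nonneg _)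
  have h1 := (abs_le.1 (Complex.abs_im_le_norm ((r : ℂ) * z))).1
  rw [norm_mul, Complex.norm_intCast] at h1
  have := mul_le_mul_of_nonneg_left h1 (by positivity : 0 ≤ 2 * Real.pi)
  linarith

lemma Ph_k {m : ℕ} (hm : 0 < m) {a} (ha : VV m a) (l : ℤ) {τ : ℂ} (hτ : 0 < τ.im) (z : ℂ) :
    HasSum (fun k : ℕ => (2 * Real.pi * I * z) ^ (2 * k) * Vk m a k l τ) (Ph m a l τ z) := by
  set c : ℤ → ℂ := fun r => Aq a l r * ee ((r : ℂ) ^ 2 / (4 * m) * τ) with hc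
  set F : ℤ × ℕ → ℂ := fun p => c p.1 * ((2 * Real.pi * I * z * p.1) ^ (2 * p.2) / (2 * p.2).factorial) with hF
  have hn : ∀ p, ‖F p‖ = ‖c p.1‖ * ((2 * Real.pi * ‖z‖ * |(p.1 : ℝ)|) ^ (2 * p.2) / (2 * p.2).factorial) := by
    intro p
    simp [hF, Complex.norm_intCast, abs_of_pos Real.pi_pos]
  have hfib : ∀ r : ℤ, HasSum (fun k : ℕ => ‖F (r, k)‖) (‖c r‖ * Real.cosh (2 * Real.pi * ‖z‖ * |(r : ℝ)|)) := by
    intro r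
    simp only [hn]
    exact (Real.hasSum_cosh _).mul_left _
  have hsF : Summable F := by
    refine Summable.of_norm ((summable_prod_of_nonneg fun p => norm_nonneg _).2 ⟨fun r => (hfib r).summable, ?_⟩)
    simp only [(hfib _).tsum_eq]
    refine Summable.of_nonneg_of_le (fun r => by positivity) (fun r => ?_) (Ph_bound hm ha l hτ z)
    refine mul_le_mul_of_nonneg_left ?_ (norm_nonneg _)
    rw [Real.cosh_eq]
    have : Real.exp (-(2 * Real.pi * ‖z‖ * |(r : ℝ)|)) ≤ Real.exp (2 * Real.pi * ‖z‖ * |(r : ℝ)|) :=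
      Real.exp_le_exp.2 (by have : 0 ≤ 2 * Real.pi * ‖z‖ * |(r : ℝ)| := by positivity
                            linarith)
    linarith
  have h1 := hsF.hasSum.prod_fiberwise (fun r => (Complex.hasSum_cosh (2 * Real.pi * I * z * r)).mul_left (c r))
  have h2 : HasSum (fun r : ℤ => c r * Complex.cosh (2 * Real.pi * I * z * r)) (Ph m a l τ z) := by
    have h3 := Ph_hs hm ha l hτ z
    have h4 := (Equiv.neg ℤ).hasSum_iff.2 h3
    refine hs_congr ((h3.add h4).mul_right (1 / 2)) (fun r => ?_) (by ring)
    have e1 : Aq a l (-r) = Aq a l r := by simp [Aq]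
    have e2 : Complex.cosh (2 * Real.pi * I * z * r) = (ee (r * z) + ee (-r * z)) / 2 := by
      rw [Complex.cosh, ee, ee]; ring_nf
    simp only [hc, Function.comp, Equiv.neg_apply, e1, e2, ee_add]
    push_cast
    rw [neg_sq]; ring
  have h5 := hsF.hasSum
  rw [h1.unique h2, ← (Equiv.prodComm ℕ ℤ).hasSum_iff] at h5
  refine HasSum.prod_fiberwise h5 (fun k => ?_)
  refine hs_congr ((Vk_sm hm ha k l hτ).hasSum.mul_left ((2 * Real.pi * I * z) ^ (2 * k))) (fun r => ?_) rfl
  simp only [Function.comp, Equiv.prodComm_apply, Prod.swap, hF, hc]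
  rw [mul_pow _ (r : ℂ)]; ring

lemma Ph_S {m : ℕ} (hm : 0 < m) {a} (ha : VV m a) (l : ℤ) {τ : ℂ} (hτ : 0 < τ.im) (z : ℂ) :
    Ph m a l (-1 / τ) (z / τ) = rtS m τ * ee (m * z ^ 2 / τ) *
      ∑ l' ∈ range (2 * m), ee (-(l : ℂ) * l' / (2 * m)) * Ph m a l' τ z := by
  have ht := ne_of_im hτ
  have hpi : (2 * (Real.pi : ℂ) * I) ≠ 0 := by simp [Real.pi_ne_zero]
  have hX : HasSum (fun k : ℕ => (2 * Real.pi * I * z) ^ (2 * k) * Xk m a l k τ) (∑ l' ∈ range (2 * m), ee (-(l : ℂ) * l' / (2 * m)) * Ph m a l' τ z) := by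
    refine hs_congr (hasSum_sum fun (l' : ℕ) (_ : l' ∈ range (2 * m)) => (Ph_k hm ha l' hτ z).mul_left (ee (-(l : ℂ) * l' / (2 * m)))) (fun k => ?_) rfl
    rw [Xk, mul_sum]
    exact sum_congr rfl fun _ _ => by push_cast; ring
  have hE : HasSum (fun k : ℕ => (2 * Real.pi * I * (m * z ^ 2 / τ)) ^ k / k.factorial) (ee (m * z ^ 2 / τ)) := by
    rw [ee, Complex.exp_eq_exp_ℂ]; exact NormedSpace.expSeries_div_hasSum_exp _
  have h1 := tsum_mul_tsum_eq_tsum_sum_antidiagonal_of_summable_norm hE.summable.norm hX.summable.norm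
  rw [hE.tsum_eq, hX.tsum_eq] at h1
  rw [mul_assoc, h1, ← tsum_mul_left, ← (Ph_k hm ha l (im_neg_inv hτ) (z / τ)).tsum_eq]
  refine tsum_congr fun k => ?_
  rw [Vk_S hm ha k l hτ, mul_left_comm, mul_sum]
  congr 1
  refine sum_congr rfl fun p hp => ?_
  have hk : k = p.1 + p.2 := (Finset.HasAntidiagonal.mem_antidiagonal.1 hp).symm
  subst hk
  have e1 : (2 * Real.pi * I * (z / τ)) ^ (2 * (p.1 + p.2)) * (kap m ^ p.1 * τ ^ (p.1 + 2 * p.2)) = (2 * Real.pi * I * (m * z ^ 2 / τ)) ^ p.1 * (2 * Real.pi * I * z) ^ (2 * p.2) := by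
    have : (2 * Real.pi * I * (z / τ)) ^ 2 * kap m * τ = 2 * Real.pi * I * (m * z ^ 2 / τ) := by
      unfold kap; field_simp
    rw [← this, mul_pow _ τ, mul_pow _ (kap m), ← pow_mul, mul_add 2, pow_add, pow_add,
      show (2 * Real.pi * I * z) ^ (2 * p.2) = (2 * Real.pi * I * (z / τ)) ^ (2 * p.2) * τ ^ (2 * p.2) by
        rw [← mul_pow]; congr 1; field_simp]
    ring
  linear_combination (Xk m a l p.2 τ / p.1.factorial) * e1

lemma fourier_uniq {c c' : ℤ → ℂ} {f : ℂ → ℂ} (h : ∀ x : ℝ, HasSum (fun r : ℤ => c r * ee (r * x)) (f x))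
    (h' : ∀ x : ℝ, HasSum (fun r : ℤ => c' r * ee (r * x)) (f x)) (r0 : ℤ) : c r0 = c' r0 := by
  have key : ∀ c : ℤ → ℂ, (∀ x : ℝ, HasSum (fun r : ℤ => c r * ee (r * x)) (f x)) →
      c r0 = ∫ x in (0 : ℝ)..1, f (0 + x) * ee (-(r0 : ℂ) * (0 + x)) := by
    intro c h
    have h1 := int_coeff (fun x => f x * ee (-(r0 : ℂ) * x)) 0 c (fun r => r - r0) (fun x => by
      rw [zero_add]
      refine hs_congr ((h x).mul_right (ee (-(r0 : ℂ) * x))) (fun r => ?_) rfl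
      rw [mul_assoc, ← ee_add]; push_cast; ring_nf)
    refine HasSum.unique ?_ h1
    simp only [sub_eq_zero]
    exact hs_congr (hasSum_ite_eq r0 (c r0)) (fun r => by by_cases hr : r = r0 <;> simp [hr]) rfl
  rw [key c h, key c' h']

lemma Ph_shift {m : ℕ} (hm : 0 < m) {a} (ha : VV m a) (l : ℤ) {τ : ℂ} (hτ : 0 < τ.im) (z : ℂ) :
    Ph m a l τ (z - τ) = ee (m * (2 * z - τ)) * Ph m a l τ z := by
  have ht := ne_of_im hτ
  have hp : ∀ (l : ℤ) (τ z : ℂ), Ph m a l τ (z + 1) = Ph m a l τ z := fun l τ z =>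
    tsum_congr fun r => by
      congr 1
      exact ee_eq_of_sub r (by ring)
  have h1 := Ph_S hm ha l (im_neg_inv hτ) (-z / τ)
  have h2 := Ph_S hm ha l (im_neg_inv hτ) (-z / τ + 1)
  simp only [hp, neg_inv_inv hτ] at h1 h2
  rw [show -z / τ / (-1 / τ) = z by field_simp] at h1
  rw [show (-z / τ + 1) / (-1 / τ) = z - τ by field_simp; ring] at h2
  rw [h1, h2, show (m : ℂ) * (-z / τ + 1) ^ 2 / (-1 / τ) = m * (2 * z - τ) + m * (-z / τ) ^ 2 / (-1 / τ) by field_simp; ring, ee_add]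
  ring

lemma Aq_per {m : ℕ} (hm : 0 < m) {a} (ha : VV m a) (l r : ℤ) : Aq a l (r + 2 * m) = Aq a l r := by
  have hm' : (m : ℂ) ≠ 0 := by exact_mod_cast hm.ne'
  have hI : 0 < I.im := by simp
  have h := fourier_uniq (c := fun r => Aq a l r * ee ((r : ℂ) ^ 2 / (4 * m) * I - r * I))
    (c' := fun r => Aq a l (r - 2 * m) * ee ((r : ℂ) ^ 2 / (4 * m) * I - r * I)) (f := fun x => Ph m a l I (x - I))
    (fun x => hs_congr (Ph_hs hm ha l hI (x - I)) (fun r => by rw [mul_assoc, ← ee_add]; ring_nf) rfl)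
    (fun x => hs_congr (((Equiv.subRight (2 * m : ℤ)).hasSum_iff.2 (Ph_hs hm ha l hI x)).mul_left (ee (m * (2 * x - I))))
      (fun r => by
        simp only [Function.comp, Equiv.subRight_apply]
        rw [mul_left_comm, ← ee_add, mul_assoc, ← ee_add]
        congr 2
        push_cast; field_simp; ring) (Ph_shift hm ha l hI x)) (r + 2 * m)
  simpa [ee_ne] using h

lemma Ph_theta {m : ℕ} (hm : 0 < m) {a} (ha : VV m a) (l : ℤ) {τ : ℂ} (hτ : 0 < τ.im) (z : ℂ) :
    Ph m a l τ z = ∑ r ∈ range (2 * m), Aq a l r * jTheta m r τ z := by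
  refine (Ph_hs hm ha l hτ z).unique (hasSum_int_split (N := 2 * m) (by positivity) _ _ fun r _ => ?_)
  refine hs_congr ((jTheta_hasSum m hm r hτ z).mul_left (Aq a l r)) (fun k => ?_) rfl
  rw [per_dvd (N := (2 * m : ℤ)) (G := Aq a l) (fun y => Aq_per hm ha l y) (x := (r : ℤ) + (2 * m : ℕ) * k) (y := r)
    ⟨k, by push_cast; ring⟩]
  push_cast; rfl

lemma Aq_dft {m : ℕ} (hm : 0 < m) {a} (ha : VV m a) (l r : ℤ) :
    (2 * m : ℕ) * Aq a l r = ∑ r' ∈ range (2 * m), ∑ l' ∈ range (2 * m),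
      ee ((r : ℂ) * r' / (2 * m : ℕ)) * (ee (-(l : ℂ) * l' / (2 * m)) * Aq a l' r') := by
  have hI : 0 < I.im := by simp
  have h := theta_indep hm hI (fun r' => ∑ r ∈ range (2 * m), ee (-(r : ℂ) * r' / (2 * m : ℕ)) * Aq a l r -
    ∑ l' ∈ range (2 * m), ee (-(l : ℂ) * l' / (2 * m)) * Aq a l' r') (fun z => by
      have h1 := Ph_S hm ha l hI z
      rw [Ph_theta hm ha l (im_neg_inv hI)] at h1
      simp only [jTheta_S m hm _ hI, Ph_theta hm ha _ hI] at h1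
      have h2 : rtS m I * ee (m * z ^ 2 / I) ≠ 0 := mul_ne_zero (rtS_ne hm hI) (ee_ne _)
      simp only [mul_left_comm (Aq a l _) (rtS m I * ee (m * z ^ 2 / I)), ← mul_sum] at h1
      have h3 := mul_left_cancel₀ h2 h1
      simp only [mul_sum] at h3
      simp only [sub_mul, Finset.sum_sub_distrib, sum_mul]
      rw [sum_comm, sum_comm (s := range (2 * m)) (t := range (2 * m)) (f := fun x i => ee (-(l : ℂ) * i / (2 * m)) * Aq a i x * jTheta m x I z), sub_eq_zero]
      refine Eq.trans ?_ (h3.trans ?_)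
      · refine sum_congr rfl fun _ _ => sum_congr rfl fun _ _ => ?_
        push_cast; ring
      · refine sum_congr rfl fun _ _ => sum_congr rfl fun _ _ => ?_
        ring)
  rw [← dft_inv (N := 2 * m) (by positivity) (x := Aq a l) (fun y => by push_cast; exact Aq_per hm ha l y) r]
  refine sum_congr rfl fun r' hr' => ?_
  rw [← mul_sum]
  congr 1
  exact sub_eq_zero.1 (h r' hr')

lemma ciz1 {m : ℕ} (hm : 0 < m) {A : ℤ → ℤ → ℂ} (h1 : ∀ l r, A (l + 2 * m) r = A l r) (h2 : ∀ l r, A l (r + 2 * m) = A l r)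
    (hs : ∀ l r, A l r ≠ 0 → (4 * m : ℤ) ∣ r ^ 2 - l ^ 2)
    (hd : ∀ l r : ℤ, (2 * m : ℕ) * A l r = ∑ r' ∈ range (2 * m), ∑ l' ∈ range (2 * m),
      ee ((r : ℂ) * r' / (2 * m : ℕ)) * (ee (-(l : ℂ) * l' / (2 * m)) * A l' r')) (u v : ℤ) :
    (2 * m : ℂ) * A (u + v) (u - v) = ∑ j ∈ range m, ∑ u' ∈ range (2 * m),
      ee (-(v * u' + u * j) / m) * A (u' + j) (u' - j) := by
  have hm' : (m : ℂ) ≠ 0 := by exact_mod_cast hm.ne'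
  have hpar : ∀ l r : ℤ, ¬ (2 : ℤ) ∣ l - r → A l r = 0 := by
    intro l r h
    by_contra h0
    obtain ⟨k, hk⟩ := hs l r h0
    apply h
    have h3 : (2 : ℤ) ∣ (l - r) * (l + r) := ⟨-(2 * m * k), by linear_combination -hk⟩
    rcases Int.prime_two.dvd_mul.1 h3 with h | h
    · exact h
    · omega
  have h := hd (u + v) (u - v)
  rw [sum_comm] at h
  have e1 : ∀ l' : ℕ, ∑ r' ∈ range (2 * m), ee (((u - v : ℤ) : ℂ) * r' / (2 * m : ℕ)) * (ee (-((u + v : ℤ) : ℂ) * l' / (2 * m)) * A l' r') =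
      ∑ j ∈ range m, ee (((u - v : ℤ) : ℂ) * ((l' - 2 * j : ℤ) : ℂ) / (2 * m : ℕ)) * (ee (-((u + v : ℤ) : ℂ) * l' / (2 * m)) * A l' (l' - 2 * j)) := by
    intro l'
    have := sum_class 2 m two_pos hm (fun r' => ee (((u - v : ℤ) : ℂ) * r' / (2 * m : ℕ)) * (ee (-((u + v : ℤ) : ℂ) * l' / (2 * m)) * A l' r')) (fun y => by
      have e := h2 l' y
      push_cast
      rw [e]
      congr 1
      exact ee_eq_of_sub (u - v) (by push_cast; field_simp)) l'
    refine Eq.trans (sum_congr rfl fun r' _ => ?_) (this.trans (sum_congr rfl fun j _ => by push_cast; rfl))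
    by_cases hp : (2 : ℤ) ∣ l' - r'
    · simp [hp]
    · simp [hp, hpar _ _ hp]
  simp only [e1] at h
  rw [sum_comm] at h
  rw [show (2 * m : ℂ) = (2 * m : ℕ) by push_cast; ring, h]
  refine sum_congr rfl fun j _ => ?_
  have h3 := sum_per_map (N := 2 * m) (by positivity) (G := fun l' : ℤ => ee (-(v * (l' - j) + u * j) / m) * A l' (l' - 2 * j)) (fun y => by
    have e : A (y + 2 * m) (y + 2 * m - 2 * j) = A y (y - 2 * j) := by
      rw [h1, show y + 2 * (m : ℤ) - 2 * j = y - 2 * j + 2 * m by ring, h2]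
    push_cast
    rw [e]
    congr 1
    exact ee_eq_of_sub (-2 * v) (by push_cast; field_simp; ring)) 1 j isCoprime_one_left
  refine Eq.trans (Eq.trans (sum_congr rfl fun l' _ => ?_) h3.symm) (sum_congr rfl fun l' _ => ?_)
  · rw [← mul_assoc, ← ee_add]
    congr 2
    push_cast; field_simp; ring
  · rw [show (1 : ℤ) * l' + j - 2 * j = l' - j by ring, one_mul]
    congr 2
    push_cast; ring

lemma gcd_inv {B : ℤ → ℤ → ℂ} (hB1 : ∀ u w, B u (w + u) = B u w) (hB2 : ∀ u w, B u w = B (-w) u) (u w : ℤ) :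
    B u w = B (Int.gcd u w) 0 := by
  have hn : ∀ u w, B (-u) (-w) = B u w := fun u w => by rw [hB2 u w, hB2 (-w) u]
  induction hk : u.natAbs using Nat.strong_induction_on generalizing u w with
  | _ k ih =>
    by_cases hu : u = 0
    · subst hu
      rw [hB2 0 w, Int.gcd_zero_left]
      rcases Int.natAbs_eq w with h | h
      · rw [← h]; simpa using hn w 0
      · rw [show -w = (w.natAbs : ℤ) by omega]
    · have h1 : B u w = B u (w % u) := per_dvd (hB1 u) (Int.dvd_self_sub_emod)
      have h2 := Int.emod_nonneg w hu
      have h3 := Int.emod_lt_abs w hu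
      rw [h1, hB2, ih _ (by rw [Int.natAbs_neg, ← hk]; have := Int.natCast_natAbs u; omega) _ _ rfl]
      congr 2
      rw [Int.neg_gcd, Int.gcd_emod, Int.gcd_comm]

lemma ciz {m : ℕ} (hm : 0 < m) {A : ℤ → ℤ → ℂ} (h1 : ∀ l r, A (l + 2 * m) r = A l r) (h2 : ∀ l r, A l (r + 2 * m) = A l r)
    (hs : ∀ l r, A l r ≠ 0 → (4 * m : ℤ) ∣ r ^ 2 - l ^ 2)
    (hd : ∀ l r : ℤ, (2 * m : ℕ) * A l r = ∑ r' ∈ range (2 * m), ∑ l' ∈ range (2 * m),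
      ee ((r : ℂ) * r' / (2 * m : ℕ)) * (ee (-(l : ℂ) * l' / (2 * m)) * A l' r')) :
    ∃ c : ℕ → ℂ, ∀ l r, A l r = ∑ d ∈ m.divisors, if Om d (m / d) l r then c d else 0 := by
  have hm' : (m : ℂ) ≠ 0 := by exact_mod_cast hm.ne'
  have hmz : (m : ℤ) ≠ 0 := by exact_mod_cast hm.ne'
  set A' : ℤ → ℤ → ℂ := fun u v => A (u + v) (u - v) with hA'
  have hc : ∀ u v : ℤ, (2 * m : ℂ) * A' u v = ∑ j ∈ range m, ∑ u' ∈ range (2 * m), ee (-(v * u' + u * j) / m) * A' u' j :=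
    ciz1 hm h1 h2 hs hd
  have h2m : (2 * m : ℂ) ≠ 0 := by simpa using hm'
  have pu : ∀ u v, A' (u + m) v = A' u v := by
    intro u v
    refine mul_left_cancel₀ h2m ?_
    rw [hc, hc]
    refine sum_congr rfl fun j _ => sum_congr rfl fun u' _ => ?_
    congr 1
    exact ee_eq_of_sub (-j) (by push_cast; field_simp; ring)
  have pv : ∀ u v, A' u (v + m) = A' u v := by
    intro u v
    refine mul_left_cancel₀ h2m ?_
    rw [hc, hc]
    refine sum_congr rfl fun j _ => sum_congr rfl fun u' _ => ?_
    congr 1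
    exact ee_eq_of_sub (-u') (by push_cast; field_simp; ring)
  set B : ℤ → ℤ → ℂ := fun u w => ∑ v ∈ range m, ee (-(v : ℂ) * w / m) * A' u v with hB
  have Bu : ∀ u w, B (u + m) w = B u w := fun u w => by simp only [hB, pu]
  have Bw : ∀ u w, B u (w + m) = B u w := by
    intro u w
    refine sum_congr rfl fun v _ => ?_
    congr 1
    exact ee_eq_of_sub (-v) (by push_cast; field_simp; ring)
  have B1 : ∀ u w, B u (w + u) = B u w := by
    intro u w
    refine sum_congr rfl fun v _ => ?_
    by_cases h0 : A' u v = 0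
    · simp [h0]
    · obtain ⟨k, hk⟩ := hs _ _ h0
      have hk' : (u : ℂ) * v = -(m * k) := by
        have : u * (v : ℤ) = -(m * k) := by linarith
        exact_mod_cast this
      congr 1
      refine ee_eq_of_sub k ?_
      push_cast; field_simp; linear_combination -hk'
  have hc2 : ∀ u v : ℤ, (m : ℂ) * A' u v = ∑ x ∈ range m, ee (-(v : ℂ) * x / m) * B x u := by
    intro u v
    have e := hc u v
    rw [sum_comm] at e
    have e2 : ∀ x : ℕ, ∑ j ∈ range m, ee (-((v : ℂ) * x + u * j) / m) * A' x j = ee (-(v : ℂ) * x / m) * B x u := by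
      intro x
      rw [hB, mul_sum]
      refine sum_congr rfl fun j _ => ?_
      rw [← mul_assoc, ← ee_add]; congr 2; push_cast; ring
    simp only [e2] at e
    rw [two_mul m, Finset.sum_range_add] at e
    have e3 : ∀ x : ℕ, ee (-(v : ℂ) * ((m + x : ℕ) : ℂ) / m) * B ((m + x : ℕ) : ℤ) u = ee (-(v : ℂ) * x / m) * B x u := by
      intro x
      push_cast
      rw [add_comm (m : ℤ) x, Bu]
      congr 1
      exact ee_eq_of_sub (-v) (by push_cast; field_simp; ring)
    simp only [e3] at e
    linear_combination e / 2
  have B2 : ∀ u w, B u w = B (-w) u := by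
    intro u w
    refine mul_left_cancel₀ hm' ?_
    have e : (m : ℂ) * B u w = ∑ x ∈ range m, (m : ℂ) * if (m : ℤ) ∣ -w - x then B x u else 0 := by
      rw [hB, mul_sum]
      simp only [mul_left_comm (m : ℂ), hc2, mul_sum]
      rw [sum_comm]
      refine sum_congr rfl fun x _ => ?_
      have := ee_sum_range m hm (-w - x)
      rw [show (m : ℂ) * (if (m : ℤ) ∣ -w - x then B x u else 0) = (if (m : ℤ) ∣ -w - x then (m : ℂ) else 0) * B x u by split_ifs <;> simp, ← this, sum_mul]
      refine sum_congr rfl fun v _ => ?_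
      rw [← mul_assoc, ← ee_add]
      congr 2
      push_cast; ring
    rw [e, ← mul_sum]
    have := sum_class m 1 hm one_pos (fun x => B x u) (fun y => by simpa using Bu y u) (-w)
    simp only [mul_one, Finset.range_one, Finset.sum_singleton, Nat.cast_zero, mul_zero, sub_zero] at this
    rw [this]
  have B3 : ∀ u w, B u w = B ((Int.gcd (Int.gcd u w) m : ℕ) : ℤ) 0 := by
    intro u w
    rw [gcd_inv B1 B2 u w, ← gcd_inv B1 B2 (Int.gcd u w) m]
    have := Bw (Int.gcd u w) 0
    rw [zero_add] at this; exact this.symm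
  obtain ⟨γ, hγ⟩ : ∃ γ : ℕ → ℂ, ∀ n : ℕ, n > 0 → ∑ i ∈ n.divisors, γ i = B (n : ℤ) 0 :=
    ⟨_, ArithmeticFunction.sum_eq_iff_sum_mul_moebius_eq.2 fun n _ => rfl⟩
  have B4 : ∀ u w : ℤ, B u w = ∑ d ∈ m.divisors, if (d : ℤ) ∣ u ∧ (d : ℤ) ∣ w then γ d else 0 := by
    intro u w
    rw [B3, ← hγ _ (Int.gcd_pos_of_ne_zero_right _ hmz), ← Finset.sum_filter]
    refine sum_congr ?_ fun _ _ => rfl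
    ext d
    rw [Finset.mem_filter, Nat.mem_divisors, Nat.mem_divisors, Int.dvd_gcd_iff, Int.natCast_dvd_natCast, Int.natCast_dvd_natCast, Int.dvd_gcd_iff]
    have := Int.gcd_pos_of_ne_zero_right (Int.gcd u w) hmz
    have h5 := this.ne'
    have h6 := hm.ne'
    tauto
  refine ⟨fun d => γ d / d, fun l r => ?_⟩
  by_cases hp : (2 : ℤ) ∣ l - r
  swap
  · rw [Finset.sum_eq_zero]
    · by_contra h0
      obtain ⟨k, hk⟩ := hs l r h0
      have h3 : (2 : ℤ) ∣ (l - r) * (l + r) := ⟨-(2 * m * k), by linear_combination -hk⟩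
      rcases Int.prime_two.dvd_mul.1 h3 with h | h
      · exact hp h
      · omega
    · intro d _
      rw [if_neg]
      exact fun h => hp ((dvd_mul_right _ _).trans h.2)
  obtain ⟨v, hv⟩ := hp
  have hl : A l r = A' (l - v) v := by simp only [hA']; congr 1 <;> omega
  have hinv := dft_inv hm (x := A' (l - v)) (pv (l - v)) v
  rw [hl]
  refine mul_left_cancel₀ hm' ?_
  rw [← hinv]
  have e0 : ∀ k : ℕ, ∑ j ∈ range m, ee (-(j : ℂ) * k / m) * A' (l - v) j = B (l - v) (k : ℤ) := fun k => by
    simp only [hB]; push_cast; rfl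
  simp only [e0, B4, mul_sum]
  rw [sum_comm]
  refine sum_congr rfl fun d hdm => ?_
  obtain ⟨⟨e, he⟩, -⟩ := Nat.mem_divisors.1 hdm
  have hd0 : 0 < d := Nat.pos_of_ne_zero (by rintro rfl; omega)
  have he0 : 0 < e := Nat.pos_of_ne_zero (by rintro rfl; omega)
  have hdc : (d : ℂ) ≠ 0 := by exact_mod_cast hd0.ne'
  have hec : (e : ℂ) ≠ 0 := by exact_mod_cast he0.ne'
  have hmc : (m : ℂ) = d * e := by exact_mod_cast he
  have hOm : Om d (m / d) l r ↔ (d : ℤ) ∣ l - v ∧ (e : ℤ) ∣ -v := by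
    rw [Om, he, Nat.mul_div_cancel_left _ hd0, hv, show l + r = 2 * (l - v) by omega, dvd_neg,
      mul_dvd_mul_iff_left two_ne_zero, mul_dvd_mul_iff_left two_ne_zero]
  simp only [hOm]
  by_cases hu : (d : ℤ) ∣ l - v
  swap
  · simp [hu]
  have h3 := sum_class d e hd0 he0 (fun x : ℤ => ee ((v : ℂ) * x / m) * γ d) (fun y => by
    congr 1
    refine ee_eq_of_sub v ?_
    push_cast; rw [hmc]; field_simp) 0
  have h4 := ee_sum_range e he0 (-v)
  have h5 : ∀ j : ℕ, ee ((v : ℂ) * ((0 - (d : ℤ) * j : ℤ) : ℂ) / m) * γ d = ee (((-v : ℤ) : ℂ) * j / e) * γ d := fun j => by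
    congr 2; push_cast; rw [hmc]; field_simp; ring
  simp only [h5, ← sum_mul, h4] at h3
  rw [← he] at h3
  refine Eq.trans (sum_congr rfl fun x _ => ?_) (h3.trans ?_)
  · simp only [hu, true_and, zero_sub, dvd_neg]
    split_ifs <;> simp
  · simp only [hu, true_and]
    split_ifs
    · rw [hmc]; field_simp
    · simp

lemma pairing {m : ℕ} (hm : 0 < m) {a} (ha : VV m a) (φ : EllFormData m) (he : IsEvenC φ.coeff) (hw : IsWeakC m φ.coeff)
    (hR : ∀ m₁ m₂ : ℕ, m₁ * m₂ = m → Rfactor m φ.coeff m₁ m₂ = 0) :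
    ∑ l : Fin (m + 1), eps m l * ∑ n : Fin (m + 1), a ((l : ℕ) ^ 2 - 4 * m * (n : ℕ)) (l : ℕ) *
      φ.coeff (-((l : ℕ) ^ 2 - 4 * m * (n : ℕ))) (l : ℕ) = 0 := by
  have hm4 : (0 : ℤ) < 4 * m := by positivity
  have hwk : ∀ (D : ℤ) (l : ℤ), φ.coeff (-D) l ≠ 0 → ∃ n : ℕ, D = l ^ 2 - 4 * m * n := by
    intro D l h
    by_cases hd : (4 * m : ℤ) ∣ -D + l ^ 2
    · obtain ⟨n, hn⟩ := hd
      by_cases h0 : n < 0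
      · refine absurd ?_ h
        rw [show -D = 4 * m * n - l ^ 2 by linarith]; exact hw n l h0
      · exact ⟨n.toNat, by rw [Int.toNat_of_nonneg (by omega)]; linarith⟩
    · exact absurd (φ.support _ _ hd) h
  have hfl : ∀ (D l : ℤ), φ.coeff D (fl m l) = φ.coeff D l := fun D l => fl_eq (G := φ.coeff D) hm (φ.periodic D) (he D) l
  have hAp : ∀ l r, Aq a (l + 2 * m) r = Aq a l r := fun l r => by simp only [Aq, ha.per]
  have hAe : ∀ l r, Aq a (-l) r = Aq a l r := fun l r => by simp only [Aq, ha.ev]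
  have h1 : ∀ l : ℕ, l ≤ m → HasSum (fun r : ℤ => Aq a l r * φ.coeff (-(r ^ 2)) l)
      (∑ n : Fin (m + 1), a ((l : ℕ) ^ 2 - 4 * m * (n : ℕ)) (l : ℕ) * φ.coeff (-((l : ℕ) ^ 2 - 4 * m * (n : ℕ))) (l : ℕ)) := by
    intro l hl
    have hinj : Function.Injective (fun n : Fin (m + 1) => ((l : ℤ) ^ 2 - 4 * m * (n : ℕ))) := fun x y h => by
      have h : (l : ℤ) ^ 2 - 4 * m * (x : ℕ) = (l : ℤ) ^ 2 - 4 * m * (y : ℕ) := h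
      have : (4 * m : ℤ) * (x : ℕ) = 4 * m * (y : ℕ) := by linarith
      have := mul_left_cancel₀ hm4.ne' this
      ext; exact_mod_cast this
    have h2 : HasSum (fun D : ℤ => a D l * φ.coeff (-D) l) (∑ n : Fin (m + 1), a ((l : ℕ) ^ 2 - 4 * m * (n : ℕ)) (l : ℕ) * φ.coeff (-((l : ℕ) ^ 2 - 4 * m * (n : ℕ))) (l : ℕ)) := by
      refine (hinj.hasSum_iff ?_).1 (hasSum_fintype _)
      intro D hD
      by_contra h0
      obtain ⟨n, hn⟩ := hwk D l (right_ne_zero_of_mul h0)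
      have h3 : 0 ≤ D := by
        by_contra h4
        exact left_ne_zero_of_mul h0 (ha.pos D l (by omega))
      have h5 : (l : ℤ) ^ 2 ≤ (m : ℤ) ^ 2 := pow_le_pow_left₀ (by positivity) (by exact_mod_cast hl) 2
      have h6 : n < m + 1 := by
        by_contra h7
        have : (m : ℤ) + 1 ≤ n := by omega
        have hmz : (0 : ℤ) < m := by exact_mod_cast hm
        nlinarith
      exact hD ⟨⟨n, h6⟩, hn.symm⟩
    refine hs_congr (sq_hs h2 fun D hD => VV_sq hm ha (left_ne_zero_of_mul hD)) (fun r => ?_) rfl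
    unfold Aq
    split_ifs with h
    · subst h; simp
    · ring
  set T : ℤ → ℂ := fun l => ∑' r : ℤ, Aq a l r * φ.coeff (-(r ^ 2)) l with hT
  have hsT : ∀ l, HasSum (fun r : ℤ => Aq a l r * φ.coeff (-(r ^ 2)) l) (T l) := by
    intro l
    refine Summable.hasSum ((h1 (fl m l) (fl_spec hm l).1).summable.congr fun r => ?_)
    rw [hfl, fl_eq (G := fun l => Aq a l r) hm (fun l => hAp l r) (fun l => hAe l r)]
  have h2 := fold_sum m hm T (fun l => by simp only [hT, hAp, φ.periodic]) (fun l => by simp only [hT, hAe, he _ l])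
  have h3 : ∀ l : Fin (m + 1), T (l : ℕ) = ∑ n : Fin (m + 1), a ((l : ℕ) ^ 2 - 4 * m * (n : ℕ)) (l : ℕ) * φ.coeff (-((l : ℕ) ^ 2 - 4 * m * (n : ℕ))) (l : ℕ) :=
    fun l => (h1 l (by omega)).tsum_eq
  simp only [← h3]
  rw [← h2]
  have h4 := hasSum_sum fun (l : ℕ) (_ : l ∈ range (2 * m)) => hsT l
  obtain ⟨c, hc⟩ := ciz hm hAp (fun l r => Aq_per hm ha l r) (fun l r h => by
    unfold Aq at h
    split_ifs at h with h0
    · subst h0; exact ha.sup _ _ h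
    · exact ha.sup _ _ fun h' => h (by rw [h']; simp)) (Aq_dft hm ha)
  have h5 : ∀ d ∈ m.divisors, HasSum (fun r : ℤ => c d * ∑ l ∈ range (2 * m), if Om d (m / d) l r then φ.coeff (-(r ^ 2)) l else 0) 0 := by
    intro d hd
    have hdm := Nat.mul_div_cancel' (Nat.dvd_of_mem_divisors hd)
    have h6 := hR d (m / d) hdm
    rw [Rfactor_eq_Rom m hm _ _ hdm _ φ.periodic, Rom] at h6
    refine hs_congr (HasSum.mul_left (c d) (Summable.hasSum (f := fun r : ℤ => ∑ l ∈ range (2 * m), if Om d (m / d) l r then φ.coeff (-(r ^ 2)) l else 0) ?_)) (fun _ => rfl) (by rw [h6, mul_zero])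
    refine summable_of_ne_finset_zero (s := Finset.Icc (-(m : ℤ)) m) fun r hr => ?_
    refine Finset.sum_eq_zero fun l _ => ?_
    have : φ.coeff (-(r ^ 2)) l = 0 := by
      by_contra h7
      rw [← hfl] at h7
      obtain ⟨n, hn⟩ := hwk _ _ h7
      have h8 : (fl m l : ℤ) ^ 2 ≤ (m : ℤ) ^ 2 := pow_le_pow_left₀ (by positivity) (by exact_mod_cast (fl_spec hm l).1) 2
      have h9 : r ^ 2 ≤ (m : ℤ) ^ 2 := by
        have : (0 : ℤ) ≤ 4 * m * n := by positivity
        linarith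
      exact hr (Finset.mem_Icc.2 (abs_le.1 (abs_le_of_sq_le_sq h9 (by positivity))))
    simp [this]
  refine h4.unique (hs_congr (hasSum_sum h5) (fun r => ?_) (by simp))
  simp only [hc, sum_mul, mul_sum]
  rw [sum_comm]
  refine sum_congr rfl fun d _ => sum_congr rfl fun l _ => ?_
  split_ifs <;> simp

def Um (m : ℕ) (Q : Matrix (Fin (m + 1)) (Fin (m + 1)) (PowerSeries ℂ)) : Submodule ℂ (Fin (m + 1) × Fin (m + 1) → ℂ) where
  carrier := {x | ∃ (g : Fin (m + 1) → ℂ → ℂ) (Pg : Fin (m + 1) → PowerSeries ℂ), (∀ j, QRep (g j) (Pg j)) ∧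
    (∀ j : Fin (m + 1), SLaw (2 + 2 * (j : ℕ)) (g j)) ∧ ∀ p : Fin (m + 1) × Fin (m + 1), x p =
      if 4 * m * (p.1 : ℕ) ≤ (p.2 : ℕ) ^ 2 then coeff p.1 (∑ j, Pg j * Q j p.2) else 0}
  zero_mem' := ⟨fun _ _ => 0, fun _ => PowerSeries.C 0, fun _ => QRep.const 0, fun _ _ _ => by simp, fun p => by simp⟩
  add_mem' := by
    rintro x y ⟨g, Pg, h1, h2, h3⟩ ⟨g', Pg', h1', h2', h3'⟩
    refine ⟨_, _, fun j => (h1 j).add (h1' j), fun j => (h2 j).add (h2' j), fun p => ?_⟩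
    rw [Pi.add_apply, h3, h3']
    simp only [add_mul, Finset.sum_add_distrib, map_add]
    split_ifs <;> simp
  smul_mem' := by
    rintro c x ⟨g, Pg, h1, h2, h3⟩
    refine ⟨_, _, fun j => (h1 j).smul c, fun j => (h2 j).smul c, fun p => ?_⟩
    rw [Pi.smul_apply, h3]
    simp only [smul_mul_assoc, ← Finset.smul_sum, map_smul]
    split_ifs <;> simp

lemma part_a2 (m : ℕ) (hm : 0 < m) (φ : EllFormData m) (he : IsEvenC φ.coeff) (hw : IsWeakC m φ.coeff)
    (hR : ∀ m₁ m₂ : ℕ, m₁ * m₂ = m → Rfactor m φ.coeff m₁ m₂ = 0) :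
    ∃ ψ : EllFormData m, ModularLaw 2 m ψ.toFun ∧ IsWeakC m ψ.coeff ∧
      ∀ n r : ℤ, 4 * (m : ℤ) * n ≤ r ^ 2 →
        ψ.coeff (4 * (m : ℤ) * n - r ^ 2) r = φ.coeff (4 * (m : ℤ) * n - r ^ 2) r := by
  obtain ⟨Pm, Q, hP, hQ, hPQ⟩ := Ginv_rep m hm
  set x : Fin (m + 1) × Fin (m + 1) → ℂ := fun p => if 4 * m * (p.1 : ℕ) ≤ (p.2 : ℕ) ^ 2 then
    eps m p.2 * φ.coeff (4 * m * (p.1 : ℕ) - (p.2 : ℕ) ^ 2) (p.2 : ℕ) else 0 with hx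
  by_cases hxU : x ∈ Um m Q
  · obtain ⟨g, Pg, h1, h2, h3⟩ := hxU
    obtain ⟨ψ, hM, hW, hE, hc⟩ := psi_exists m hm hQ g Pg h1 h2
    refine ⟨ψ, hM, hW, fun n r hn => ?_⟩
    have hmz : (0 : ℤ) < m := by exact_mod_cast hm
    obtain ⟨⟨k, hk⟩, -⟩ := fl_sq hm r
    rw [← fl_eq (G := ψ.coeff _) hm (ψ.periodic _) (hE _) r, ← fl_eq (G := φ.coeff _) hm (φ.periodic _) (he _) r,
      show 4 * (m : ℤ) * n - r ^ 2 = 4 * m * (n - k) - (fl m r : ℤ) ^ 2 by linear_combination -hk]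
    by_cases h0 : n - k < 0
    · rw [hW _ _ h0, hw _ _ h0]
    obtain ⟨n', hn'⟩ : ∃ n' : ℕ, n - k = n' := ⟨(n - k).toNat, by omega⟩
    have h5 : 4 * (m : ℤ) * n' ≤ (fl m r : ℤ) ^ 2 := by rw [← hn']; linarith
    have h6 : (fl m r : ℤ) ^ 2 ≤ (m : ℤ) ^ 2 := pow_le_pow_left₀ (by positivity) (by exact_mod_cast (fl_spec hm r).1) 2
    have h7 : n' < m + 1 := by
      by_contra h7
      have : (m : ℤ) + 1 ≤ n' := by omega
      nlinarith
    have h8 := h3 (⟨n', h7⟩, ⟨fl m r, Nat.lt_succ_of_le (fl_spec hm r).1⟩)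
    rw [← hc, hx] at h8
    simp only [if_pos (show 4 * m * n' ≤ (fl m r) ^ 2 by exact_mod_cast h5)] at h8
    rw [hn']
    exact (mul_left_cancel₀ (eps_ne _ _) h8).symm
  · exfalso
    obtain ⟨f, hf1, hf2⟩ := Submodule.exists_le_ker_of_notMem hxU
    apply hf1
    set lam : Fin (m + 1) → Fin (m + 1) → ℂ := fun n l => if 4 * m * (n : ℕ) ≤ (l : ℕ) ^ 2 then
      f (fun p => if (n, l) = p then 1 else 0) else 0 with hlam
    have hf : ∀ y : Fin (m + 1) → Fin (m + 1) → ℂ, f (fun p => if 4 * m * (p.1 : ℕ) ≤ (p.2 : ℕ) ^ 2 then y p.1 p.2 else 0) =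
        ∑ n, ∑ l, lam n l * y n l := by
      intro y
      rw [LinearMap.pi_apply_eq_sum_univ, Fintype.sum_prod_type]
      refine sum_congr rfl fun n _ => sum_congr rfl fun l _ => ?_
      simp only [hlam]
      split_ifs
      · rw [smul_eq_mul, mul_comm]
      · simp
    obtain ⟨a, ha, hal⟩ := VV_dual m hm Pm Q (fun l j => (hP l j).1) hPQ lam (fun n l h => by
      simp only [hlam]
      rw [if_neg]
      have : (l : ℕ) ^ 2 < 4 * m * (n : ℕ) := by exact_mod_cast h
      omega) (fun j g Pg hg hq => by
      rw [← hf fun n l => coeff n (Pg * Q j l)]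
      refine LinearMap.mem_ker.1 (hf2 ⟨fun i => if i = j then g else fun _ => 0, fun i => if i = j then Pg else PowerSeries.C 0, fun i => ?_, fun i => ?_, fun p => ?_⟩)
      · beta_reduce; split_ifs
        · exact hq
        · exact QRep.const 0
      · beta_reduce; split_ifs with h
        · rw [h]; exact hg
        · intro τ _; simp
      · rw [Finset.sum_eq_single j]
        · simp
        · intro i _ hi; simp [hi]
        · simp)
    rw [hx, hf fun n l => eps m l * φ.coeff (4 * m * (n : ℕ) - (l : ℕ) ^ 2) (l : ℕ), ← pairing hm ha φ he hw hR, sum_comm]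
    refine sum_congr rfl fun l _ => ?_
    rw [mul_sum]
    refine sum_congr rfl fun n _ => ?_
    rw [hal, neg_sub]; ring
end

/-- Theorem: (a) an even weak elliptic form `φ` of index `m` agrees, in all its Fourier
coefficients `c(n,r)` with `4nm ≤ r²`, with some weak Jacobi form of weight 2 and index `m`
if and only if `R_{m₁,m₂}(φ) = 0` for every unordered factorization `m = m₁·m₂`; and
(b) the map sending an even weak elliptic form of index `m` to the vector of its residues
`(R_{m₁,m₂}(φ))` (a symmetric function of the factorization) is surjective. -/
theorem residue_map_exactness (m : ℕ) (hm : 0 < m) :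
    (∀ φ : EllFormData m, IsEvenC φ.coeff → IsWeakC m φ.coeff →
      ((∃ ψ : EllFormData m, ModularLaw 2 m ψ.toFun ∧ IsWeakC m ψ.coeff ∧
          ∀ n r : ℤ, 4 * (m : ℤ) * n ≤ r ^ 2 →
            ψ.coeff (4 * (m : ℤ) * n - r ^ 2) r = φ.coeff (4 * (m : ℤ) * n - r ^ 2) r) ↔
        (∀ m₁ m₂ : ℕ, m₁ * m₂ = m → Rfactor m φ.coeff m₁ m₂ = 0))) ∧
    (∀ v : ℕ → ℕ → ℂ, (∀ m₁ m₂ : ℕ, v m₁ m₂ = v m₂ m₁) →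
      ∃ φ : EllFormData m, IsEvenC φ.coeff ∧ IsWeakC m φ.coeff ∧
        ∀ m₁ m₂ : ℕ, m₁ * m₂ = m → Rfactor m φ.coeff m₁ m₂ = v m₁ m₂) := by
  exact ⟨fun φ he hw => ⟨fun ⟨ψ, hM, _, h⟩ m₁ m₂ h12 => part_a1 m hm φ ψ hM h m₁ m₂ h12, part_a2 m hm φ he hw⟩, part_b m hm⟩
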